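/- There exist constants C, c > 0 depending only on Ω such that for all ε ∈ (0, 1]: sup_{θ⋆ ∈ D} P( sup_{λ ∈ [λ_min, λ_max]} | σ̂²(λ) − σ² | > ε ) ≤ (C/ε⁶) N^q e^{−cNε⁶}, where σ̂²(λ) = τ̂(λ)² (1 + N/n − (2/n)‖θ̂_λ‖₀) − ‖Xᵀ(y − Xθ̂_λ)‖² / ( n (1 − (1/n)‖θ̂_λ‖₀)² ) and τ̂(λ) = √n ‖y − Xθ̂_λ‖ / (n − ‖θ̂_λ‖₀). -/

import Mathlib

open MeasureTheory ProbabilityTheory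
open scoped ENNReal NNReal

noncomputable section

/-- Standard Gaussian density φ. -/
def gphi (x : ℝ) : ℝ := Real.exp (-x ^ 2 / 2) / Real.sqrt (2 * Real.pi)

/-- Standard Gaussian CDF Φ. -/
def gPhi (x : ℝ) : ℝ := ∫ t in Set.Iic x, gphi t

/-- Soft thresholding η(x; b) = sign(x)(|x| − b)₊. -/
def eta (x b : ℝ) : ℝ := Real.sign x * max (|x| - b) 0

/-- Derivative in x of soft thresholding: η′(x; b) = 1_{|x| > b}. -/
def eta' (x b : ℝ) : ℝ := if b < |x| then 1 else 0

/-- The ℓ_p ball F_p(ξ) = {x : (1/N) ∑ |xᵢ|^p ≤ ξ^p}. -/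
def Fball (N : ℕ) (p ξ : ℝ) : Set (Fin N → ℝ) :=
  {x | (1 / (N : ℝ)) * ∑ i, |x i| ^ p ≤ ξ ^ p}

/-- Number of nonzero entries ‖x‖₀. -/
def l0 {N : ℕ} (x : Fin N → ℝ) : ℕ := (Finset.univ.filter fun i => x i ≠ 0).card

/-- The ℓ₀ ball F_0(s) = {x : ‖x‖₀ ≤ sN}. -/
def F0ball (N : ℕ) (s : ℝ) : Set (Fin N → ℝ) := {x | (l0 x : ℝ) ≤ s * N}

/-- The critical sparsity s_max(δ). -/
def smax (δ : ℝ) : ℝ :=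
  δ * sSup ((fun α : ℝ =>
      (1 - (2 / δ) * ((1 + α ^ 2) * gPhi (-α) - α * gphi α)) /
      (1 + α ^ 2 - 2 * ((1 + α ^ 2) * gPhi (-α) - α * gphi α))) '' Set.Ici 0)

/-- Empirical distribution of the entries of a vector. -/
def empDist {N : ℕ} (θ : Fin N → ℝ) : Measure ℝ :=
  ((N : ℝ≥0∞))⁻¹ • ∑ i : Fin N, Measure.dirac (θ i)

/-- Empirical distribution of pairs of entries of two vectors. -/
def empDist2 {N : ℕ} (u v : Fin N → ℝ) : Measure (ℝ × ℝ) :=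
  ((N : ℝ≥0∞))⁻¹ • ∑ i : Fin N, Measure.dirac (u i, v i)

/-- Squared order-2 Wasserstein distance between measures on ℝ². -/
def W2sq (μ ν : Measure (ℝ × ℝ)) : ℝ :=
  sInf {r : ℝ | ∃ γ : Measure ((ℝ × ℝ) × (ℝ × ℝ)),
    γ.map Prod.fst = μ ∧ γ.map Prod.snd = ν ∧
    r = ∫ q, ((q.1.1 - q.2.1) ^ 2 + (q.1.2 - q.2.2) ^ 2) ∂γ}

/-- Order-2 Wasserstein distance. -/
def W2 (μ ν : Measure (ℝ × ℝ)) : ℝ := Real.sqrt (W2sq μ ν)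

/-- Standard Gaussian measure on ℝ. -/
def stdG : Measure ℝ := gaussianReal 0 1

/-- The state-evolution fixed point equations (for (Θ,Z) ∼ μ ⊗ N(0,1)),
together with positivity of (β, τ). -/
def StateEvo (δ σ : ℝ) (μ : Measure ℝ) (lam β τ : ℝ) : Prop :=
  0 < β ∧ 0 < τ ∧
  τ ^ 2 = σ ^ 2 + (1 / δ) *
    ∫ q : ℝ × ℝ, (eta (q.1 + τ * q.2) (τ * lam / β) - q.1) ^ 2 ∂(μ.prod stdG) ∧
  β = τ * (1 - (1 / δ) *
    ∫ q : ℝ × ℝ, eta' (q.1 + τ * q.2) (τ * lam / β) ∂(μ.prod stdG))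

/-- s⋆ = P(|Θ + τZ| ≥ ατ) for (Θ,Z) ∼ μ ⊗ N(0,1). -/
def sStar (μ : Measure ℝ) (τ α : ℝ) : ℝ :=
  ((μ.prod stdG) {q : ℝ × ℝ | α * τ ≤ |q.1 + τ * q.2|}).toReal

/-- The limit law μ⋆: law of (η(Θ + τZ; ατ), Θ) for (Θ,Z) ∼ μ ⊗ N(0,1). -/
def muStar (μ : Measure ℝ) (τ α : ℝ) : Measure (ℝ × ℝ) :=
  (μ.prod stdG).map (fun q => (eta (q.1 + τ * q.2) (α * τ), q.1))

/-- The limit law for the debiased Lasso: law of (Θ + τZ, Θ). -/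
def muStarD (μ : Measure ℝ) (τ : ℝ) : Measure (ℝ × ℝ) :=
  (μ.prod stdG).map (fun q => (q.1 + τ * q.2, q.1))

/-- Law of the design matrix: i.i.d. N(0, 1/n) entries. -/
def PX (n N : ℕ) : Measure (Fin n → Fin N → ℝ) :=
  Measure.pi fun _ => Measure.pi fun _ => gaussianReal 0 ((n : ℝ≥0))⁻¹

/-- Law of the noise: i.i.d. standard Gaussian entries. -/
def Pz (n : ℕ) : Measure (Fin n → ℝ) :=
  Measure.pi fun _ => gaussianReal 0 1

/-- Joint law of (X, z). -/
def Pmodel (n N : ℕ) : Measure ((Fin n → Fin N → ℝ) × (Fin n → ℝ)) :=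
  (PX n N).prod (Pz n)

/-- The response y = Xθ⋆ + σz. -/
def yvec {n N : ℕ} (σ : ℝ) (θstar : Fin N → ℝ) (X : Fin n → Fin N → ℝ)
    (z : Fin n → ℝ) : Fin n → ℝ :=
  fun i => (∑ j, X i j * θstar j) + σ * z i

/-- The Lasso cost (1/(2n))‖y − Xθ‖² + (λ/n)‖θ‖₁. -/
def lassoCost {n N : ℕ} (X : Fin n → Fin N → ℝ) (y : Fin n → ℝ) (lam : ℝ)
    (θ : Fin N → ℝ) : ℝ :=
  (1 / (2 * (n : ℝ))) * ∑ i, (y i - ∑ j, X i j * θ j) ^ 2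
    + (lam / (n : ℝ)) * ∑ j, |θ j|

/-- The uniformity class: D is either an ℓ_p ball F_p(ξ) or an ℓ₀ ball F_0(s) with
s below the critical sparsity, with the corresponding exponent q. -/
def DFamSpec (δ : ℝ) (Dfam : (M : ℕ) → Set (Fin M → ℝ)) (q : ℝ) : Prop :=
  (∃ p ξ : ℝ, 0 < p ∧ 0 < ξ ∧ (∀ M, Dfam M = Fball M p ξ) ∧ q = max (1 / p - 1) 0) ∨
  (∃ s : ℝ, 0 ≤ s ∧ s < smax δ ∧ (∀ M, Dfam M = F0ball M s) ∧ q = 0)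

/-- The estimator τ̂(λ) = √n ‖y − Xθ̂_λ‖ / (n − ‖θ̂_λ‖₀). -/
def tauHat {n N : ℕ} (X : Fin n → Fin N → ℝ) (y : Fin n → ℝ) (θ : Fin N → ℝ) : ℝ :=
  Real.sqrt (n : ℝ) * Real.sqrt (∑ i, (y i - ∑ j, X i j * θ j) ^ 2)
    / ((n : ℝ) - (l0 θ : ℝ))

/-- The noise level estimator σ̂². -/
def sigmaHatSq {n N : ℕ} (X : Fin n → Fin N → ℝ) (y : Fin n → ℝ)
    (θ : Fin N → ℝ) : ℝ :=
  (tauHat X y θ) ^ 2 * (1 + (N : ℝ) / (n : ℝ) - (2 / (n : ℝ)) * (l0 θ : ℝ))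
    - (∑ j, (∑ i, X i j * (y i - ∑ j', X i j' * θ j')) ^ 2)
      / ((n : ℝ) * (1 - (l0 θ : ℝ) / (n : ℝ)) ^ 2)

namespace Lasso

/-- Density of the law of the design and the noise. -/
def jointDensity (n N : ℕ) (ω : (Fin n → Fin N → ℝ) × (Fin n → ℝ)) : ℝ :=
  (∏ i, ∏ j, gaussianPDFReal 0 ((n : ℝ≥0)⁻¹) (ω.1 i j)) * ∏ i, gaussianPDFReal 0 1 (ω.2 i)

lemma pi_gaussian_withDensity {ι : Type*} [Fintype ι] {v : ℝ≥0} (hv : v ≠ 0) :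
    Measure.pi (fun _ : ι => gaussianReal 0 v) =
      (volume : Measure (ι → ℝ)).withDensity
        (fun x => ENNReal.ofReal (∏ i, gaussianPDFReal 0 v (x i))) := by
  refine Measure.pi_eq fun s hs => ?_
  rw [withDensity_apply _ (MeasurableSet.univ_pi hs), volume_pi, Measure.restrict_pi_pi]
  have hint : ∀ i, Integrable (gaussianPDFReal 0 v) ((volume : Measure ℝ).restrict (s i)) :=
    fun i => (integrable_gaussianPDFReal 0 v).restrict
  rw [← ofReal_integral_eq_lintegral_ofReal]
  · rw [integral_fintype_prod_eq_prod (μ := fun i => (volume : Measure ℝ).restrict (s i))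
      (f := fun _ => gaussianPDFReal 0 v), ENNReal.ofReal_prod_of_nonneg]
    · refine Finset.prod_congr rfl fun i _ => ?_
      rw [gaussianReal_apply_eq_integral 0 hv]
    · exact fun i _ => integral_nonneg fun x => gaussianPDFReal_nonneg _ _ _
  · exact Integrable.fintype_prod (f := fun _ => gaussianPDFReal 0 v) hint
  · exact Filter.Eventually.of_forall fun x => Finset.prod_nonneg fun i _ => gaussianPDFReal_nonneg _ _ _

lemma measurable_jointDensity (n N : ℕ) : Measurable (jointDensity n N) := by
  unfold jointDensity
  refine Measurable.mul (Finset.measurable_prod _ fun i _ => Finset.measurable_prod _ fun j _ => ?_)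
    (Finset.measurable_prod _ fun i _ => ?_)
  · exact (measurable_gaussianPDFReal _ _).comp (by fun_prop)
  · exact (measurable_gaussianPDFReal _ _).comp (by fun_prop)

lemma pi_withDensity_pi {ι κ : Type*} [Fintype ι] [Fintype κ] {v : ℝ≥0} (hv : v ≠ 0) :
    Measure.pi (fun _ : ι => Measure.pi (fun _ : κ => gaussianReal 0 v)) =
      (volume : Measure (ι → κ → ℝ)).withDensity
        (fun x => ENNReal.ofReal (∏ i, ∏ j, gaussianPDFReal 0 v (x i j))) := by
  refine Measure.pi_eq fun s hs => ?_
  rw [withDensity_apply _ (MeasurableSet.univ_pi hs), volume_pi, Measure.restrict_pi_pi]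
  have h0 : ∀ x : κ → ℝ, 0 ≤ ∏ j, gaussianPDFReal 0 v (x j) := fun x =>
    Finset.prod_nonneg fun i _ => gaussianPDFReal_nonneg _ _ _
  have hint : ∀ i, Integrable (fun x : κ → ℝ => ∏ j, gaussianPDFReal 0 v (x j))
      ((volume : Measure (κ → ℝ)).restrict (s i)) := fun i =>
    (Integrable.fintype_prod (f := fun _ => gaussianPDFReal 0 v)
      (fun _ => integrable_gaussianPDFReal 0 v)).restrict
  rw [← ofReal_integral_eq_lintegral_ofReal]
  · rw [integral_fintype_prod_eq_prod (μ := fun i => (volume : Measure (κ → ℝ)).restrict (s i))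
      (f := fun _ x => ∏ j, gaussianPDFReal 0 v (x j)), ENNReal.ofReal_prod_of_nonneg]
    · refine Finset.prod_congr rfl fun i _ => ?_
      rw [pi_gaussian_withDensity hv, withDensity_apply _ (hs i), ofReal_integral_eq_lintegral_ofReal (hint i)
        (Filter.Eventually.of_forall h0)]
    · exact fun i _ => integral_nonneg fun x => h0 x
  · exact Integrable.fintype_prod (f := fun _ (x : κ → ℝ) => ∏ j, gaussianPDFReal 0 v (x j)) hint
  · exact Filter.Eventually.of_forall fun x => Finset.prod_nonneg fun i _ => h0 _

lemma pmodel_eq_withDensity {n N : ℕ} (hn : 0 < n) :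
    Pmodel n N = (volume : Measure ((Fin n → Fin N → ℝ) × (Fin n → ℝ))).withDensity
      (fun ω => ENNReal.ofReal (jointDensity n N ω)) := by
  have hv : ((n : ℝ≥0)⁻¹) ≠ 0 := by positivity
  rw [Pmodel, PX, Pz, pi_withDensity_pi hv, pi_gaussian_withDensity one_ne_zero, prod_withDensity]
  · refine congrArg₂ _ rfl ?_
    ext ω
    rw [jointDensity, ENNReal.ofReal_mul]
    exact Finset.prod_nonneg fun _ _ => Finset.prod_nonneg fun _ _ => gaussianPDFReal_nonneg _ _ _
  · refine ENNReal.measurable_ofReal.comp ?_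
    refine Finset.measurable_prod _ fun i _ => Finset.measurable_prod _ fun j _ => ?_
    exact (measurable_gaussianPDFReal _ _).comp (by fun_prop)
  · refine ENNReal.measurable_ofReal.comp ?_
    refine Finset.measurable_prod _ fun i _ => ?_
    exact (measurable_gaussianPDFReal _ _).comp (by fun_prop)

instance (n N : ℕ) : IsProbabilityMeasure (Pmodel n N) := by
  unfold Pmodel PX Pz; infer_instance

lemma prod_gaussianPDF {ι : Type*} [Fintype ι] (v : ℝ≥0) (x : ι → ℝ) :
    ∏ i, gaussianPDFReal 0 v (x i) =
      (√(2 * Real.pi * v))⁻¹ ^ Fintype.card ι * Real.exp (-(x ⬝ᵥ x) / (2 * v)) := by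
  simp only [gaussianPDFReal, Finset.prod_mul_distrib, Finset.prod_const, Finset.card_univ, sub_zero]
  rw [← Real.exp_sum]
  congr 2
  rw [← Finset.sum_div, Finset.sum_neg_distrib]
  simp [dotProduct, sq]

/-- Normalising constant of the joint density. -/
def densityConst (n N : ℕ) : ℝ :=
  (√(2 * Real.pi * ((n : ℝ≥0)⁻¹ : ℝ≥0)))⁻¹ ^ (N * n) * (√(2 * Real.pi * (1 : ℝ≥0)))⁻¹ ^ n

lemma densityConst_nonneg (n N : ℕ) : 0 ≤ densityConst n N := by unfold densityConst; positivity

lemma jointDensity_eq {n N : ℕ} (ω : (Fin n → Fin N → ℝ) × (Fin n → ℝ)) :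
    jointDensity n N ω = densityConst n N *
      Real.exp (-(n * (∑ i, ω.1 i ⬝ᵥ ω.1 i) + ω.2 ⬝ᵥ ω.2) / 2) := by
  simp only [jointDensity, prod_gaussianPDF, Finset.prod_mul_distrib, Finset.prod_const,
    Finset.card_univ, Fintype.card_fin, densityConst, ← pow_mul]
  rw [← Real.exp_sum, mul_mul_mul_comm, ← Real.exp_add]
  congr 2
  rw [← Finset.sum_div, Finset.sum_neg_distrib]
  push_cast
  rcases Nat.eq_zero_or_pos n with h | h
  · subst h; simp
  · field_simp; ring

end Lasso

namespace Lasso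

open Matrix

/-- The resid of a linear regression. -/
def resid {n N : ℕ} (X : Matrix (Fin n) (Fin N) ℝ) (y : Fin n → ℝ) (θ : Fin N → ℝ) : Fin n → ℝ :=
  y - X *ᵥ θ

/-- The `ℓ¹` norm. -/
def l1 {ι : Type*} [Fintype ι] (v : ι → ℝ) : ℝ := ∑ i, |v i|

/-- The Lasso objective, scaled by the sample size. -/
def obj {n N : ℕ} (X : Matrix (Fin n) (Fin N) ℝ) (y : Fin n → ℝ) (lam : ℝ) (θ : Fin N → ℝ) : ℝ :=
  (1 / 2) * (resid X y θ ⬝ᵥ resid X y θ) + lam * l1 θ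

/-- `θ` is a Lasso solution. -/
def IsLasso {n N : ℕ} (X : Matrix (Fin n) (Fin N) ℝ) (y : Fin n → ℝ) (lam : ℝ) (θ : Fin N → ℝ) : Prop :=
  ∀ θ', obj X y lam θ ≤ obj X y lam θ'

section vectors
variable {ι : Type*} [Fintype ι]

lemma l1_nonneg (v : ι → ℝ) : 0 ≤ l1 v := Finset.sum_nonneg fun _ _ => abs_nonneg _

lemma ss_nonneg (v : ι → ℝ) : 0 ≤ v ⬝ᵥ v := Finset.sum_nonneg fun _ _ => mul_self_nonneg _

lemma l1_smul (c : ℝ) (v : ι → ℝ) : l1 (c • v) = |c| * l1 v := by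
  simp [l1, abs_mul, Finset.mul_sum]

lemma l1_add_le (u v : ι → ℝ) : l1 (u + v) ≤ l1 u + l1 v := by
  simp only [l1, ← Finset.sum_add_distrib]
  exact Finset.sum_le_sum fun i _ => abs_add_le _ _

lemma l1_sub_le (u v : ι → ℝ) : l1 u - l1 v ≤ l1 (u - v) := by
  have := l1_add_le (u - v) v
  simp only [sub_add_cancel] at this
  linarith

lemma l1_neg (u : ι → ℝ) : l1 (-u) = l1 u := by simp [l1]

lemma dot_sq_le (u v : ι → ℝ) : (u ⬝ᵥ v) ^ 2 ≤ (u ⬝ᵥ u) * (v ⬝ᵥ v) := by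
  have := Finset.sum_mul_sq_le_sq_mul_sq Finset.univ u v
  simpa [dotProduct, sq] using this

lemma dot_le_sqrt (u v : ι → ℝ) : u ⬝ᵥ v ≤ √(u ⬝ᵥ u) * √(v ⬝ᵥ v) := by
  rw [← Real.sqrt_mul (ss_nonneg u)]
  exact Real.le_sqrt_of_sq_le (dot_sq_le u v)

lemma abs_dot_le_sqrt (u v : ι → ℝ) : |u ⬝ᵥ v| ≤ √(u ⬝ᵥ u) * √(v ⬝ᵥ v) := by
  rw [← Real.sqrt_mul (ss_nonneg u)]
  exact Real.abs_le_sqrt (dot_sq_le u v)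

lemma l1_sq_le (v : ι → ℝ) : (l1 v) ^ 2 ≤ Fintype.card ι * (v ⬝ᵥ v) := by
  have := Finset.sum_mul_sq_le_sq_mul_sq Finset.univ (fun _ : ι => (1 : ℝ)) (fun i => |v i|)
  simpa [dotProduct, sq, l1] using this

lemma ss_add (u v : ι → ℝ) : (u + v) ⬝ᵥ (u + v) = u ⬝ᵥ u + 2 * (u ⬝ᵥ v) + v ⬝ᵥ v := by
  simp only [add_dotProduct, dotProduct_add, dotProduct_comm v u]; ring

lemma ss_sub (u v : ι → ℝ) : (u - v) ⬝ᵥ (u - v) = u ⬝ᵥ u - 2 * (u ⬝ᵥ v) + v ⬝ᵥ v := by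
  simp only [sub_dotProduct, dotProduct_sub, dotProduct_comm v u]; ring

lemma ss_eq_zero {v : ι → ℝ} : v ⬝ᵥ v = 0 ↔ v = 0 := dotProduct_self_eq_zero

lemma abs_le_sqrt_ss (v : ι → ℝ) (i : ι) : |v i| ≤ √(v ⬝ᵥ v) := by
  apply Real.abs_le_sqrt
  rw [sq]
  exact Finset.single_le_sum (f := fun i => v i * v i) (fun i _ => mul_self_nonneg _) (Finset.mem_univ i)

end vectors

/-- Squared Frobenius norm. -/
def frob {n N : ℕ} (X : Matrix (Fin n) (Fin N) ℝ) : ℝ := ∑ i, X i ⬝ᵥ X i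

variable {n N : ℕ} {X : Matrix (Fin n) (Fin N) ℝ} {y : Fin n → ℝ} {lam : ℝ} {θ : Fin N → ℝ}

lemma ss_mulVec_le (X : Matrix (Fin n) (Fin N) ℝ) (w : Fin N → ℝ) :
    (X *ᵥ w) ⬝ᵥ (X *ᵥ w) ≤ frob X * (w ⬝ᵥ w) := by
  rw [frob, Finset.sum_mul]
  refine Finset.sum_le_sum fun i _ => ?_
  rw [← sq]; exact dot_sq_le (X i) w

lemma frob_transpose (X : Matrix (Fin n) (Fin N) ℝ) : frob Xᵀ = frob X := by
  simp only [frob, dotProduct]; exact Finset.sum_comm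

lemma ss_vecMul_le (X : Matrix (Fin n) (Fin N) ℝ) (r : Fin n → ℝ) :
    (r ᵥ* X) ⬝ᵥ (r ᵥ* X) ≤ frob X * (r ⬝ᵥ r) := by
  rw [← mulVec_transpose, ← frob_transpose X]; exact ss_mulVec_le _ _

/-- Variational inequality characterising Lasso solutions. -/
lemma variational (h : IsLasso X y lam θ) (θ' : Fin N → ℝ) (hl : 0 ≤ lam) :
    (resid X y θ ᵥ* X) ⬝ᵥ (θ' - θ) ≤ lam * (l1 θ' - l1 θ) := by
  set r := resid X y θ with hr
  set d := θ' - θ with hd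
  set A := (X *ᵥ d) ⬝ᵥ (X *ᵥ d) with hA
  have key : ∀ t : ℝ, 0 < t → t ≤ 1 →
      (r ᵥ* X) ⬝ᵥ d ≤ lam * (l1 θ' - l1 θ) + t * (A / 2) := by
    intro t ht ht1
    have h1 := h (θ + t • d)
    have h2 : resid X y (θ + t • d) = r - t • (X *ᵥ d) := by
      simp only [hr, resid, mulVec_add, mulVec_smul]; abel
    have h3 : l1 (θ + t • d) ≤ (1 - t) * l1 θ + t * l1 θ' := by
      have : θ + t • d = (1 - t) • θ + t • θ' := by
        rw [hd, smul_sub, sub_smul, one_smul]; abel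
      rw [this]
      refine (l1_add_le _ _).trans ?_
      rw [l1_smul, l1_smul, abs_of_nonneg ht.le, abs_of_nonneg (by linarith)]
    have h4 := mul_le_mul_of_nonneg_left h3 hl
    simp only [obj, h2, ss_sub, ← hr, dotProduct_smul, smul_dotProduct, smul_eq_mul] at h1
    rw [← dotProduct_mulVec]
    have : t * (r ⬝ᵥ X *ᵥ d) ≤ t * (lam * (l1 θ' - l1 θ) + t * (A / 2)) := by
      rw [hA]; nlinarith
    exact le_of_mul_le_mul_left this ht
  refine le_of_forall_pos_le_add fun e he => ?_
  have hA0 : 0 ≤ A := ss_nonneg _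
  refine (key (min 1 (e / (A + 1))) (lt_min one_pos (by positivity)) (min_le_left _ _)).trans ?_
  have : min 1 (e / (A + 1)) * (A / 2) ≤ e / (A + 1) * (A / 2) := by
    gcongr; exact min_le_right _ _
  have h5 : e / (A + 1) * (A / 2) ≤ e := by
    rw [div_mul_div_comm, div_le_iff₀ (by positivity)]; nlinarith
  linarith

/-- Converse: stationarity implies optimality. -/
lemma isLasso_of_variational
    (h : ∀ θ', (resid X y θ ᵥ* X) ⬝ᵥ (θ' - θ) ≤ lam * (l1 θ' - l1 θ)) : IsLasso X y lam θ := by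
  intro θ'
  have h1 := h θ'
  rw [← dotProduct_mulVec] at h1
  have h2 : resid X y θ' = resid X y θ - X *ᵥ (θ' - θ) := by
    simp only [resid, mulVec_sub]; abel
  simp only [obj, h2, ss_sub]
  nlinarith [ss_nonneg (X *ᵥ (θ' - θ))]

lemma l1_update (θ : Fin N → ℝ) (j : Fin N) (a : ℝ) :
    l1 (Function.update θ j a) - l1 θ = |a| - |θ j| := by
  simp only [l1]
  rw [← Finset.add_sum_erase _ (fun i => |Function.update θ j a i|) (Finset.mem_univ j), ← Finset.add_sum_erase _ (fun i => |θ i|) (Finset.mem_univ j)]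
  rw [Finset.sum_congr rfl (g := fun i => |θ i|)]
  · rw [Function.update_self]; ring
  · intro i hi; rw [Function.update_of_ne (Finset.ne_of_mem_erase hi)]

lemma coord_variational (h : IsLasso X y lam θ) (hl : 0 ≤ lam) (j : Fin N) (a : ℝ) :
    (resid X y θ ᵥ* X) j * (a - θ j) ≤ lam * (|a| - |θ j|) := by
  have h1 := variational h (Function.update θ j a) hl
  rw [l1_update] at h1
  have : Function.update θ j a - θ = Pi.single j (a - θ j) := by
    ext i; by_cases hi : i = j
    · subst hi; simp
    · simp [hi]
  rwa [this, dotProduct_single] at h1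

lemma kkt_mul (h : IsLasso X y lam θ) (hl : 0 ≤ lam) (j : Fin N) :
    (resid X y θ ᵥ* X) j * θ j = lam * |θ j| := by
  have h1 := coord_variational h hl j 0
  have h2 := coord_variational h hl j (2 * θ j)
  simp only [abs_zero, abs_mul, abs_two] at h1 h2
  linarith

lemma kkt_abs (h : IsLasso X y lam θ) (hl : 0 ≤ lam) (j : Fin N) :
    |(resid X y θ ᵥ* X) j| ≤ lam := by
  have h1 := coord_variational h hl j 1
  have h2 := coord_variational h hl j (-1)
  have h3 := kkt_mul h hl j
  simp only [abs_one, abs_neg] at h1 h2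
  rw [abs_le]; constructor <;> linarith

lemma kkt_of_ne (h : IsLasso X y lam θ) (hl : 0 ≤ lam) (j : Fin N) (hj : θ j ≠ 0) :
    |(resid X y θ ᵥ* X) j| = lam := by
  have h3 := congrArg abs (kkt_mul h hl j)
  rw [abs_mul, abs_mul, abs_abs, abs_of_nonneg hl] at h3
  exact mul_right_cancel₀ (abs_ne_zero.2 hj) h3

lemma isLasso_of_kkt (h1 : ∀ j, |(resid X y θ ᵥ* X) j| ≤ lam)
    (h2 : ∀ j, (resid X y θ ᵥ* X) j * θ j = lam * |θ j|) : IsLasso X y lam θ := by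
  refine isLasso_of_variational fun θ' => ?_
  simp only [dotProduct, l1, Pi.sub_apply, mul_sub, ← Finset.sum_sub_distrib, Finset.mul_sum]
  refine Finset.sum_le_sum fun j _ => ?_
  rw [h2]
  have := (le_abs_self _).trans (abs_mul ((resid X y θ ᵥ* X) j) (θ' j)).le
  nlinarith [mul_le_mul_of_nonneg_right (h1 j) (abs_nonneg (θ' j))]

/-- Residuals at two penalty levels. -/
lemma resid_sub_sq_le {lam' : ℝ} {θ' : Fin N → ℝ} (h : IsLasso X y lam θ) (h' : IsLasso X y lam' θ')
    (hl : 0 ≤ lam) (hl' : 0 ≤ lam') :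
    (resid X y θ - resid X y θ') ⬝ᵥ (resid X y θ - resid X y θ') ≤
      (lam - lam') * (l1 θ' - l1 θ) := by
  have h1 := variational h θ' hl
  have h2 := variational h' θ hl'
  rw [← dotProduct_mulVec] at h1 h2
  have h3 : resid X y θ - resid X y θ' = X *ᵥ (θ' - θ) := by
    simp only [resid, mulVec_sub]; abel
  have h4 : X *ᵥ (θ - θ') = -(X *ᵥ (θ' - θ)) := by simp only [mulVec_sub]; abel
  rw [h4, dotProduct_neg] at h2
  nth_rewrite 2 [h3]
  rw [sub_dotProduct]
  linarith

lemma resid_unique {θ' : Fin N → ℝ} (h : IsLasso X y lam θ) (h' : IsLasso X y lam θ')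
    (hl : 0 ≤ lam) : resid X y θ = resid X y θ' := by
  have := resid_sub_sq_le h h' hl hl
  simp only [sub_self, zero_mul] at this
  exact sub_eq_zero.1 (ss_eq_zero.1 (le_antisymm this (ss_nonneg _)))

end Lasso

namespace Lasso

open Matrix

/-- The first row of the design determined by the other rows, the subgradient and the residual. -/
def chartRow {m N : ℕ} (lam : ℝ) (Y : Fin m → Fin N → ℝ) (v : Fin N → ℝ) (r : Fin (m + 1) → ℝ) :
    Fin N → ℝ :=
  fun j => (lam * v j - ∑ i, Y i j * r i.succ) / r 0

/-- The design determined by the other rows, the subgradient and the residual. -/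
def chartDesign {m N : ℕ} (lam : ℝ) (Y : Fin m → Fin N → ℝ) (v : Fin N → ℝ) (r : Fin (m + 1) → ℝ) :
    Matrix (Fin (m + 1)) (Fin N) ℝ :=
  Fin.cons (α := fun _ => Fin N → ℝ) (chartRow lam Y v r) Y

/-- The first row of the design and the noise in terms of subgradient, estimator and residual. -/
def chartCore {m N : ℕ} (σ : ℝ) (θs : Fin N → ℝ) (lam : ℝ) (Y : Fin m → Fin N → ℝ)
    (v θ : Fin N → ℝ) (r : Fin (m + 1) → ℝ) : Fin N ⊕ Fin (m + 1) → ℝ :=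
  Sum.elim (chartRow lam Y v r)
    (fun i => σ⁻¹ * (r i + ∑ j, chartDesign lam Y v r i j * (θ j - θs j)))

variable {m N : ℕ} {σ lam : ℝ} {θs : Fin N → ℝ} {Y : Fin m → Fin N → ℝ}

lemma chartDesign_zero (v : Fin N → ℝ) (r : Fin (m + 1) → ℝ) :
    chartDesign lam Y v r 0 = chartRow lam Y v r := rfl

lemma chartDesign_succ (v : Fin N → ℝ) (r : Fin (m + 1) → ℝ) (i : Fin m) :
    chartDesign lam Y v r i.succ = Y i := rfl

lemma vecMul_chartDesign (v : Fin N → ℝ) {r : Fin (m + 1) → ℝ} (hr : r 0 ≠ 0) :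
    r ᵥ* chartDesign lam Y v r = lam • v := by
  ext j
  simp only [vecMul, dotProduct, Fin.sum_univ_succ, chartDesign_zero, chartDesign_succ, chartRow,
    Pi.smul_apply, smul_eq_mul]
  rw [mul_div_cancel₀ _ hr]
  simp only [mul_comm (r _)]
  ring

lemma eq_chartDesign {X : Matrix (Fin (m + 1)) (Fin N) ℝ} {v : Fin N → ℝ} {r : Fin (m + 1) → ℝ}
    (hr : r 0 ≠ 0) (h : r ᵥ* X = lam • v) : chartDesign lam (fun i => X i.succ) v r = X := by
  ext i j
  refine Fin.cases ?_ (fun i => rfl) i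
  have := congrFun h j
  simp only [vecMul, dotProduct, Fin.sum_univ_succ, Pi.smul_apply, smul_eq_mul] at this
  rw [chartDesign_zero, chartRow, ← this, div_eq_iff hr]
  simp only [mul_comm (r _)]
  ring

/-- The smooth chart with an affine subgradient map `g ↦ a + e * g`. -/
def chartAff (σ : ℝ) (θs : Fin N → ℝ) (lam : ℝ) (Y : Fin m → Fin N → ℝ) (a e : Fin N → ℝ)
    (ξ : Fin N ⊕ Fin (m + 1) → ℝ) : Fin N ⊕ Fin (m + 1) → ℝ :=
  chartCore σ θs lam Y (fun j => a j + e j * ξ (.inl j))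
    (fun j => ξ (.inl j) - (a j + e j * ξ (.inl j))) (fun i => ξ (.inr i))

/-- The Jacobian matrix of the chart, factored. -/
def chartJac (σ lam r0 : ℝ) (X : Matrix (Fin (m + 1)) (Fin N) ℝ) (e w : Fin N → ℝ) :
    Matrix (Fin N ⊕ Fin (m + 1)) (Fin N ⊕ Fin (m + 1)) ℝ :=
  fromBlocks 1 0 (σ⁻¹ • vecMulVec (Pi.single 0 1) w) (σ⁻¹ • 1) *
    fromBlocks (r0⁻¹ • lam • diagonal e) (-(r0⁻¹ • Xᵀ)) (X * diagonal (1 - e)) 1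

lemma det_chartJac (σ lam r0 : ℝ) (X : Matrix (Fin (m + 1)) (Fin N) ℝ) (e w : Fin N → ℝ) :
    (chartJac σ lam r0 X e w).det =
      σ⁻¹ ^ (m + 1) * (r0⁻¹ ^ N * (lam • diagonal e + Xᵀ * X * diagonal (1 - e)).det) := by
  rw [chartJac, det_mul, det_fromBlocks_zero₁₂, det_fromBlocks_one₂₂]
  simp only [det_one, one_mul, det_smul, Fintype.card_fin, mul_one]
  congr 1
  have : r0⁻¹ • lam • diagonal e - -(r0⁻¹ • Xᵀ) * (X * diagonal (1 - e)) =
      r0⁻¹ • (lam • diagonal e + Xᵀ * X * diagonal (1 - e)) := by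
    rw [Matrix.neg_mul, sub_neg_eq_add, smul_add, Matrix.smul_mul, Matrix.mul_assoc]
  rw [this, det_smul, Fintype.card_fin]

lemma hasFDerivAt_chartRow (a e : Fin N → ℝ) {ξ : Fin N ⊕ Fin (m + 1) → ℝ} (hr : ξ (.inr 0) ≠ 0)
    (j : Fin N) :
    HasFDerivAt (fun ξ : Fin N ⊕ Fin (m + 1) → ℝ =>
        chartRow lam Y (fun j => a j + e j * ξ (.inl j)) (fun i => ξ (.inr i)) j)
      ((ξ (.inr 0))⁻¹ • ((lam * e j) • ContinuousLinearMap.proj (R := ℝ) (φ := fun _ => ℝ) (Sum.inl j) -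
        ∑ i, chartDesign lam Y (fun j => a j + e j * ξ (.inl j)) (fun i => ξ (.inr i)) i j •
          ContinuousLinearMap.proj (R := ℝ) (φ := fun _ => ℝ) (Sum.inr i))) ξ := by
  have hp : ∀ c : Fin N ⊕ Fin (m + 1), HasFDerivAt (fun ξ : Fin N ⊕ Fin (m + 1) → ℝ => ξ c)
      (ContinuousLinearMap.proj (R := ℝ) (φ := fun _ => ℝ) c) ξ := fun c => hasFDerivAt_apply c ξ
  have h1 : HasFDerivAt (fun ξ : Fin N ⊕ Fin (m + 1) → ℝ =>
      lam * (a j + e j * ξ (.inl j)) - ∑ i : Fin m, Y i j * ξ (.inr i.succ))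
      (lam • (e j • ContinuousLinearMap.proj (R := ℝ) (φ := fun _ => ℝ) (Sum.inl j)) -
        ∑ i : Fin m, Y i j • ContinuousLinearMap.proj (R := ℝ) (φ := fun _ => ℝ) (Sum.inr i.succ)) ξ := by
    refine HasFDerivAt.sub ((((hp _).const_mul _).const_add _).const_mul _) ?_
    exact HasFDerivAt.fun_sum fun i _ => (hp _).const_mul _
  have h2 := h1.fun_mul ((hasDerivAt_inv hr).comp_hasFDerivAt ξ (hp (.inr 0)))
  unfold chartRow
  simp only [div_eq_mul_inv]
  refine h2.congr_fderiv ?_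
  ext x
  simp [Fin.sum_univ_succ, chartDesign_zero, chartDesign_succ, chartRow]
  field_simp
  ring

lemma hasFDerivAt_chartAff (a e : Fin N → ℝ) {ξ : Fin N ⊕ Fin (m + 1) → ℝ} (hr : ξ (.inr 0) ≠ 0) :
    HasFDerivAt (chartAff σ θs lam Y a e)
      (Matrix.toLin' (chartJac σ lam (ξ (.inr 0))
        (chartDesign lam Y (fun j => a j + e j * ξ (.inl j)) (fun i => ξ (.inr i))) e
        (fun j => ξ (.inl j) - (a j + e j * ξ (.inl j)) - θs j))).toContinuousLinearMap ξ := by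
  have hp : ∀ c : Fin N ⊕ Fin (m + 1), HasFDerivAt (fun ξ : Fin N ⊕ Fin (m + 1) → ℝ => ξ c)
      (ContinuousLinearMap.proj (R := ℝ) (φ := fun _ => ℝ) c) ξ := fun c => hasFDerivAt_apply c ξ
  have hrow := hasFDerivAt_chartRow (lam := lam) (Y := Y) a e hr
  set X := chartDesign lam Y (fun j => a j + e j * ξ (.inl j)) (fun i => ξ (.inr i)) with hX
  set D : Fin N → ((Fin N ⊕ Fin (m + 1) → ℝ) →L[ℝ] ℝ) := fun j =>
    ((ξ (.inr 0))⁻¹ • ((lam * e j) • ContinuousLinearMap.proj (R := ℝ) (φ := fun _ => ℝ) (Sum.inl j) -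
        ∑ i, X i j • ContinuousLinearMap.proj (R := ℝ) (φ := fun _ => ℝ) (Sum.inr i))) with hD
  have hDx : ∀ j x, D j x = (((ξ (.inr 0))⁻¹ • lam • diagonal e) *ᵥ (x ∘ Sum.inl) +
      (-((ξ (.inr 0))⁻¹ • Xᵀ)) *ᵥ (x ∘ Sum.inr)) j := by
    intro j x
    rw [smul_mulVec, smul_mulVec, neg_mulVec, smul_mulVec]
    simp only [Pi.add_apply, Pi.neg_apply, Pi.smul_apply, mulVec_diagonal, smul_eq_mul, hD,
      _root_.smul_apply, _root_.sub_apply, _root_.sum_apply, ContinuousLinearMap.proj_apply]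
    simp only [mulVec, dotProduct, transpose_apply, Function.comp]
    ring
  rw [hasFDerivAt_pi']
  intro c
  rcases c with j | i
  · refine (hrow j).congr_fderiv ?_
    ext x
    change D j x = _
    simp only [hDx, chartJac, ContinuousLinearMap.comp_apply, ContinuousLinearMap.proj_apply,
      LinearMap.coe_toContinuousLinearMap', toLin'_apply, ← mulVec_mulVec, fromBlocks_mulVec]
    simp only [Sum.elim_inl, one_mulVec, zero_mulVec, add_zero, Sum.elim_comp_inl]
  · have hdes : ∀ j, HasFDerivAt (fun ξ : Fin N ⊕ Fin (m + 1) → ℝ =>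
        chartDesign lam Y (fun j => a j + e j * ξ (.inl j)) (fun i => ξ (.inr i)) i j)
        ((Pi.single 0 1 : Fin (m + 1) → ℝ) i • D j) ξ := by
      intro j
      refine Fin.cases ?_ (fun i => ?_) i
      · have h0 := hrow j
        simp only [Pi.single_eq_same, one_smul]
        exact h0
      · simp only [chartDesign_succ, Pi.single_eq_of_ne (Fin.succ_ne_zero i), zero_smul]
        exact hasFDerivAt_const _ _
    have hth : ∀ j, HasFDerivAt (fun ξ : Fin N ⊕ Fin (m + 1) → ℝ =>
        ξ (.inl j) - (a j + e j * ξ (.inl j)) - θs j)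
        ((1 - e j) • ContinuousLinearMap.proj (R := ℝ) (φ := fun _ => ℝ) (Sum.inl j)) ξ := by
      intro j
      refine (((hp (.inl j)).sub (((hp (.inl j)).const_mul (e j)).const_add (a j))).sub_const
        (θs j)).congr_fderiv ?_
      ext x; simp; ring
    have h := ((hp (.inr i)).fun_add (HasFDerivAt.fun_sum fun j (_ : j ∈ Finset.univ) =>
      (hdes j).fun_mul (hth j))).const_mul σ⁻¹
    refine HasFDerivAt.congr_fderiv h ?_
    ext x
    simp only [chartJac, ContinuousLinearMap.comp_apply, ContinuousLinearMap.proj_apply,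
      LinearMap.coe_toContinuousLinearMap', toLin'_apply, ← mulVec_mulVec, fromBlocks_mulVec]
    simp only [Sum.elim_inr, _root_.smul_apply, _root_.add_apply, Sum.elim_comp_inl,
      Sum.elim_comp_inr, _root_.sum_apply, ContinuousLinearMap.proj_apply, smul_eq_mul, hDx]
    generalize hu : (((ξ (.inr 0))⁻¹ • lam • diagonal e) *ᵥ (x ∘ Sum.inl) +
      (-((ξ (.inr 0))⁻¹ • Xᵀ)) *ᵥ (x ∘ Sum.inr)) = u
    simp only [smul_mulVec, one_mulVec, Pi.add_apply, Pi.smul_apply, vecMulVec_mulVec, smul_eq_mul]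
    rw [← hX, ← mul_add]
    congr 1
    rw [Finset.sum_add_distrib]
    simp only [mulVec, dotProduct, diagonal_apply, Function.comp, Pi.sub_apply, Pi.one_apply,
      ite_mul, zero_mul, Finset.sum_ite_eq, Finset.mem_univ, if_true, MulOpposite.smul_eq_mul_unop,
      MulOpposite.unop_op]
    rw [show ∀ s : ℝ, ∑ j, (ξ (Sum.inl j) - (a j + e j * ξ (Sum.inl j)) - θs j) * (s * u j) =
      (∑ j, (ξ (Sum.inl j) - (a j + e j * ξ (Sum.inl j)) - θs j) * u j) * s from fun s => by
        rw [Finset.sum_mul]; exact Finset.sum_congr rfl fun j _ => by ring]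
    ring

end Lasso

namespace Lasso

open Matrix

/-- Projection of a real number onto `[-1, 1]`. -/
def clip (x : ℝ) : ℝ := max (-1) (min x 1)

/-- The sign pattern of a coordinate: zero inside the open unit interval. -/
def pat (x : ℝ) : SignType := if |x| < 1 then 0 else SignType.sign x

/-- Indicator of the inactive coordinates of a pattern. -/
def gate (P : SignType) : ℝ := if P = 0 then 1 else 0

lemma measurable_clip : Measurable clip := by unfold clip; fun_prop

lemma clip_of_abs_le {x : ℝ} (h : |x| ≤ 1) : clip x = x := by
  rw [abs_le] at h
  rw [clip, min_eq_left h.2, max_eq_right h.1]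

lemma clip_of_ge {x : ℝ} (h : 1 ≤ x) : clip x = 1 := by
  rw [clip, min_eq_right h, max_eq_right (by norm_num)]

lemma clip_of_le {x : ℝ} (h : x ≤ -1) : clip x = -1 := by
  rw [clip, min_eq_left (by linarith), max_eq_left h]

lemma abs_clip_le (x : ℝ) : |clip x| ≤ 1 := by
  rw [abs_le]
  exact ⟨le_max_left _ _, max_le (by norm_num) (min_le_right _ _)⟩

lemma clip_cases (x : ℝ) : (|x| < 1 ∧ clip x = x) ∨ (1 ≤ x ∧ clip x = 1) ∨ (x ≤ -1 ∧ clip x = -1) := by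
  rcases lt_or_ge (|x|) 1 with h | h
  · exact .inl ⟨h, clip_of_abs_le h.le⟩
  · rcases le_abs.1 h with h | h
    · exact .inr (.inl ⟨h, clip_of_ge h⟩)
    · exact .inr (.inr ⟨by linarith, clip_of_le (by linarith)⟩)

lemma clip_mul_sub (x : ℝ) : clip x * (x - clip x) = |x - clip x| := by
  rcases clip_cases x with ⟨_, h⟩ | ⟨h', h⟩ | ⟨h', h⟩
  · simp [h]
  · rw [h, abs_of_nonneg (by linarith), one_mul]
  · rw [h, abs_of_nonpos (by linarith)]; ring

lemma clip_add {v t : ℝ} (hv : |v| ≤ 1) (h : v * t = |t|) : clip (v + t) = v := by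
  rw [abs_le] at hv
  rcases lt_trichotomy t 0 with ht | ht | ht
  · rw [abs_of_neg ht] at h
    have : v = -1 := by nlinarith
    rw [this]; exact clip_of_le (by linarith)
  · rw [ht, add_zero]; exact clip_of_abs_le (abs_le.2 hv)
  · rw [abs_of_pos ht] at h
    have : v = 1 := by nlinarith
    rw [this]; exact clip_of_ge (by linarith)

lemma abs_clip_lt_iff {x : ℝ} : |clip x| < 1 ↔ |x| < 1 := by
  rcases clip_cases x with ⟨h', h⟩ | ⟨h', h⟩ | ⟨h', h⟩
  · rw [h]
  · rw [h]; simp; exact le_abs.2 (.inl h')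
  · rw [h]; simp; exact le_abs.2 (.inr (by linarith))

lemma clip_eq_pat (x : ℝ) : clip x = (pat x : ℝ) + gate (pat x) * x := by
  rcases clip_cases x with ⟨h', h⟩ | ⟨h', h⟩ | ⟨h', h⟩
  · rw [h, pat, if_pos h']; simp [gate]
  · have : pat x = 1 := by
      rw [pat, if_neg (not_lt.2 (le_abs.2 (.inl h'))), sign_pos (by linarith)]
    rw [h, this]; simp [gate]
  · have : pat x = -1 := by
      rw [pat, if_neg (not_lt.2 (le_abs.2 (.inr (by linarith)))), sign_neg (by linarith)]
    rw [h, this]; simp [gate]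

lemma pat_eq_zero_iff {x : ℝ} : pat x = 0 ↔ |x| < 1 := by
  rw [pat]
  split_ifs with h
  · simpa using h
  · simp only [h, iff_false, sign_eq_zero_iff]
    rintro rfl; simp at h

lemma pat_clip (x y : ℝ) (h : clip x = clip y) : gate (pat x) = gate (pat y) := by
  simp only [gate, pat_eq_zero_iff, ← abs_clip_lt_iff (x := x), ← abs_clip_lt_iff (x := y), h]

lemma eventually_clip {x : ℝ} (h : |x| ≠ 1) :
    ∀ᶠ y in nhds x, clip y = (pat x : ℝ) + gate (pat x) * y := by
  rcases clip_cases x with ⟨h', _⟩ | ⟨h', _⟩ | ⟨h', _⟩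
  · filter_upwards [continuous_abs.continuousAt.eventually_lt continuousAt_const h'] with y hy
    rw [clip_of_abs_le hy.le, pat, if_pos h']; simp [gate]
  · have h1 : 1 < x := lt_of_le_of_ne h' fun h2 => h (by rw [← h2]; simp)
    have : pat x = 1 := by
      rw [pat, if_neg (not_lt.2 (le_abs.2 (.inl h'))), sign_pos (by linarith)]
    filter_upwards [lt_mem_nhds h1] with y hy
    rw [clip_of_ge hy.le, this]; simp [gate]
  · have h1 : x < -1 := lt_of_le_of_ne h' fun h2 => h (by rw [h2]; simp)
    have : pat x = -1 := by
      rw [pat, if_neg (not_lt.2 (le_abs.2 (.inr (by linarith)))), sign_neg (by linarith)]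
    filter_upwards [gt_mem_nhds h1] with y hy
    rw [clip_of_le hy.le, this]; simp [gate]

variable {m N : ℕ} {σ lam : ℝ} {θs : Fin N → ℝ} {Y : Fin m → Fin N → ℝ}

/-- The subgradient coordinate of a chart point. -/
def cV (ξ : Fin N ⊕ Fin (m + 1) → ℝ) : Fin N → ℝ := fun j => clip (ξ (.inl j))

/-- The estimator coordinate of a chart point. -/
def cT (ξ : Fin N ⊕ Fin (m + 1) → ℝ) : Fin N → ℝ := fun j => ξ (.inl j) - clip (ξ (.inl j))

/-- The residual coordinate of a chart point. -/
def cR (ξ : Fin N ⊕ Fin (m + 1) → ℝ) : Fin (m + 1) → ℝ := fun i => ξ (.inr i)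

/-- The inactive set of a chart point. -/
def cE (ξ : Fin N ⊕ Fin (m + 1) → ℝ) : Fin N → ℝ := fun j => gate (pat (ξ (.inl j)))

/-- The design of a chart point. -/
def cX (lam : ℝ) (q : (Fin m → Fin N → ℝ) × (Fin N ⊕ Fin (m + 1) → ℝ)) :
    Matrix (Fin (m + 1)) (Fin N) ℝ := chartDesign lam q.1 (cV q.2) (cR q.2)

/-- The noise of a chart point. -/
def cZ (σ : ℝ) (θs : Fin N → ℝ) (lam : ℝ) (q : (Fin m → Fin N → ℝ) × (Fin N ⊕ Fin (m + 1) → ℝ)) :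
    Fin (m + 1) → ℝ := fun i => σ⁻¹ * (cR q.2 i + ∑ j, cX lam q i j * (cT q.2 j - θs j))

/-- The chart of the sample space. -/
def chart (σ : ℝ) (θs : Fin N → ℝ) (lam : ℝ) (q : (Fin m → Fin N → ℝ) × (Fin N ⊕ Fin (m + 1) → ℝ)) :
    (Fin (m + 1) → Fin N → ℝ) × (Fin (m + 1) → ℝ) := (cX lam q, cZ σ θs lam q)

/-- The matrix `Λ + XᵀX 1_S`. -/
def cM (lam : ℝ) (X : Matrix (Fin (m + 1)) (Fin N) ℝ) (e : Fin N → ℝ) : Matrix (Fin N) (Fin N) ℝ :=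
  lam • diagonal e + Xᵀ * X * diagonal (1 - e)

/-- The Jacobian determinant of the chart. -/
def cJ (σ lam : ℝ) (q : (Fin m → Fin N → ℝ) × (Fin N ⊕ Fin (m + 1) → ℝ)) : ℝ :=
  σ⁻¹ ^ (m + 1) * ((cR q.2 0)⁻¹ ^ N * (cM lam (cX lam q) (cE q.2)).det)

/-- The regular domain of the chart. -/
def cU (m N : ℕ) (lam : ℝ) : Set ((Fin m → Fin N → ℝ) × (Fin N ⊕ Fin (m + 1) → ℝ)) :=
  {q | (∀ i, cR q.2 i ≠ 0) ∧ (∀ j, |q.2 (.inl j)| ≠ 1) ∧ (cM lam (cX lam q) (cE q.2)).det ≠ 0}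

lemma yvec_chart (hσ : σ ≠ 0) (q : (Fin m → Fin N → ℝ) × (Fin N ⊕ Fin (m + 1) → ℝ)) :
    resid (cX lam q) (yvec σ θs (cX lam q) (cZ σ θs lam q)) (cT q.2) = cR q.2 := by
  ext i
  simp only [resid, yvec, cZ, Pi.sub_apply, mulVec, dotProduct]
  rw [mul_inv_cancel_left₀ hσ]
  simp only [mul_sub, Finset.sum_sub_distrib]
  ring

lemma isLasso_chart (hσ : σ ≠ 0) (hl : 0 ≤ lam) {q : (Fin m → Fin N → ℝ) × (Fin N ⊕ Fin (m + 1) → ℝ)}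
    (hr : cR q.2 0 ≠ 0) :
    IsLasso (cX lam q) (yvec σ θs (cX lam q) (cZ σ θs lam q)) lam (cT q.2) := by
  have hv : cR q.2 ᵥ* cX lam q = lam • cV q.2 := vecMul_chartDesign _ hr
  refine isLasso_of_kkt (fun j => ?_) (fun j => ?_)
  · rw [yvec_chart hσ, hv, Pi.smul_apply, smul_eq_mul, abs_mul, abs_of_nonneg hl]
    exact mul_le_of_le_one_right hl (abs_clip_le _)
  · rw [yvec_chart hσ, hv, Pi.smul_apply, smul_eq_mul, mul_assoc]
    congr 1
    exact clip_mul_sub _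

/-- Chart coordinates of a sample with given estimator. -/
def coord (lam : ℝ) (X : Matrix (Fin (m + 1)) (Fin N) ℝ) (y : Fin (m + 1) → ℝ) (θ : Fin N → ℝ) :
    (Fin m → Fin N → ℝ) × (Fin N ⊕ Fin (m + 1) → ℝ) :=
  (fun i => X i.succ, Sum.elim (lam⁻¹ • (resid X y θ ᵥ* X) + θ) (resid X y θ))

lemma cV_coord {X : Matrix (Fin (m + 1)) (Fin N) ℝ} {y : Fin (m + 1) → ℝ} {θ : Fin N → ℝ} (hl : 0 < lam)
    (h : IsLasso X y lam θ) : cV (coord lam X y θ).2 = lam⁻¹ • (resid X y θ ᵥ* X) := by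
  ext j
  refine clip_add ?_ ?_
  · rw [Pi.smul_apply, smul_eq_mul, abs_mul, abs_of_pos (inv_pos.2 hl), inv_mul_le_one₀ hl]
    exact kkt_abs h hl.le j
  · rw [Pi.smul_apply, smul_eq_mul, mul_assoc, kkt_mul h hl.le j, inv_mul_cancel_left₀ hl.ne']

lemma cT_coord {X : Matrix (Fin (m + 1)) (Fin N) ℝ} {y : Fin (m + 1) → ℝ} {θ : Fin N → ℝ} (hl : 0 < lam)
    (h : IsLasso X y lam θ) : cT (coord lam X y θ).2 = θ := by
  ext j
  have := congrFun (cV_coord hl h) j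
  rw [cV] at this
  rw [cT, this, coord]
  simp

lemma cR_coord {X : Matrix (Fin (m + 1)) (Fin N) ℝ} {y : Fin (m + 1) → ℝ} {θ : Fin N → ℝ} :
    cR (coord lam X y θ).2 = resid X y θ := rfl

lemma cX_coord {X : Matrix (Fin (m + 1)) (Fin N) ℝ} {y : Fin (m + 1) → ℝ} {θ : Fin N → ℝ} (hl : 0 < lam)
    (h : IsLasso X y lam θ) (hr : resid X y θ 0 ≠ 0) : cX lam (coord lam X y θ) = X := by
  rw [cX, cV_coord hl h, cR_coord]
  refine eq_chartDesign hr ?_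
  rw [smul_smul, mul_inv_cancel₀ hl.ne', one_smul]

lemma chart_coord {X : Matrix (Fin (m + 1)) (Fin N) ℝ} {z : Fin (m + 1) → ℝ} {θ : Fin N → ℝ}
    (hσ : σ ≠ 0) (hl : 0 < lam) (h : IsLasso X (yvec σ θs X z) lam θ)
    (hr : resid X (yvec σ θs X z) θ 0 ≠ 0) :
    chart σ θs lam (coord lam X (yvec σ θs X z) θ) = (X, z) := by
  rw [chart, cX_coord hl h hr]
  refine Prod.ext rfl ?_
  ext i
  simp only [cZ, cX_coord hl h hr, cT_coord hl h, cR_coord]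
  simp only [resid, yvec, Pi.sub_apply, mulVec, dotProduct, mul_sub, Finset.sum_sub_distrib]
  field_simp
  ring

lemma injOn_chart (hσ : σ ≠ 0) (hl : 0 < lam) : Set.InjOn (chart (m := m) σ θs lam) (cU m N lam) := by
  rintro q hq q' hq' h
  have hX : cX lam q = cX lam q' := congrArg Prod.fst h
  have hZ : cZ σ θs lam q = cZ σ θs lam q' := congrArg Prod.snd h
  have h1 := isLasso_chart (σ := σ) (θs := θs) hσ hl.le (hq.1 0)
  have h2 := isLasso_chart (σ := σ) (θs := θs) hσ hl.le (hq'.1 0)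
  have hr : cR q.2 = cR q'.2 := by
    rw [← yvec_chart (θs := θs) (lam := lam) hσ q, ← yvec_chart (θs := θs) (lam := lam) hσ q']
    rw [← hX, ← hZ] at h2 ⊢
    exact resid_unique h1 h2 hl.le
  have hv : cV q.2 = cV q'.2 := by
    have e1 : cR q.2 ᵥ* cX lam q = lam • cV q.2 := vecMul_chartDesign _ (hq.1 0)
    have e2 : cR q'.2 ᵥ* cX lam q' = lam • cV q'.2 := vecMul_chartDesign _ (hq'.1 0)
    rw [hr, hX, e2] at e1
    exact (smul_right_injective _ hl.ne' e1).symm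
  have hE : cE q.2 = cE q'.2 := by
    ext j; exact pat_clip _ _ (congrFun hv j)
  have hY : q.1 = q'.1 := by
    ext i j; exact congrFun (congrFun hX i.succ) j
  have hT0 : ∀ p : (Fin m → Fin N → ℝ) × (Fin N ⊕ Fin (m + 1) → ℝ), ∀ j, cE p.2 j * cT p.2 j = 0 := by
    intro p j
    simp only [cE, cT, gate, pat_eq_zero_iff]
    split_ifs with hh
    · rw [clip_of_abs_le hh.le]; simp
    · simp
  have hXT : cX lam q *ᵥ (cT q.2 - cT q'.2) = 0 := by
    have e1 := yvec_chart (θs := θs) (lam := lam) hσ q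
    have e2 := yvec_chart (θs := θs) (lam := lam) hσ q'
    rw [← hX, ← hZ, ← hr, ← e1, resid, resid] at e2
    rw [mulVec_sub, sub_eq_zero]
    exact (sub_right_injective e2).symm
  have hd : cT q.2 - cT q'.2 = 0 := by
    refine eq_zero_of_mulVec_eq_zero hq.2.2 ?_
    have e3 : diagonal (1 - cE q.2) *ᵥ (cT q.2 - cT q'.2) = cT q.2 - cT q'.2 := by
      ext j
      have := hT0 q j
      have h5 := hT0 q' j
      rw [← hE] at h5
      simp only [mulVec_diagonal, Pi.sub_apply, Pi.one_apply, sub_mul, mul_sub, one_mul, this, h5]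
      ring
    rw [cM, add_mulVec, ← mulVec_mulVec, ← mulVec_mulVec, e3, hXT, mulVec_zero, add_zero, smul_mulVec]
    ext j
    have := hT0 q j
    have h5 := hT0 q' j
    rw [← hE] at h5
    simp only [Pi.smul_apply, mulVec_diagonal, Pi.sub_apply, mul_sub, this, h5]
    simp
  refine Prod.ext hY ?_
  ext c
  rcases c with j | i
  · have e1 := congrFun hd j
    have e2 := congrFun hv j
    simp only [cT, cV, Pi.sub_apply, Pi.zero_apply] at e1 e2
    linarith
  · exact congrFun hr i

end Lasso

namespace Lasso

open Matrix

instance isAddHaarMeasure_volume_pi_pi (m N : ℕ) :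
    (volume : Measure (Fin m → Fin N → ℝ)).IsAddHaarMeasure := by
  have : (volume : Measure (Fin N → ℝ)).IsAddHaarMeasure := inferInstance
  exact Measure.pi.isAddHaarMeasure _

/-- The space of chart coordinates. -/
abbrev CSpace (m N : ℕ) := (Fin m → Fin N → ℝ) × (Fin N ⊕ Fin (m + 1) → ℝ)

instance isAddHaarMeasure_volume_cspace (m N : ℕ) : (volume : Measure (CSpace m N)).IsAddHaarMeasure := by
  exact Measure.prod.instIsAddHaarMeasure _ _

/-- Reassembling a design and a noise vector from the other rows, the first row and the noise. -/
def assemble (m N : ℕ) : CSpace m N ≃ᵐ (Fin (m + 1) → Fin N → ℝ) × (Fin (m + 1) → ℝ) :=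
  ((MeasurableEquiv.prodCongr (MeasurableEquiv.refl _) (MeasurableEquiv.sumPiEquivProdPi fun _ => ℝ)).trans
   MeasurableEquiv.prodAssoc.symm).trans
   (MeasurableEquiv.prodCongr
    (MeasurableEquiv.prodComm.trans (MeasurableEquiv.piFinSuccAbove (fun _ => Fin N → ℝ) 0).symm)
    (MeasurableEquiv.refl _))

lemma assemble_apply (m N : ℕ) (q : CSpace m N) : assemble m N q =
    ((Fin.cons (α := fun _ => Fin N → ℝ) (fun j => q.2 (.inl j)) q.1), fun i => q.2 (.inr i)) := by
  refine Prod.ext ?_ rfl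
  change Fin.insertNth (α := fun _ => Fin N → ℝ) 0 (fun j => q.2 (.inl j)) q.1 = _
  exact Fin.insertNth_zero _ _

lemma measurePreserving_assemble (m N : ℕ) : MeasurePreserving (assemble m N) volume volume := by
  refine MeasurePreserving.trans (μb := volume) (MeasurePreserving.trans (μb := volume) ?_ ?_) ?_
  · exact (MeasurePreserving.id _).prod (volume_measurePreserving_sumPiEquivProdPi fun _ => ℝ)
  · exact MeasurePreserving.symm _ volume_preserving_prodAssoc
  · refine MeasurePreserving.prod ?_ (MeasurePreserving.id _)
    refine MeasurePreserving.trans (μb := (volume : Measure ((Fin N → ℝ) × (Fin m → Fin N → ℝ))))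
      Measure.measurePreserving_swap ?_
    exact MeasurePreserving.symm _ (volume_preserving_piFinSuccAbove (fun _ : Fin (m+1) => Fin N → ℝ) 0)

variable {m N : ℕ} {σ lam : ℝ} {θs : Fin N → ℝ}

/-- The slice of the chart at fixed other rows. -/
def cS (σ : ℝ) (θs : Fin N → ℝ) (lam : ℝ) (q : CSpace m N) : Fin N ⊕ Fin (m + 1) → ℝ :=
  chartCore σ θs lam q.1 (cV q.2) (cT q.2) (cR q.2)

lemma chart_eq (q : CSpace m N) : chart σ θs lam q = assemble m N (q.1, cS σ θs lam q) := by
  rw [assemble_apply]; rfl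

/-- Affine version of the chart for a fixed pattern. -/
def affS (σ : ℝ) (θs : Fin N → ℝ) (lam : ℝ) (P : Fin N → SignType) (q : CSpace m N) : CSpace m N :=
  (q.1, chartAff σ θs lam q.1 (fun j => (P j : ℝ)) (fun j => gate (P j)) q.2)

lemma differentiableAt_affS (P : Fin N → SignType) {q : CSpace m N} (hr : q.2 (.inr 0) ≠ 0) :
    DifferentiableAt ℝ (affS σ θs lam P) q := by
  have hrow : ∀ j, DifferentiableAt ℝ (fun q : CSpace m N => chartRow lam q.1
      (fun j => (P j : ℝ) + gate (P j) * q.2 (.inl j)) (fun i => q.2 (.inr i)) j) q := by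
    intro j
    unfold chartRow
    fun_prop (disch := exact hr)
  refine DifferentiableAt.prodMk differentiableAt_fst ?_
  rw [differentiableAt_pi]
  rintro (j | i)
  · exact hrow j
  · simp only [chartAff, chartCore, Sum.elim_inr]
    have hdes : ∀ j, DifferentiableAt ℝ (fun q : CSpace m N => chartDesign lam q.1
      (fun j => (P j : ℝ) + gate (P j) * q.2 (.inl j)) (fun i => q.2 (.inr i)) i j) q := by
      intro j
      refine Fin.cases (hrow j) (fun i => ?_) i
      simp only [chartDesign_succ]
      fun_prop
    fun_prop

lemma det_fderiv_affS (P : Fin N → SignType) {q : CSpace m N} (hr : q.2 (.inr 0) ≠ 0)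
    (hdet : (cM lam (chartDesign lam q.1 (fun j => (P j : ℝ) + gate (P j) * q.2 (.inl j))
      (fun i => q.2 (.inr i))) (fun j => gate (P j))).det = 0) :
    (fderiv ℝ (affS σ θs lam P) q).det = 0 := by
  have h1 := (differentiableAt_affS (σ := σ) (θs := θs) (lam := lam) P hr).hasFDerivAt
  have h2 := h1.snd.comp q.2 (f := fun ξ => (q.1, ξ)) (hasFDerivAt_prodMk_right q.1 q.2)
  have h3 := hasFDerivAt_chartAff (σ := σ) (θs := θs) (lam := lam) (Y := q.1) (fun j => (P j : ℝ))
    (fun j => gate (P j)) hr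
  have h4 := h3.unique h2
  have hd : (chartJac σ lam (q.2 (.inr 0))
        (chartDesign lam q.1 (fun j => (P j : ℝ) + gate (P j) * q.2 (.inl j)) (fun i => q.2 (.inr i)))
        (fun j => gate (P j))
        (fun j => q.2 (.inl j) - ((P j : ℝ) + gate (P j) * q.2 (.inl j)) - θs j)).det = 0 := by
    rw [det_chartJac]
    rw [cM] at hdet
    rw [hdet]; simp
  obtain ⟨u, hu0, hu⟩ := exists_mulVec_eq_zero_iff.2 hd
  have h5 := congrArg (fun L => L u) h4
  simp only [LinearMap.coe_toContinuousLinearMap', toLin'_apply, hu] at h5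
  change LinearMap.det _ = 0
  rw [LinearMap.det_eq_zero_iff_ker_ne_bot]
  intro hker
  have h6 : (((0 : Fin m → Fin N → ℝ), u) : CSpace m N) ∈
      LinearMap.ker (fderiv ℝ (affS σ θs lam P) q : CSpace m N →ₗ[ℝ] CSpace m N) := by
    rw [LinearMap.mem_ker]
    refine Prod.ext ?_ h5.symm
    have h7 := h1.fst
    have h8 : HasFDerivAt (fun x : CSpace m N => (affS σ θs lam P x).1)
        (ContinuousLinearMap.fst ℝ _ _) q := hasFDerivAt_fst
    exact congrArg (fun L => L ((0 : Fin m → Fin N → ℝ), u)) (h7.unique h8)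
  rw [hker, Submodule.mem_bot] at h6
  exact hu0 (congrArg Prod.snd h6)

lemma volume_coord_eq (c : Fin N ⊕ Fin (m + 1)) (t : ℝ) :
    (volume : Measure (CSpace m N)) {q | q.2 c = t} = 0 := by
  have : {q : CSpace m N | q.2 c = t} = Set.univ ×ˢ {ξ | ξ c = t} := by ext; simp
  rw [this, Measure.volume_eq_prod, Measure.prod_prod]
  have h0 : (volume : Measure (Fin N ⊕ Fin (m + 1) → ℝ)) {ξ | ξ c = t} = 0 :=
    Measure.pi_hyperplane _ _ _
  rw [h0, mul_zero]

lemma cS_eq_affS {q : CSpace m N} {P : Fin N → SignType}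
    (h : ∀ j, clip (q.2 (.inl j)) = (P j : ℝ) + gate (P j) * q.2 (.inl j)) :
    (q.1, cS σ θs lam q) = affS σ θs lam P q := by
  have hv : cV q.2 = fun j => (P j : ℝ) + gate (P j) * q.2 (.inl j) := funext h
  have ht : cT q.2 = fun j => q.2 (.inl j) - ((P j : ℝ) + gate (P j) * q.2 (.inl j)) :=
    funext fun j => by rw [cT, h j]
  rw [affS, cS, chartAff, hv, ht]; rfl

lemma volume_exceptional :
    (volume : Measure (CSpace m N))
      ((fun q => (q.1, cS σ θs lam q)) '' {q | cR q.2 0 ≠ 0 ∧ q ∉ cU m N lam}) = 0 := by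
  set A : (Fin N → SignType) → Set (CSpace m N) := fun P => {q | q.2 (.inr 0) ≠ 0 ∧
    (cM lam (chartDesign lam q.1 (fun j => (P j : ℝ) + gate (P j) * q.2 (.inl j))
      (fun i => q.2 (.inr i))) (fun j => gate (P j))).det = 0} with hA
  set B : (Fin N ⊕ Fin (m + 1)) × SignType → Set (CSpace m N) :=
    fun c => {q | q.2 (.inr 0) ≠ 0 ∧ q.2 c.1 = (c.2 : ℝ)} with hB
  have hsub : ((fun q => (q.1, cS σ θs lam q)) '' {q : CSpace m N | cR q.2 0 ≠ 0 ∧ q ∉ cU m N lam}) ⊆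
      ⋃ P : Fin N → SignType, (affS σ θs lam P '' A P ∪ ⋃ c, affS σ θs lam P '' B c) := by
    rintro _ ⟨q, ⟨hr, hq⟩, rfl⟩
    have hcl := fun j => clip_eq_pat (q.2 (.inl j))
    refine Set.mem_iUnion.2 ⟨fun j => pat (q.2 (.inl j)), ?_⟩
    simp only
    rw [cS_eq_affS hcl]
    simp only [cU, Set.mem_ofPred_eq, not_and_or, not_forall, not_not] at hq
    rcases hq with ⟨i, hi⟩ | ⟨j, hj⟩ | hd
    · refine .inr (Set.mem_iUnion.2 ⟨(.inr i, 0), Set.mem_image_of_mem _ ⟨hr, ?_⟩⟩)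
      simpa [cR] using hi
    · refine .inr ?_
      rcases (abs_eq zero_le_one).1 hj with hj | hj
      · exact Set.mem_iUnion.2 ⟨(.inl j, 1), Set.mem_image_of_mem _ ⟨hr, by simpa using hj⟩⟩
      · exact Set.mem_iUnion.2 ⟨(.inl j, -1), Set.mem_image_of_mem _ ⟨hr, by simpa using hj⟩⟩
    · refine .inl (Set.mem_image_of_mem _ ⟨hr, ?_⟩)
      convert hd using 3
      · rw [cX]
        congr 1
        exact (funext hcl).symm
      · rfl
  refine measure_mono_null hsub ?_
  rw [measure_iUnion_null_iff]
  intro P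
  refine measure_union_null ?_ ?_
  · exact addHaar_image_eq_zero_of_det_fderivWithin_eq_zero volume
      (fun q hq => (differentiableAt_affS P hq.1).hasFDerivAt.hasFDerivWithinAt)
      (fun q hq => det_fderiv_affS P hq.1 hq.2)
  · rw [measure_iUnion_null_iff]
    intro c
    refine addHaar_image_eq_zero_of_differentiableOn_of_addHaar_eq_zero volume
      (fun q hq => (differentiableAt_affS P hq.1).differentiableWithinAt) ?_
    exact measure_mono_null (fun q hq => hq.2) (volume_coord_eq c.1 (c.2 : ℝ))

lemma hasFDerivAt_cS {q : CSpace m N} (hq : q ∈ cU m N lam) :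
    ∃ D : (Fin N ⊕ Fin (m + 1) → ℝ) →L[ℝ] (Fin N ⊕ Fin (m + 1) → ℝ),
      HasFDerivAt (fun ξ => cS σ θs lam (q.1, ξ)) D q.2 ∧ D.det = cJ σ lam q := by
  have hcl := fun j => clip_eq_pat (q.2 (.inl j))
  have h3 := hasFDerivAt_chartAff (σ := σ) (θs := θs) (lam := lam) (Y := q.1)
    (fun j => (pat (q.2 (.inl j)) : ℝ)) (fun j => gate (pat (q.2 (.inl j)))) (hq.1 0)
  refine ⟨_, h3.congr_of_eventuallyEq ?_, ?_⟩
  · have : ∀ᶠ ξ in nhds q.2, ∀ j, clip (ξ (.inl j)) =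
        (pat (q.2 (.inl j)) : ℝ) + gate (pat (q.2 (.inl j))) * ξ (.inl j) := by
      rw [Filter.eventually_all]
      intro j
      exact (continuous_apply (Sum.inl j)).continuousAt.eventually (eventually_clip (hq.2.1 j))
    filter_upwards [this] with ξ hξ
    exact congrArg Prod.snd (cS_eq_affS (q := (q.1, ξ)) hξ)
  · rw [ContinuousLinearMap.det, LinearMap.coe_toContinuousLinearMap, LinearMap.det_toLin', det_chartJac, cJ, cM, cX]
    have : cV q.2 = fun j => (pat (q.2 (.inl j)) : ℝ) + gate (pat (q.2 (.inl j))) * q.2 (.inl j) :=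
      funext hcl
    rw [this]; rfl

end Lasso

namespace Lasso

open Matrix

variable {m N : ℕ} {σ lam : ℝ} {θs : Fin N → ℝ}

lemma measurable_cV : Measurable (cV (m := m) (N := N)) :=
  measurable_pi_lambda _ fun _ => measurable_clip.comp (measurable_pi_apply _)

lemma measurable_cT : Measurable (cT (m := m) (N := N)) :=
  measurable_pi_lambda _ fun _ =>
    (measurable_pi_apply _).sub (measurable_clip.comp (measurable_pi_apply _))

lemma measurable_cR : Measurable (cR (m := m) (N := N)) :=
  measurable_pi_lambda _ fun _ => measurable_pi_apply _

lemma measurable_cE : Measurable (cE (m := m) (N := N)) := by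
  refine measurable_pi_lambda _ fun j => ?_
  simp only [cE, gate, pat_eq_zero_iff]
  refine Measurable.ite ?_ measurable_const measurable_const
  exact measurableSet_lt (by fun_prop) measurable_const

lemma measurable_cX :
    Measurable (β := Fin (m + 1) → Fin N → ℝ) (cX (m := m) (N := N) lam) := by
  refine measurable_pi_lambda _ fun i => measurable_pi_lambda _ fun j => ?_
  have hv : ∀ j, Measurable fun q : CSpace m N => cV q.2 j := fun j =>
    (measurable_pi_iff.1 measurable_cV j).comp measurable_snd
  have hr : ∀ i, Measurable fun q : CSpace m N => cR q.2 i := fun j =>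
    (measurable_pi_iff.1 measurable_cR j).comp measurable_snd
  refine Fin.cases ?_ (fun i => ?_) i
  · simp only [cX, chartDesign_zero, chartRow]
    refine Measurable.div (((hv j).const_mul _).sub (Finset.measurable_sum _ fun i _ => ?_)) (hr 0)
    exact Measurable.mul (by fun_prop) (hr _)
  · simp only [cX, chartDesign_succ]
    fun_prop

lemma measurable_cX_apply (i j) : Measurable fun q : CSpace m N => cX lam q i j :=
  measurable_pi_iff.1 (measurable_pi_iff.1 measurable_cX i) j

lemma measurable_cZ : Measurable (cZ (m := m) σ θs lam) := by
  refine measurable_pi_lambda _ fun i => ?_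
  have ht : ∀ j, Measurable fun q : CSpace m N => cT q.2 j := fun j =>
    (measurable_pi_iff.1 measurable_cT j).comp measurable_snd
  have hr : ∀ i, Measurable fun q : CSpace m N => cR q.2 i := fun j =>
    (measurable_pi_iff.1 measurable_cR j).comp measurable_snd
  refine Measurable.const_mul ((hr i).add (Finset.measurable_sum _ fun j _ => ?_)) _
  exact (measurable_cX_apply i j).mul ((ht j).sub_const _)

lemma measurable_chart : Measurable (chart (m := m) σ θs lam) := measurable_cX.prodMk measurable_cZ

lemma measurable_det {α : Type*} [MeasurableSpace α] {f : α → Matrix (Fin N) (Fin N) ℝ}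
    (hf : ∀ i j, Measurable fun a => f a i j) : Measurable fun a => (f a).det := by
  simp only [det_apply]
  refine Finset.measurable_sum _ fun s _ => Measurable.const_smul ?_ _
  exact Finset.measurable_prod _ fun i _ => hf _ _

lemma measurable_det_cM : Measurable fun q : CSpace m N => (cM lam (cX lam q) (cE q.2)).det := by
  refine measurable_det fun i j => ?_
  have he : ∀ i, Measurable fun q : CSpace m N => cE q.2 i := fun j =>
    (measurable_pi_iff.1 measurable_cE j).comp measurable_snd
  simp only [cM, Matrix.add_apply, Matrix.smul_apply, mul_diagonal, smul_eq_mul, transpose_apply,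
    diagonal_apply, mul_apply (M := (cX lam _)ᵀ) (N := cX lam _)]
  refine Measurable.add ?_ (Measurable.mul ?_ ((he _).const_sub _))
  · split_ifs
    · exact (he _).const_mul _
    · fun_prop
  · exact Finset.measurable_sum _ fun k _ => (measurable_cX_apply k i).mul (measurable_cX_apply k j)

lemma measurable_cJ : Measurable (cJ (m := m) (N := N) σ lam) := by
  unfold cJ
  refine Measurable.const_mul (Measurable.mul (Measurable.pow_const (Measurable.inv ?_) _)
    measurable_det_cM) _
  exact (measurable_pi_iff.1 measurable_cR 0).comp measurable_snd

lemma measurableSet_cU : MeasurableSet (cU m N lam) := by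
  have h : cU m N lam = (⋂ i, {q : CSpace m N | cR q.2 i ≠ 0}) ∩ ((⋂ j, {q | |q.2 (.inl j)| ≠ 1}) ∩
      {q | (cM lam (cX lam q) (cE q.2)).det ≠ 0}) := by
    ext q; simp [cU]
  rw [h]
  refine (MeasurableSet.iInter fun i => ?_).inter ((MeasurableSet.iInter fun j => ?_).inter ?_)
  · exact ((measurable_pi_iff.1 measurable_cR i).comp measurable_snd) (measurableSet_singleton 0).compl
  · have : Measurable fun q : CSpace m N => |q.2 (.inl j)| := by fun_prop
    exact this (measurableSet_singleton 1).compl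
  · exact measurable_det_cM (measurableSet_singleton 0).compl

/-- The density of the law of the sample in chart coordinates. -/
def dens (σ : ℝ) (θs : Fin N → ℝ) (lam : ℝ) (q : CSpace m N) : ℝ≥0∞ :=
  ENNReal.ofReal |cJ σ lam q| * ENNReal.ofReal (jointDensity (m + 1) N (chart σ θs lam q))

lemma measurable_dens : Measurable (dens (m := m) σ θs lam) := by
  refine Measurable.mul (ENNReal.measurable_ofReal.comp (measurable_cJ.abs)) (ENNReal.measurable_ofReal.comp ?_)
  exact (measurable_jointDensity _ _).comp measurable_chart

lemma pmodel_chart_image (hσ : σ ≠ 0) (hl : 0 < lam) {B : Set (CSpace m N)} (hB : MeasurableSet B)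
    (hBU : B ⊆ cU m N lam) :
    Pmodel (m + 1) N (chart σ θs lam '' B) = ∫⁻ q in B, dens σ θs lam q := by
  have hinj : Set.InjOn (chart σ θs lam) B := (injOn_chart hσ hl).mono hBU
  have hS : MeasurableSet (chart σ θs lam '' B) := hB.image_of_measurable_injOn measurable_chart hinj
  have hp : Measurable fun ω => ENNReal.ofReal (jointDensity (m + 1) N ω) :=
    ENNReal.measurable_ofReal.comp (measurable_jointDensity _ _)
  have hpa : Measurable fun a => ENNReal.ofReal (jointDensity (m + 1) N (assemble m N a)) :=
    hp.comp (assemble m N).measurable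
  rw [pmodel_eq_withDensity (Nat.succ_pos m), withDensity_apply _ hS,
    ← (measurePreserving_assemble m N).setLIntegral_comp_preimage hS hp,
    ← lintegral_indicator ((assemble m N).measurable hS), ← lintegral_indicator hB, Measure.volume_eq_prod,
    lintegral_prod _ (hpa.indicator ((assemble m N).measurable hS)).aemeasurable,
    lintegral_prod _ (measurable_dens.indicator hB).aemeasurable]
  refine lintegral_congr fun Y => ?_
  set BY : Set (Fin N ⊕ Fin (m + 1) → ℝ) := {ξ | (Y, ξ) ∈ B} with hBY
  have hBYm : MeasurableSet BY := measurable_prodMk_left hB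
  have hpre : ∀ η, (Y, η) ∈ (assemble m N) ⁻¹' (chart σ θs lam '' B) ↔
      η ∈ (fun ξ => cS σ θs lam (Y, ξ)) '' BY := by
    intro η
    constructor
    · rintro ⟨q, hq, h⟩
      rw [chart_eq] at h
      have h' := (assemble m N).injective h
      have h1 : q.1 = Y := congrArg Prod.fst h'
      subst h1
      exact ⟨q.2, hq, congrArg Prod.snd h'⟩
    · rintro ⟨ξ, hξ, rfl⟩
      exact ⟨(Y, ξ), hξ, chart_eq _⟩
  have hinjY : Set.InjOn (fun ξ => cS σ θs lam (Y, ξ)) BY := by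
    intro ξ hξ ξ' hξ' h
    have := hinj hξ hξ' (by rw [chart_eq, chart_eq]; exact congrArg _ (Prod.ext rfl h))
    exact congrArg Prod.snd this
  choose! D hD using fun (ξ : Fin N ⊕ Fin (m + 1) → ℝ) (hξ : ξ ∈ BY) =>
    hasFDerivAt_cS (σ := σ) (θs := θs) (hBU hξ)
  have hSY : MeasurableSet ((fun ξ => cS σ θs lam (Y, ξ)) '' BY) := by
    have : (fun ξ => cS σ θs lam (Y, ξ)) '' BY =
        Prod.mk Y ⁻¹' ((assemble m N) ⁻¹' (chart σ θs lam '' B)) := by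
      ext η; exact (hpre η).symm
    rw [this]
    exact measurable_prodMk_left ((assemble m N).measurable hS)
  have hl1 : ∀ η, ((assemble m N) ⁻¹' (chart σ θs lam '' B)).indicator
      (fun a => ENNReal.ofReal (jointDensity (m + 1) N (assemble m N a))) (Y, η) =
      ((fun ξ => cS σ θs lam (Y, ξ)) '' BY).indicator
        (fun η => ENNReal.ofReal (jointDensity (m + 1) N (assemble m N (Y, η)))) η := by
    intro η
    by_cases h : η ∈ (fun ξ => cS σ θs lam (Y, ξ)) '' BY
    · rw [Set.indicator_of_mem h, Set.indicator_of_mem ((hpre η).2 h)]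
    · rw [Set.indicator_of_notMem h, Set.indicator_of_notMem (fun h' => h ((hpre η).1 h'))]
  have hl2 : ∀ ξ, B.indicator (fun q => dens σ θs lam q) (Y, ξ) =
      BY.indicator (fun ξ => dens σ θs lam (Y, ξ)) ξ := fun ξ => rfl
  rw [lintegral_congr hl1, lintegral_congr hl2, lintegral_indicator hSY, lintegral_indicator hBYm,
    lintegral_image_eq_lintegral_abs_det_fderiv_mul volume hBYm
      (fun ξ hξ => (hD ξ hξ).1.hasFDerivWithinAt) hinjY]
  refine setLIntegral_congr_fun hBYm fun ξ hξ => ?_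
  simp only [dens, chart_eq, (hD ξ hξ).2]

lemma setLIntegral_dens_le_one (hσ : σ ≠ 0) (hl : 0 < lam) :
    ∫⁻ q in cU m N lam, dens (m := m) σ θs lam q ≤ 1 := by
  rw [← pmodel_chart_image hσ hl measurableSet_cU subset_rfl]
  exact prob_le_one

lemma pmodel_absolutelyContinuous : Pmodel (m + 1) N ≪ volume := by
  rw [pmodel_eq_withDensity (Nat.succ_pos m)]
  exact withDensity_absolutelyContinuous _ _

/-- The image of the singular part of the chart domain. -/
def excep (m : ℕ) (σ : ℝ) (θs : Fin N → ℝ) (lam : ℝ) : Set ((Fin (m + 1) → Fin N → ℝ) × (Fin (m + 1) → ℝ)) :=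
  chart σ θs lam '' {q | cR q.2 0 ≠ 0 ∧ q ∉ cU m N lam}

lemma volume_excep : volume (excep m σ θs lam) = 0 := by
  have h : excep m σ θs lam = (assemble m N).symm ⁻¹' ((fun q => (q.1, cS σ θs lam q)) ''
      {q : CSpace m N | cR q.2 0 ≠ 0 ∧ q ∉ cU m N lam}) := by
    rw [excep, ← MeasurableEquiv.image_eq_preimage_symm, Set.image_image]
    exact Set.image_congr fun q _ => chart_eq q
  rw [h, ((measurePreserving_assemble m N).symm _).measure_preimage_equiv]
  exact volume_exceptional

/-- Relabelling the rows of a sample. -/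
def rowPerm (m N : ℕ) (e : Equiv.Perm (Fin (m + 1))) (ω : (Fin (m + 1) → Fin N → ℝ) × (Fin (m + 1) → ℝ)) :
    (Fin (m + 1) → Fin N → ℝ) × (Fin (m + 1) → ℝ) := (fun i => ω.1 (e i), fun i => ω.2 (e i))

lemma measurePreserving_rowPerm (e : Equiv.Perm (Fin (m + 1))) :
    MeasurePreserving (rowPerm m N e) volume volume := by
  have h1 := volume_measurePreserving_piCongrLeft (fun _ : Fin (m + 1) => Fin N → ℝ) e.symm
  have h2 := volume_measurePreserving_piCongrLeft (fun _ : Fin (m + 1) => ℝ) e.symm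
  have h : rowPerm m N e = Prod.map (MeasurableEquiv.piCongrLeft (fun _ : Fin (m + 1) => Fin N → ℝ) e.symm)
      (MeasurableEquiv.piCongrLeft (fun _ : Fin (m + 1) => ℝ) e.symm) := by
    funext ω
    refine Prod.ext (funext fun i => ?_) (funext fun i => ?_)
    · obtain ⟨k, rfl⟩ := e.symm.surjective i
      simp [rowPerm, MeasurableEquiv.coe_piCongrLeft, Equiv.piCongrLeft_apply_apply]
    · obtain ⟨k, rfl⟩ := e.symm.surjective i
      simp [rowPerm, MeasurableEquiv.coe_piCongrLeft, Equiv.piCongrLeft_apply_apply]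
  rw [h]
  exact h1.prod h2

lemma resid_rowPerm (e : Equiv.Perm (Fin (m + 1))) (ω) (θ : Fin N → ℝ) (i) :
    resid (rowPerm m N e ω).1 (yvec σ θs (rowPerm m N e ω).1 (rowPerm m N e ω).2) θ i =
      resid ω.1 (yvec σ θs ω.1 ω.2) θ (e i) := rfl

lemma isLasso_rowPerm (e : Equiv.Perm (Fin (m + 1))) (ω) {θ : Fin N → ℝ}
    (h : IsLasso ω.1 (yvec σ θs ω.1 ω.2) lam θ) :
    IsLasso (rowPerm m N e ω).1 (yvec σ θs (rowPerm m N e ω).1 (rowPerm m N e ω).2) lam θ := by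
  intro θ'
  have := h θ'
  have hs : ∀ θ'', resid (rowPerm m N e ω).1 (yvec σ θs (rowPerm m N e ω).1 (rowPerm m N e ω).2) θ'' ⬝ᵥ
      resid (rowPerm m N e ω).1 (yvec σ θs (rowPerm m N e ω).1 (rowPerm m N e ω).2) θ'' =
      resid ω.1 (yvec σ θs ω.1 ω.2) θ'' ⬝ᵥ resid ω.1 (yvec σ θs ω.1 ω.2) θ'' := by
    intro θ''
    simp only [dotProduct, resid_rowPerm]
    exact Equiv.sum_comp e (fun i => resid ω.1 (yvec σ θs ω.1 ω.2) θ'' i *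
      resid ω.1 (yvec σ θs ω.1 ω.2) θ'' i)
  simpa only [obj, hs] using this

lemma pmodel_resid_zero (hσ : σ ≠ 0) (hl : 0 < lam) :
    Pmodel (m + 1) N {ω | ∃ θ, IsLasso ω.1 (yvec σ θs ω.1 ω.2) lam θ ∧
      resid ω.1 (yvec σ θs ω.1 ω.2) θ 0 = 0} = 0 := by
  refine pmodel_absolutelyContinuous ?_
  have hy : volume {ω : (Fin (m + 1) → Fin N → ℝ) × (Fin (m + 1) → ℝ) | yvec σ θs ω.1 ω.2 0 = 0} = 0 := by
    have hm : MeasurableSet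
        {ω : (Fin (m + 1) → Fin N → ℝ) × (Fin (m + 1) → ℝ) | yvec σ θs ω.1 ω.2 0 = 0} := by
      have : Measurable fun ω : (Fin (m + 1) → Fin N → ℝ) × (Fin (m + 1) → ℝ) => yvec σ θs ω.1 ω.2 0 := by
        unfold yvec; fun_prop
      exact this (measurableSet_singleton 0)
    rw [Measure.volume_eq_prod, Measure.measure_prod_null hm]
    refine Filter.Eventually.of_forall fun X => ?_
    have h0 : (volume : Measure (Fin (m + 1) → ℝ)) {z | z 0 = -(∑ j, X 0 j * θs j) / σ} = 0 :=
      Measure.pi_hyperplane _ _ _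
    refine measure_mono_null (fun z hz => ?_) h0
    simp only [yvec, Set.mem_preimage, Set.mem_ofPred_eq] at hz ⊢
    rw [eq_div_iff hσ]; linarith
  refine measure_mono_null (t := {ω | yvec σ θs ω.1 ω.2 0 = 0} ∪
    ⋃ i, rowPerm m N (Equiv.swap 0 i) ⁻¹' excep m σ θs lam) ?_ ?_
  · rintro ω ⟨θ, hθ, h0⟩
    by_cases hz : resid ω.1 (yvec σ θs ω.1 ω.2) θ = 0
    · left
      have hθ0 : θ = 0 := by
        ext j
        have h := kkt_mul hθ hl.le j
        have h' : (0 : Fin (m + 1) → ℝ) ᵥ* (ω.1 : Matrix (Fin (m + 1)) (Fin N) ℝ) = 0 := zero_vecMul _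
        rw [hz] at h
        rw [congrFun h' j] at h
        simpa [hl.ne'] using h.symm
      have h1 : resid ω.1 (yvec σ θs ω.1 ω.2) 0 = yvec σ θs ω.1 ω.2 := by
        simp only [resid]
        rw [mulVec_zero (ω.1 : Matrix (Fin (m + 1)) (Fin N) ℝ), sub_zero]
      rw [hθ0, h1] at hz
      exact congrFun hz 0
    · right
      obtain ⟨i, hi⟩ := Function.ne_iff.1 hz
      refine Set.mem_iUnion.2 ⟨i, ?_⟩
      set ω' := rowPerm m N (Equiv.swap 0 i) ω with hω'
      have h1 : IsLasso ω'.1 (yvec σ θs ω'.1 ω'.2) lam θ := isLasso_rowPerm _ ω hθ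
      have h2 : resid ω'.1 (yvec σ θs ω'.1 ω'.2) θ 0 ≠ 0 := by
        rw [hω', resid_rowPerm, Equiv.swap_apply_left]; exact hi
      refine ⟨coord lam ω'.1 (yvec σ θs ω'.1 ω'.2) θ, ⟨h2, fun hU => hU.1 i ?_⟩,
        chart_coord hσ hl h1 h2⟩
      change resid ω'.1 (yvec σ θs ω'.1 ω'.2) θ i = 0
      rw [hω', resid_rowPerm, Equiv.swap_apply_right]; exact h0
  · refine measure_union_null hy ?_
    rw [measure_iUnion_null_iff]
    exact fun i => (measurePreserving_rowPerm _).quasiMeasurePreserving.preimage_null volume_excep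

/-- An event implied by chart coordinates lying in `B` has probability at most the chart integral. -/
lemma pmodel_le_setLIntegral (hσ : σ ≠ 0) (hl : 0 < lam) {B : Set (CSpace m N)} (hB : MeasurableSet B)
    {A : Set ((Fin (m + 1) → Fin N → ℝ) × (Fin (m + 1) → ℝ))}
    (hA : ∀ ω ∈ A, ∃ θ, IsLasso ω.1 (yvec σ θs ω.1 ω.2) lam θ ∧
      (resid ω.1 (yvec σ θs ω.1 ω.2) θ 0 ≠ 0 → coord lam ω.1 (yvec σ θs ω.1 ω.2) θ ∈ B)) :
    Pmodel (m + 1) N A ≤ ∫⁻ q in B ∩ cU m N lam, dens σ θs lam q := by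
  rw [← pmodel_chart_image hσ hl (hB.inter measurableSet_cU) Set.inter_subset_right]
  have hsub : A ⊆ chart σ θs lam '' (B ∩ cU m N lam) ∪ (excep m σ θs lam ∪
      {ω | ∃ θ, IsLasso ω.1 (yvec σ θs ω.1 ω.2) lam θ ∧
      resid ω.1 (yvec σ θs ω.1 ω.2) θ 0 = 0}) := by
    intro ω hω
    obtain ⟨θ, hθ, h⟩ := hA ω hω
    by_cases h0 : resid ω.1 (yvec σ θs ω.1 ω.2) θ 0 = 0
    · exact .inr (.inr ⟨θ, hθ, h0⟩)
    · by_cases hU : coord lam ω.1 (yvec σ θs ω.1 ω.2) θ ∈ cU m N lam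
      · exact .inl ⟨_, ⟨h h0, hU⟩, chart_coord hσ hl hθ h0⟩
      · exact .inr (.inl ⟨coord lam ω.1 (yvec σ θs ω.1 ω.2) θ, ⟨h0, hU⟩, chart_coord hσ hl hθ h0⟩)
  refine (measure_mono hsub).trans ((measure_union_le _ _).trans ?_)
  rw [measure_union_null (pmodel_absolutelyContinuous volume_excep) (pmodel_resid_zero hσ hl), add_zero]

end Lasso

namespace Lasso

open Matrix

section determinants

variable {n N : ℕ}

lemma det_one_add_vecMulVec (u v : Fin N → ℝ) : (1 + vecMulVec u v).det = 1 + v ⬝ᵥ u := by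
  rw [vecMulVec_eq (Fin 1), det_one_add_replicateCol_mul_replicateRow]

lemma det_le_det_add_vecMulVec {P : Matrix (Fin N) (Fin N) ℝ} (hP : P.PosSemidef) {s : ℝ} (hs : 0 ≤ s)
    (f : Fin N → ℝ) : P.det ≤ (P + s • vecMulVec f f).det := by
  have hf : (vecMulVec f f).PosSemidef := posSemidef_vecMulVec_self_star f
  by_cases h0 : P.det = 0
  · rw [h0]; exact (hP.add (hf.smul hs)).det_nonneg
  have hu : IsUnit P.det := isUnit_iff_ne_zero.2 h0
  have h1 : P + s • vecMulVec f f = P * (1 + vecMulVec (P⁻¹ *ᵥ (s • f)) f) := by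
    rw [Matrix.mul_add, mul_one, mul_vecMulVec, mulVec_mulVec, mul_nonsing_inv _ hu, one_mulVec,
      smul_vecMulVec]
  have h2 : 0 ≤ f ⬝ᵥ (P⁻¹ *ᵥ f) := by simpa using hP.inv.dotProduct_mulVec_nonneg f
  rw [h1, det_mul, det_one_add_vecMulVec, mulVec_smul, dotProduct_smul, smul_eq_mul]
  exact le_mul_of_one_le_right hP.det_nonneg (by nlinarith)

/-- The symmetrized Jacobian matrix. -/
def cG (lam : ℝ) (X : Matrix (Fin n) (Fin N) ℝ) (e : Fin N → ℝ) : Matrix (Fin N) (Fin N) ℝ :=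
  lam • diagonal e + (X * diagonal (1 - e))ᵀ * (X * diagonal (1 - e))

variable {lam : ℝ} {X : Matrix (Fin n) (Fin N) ℝ} {e : Fin N → ℝ}

lemma posSemidef_cG (hl : 0 ≤ lam) (he : ∀ j, e j = 0 ∨ e j = 1) : (cG lam X e).PosSemidef := by
  have h1 : (diagonal e).PosSemidef := posSemidef_diagonal_iff.2 fun j => by
    rcases he j with h | h <;> simp [h]
  have h2 : ((X * diagonal (1 - e))ᵀ * (X * diagonal (1 - e))).PosSemidef := by
    rw [← conjTranspose_eq_transpose_of_trivial]
    exact posSemidef_conjTranspose_mul_self (X * diagonal (1 - e))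
  exact (h1.smul hl).add h2

lemma det_cM {X : Matrix (Fin (n + 1)) (Fin N) ℝ} (hl : lam ≠ 0) (he : ∀ j, e j = 0 ∨ e j = 1) : (cM lam X e).det = (cG lam X e).det := by
  set E : Matrix (Fin N) (Fin N) ℝ := diagonal e with hE
  set F : Matrix (Fin N) (Fin N) ℝ := diagonal (1 - e) with hF
  have hEE : E * E = E := by
    rw [hE, diagonal_mul_diagonal]; congr 1; ext j; rcases he j with h | h <;> simp [h]
  have hFE : F * E = 0 := by
    rw [hE, hF, diagonal_mul_diagonal, ← diagonal_zero]; congr 1; ext j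
    rcases he j with h | h <;> simp [h]
  have hEF : E + F = 1 := by
    rw [hE, hF, diagonal_add, ← diagonal_one]; congr 1; ext j; simp
  have h1 : cM lam X e = cG lam X e * (1 + (lam⁻¹ • E) * (Xᵀ * X * F)) := by
    rw [cM, cG, ← hE, ← hF, transpose_mul, hF, diagonal_transpose, ← hF]
    have h2 : (lam • E + F * Xᵀ * (X * F)) * (1 + (lam⁻¹ • E) * (Xᵀ * X * F)) =
        lam • E + F * Xᵀ * (X * F) + (lam * lam⁻¹) • ((E * E) * (Xᵀ * X * F)) +
          lam⁻¹ • (F * Xᵀ * X * (F * E) * (Xᵀ * X * F)) := by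
      simp only [Matrix.add_mul, Matrix.mul_add, mul_one, Matrix.smul_mul, Matrix.mul_smul, Matrix.mul_assoc]
      module
    rw [h2, hEE, hFE, mul_inv_cancel₀ hl]
    have h3 : Xᵀ * X * F = (E + F) * (Xᵀ * X * F) := by rw [hEF, one_mul]
    conv_lhs => rw [h3]
    simp only [Matrix.add_mul, Matrix.mul_zero, Matrix.zero_mul, smul_zero, one_smul, Matrix.mul_assoc]
    abel
  rw [h1, det_mul, det_one_add_mul_comm, Matrix.mul_smul, Matrix.mul_assoc _ F E, hFE]
  simp

lemma det_cG_exp_mul (l : ℝ) (he : ∀ j, e j = 0 ∨ e j = 1) :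
    (cG (Real.exp l * lam) X e).det = Real.exp (l * ∑ j, e j) * (cG lam X e).det := by
  have h1 : cG (Real.exp l * lam) X e = cG lam X e * diagonal (fun j => Real.exp l * e j + (1 - e j)) := by
    have h2 : X * diagonal (1 - e) = X * diagonal (1 - e) * diagonal (fun j => Real.exp l * e j + (1 - e j)) := by
      rw [Matrix.mul_assoc, diagonal_mul_diagonal]; congr 2; ext j
      rcases he j with h | h <;> simp [h]
    have h3 : (Real.exp l * lam) • diagonal e = lam • (diagonal e * diagonal (fun j => Real.exp l * e j + (1 - e j))) := by
      rw [diagonal_mul_diagonal, ← diagonal_smul, ← diagonal_smul]; congr 1; ext j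
      rcases he j with h | h <;> simp [h, mul_comm]
    rw [cG, cG, Matrix.add_mul, Matrix.mul_assoc (_)ᵀ, ← h2, h3, Matrix.smul_mul]
  rw [h1, det_mul, det_diagonal, mul_comm]
  congr 1
  rw [Finset.mul_sum, Real.exp_sum]
  refine Finset.prod_congr rfl fun j _ => ?_
  rcases he j with h | h <;> simp [h]

/-- Growth of the Jacobian determinant under a rank one perturbation of the design. -/
lemma det_cG_perturb (hl : 0 < lam) (he : ∀ j, e j = 0 ∨ e j = 1) (hdet : (cG lam X e).det ≠ 0)
    (b : Fin n → ℝ) (c : Fin N → ℝ) : ∃ x : ℝ,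
      (∀ κ : ℝ, (1 + κ * x) ^ 2 * (cG lam X e).det ≤ (cG lam (X + κ • vecMulVec b c) e).det) ∧
      (c = b ᵥ* X → 0 ≤ x ∧ x ≤ b ⬝ᵥ b) := by
  set G := cG lam X e with hG
  set A := X * diagonal (1 - e) with hA
  set f := diagonal (1 - e) *ᵥ c with hf
  set p := b ᵥ* A with hp
  set u := G⁻¹ *ᵥ p with hu
  have hPS : G.PosSemidef := posSemidef_cG hl.le he
  have hGu : G *ᵥ u = p := by
    rw [hu, mulVec_mulVec, mul_nonsing_inv _ (isUnit_iff_ne_zero.2 hdet), one_mulVec]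
  have hGs : Gᵀ = G := by simpa using hPS.isHermitian.eq
  clear_value u
  have hAt : ∀ v, u ⬝ᵥ (Aᵀ *ᵥ v) = (A *ᵥ u) ⬝ᵥ v := fun v => by
    rw [dotProduct_mulVec, vecMul_transpose]
  have hup : u ⬝ᵥ p ≤ b ⬝ᵥ b ∧ 0 ≤ u ⬝ᵥ p := by
    have h1 : u ⬝ᵥ p = lam * (u ⬝ᵥ (diagonal e *ᵥ u)) + (A *ᵥ u) ⬝ᵥ (A *ᵥ u) := by
      rw [← hGu, hG, cG, add_mulVec, dotProduct_add, Matrix.smul_mulVec, dotProduct_smul, smul_eq_mul,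
        ← hA, ← mulVec_mulVec, hAt]
    have h2 : 0 ≤ u ⬝ᵥ (diagonal e *ᵥ u) := by
      simp only [dotProduct, mulVec_diagonal]
      refine Finset.sum_nonneg fun j _ => ?_
      rcases he j with h | h
      · simp [h]
      · simp only [h, one_mul]; exact mul_self_nonneg _
    have h3 : u ⬝ᵥ p = b ⬝ᵥ (A *ᵥ u) := by rw [dotProduct_comm u p, hp, dotProduct_mulVec]
    have h4 := dot_sq_le b (A *ᵥ u)
    have h5 := ss_nonneg (A *ᵥ u)
    have h6 := ss_nonneg b
    have h7 : 0 ≤ lam * (u ⬝ᵥ (diagonal e *ᵥ u)) := mul_nonneg hl.le h2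
    rw [← h3] at h4
    refine ⟨?_, by linarith⟩
    by_contra! h8
    nlinarith
  refine ⟨f ⬝ᵥ u, fun κ => ?_, ?_⟩
  · set M : Matrix (Fin N) (Fin N) ℝ := 1 + κ • vecMulVec u f with hM
    have hMdet : M.det = 1 + κ * (f ⬝ᵥ u) := by
      rw [hM, ← smul_vecMulVec, det_one_add_vecMulVec, dotProduct_smul, smul_eq_mul]
    have hA' : (X + κ • vecMulVec b c) * diagonal (1 - e) = A + κ • vecMulVec b f := by
      rw [Matrix.add_mul, Matrix.smul_mul, vecMulVec_mul, hf, ← vecMul_transpose, diagonal_transpose]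
    have key : cG lam (X + κ • vecMulVec b c) e =
        Mᵀ * G * M + (κ ^ 2 * (b ⬝ᵥ b - u ⬝ᵥ p)) • vecMulVec f f := by
      have hGM : G * M = G + κ • vecMulVec p f := by
        rw [hM, Matrix.mul_add, mul_one, Matrix.mul_smul, mul_vecMulVec, hGu]
      have hMt : Mᵀ = 1 + κ • vecMulVec f u := by
        rw [hM, transpose_add, transpose_one, transpose_smul, transpose_vecMulVec]
      have huG : u ᵥ* G = p := by rw [← mulVec_transpose, hGs, hGu]
      rw [Matrix.mul_assoc, hGM, hMt, Matrix.add_mul, one_mul, Matrix.mul_add, Matrix.smul_mul, Matrix.smul_mul, Matrix.mul_smul, vecMulVec_mul,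
        huG, vecMulVec_mul_vecMulVec, cG, hA', transpose_add, transpose_smul, transpose_vecMulVec,
        Matrix.add_mul, Matrix.mul_add, Matrix.mul_add, Matrix.mul_smul, mul_vecMulVec, mulVec_transpose, ← hp, Matrix.smul_mul, Matrix.smul_mul,
        Matrix.mul_smul, vecMulVec_mul, ← hp, vecMulVec_mul_vecMulVec, hG, cG, ← hA]
      ext i j
      simp only [Matrix.add_apply, Matrix.smul_apply, vecMulVec_apply, smul_eq_mul, Pi.smul_apply]
      ring
    rw [key]
    have hP : (Mᵀ * G * M).PosSemidef := hPS.conjTranspose_mul_mul_same M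
    refine le_trans (le_of_eq ?_) (det_le_det_add_vecMulVec hP (mul_nonneg (sq_nonneg _) (by linarith)) f)
    rw [det_mul, det_mul, det_transpose, hMdet]
    ring
  · intro hc
    have : f = p := by
      rw [hf, hc, hp, hA, ← vecMul_vecMul, ← mulVec_transpose (diagonal (1 - e)), diagonal_transpose]
    rw [this, dotProduct_comm]
    exact ⟨hup.2, hup.1⟩

end determinants

end Lasso

namespace Lasso

open Matrix

variable {m N : ℕ} {σ lam lam' : ℝ} {θs : Fin N → ℝ}

/-- The transformation of chart space acting affinely on the rows of the design and scaling the
residual. -/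
def rowFlow (s : ℝ) (A : (Fin N ⊕ Fin (m + 1) → ℝ) → Matrix (Fin N) (Fin N) ℝ)
    (b : (Fin N ⊕ Fin (m + 1) → ℝ) → Fin m → Fin N → ℝ) (q : CSpace m N) : CSpace m N :=
  (fun i => q.1 i ᵥ* A q.2 + b q.2 i, Sum.elim (fun j => q.2 (.inl j)) (fun i => s * q.2 (.inr i)))

lemma measurable_rowFlow {s : ℝ} {A : (Fin N ⊕ Fin (m + 1) → ℝ) → Matrix (Fin N) (Fin N) ℝ}
    {b : (Fin N ⊕ Fin (m + 1) → ℝ) → Fin m → Fin N → ℝ} (hA : ∀ j k, Measurable fun ξ => A ξ j k)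
    (hb : ∀ i j, Measurable fun ξ => b ξ i j) : Measurable (rowFlow s A b) := by
  refine Measurable.prodMk ?_ ?_
  · refine measurable_pi_lambda _ fun i => measurable_pi_lambda _ fun j => ?_
    simp only [Pi.add_apply, vecMul, dotProduct]
    refine (Finset.measurable_sum _ fun k _ => ?_).add ((hb i j).comp measurable_snd)
    exact Measurable.mul (by fun_prop) ((hA k j).comp measurable_snd)
  · refine measurable_pi_lambda _ fun c => ?_
    cases c <;> simp only [Sum.elim_inl, Sum.elim_inr] <;> fun_prop

lemma lintegral_comp_rows (A : Matrix (Fin N) (Fin N) ℝ) (hA : A.det ≠ 0) (b : Fin m → Fin N → ℝ)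
    {f : (Fin m → Fin N → ℝ) → ℝ≥0∞} (hf : Measurable f) :
    ENNReal.ofReal (|A.det| ^ m) * ∫⁻ Y : Fin m → Fin N → ℝ, f (fun i => Y i ᵥ* A + b i) =
      ∫⁻ Y, f Y := by
  let g : (Fin N → ℝ) →ₗ[ℝ] (Fin N → ℝ) := toLin' Aᵀ
  let F : (Fin m → Fin N → ℝ) →ₗ[ℝ] (Fin m → Fin N → ℝ) :=
    LinearMap.pi fun i => g.comp (LinearMap.proj i)
  have hdet : LinearMap.det F = A.det ^ m := by
    rw [LinearMap.det_pi]
    simp [g, LinearMap.det_toLin']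
  have hF0 : LinearMap.det F ≠ 0 := by rw [hdet]; exact pow_ne_zero _ hA
  have hmap := Measure.map_linearMap_addHaar_eq_smul_addHaar (μ := (volume : Measure (Fin m → Fin N → ℝ))) hF0
  have hFm : Measurable F := F.continuous_of_finiteDimensional.measurable
  have h1 : ∀ Y : Fin m → Fin N → ℝ, (fun i => Y i ᵥ* A + b i) = F Y + b := fun Y => by
    ext i j
    simp [F, g, mulVec_transpose]
  have hfb : Measurable fun Y => f (Y + b) := hf.comp (measurable_add_const b)
  simp only [h1]
  rw [← lintegral_map (f := fun Y => f (Y + b)) hfb hFm, hmap, lintegral_smul_measure, lintegral_add_right_eq_self f b,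
    smul_eq_mul, ← mul_assoc, ← ENNReal.ofReal_mul (by positivity), hdet]
  have : |A.det| ^ m * |(A.det ^ m)⁻¹| = 1 := by
    rw [abs_inv, abs_pow, mul_inv_cancel₀]; positivity
  rw [this, ENNReal.ofReal_one, one_mul]

lemma lintegral_comp_scale_inr {s : ℝ} (hs : 0 < s) {f : (Fin N ⊕ Fin (m + 1) → ℝ) → ℝ≥0∞} (hf : Measurable f) :
    ENNReal.ofReal (s ^ (m + 1)) * ∫⁻ ξ : Fin N ⊕ Fin (m + 1) → ℝ,
      f (Sum.elim (fun j => ξ (.inl j)) (fun i => s * ξ (.inr i))) = ∫⁻ ξ, f ξ := by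
  set D : Fin N ⊕ Fin (m + 1) → ℝ := Sum.elim (fun _ => 1) (fun _ => s) with hD
  have hdet : (diagonal D).det = s ^ (m + 1) := by
    rw [det_diagonal, Fintype.prod_sum_type]; simp [hD]
  have h0 : (diagonal D).det ≠ 0 := by rw [hdet]; positivity
  have h := Real.smul_map_diagonal_volume_pi (D := D) h0
  have h1 : ∀ ξ : Fin N ⊕ Fin (m + 1) → ℝ, Sum.elim (fun j => ξ (.inl j)) (fun i => s * ξ (.inr i)) =
      toLin' (diagonal D) ξ := fun ξ => by
    ext c; cases c <;> simp [hD, mulVec_diagonal]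
  simp only [h1]
  have hm : Measurable (toLin' (diagonal D)) :=
    (toLin' (diagonal D)).continuous_of_finiteDimensional.measurable
  rw [← lintegral_map hf hm]
  nth_rewrite 2 [← h]
  rw [lintegral_smul_measure, hdet, abs_of_pos (by positivity), smul_eq_mul]

lemma lintegral_rowFlow {s : ℝ} {A : (Fin N ⊕ Fin (m + 1) → ℝ) → Matrix (Fin N) (Fin N) ℝ}
    {b : (Fin N ⊕ Fin (m + 1) → ℝ) → Fin m → Fin N → ℝ} (hs : 0 < s)
    (hA : ∀ j k, Measurable fun ξ => A ξ j k) (hb : ∀ i j, Measurable fun ξ => b ξ i j)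
    (hdet : ∀ ξ, (A ξ).det ≠ 0) {f : CSpace m N → ℝ≥0∞} (hf : Measurable f) :
    ∫⁻ q : CSpace m N, ENNReal.ofReal (s ^ (m + 1) * |(A q.2).det| ^ m) * f (rowFlow s A b q) =
      ∫⁻ q : CSpace m N, f q := by
  have hτ := measurable_rowFlow (s := s) hA hb
  have hd : Measurable fun ξ => (A ξ).det := measurable_det hA
  have hF : Measurable fun q : CSpace m N =>
      ENNReal.ofReal (s ^ (m + 1) * |(A q.2).det| ^ m) * f (rowFlow s A b q) := by
    refine Measurable.mul (ENNReal.measurable_ofReal.comp ?_) (hf.comp hτ)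
    exact ((hd.comp measurable_snd).abs.pow_const m).const_mul _
  set g : (Fin N ⊕ Fin (m + 1) → ℝ) → ℝ≥0∞ := fun ξ => ∫⁻ Y : Fin m → Fin N → ℝ, f (Y, ξ) with hg
  have hgm : Measurable g := hf.lintegral_prod_left'
  rw [Measure.volume_eq_prod, lintegral_prod_symm' _ hF, lintegral_prod_symm' _ hf]
  calc _ = ∫⁻ ξ : Fin N ⊕ Fin (m + 1) → ℝ, ENNReal.ofReal (s ^ (m + 1)) *
        g (Sum.elim (fun j => ξ (.inl j)) (fun i => s * ξ (.inr i))) := by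
        refine lintegral_congr fun ξ => ?_
        have h1 := lintegral_comp_rows (A ξ) (hdet ξ) (b ξ)
          (f := fun Y => f (Y, Sum.elim (fun j => ξ (.inl j)) (fun i => s * ξ (.inr i))))
          (hf.comp measurable_prodMk_right)
        simp only [hg]
        rw [← h1, ← mul_assoc, ← ENNReal.ofReal_mul (by positivity), lintegral_const_mul]
        · rfl
        · exact (hf.comp hτ).comp (measurable_prodMk_right (y := ξ))
    _ = ∫⁻ ξ, g ξ := by
        have hm : Measurable fun ξ : Fin N ⊕ Fin (m + 1) → ℝ =>
            (Sum.elim (fun j => ξ (.inl j)) (fun i => s * ξ (.inr i)) : Fin N ⊕ Fin (m + 1) → ℝ) := by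
          refine measurable_pi_lambda _ fun c => ?_
          cases c <;> simp only [Sum.elim_inl, Sum.elim_inr] <;> fun_prop
        have hgs : Measurable fun ξ : Fin N ⊕ Fin (m + 1) → ℝ =>
            g (Sum.elim (fun j => ξ (.inl j)) (fun i => s * ξ (.inr i))) := hgm.comp hm
        rw [lintegral_const_mul _ hgs, lintegral_comp_scale_inr hs hgm]

/-- Indicator vector of the inactive coordinates. -/
def inact (θ : Fin N → ℝ) : Fin N → ℝ := fun j => if θ j = 0 then 1 else 0

lemma inact_eq (θ : Fin N → ℝ) (j : Fin N) : inact θ j = 0 ∨ inact θ j = 1 := by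
  rw [inact]; split_ifs <;> simp

lemma cE_eq_inact {q : CSpace m N} (hq : q ∈ cU m N lam) : cE q.2 = inact (cT q.2) := by
  ext j
  simp only [cE, gate, pat_eq_zero_iff, inact]
  rcases lt_or_gt_of_ne (hq.2.1 j) with h | h
  · rw [if_pos h, if_pos (by rw [cT, clip_of_abs_le h.le, sub_self])]
  · rw [if_neg (not_lt.2 h.le), if_neg]
    intro h0
    rw [cT] at h0
    rw [sub_eq_zero.1 h0] at h
    exact absurd h (not_lt.2 (abs_clip_le _))

/-- The quadratic form in the exponent of the density of the sample. -/
def energy {n N : ℕ} (X : Matrix (Fin n) (Fin N) ℝ) (z : Fin n → ℝ) : ℝ := n * frob X + z ⬝ᵥ z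

lemma dens_eq (hl : lam ≠ 0) (hσ : 0 < σ) {q : CSpace m N} (he : cE q.2 = inact (cT q.2)) (hl0 : 0 ≤ lam) :
    dens σ θs lam q = ENNReal.ofReal (densityConst (m + 1) N * (σ⁻¹ ^ (m + 1) * ((|cR q.2 0|)⁻¹ ^ N *
      ((cG lam (cX lam q) (inact (cT q.2))).det * Real.exp (-energy (cX lam q) (cZ σ θs lam q) / 2))))) := by
  rw [dens, ← ENNReal.ofReal_mul (abs_nonneg _), jointDensity_eq, cJ, he,
    det_cM hl (inact_eq _), abs_mul, abs_mul,
    abs_of_nonneg (posSemidef_cG hl0 (inact_eq _)).det_nonneg, abs_pow, abs_pow, abs_inv, abs_inv, abs_of_pos hσ]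
  congr 1
  simp only [energy, frob, chart]
  ring_nf

/-- Flow principle: a change of variables of chart space bounds the probability of the event on
which it does not decrease the density by more than the factor `K`. -/
lemma pmodel_le_of_flow (hσ : 0 < σ) (hl : 0 < lam) (hl' : 0 < lam')
    {s K : ℝ} {A : (Fin N ⊕ Fin (m + 1) → ℝ) → Matrix (Fin N) (Fin N) ℝ}
    {b : (Fin N ⊕ Fin (m + 1) → ℝ) → Fin m → Fin N → ℝ} (hs : 0 < s) (hK : 0 ≤ K)
    (hA : ∀ j k, Measurable fun ξ => A ξ j k) (hb : ∀ i j, Measurable fun ξ => b ξ i j)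
    (hdet : ∀ ξ, (A ξ).det ≠ 0)
    {S : Set ((Fin (m + 1) → Fin N → ℝ) × (Fin (m + 1) → ℝ))}
    (hS : ∀ (X : Matrix (Fin (m + 1)) (Fin N) ℝ) (z : Fin (m + 1) → ℝ), (X, z) ∈ S →
      ∃ θ, IsLasso X (yvec σ θs X z) lam θ ∧ ∀ r, r = resid X (yvec σ θs X z) θ →
        r 0 ≠ 0 → (cG lam X (inact θ)).det ≠ 0 → ∃ X' : Matrix (Fin (m + 1)) (Fin N) ℝ,
          (∀ i : Fin m, X' i.succ = X i.succ ᵥ* A (coord lam X (yvec σ θs X z) θ).2 +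
            b (coord lam X (yvec σ θs X z) θ).2 i) ∧
          (s • r) ᵥ* X' = (lam' * lam⁻¹) • (r ᵥ* X) ∧
          (cG lam X (inact θ)).det ≤ K * (s ^ (m + 1) * |(A (coord lam X (yvec σ θs X z) θ).2).det| ^ m) *
            s⁻¹ ^ N * Real.exp ((energy X z - energy X' (σ⁻¹ • (s • r + X' *ᵥ (θ - θs)))) / 2) *
            (cG lam' X' (inact θ)).det) :
    Pmodel (m + 1) N S ≤ ENNReal.ofReal K := by
  set κ : CSpace m N → ℝ≥0∞ := fun q => ENNReal.ofReal (s ^ (m + 1) * |(A q.2).det| ^ m) with hκ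
  set τ := rowFlow s A b with hτdef
  have hτ : Measurable τ := measurable_rowFlow hA hb
  have hd : Measurable fun ξ => (A ξ).det := measurable_det hA
  have hκm : Measurable κ := ENNReal.measurable_ofReal.comp
    (((hd.comp measurable_snd).abs.pow_const m).const_mul _)
  set T : Set (CSpace m N) := {q | τ q ∈ cU m N lam' ∧
    dens σ θs lam q ≤ ENNReal.ofReal K * κ q * dens σ θs lam' (τ q)} with hT
  have hTm : MeasurableSet T :=
    (hτ measurableSet_cU).inter (measurableSet_le measurable_dens
      ((hκm.const_mul _).mul (measurable_dens.comp hτ)))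
  have hB : MeasurableSet (T ∪ (cU m N lam)ᶜ) := hTm.union measurableSet_cU.compl
  have step : Pmodel (m + 1) N S ≤ ∫⁻ q in (T ∪ (cU m N lam)ᶜ) ∩ cU m N lam, dens σ θs lam q := by
    refine pmodel_le_setLIntegral hσ.ne' hl hB fun ω hω => ?_
    obtain ⟨X, z⟩ := ω
    obtain ⟨θ, hθ, h⟩ := hS X z hω
    refine ⟨θ, hθ, fun hr0 => ?_⟩
    change resid X (yvec σ θs X z) θ 0 ≠ 0 at hr0
    set q : CSpace m N := coord lam X (yvec σ θs X z) θ with hq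
    by_cases hU : q ∈ cU m N lam
    · left
      have hX : cX lam q = X := cX_coord hl hθ hr0
      have hTq : cT q.2 = θ := cT_coord hl hθ
      have hR : cR q.2 = resid X (yvec σ θs X z) θ := rfl
      have hZ : cZ σ θs lam q = z := congrArg Prod.snd (chart_coord hσ.ne' hl hθ hr0)
      have hV : cV q.2 = lam⁻¹ • (resid X (yvec σ θs X z) θ ᵥ* X) := cV_coord hl hθ
      have hE : cE q.2 = inact (cT q.2) := cE_eq_inact hU
      have hdet0 : (cG lam X (inact θ)).det ≠ 0 := by
        have := hU.2.2
        rw [hX, hE, hTq] at this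
        exact fun h0 => this ((det_cM hl.ne' (inact_eq θ)).trans h0)
      obtain ⟨X', hrows, hv, hle⟩ := h _ rfl hr0 hdet0
      have hR' : cR (τ q).2 = s • resid X (yvec σ θs X z) θ := rfl
      have hT' : cT (τ q).2 = θ := hTq
      have hV' : cV (τ q).2 = cV q.2 := rfl
      have hE' : cE (τ q).2 = inact (cT (τ q).2) := hE
      have hX' : cX lam' (τ q) = X' := by
        rw [cX, hV', hR', hV]
        have h1 : (τ q).1 = fun i => X' i.succ := funext fun i => (hrows i).symm
        rw [h1]
        refine eq_chartDesign ?_ ?_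
        · simpa using ⟨hs.ne', hr0⟩
        · rw [hv, smul_smul]
      have hZ' : cZ σ θs lam' (τ q) = σ⁻¹ • (s • resid X (yvec σ θs X z) θ + X' *ᵥ (θ - θs)) := by
        ext i
        rw [cZ, hR', hX', hT']
        rfl
      have hdet' : (cG lam' X' (inact θ)).det ≠ 0 := by
        intro h0
        rw [h0, mul_zero] at hle
        exact hdet0 (le_antisymm hle (posSemidef_cG hl.le (inact_eq _)).det_nonneg)
      refine ⟨⟨fun i => ?_, hU.2.1, ?_⟩, ?_⟩
      · exact mul_ne_zero hs.ne' (hU.1 i)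
      · rw [hX', hE', hT']
        exact fun h0 => hdet' ((det_cM hl'.ne' (inact_eq θ)).symm.trans h0)
      · rw [dens_eq hl.ne' hσ hE hl.le, dens_eq hl'.ne' hσ hE' hl'.le, hκ, ← ENNReal.ofReal_mul hK,
          ← ENNReal.ofReal_mul (by positivity)]
        apply ENNReal.ofReal_le_ofReal
        rw [hX, hTq, hZ, hX', hT', hZ', hR', hR]
        simp only [Pi.smul_apply, smul_eq_mul, abs_mul, abs_of_pos hs, mul_inv, mul_pow]
        set E1 := energy X z
        set E2 := energy X' (σ⁻¹ • (s • resid X (yvec σ θs X z) θ + X' *ᵥ (θ - θs)))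
        have hexp : Real.exp ((E1 - E2) / 2) * Real.exp (-E1 / 2) = Real.exp (-E2 / 2) := by
          rw [← Real.exp_add]; ring_nf
        set C0 := densityConst (m + 1) N * (σ⁻¹ ^ (m + 1) * (|resid X (yvec σ θs X z) θ 0|⁻¹ ^ N * Real.exp (-E1 / 2)))
        have hC0 : 0 ≤ C0 := mul_nonneg (densityConst_nonneg _ _) (by positivity)
        have := mul_le_mul_of_nonneg_left hle hC0
        rw [← hexp]
        refine (le_of_eq ?_).trans (this.trans (le_of_eq ?_))
        · simp only [C0]; ring
        · simp only [C0]; ring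
    · exact .inr hU
  refine step.trans ?_
  have hind : Measurable ((cU m N lam').indicator (dens σ θs lam')) := measurable_dens.indicator measurableSet_cU
  calc ∫⁻ q in (T ∪ (cU m N lam)ᶜ) ∩ cU m N lam, dens σ θs lam q
      ≤ ∫⁻ q in T, dens σ θs lam q := by
        refine lintegral_mono_set ?_
        rintro q ⟨h | h, h'⟩
        · exact h
        · exact absurd h' h
    _ ≤ ∫⁻ q in T, ENNReal.ofReal K * (κ q * (cU m N lam').indicator (dens σ θs lam') (τ q)) := by
        refine setLIntegral_mono' hTm fun q hq => ?_
        rw [Set.indicator_of_mem hq.1, ← mul_assoc]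
        exact hq.2
    _ ≤ ∫⁻ q, ENNReal.ofReal K * (κ q * (cU m N lam').indicator (dens σ θs lam') (τ q)) :=
        setLIntegral_le_lintegral _ _
    _ = ENNReal.ofReal K * ∫⁻ q in cU m N lam', dens σ θs lam' q := by
        have hm : Measurable fun q => κ q * (cU m N lam').indicator (dens σ θs lam') (τ q) :=
          hκm.mul (hind.comp hτ)
        rw [lintegral_const_mul _ hm, lintegral_rowFlow hs hA hb hdet hind,
          lintegral_indicator measurableSet_cU]
    _ ≤ ENNReal.ofReal K := by
        refine (mul_le_mul_right (setLIntegral_dens_le_one hσ.ne' hl') _).trans ?_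
        rw [mul_one]

end Lasso

namespace Lasso

open Matrix

variable {m N : ℕ} {σ lam : ℝ} {θs : Fin N → ℝ}

lemma sum_inact (θ : Fin N → ℝ) : ∑ j, inact θ j = N - l0 θ := by
  have h1 := Finset.card_filter_add_card_filter_not (s := (Finset.univ : Finset (Fin N))) (fun j => θ j = 0)
  have h2 : l0 θ = (Finset.univ.filter fun j => ¬ θ j = 0).card := by
    simp [l0]
  simp only [inact, Finset.sum_boole]
  rw [h2, eq_sub_iff_add_eq]
  rw [Finset.card_univ, Fintype.card_fin] at h1
  exact_mod_cast h1

lemma noise_eq {n : ℕ} {X : Matrix (Fin n) (Fin N) ℝ} {z : Fin n → ℝ} {θ : Fin N → ℝ} :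
    σ • z = resid X (yvec σ θs X z) θ + X *ᵥ (θ - θs) := by
  ext i
  simp only [resid, yvec, mulVec_sub, Pi.add_apply, Pi.sub_apply, mulVec, dotProduct, Pi.smul_apply, smul_eq_mul]
  ring

lemma det_cG_pos {n : ℕ} {X : Matrix (Fin n) (Fin N) ℝ} {θ : Fin N → ℝ} (hl : 0 ≤ lam)
    (h : (cG lam X (inact θ)).det ≠ 0) : 0 < (cG lam X (inact θ)).det :=
  lt_of_le_of_ne (posSemidef_cG hl (inact_eq _)).det_nonneg h.symm

lemma det_cG_scale {n : ℕ} {X : Matrix (Fin n) (Fin N) ℝ} {θ : Fin N → ℝ} {s : ℝ} (hs : 0 < s) :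
    (cG (s * lam) X (inact θ)).det = Real.exp ((N - l0 θ) * Real.log s) * (cG lam X (inact θ)).det := by
  have := det_cG_exp_mul (X := X) (lam := lam) (Real.log s) (inact_eq θ)
  rw [Real.exp_log hs, sum_inact] at this
  rw [this, mul_comm (Real.log s)]

/-- Tail bound from scaling the residual and the penalty. -/
lemma pmodel_scale_le (hσ : 0 < σ) (hl : 0 < lam) {t κ : ℝ} (ht : -1 < t)
    {S : Set ((Fin (m + 1) → Fin N → ℝ) × (Fin (m + 1) → ℝ))}
    (hS : ∀ (X : Matrix (Fin (m + 1)) (Fin N) ℝ) (z : Fin (m + 1) → ℝ), (X, z) ∈ S →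
      ∃ θ, IsLasso X (yvec σ θs X z) lam θ ∧ ∀ r, r = resid X (yvec σ θs X z) θ → r ≠ 0 →
        t * (z ⬝ᵥ r) / σ + t ^ 2 * (r ⬝ᵥ r) / (2 * σ ^ 2) - ((m + 1 : ℕ) - l0 θ) * Real.log (1 + t) ≤ κ) :
    Pmodel (m + 1) N S ≤ ENNReal.ofReal (Real.exp κ) := by
  have hs : 0 < 1 + t := by linarith
  refine pmodel_le_of_flow (θs := θs) hσ hl (mul_pos hs hl) hs (Real.exp_pos _).le (A := fun _ => 1) (b := fun _ => 0)
    (fun _ _ => measurable_const) (fun _ _ => measurable_const) (fun _ => by simp) fun X z hω => ?_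
  obtain ⟨θ, hθ, h⟩ := hS X z hω
  refine ⟨θ, hθ, fun r hr hr0 hdet => ⟨X, fun i => by simp, ?_, ?_⟩⟩
  · rw [smul_vecMul, mul_assoc, mul_inv_cancel₀ hl.ne', mul_one]
  have hκ := h r hr (fun h0 => hr0 (by rw [h0]; rfl))
  have hz : σ⁻¹ • ((1 + t) • r + X *ᵥ (θ - θs)) = z + (t / σ) • r := by
    have := noise_eq (σ := σ) (θs := θs) (X := X) (z := z) (θ := θ)
    rw [← hr] at this
    rw [add_smul, one_smul, add_right_comm, ← this, smul_add, smul_smul, smul_smul, inv_mul_cancel₀ hσ.ne', one_smul,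
      div_eq_inv_mul]
  have hE : (energy X z - energy X (z + (t / σ) • r)) / 2 =
      -(t * (z ⬝ᵥ r) / σ + t ^ 2 * (r ⬝ᵥ r) / (2 * σ ^ 2)) := by
    rw [energy, energy, ss_add, dotProduct_smul, smul_dotProduct, dotProduct_smul, smul_eq_mul, smul_eq_mul, smul_eq_mul]
    field_simp
    ring
  rw [hz, hE, det_cG_scale hs, ← mul_assoc]
  have hpos := det_cG_pos hl.le hdet
  refine le_mul_of_one_le_left hpos.le ?_
  have e1 : ∀ p : ℕ, (1 + t) ^ p = Real.exp (p * Real.log (1 + t)) := fun p => by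
    rw [mul_comm, Real.exp_mul, Real.exp_log hs, Real.rpow_natCast]
  rw [det_one, abs_one, one_pow, mul_one, inv_pow, e1, e1, ← Real.exp_neg, ← Real.exp_add, ← Real.exp_add, ← Real.exp_add, ← Real.exp_add]
  apply Real.one_le_exp
  linarith

lemma frob_add_vecMulVec {n : ℕ} (X : Matrix (Fin n) (Fin N) ℝ) (b : Fin n → ℝ) (c : Fin N → ℝ) (κ : ℝ) :
    frob (X + κ • vecMulVec b c) = frob X + 2 * κ * (b ⬝ᵥ (X *ᵥ c)) + κ ^ 2 * (b ⬝ᵥ b) * (c ⬝ᵥ c) := by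
  have h : ∀ i, (X + κ • vecMulVec b c) i = X i + (κ * b i) • c := fun i => by
    ext j; simp [vecMulVec_apply, mul_assoc]
  simp only [frob, h, ss_add]
  rw [Finset.sum_add_distrib, Finset.sum_add_distrib]
  simp only [dotProduct_smul, smul_dotProduct, smul_eq_mul]
  rw [show κ ^ 2 * (b ⬝ᵥ b) * (c ⬝ᵥ c) = ∑ i, κ ^ 2 * (b i * b i) * (c ⬝ᵥ c) by
      rw [← Finset.sum_mul, ← Finset.mul_sum]; rfl,
    show 2 * κ * (b ⬝ᵥ (X *ᵥ c)) = ∑ i, 2 * κ * (b i * (X *ᵥ c) i) by rw [← Finset.mul_sum]; rfl]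
  congr 1
  · congr 1
    refine Finset.sum_congr rfl fun i _ => ?_
    rw [mulVec]; ring
  · refine Finset.sum_congr rfl fun i _ => ?_
    ring

/-- Tail bound from stretching the design along the residual. -/
lemma pmodel_stretch_le (hσ : 0 < σ) (hl : 0 < lam) {a κ : ℝ} (ha : -(1 / 2) ≤ a)
    {S : Set ((Fin (m + 1) → Fin N → ℝ) × (Fin (m + 1) → ℝ))}
    (hS : ∀ (X : Matrix (Fin (m + 1)) (Fin N) ℝ) (z : Fin (m + 1) → ℝ), (X, z) ∈ S →
      ∃ θ, IsLasso X (yvec σ θs X z) lam θ ∧ ∀ r, r = resid X (yvec σ θs X z) θ → r ≠ 0 → ∀ β,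
        β = (z ⬝ᵥ r) / (r ⬝ᵥ r) - 1 / σ →
        (m + 1 : ℕ) * (a + a ^ 2 / 2) * (((r ᵥ* X) ⬝ᵥ (r ᵥ* X)) / (r ⬝ᵥ r)) + a * β * (z ⬝ᵥ r) +
          a ^ 2 * β ^ 2 * (r ⬝ᵥ r) / 2 - (N - l0 θ) * Real.log (1 + a) ≤ κ) :
    Pmodel (m + 1) N S ≤ ENNReal.ofReal (4 * Real.exp κ) := by
  have hs : 0 < 1 + a := by linarith
  refine pmodel_le_of_flow (θs := θs) hσ hl (mul_pos hs hl) one_pos (by positivity) (A := fun _ => 1)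
    (b := fun ξ i => (a / (cR ξ ⬝ᵥ cR ξ) * cR ξ i.succ * lam) • cV ξ)
    (fun _ _ => measurable_const) (fun i j => ?_) (fun _ => by simp) fun X z hω => ?_
  · have hV := measurable_pi_iff.1 (measurable_cV (m := m) (N := N)) j
    have hR := fun i => measurable_pi_iff.1 (measurable_cR (m := m) (N := N)) i
    simp only [Pi.smul_apply, smul_eq_mul, dotProduct]
    refine Measurable.mul (Measurable.mul (Measurable.mul (Measurable.const_div ?_ _) (hR _)) measurable_const) hV
    exact Finset.measurable_sum _ fun k _ => (hR k).mul (hR k)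
  obtain ⟨θ, hθ, h⟩ := hS X z hω
  refine ⟨θ, hθ, fun r hr hr0 hdet => ?_⟩
  have hrne : r ≠ 0 := fun h0 => hr0 (by rw [h0]; rfl)
  have hκ := h r hr hrne _ rfl
  set β := (z ⬝ᵥ r) / (r ⬝ᵥ r) - 1 / σ with hβ
  have hρ : 0 < r ⬝ᵥ r := lt_of_le_of_ne (ss_nonneg r) fun h0 => hrne (ss_eq_zero.1 h0.symm)
  set ρ := r ⬝ᵥ r with hρdef
  set g := r ᵥ* X with hg
  set X' := X + (a / ρ) • vecMulVec r g with hX'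
  have hn := noise_eq (σ := σ) (θs := θs) (X := X) (z := z) (θ := θ)
  rw [← hr] at hn
  have hgw : g ⬝ᵥ (θ - θs) = σ * (z ⬝ᵥ r) - ρ := by
    have := congrArg (fun u => r ⬝ᵥ u) hn
    simp only [dotProduct_smul, dotProduct_add, smul_eq_mul, dotProduct_mulVec] at this
    rw [dotProduct_comm z r]; linarith
  refine ⟨X', fun i => ?_, ?_, ?_⟩
  · rw [cV_coord hl hθ, cR_coord, ← hr, vecMul_one, smul_smul, mul_assoc _ lam, mul_inv_cancel₀ hl.ne', mul_one]
    ext j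
    simp [hX', vecMulVec_apply, hρdef, hg, mul_assoc]
  · rw [one_smul, hX', vecMul_add, vecMul_smul, ← hg, vecMul_vecMulVec, smul_smul, ← hρdef, div_mul_cancel₀ _ hρ.ne',
      mul_assoc, mul_inv_cancel₀ hl.ne', mul_one, add_smul, one_smul]
  have hz : σ⁻¹ • ((1 : ℝ) • r + X' *ᵥ (θ - θs)) = z + (a * β) • r := by
    rw [one_smul, hX', add_mulVec, ← add_assoc, ← hn, smul_mulVec, vecMulVec_mulVec, hgw, smul_add, smul_smul,
      inv_mul_cancel₀ hσ.ne', one_smul]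
    congr 1
    ext i
    simp only [Pi.smul_apply, smul_eq_mul, MulOpposite.smul_eq_mul_unop, MulOpposite.unop_op, hβ]
    field_simp
  have hE : (energy X z - energy X' (z + (a * β) • r)) / 2 =
      -((m + 1 : ℕ) * (a + a ^ 2 / 2) * ((g ⬝ᵥ g) / ρ) + a * β * (z ⬝ᵥ r) + a ^ 2 * β ^ 2 * ρ / 2) := by
    rw [energy, energy, ss_add, dotProduct_smul, smul_dotProduct, dotProduct_smul, smul_eq_mul, smul_eq_mul, smul_eq_mul,
      hX', frob_add_vecMulVec, dotProduct_mulVec, ← hg, ← hρdef]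
    field_simp
    ring
  rw [hz, hE, det_cG_scale hs]
  have hpos := det_cG_pos hl.le hdet
  obtain ⟨x, hx, hx'⟩ := det_cG_perturb hl (inact_eq θ) hdet r g
  obtain ⟨hx0, hx1⟩ := hx' hg
  have h4 : (1 / 4 : ℝ) * (cG lam X (inact θ)).det ≤ (cG lam X' (inact θ)).det := by
    refine le_trans (mul_le_mul_of_nonneg_right ?_ hpos.le) (hx (a / ρ))
    have h5 : x / ρ ≤ 1 := (div_le_one hρ).2 hx1
    have h6 : 0 ≤ x / ρ := by positivity
    have h7 : 1 / 2 ≤ 1 + a / ρ * x := by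
      rw [div_mul_eq_mul_div, mul_div_assoc]; nlinarith
    nlinarith
  set F := Real.exp (-((m + 1 : ℕ) * (a + a ^ 2 / 2) * ((g ⬝ᵥ g) / ρ) + a * β * (z ⬝ᵥ r) + a ^ 2 * β ^ 2 * ρ / 2))
  have h8 : 1 ≤ Real.exp κ * F * Real.exp ((N - l0 θ) * Real.log (1 + a)) := by
    rw [← Real.exp_add, ← Real.exp_add]
    apply Real.one_le_exp
    linarith
  calc (cG lam X (inact θ)).det ≤ (Real.exp κ * F * Real.exp ((N - l0 θ) * Real.log (1 + a))) * (cG lam X (inact θ)).det :=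
        le_mul_of_one_le_left hpos.le h8
    _ ≤ (Real.exp κ * F * Real.exp ((N - l0 θ) * Real.log (1 + a))) * (4 * (cG lam X' (inact θ)).det) := by
        refine mul_le_mul_of_nonneg_left (by linarith) (by positivity)
    _ = _ := by simp; ring

/-- Tail bound from contracting the design along the estimation error, orthogonally to the
residual. -/
lemma pmodel_contract_aux (hσ : 0 < σ) (hl : 0 < lam) {u κ : ℝ} (hu : u < 1)
    {S : Set ((Fin (m + 1) → Fin N → ℝ) × (Fin (m + 1) → ℝ))}
    (hS : ∀ (X : Matrix (Fin (m + 1)) (Fin N) ℝ) (z : Fin (m + 1) → ℝ), (X, z) ∈ S →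
      ∃ θ, IsLasso X (yvec σ θs X z) lam θ ∧ ∀ r, r = resid X (yvec σ θs X z) θ → r ≠ 0 → ∀ w, w = θ - θs →
        (cG lam X (inact θ)).det ≠ 0 → w ≠ 0 ∧
        (cG lam X (inact θ)).det ≤ 9 *
          (cG lam (X + (-u) • vecMulVec (σ • (z - ((z ⬝ᵥ r) / (r ⬝ᵥ r)) • r)) ((w ⬝ᵥ w)⁻¹ • w)) (inact θ)).det ∧
        -(u - u ^ 2 / 2) * ((z ⬝ᵥ z) - (z ⬝ᵥ r) ^ 2 / (r ⬝ᵥ r)) * ((m + 1 : ℕ) * σ ^ 2 / (w ⬝ᵥ w) + 1) -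
          m * Real.log (1 - u) ≤ κ) :
    Pmodel (m + 1) N S ≤ ENNReal.ofReal (9 * Real.exp κ) := by
  have hdetA : ∀ ξ : Fin N ⊕ Fin (m + 1) → ℝ,
      (1 + vecMulVec ((-u * ((cT ξ - θs) ⬝ᵥ (cT ξ - θs))⁻¹) • (cT ξ - θs)) (cT ξ - θs)).det =
        1 - u * (((cT ξ - θs) ⬝ᵥ (cT ξ - θs))⁻¹ * ((cT ξ - θs) ⬝ᵥ (cT ξ - θs))) := fun ξ => by
    rw [det_one_add_vecMulVec, dotProduct_smul, smul_eq_mul]; ring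
  refine pmodel_le_of_flow (θs := θs) hσ hl hl one_pos (by positivity)
    (A := fun ξ => 1 + vecMulVec ((-u * ((cT ξ - θs) ⬝ᵥ (cT ξ - θs))⁻¹) • (cT ξ - θs)) (cT ξ - θs))
    (b := fun ξ i => (u * ((cT ξ - θs) ⬝ᵥ (cT ξ - θs))⁻¹ * (cR ξ ⬝ᵥ cR ξ)⁻¹ * cR ξ i.succ *
      (lam * (cV ξ ⬝ᵥ (cT ξ - θs)))) • (cT ξ - θs))
    (fun j k => ?_) (fun i j => ?_) (fun ξ => ?_) fun X z hω => ?_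
  · have hT := fun j => (measurable_pi_iff.1 (measurable_cT (m := m) (N := N)) j).sub_const (θs j)
    simp only [Matrix.add_apply, vecMulVec_apply, Pi.smul_apply, smul_eq_mul, dotProduct, Pi.sub_apply]
    refine Measurable.add measurable_const (Measurable.mul (Measurable.mul (Measurable.const_mul (Measurable.inv ?_) _) (hT _)) (hT _))
    exact Finset.measurable_sum _ fun k _ => (hT k).mul (hT k)
  · have hT := fun j => (measurable_pi_iff.1 (measurable_cT (m := m) (N := N)) j).sub_const (θs j)
    have hV := fun j => measurable_pi_iff.1 (measurable_cV (m := m) (N := N)) j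
    have hR := fun i => measurable_pi_iff.1 (measurable_cR (m := m) (N := N)) i
    have h1 : Measurable fun ξ : Fin N ⊕ Fin (m + 1) → ℝ => ∑ k, (cT ξ k - θs k) * (cT ξ k - θs k) :=
      Finset.measurable_sum _ fun k _ => (hT k).mul (hT k)
    have h2 : Measurable fun ξ : Fin N ⊕ Fin (m + 1) → ℝ => ∑ k, cR ξ k * cR ξ k :=
      Finset.measurable_sum _ fun k _ => (hR k).mul (hR k)
    have h3 : Measurable fun ξ : Fin N ⊕ Fin (m + 1) → ℝ => ∑ k, cV ξ k * (cT ξ k - θs k) :=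
      Finset.measurable_sum _ fun k _ => (hV k).mul (hT k)
    simp only [Pi.smul_apply, smul_eq_mul, dotProduct, Pi.sub_apply]
    exact (((((h1.inv).const_mul u).mul h2.inv).mul (hR _)).mul (h3.const_mul lam)).mul (hT _)
  · rw [hdetA]
    by_cases h0 : (cT ξ - θs) ⬝ᵥ (cT ξ - θs) = 0
    · simp [h0]
    · rw [inv_mul_cancel₀ h0]; linarith
  obtain ⟨θ, hθ, h⟩ := hS X z hω
  refine ⟨θ, hθ, fun r hr hr0 hdet => ?_⟩
  have hrne : r ≠ 0 := fun h0 => hr0 (by rw [h0]; rfl)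
  obtain ⟨hw, h9, hκ⟩ := h r hr hrne _ rfl hdet
  have hρ : 0 < r ⬝ᵥ r := lt_of_le_of_ne (ss_nonneg r) fun h0 => hrne (ss_eq_zero.1 h0.symm)
  have hn := noise_eq (σ := σ) (θs := θs) (X := X) (z := z) (θ := θ)
  rw [← hr] at hn
  rw [cT_coord hl hθ, cR_coord, cV_coord hl hθ, ← hr]
  rw [← cT_coord hl hθ, hdetA, cT_coord hl hθ]
  set w := θ - θs with hwdef
  have hW : 0 < w ⬝ᵥ w := lt_of_le_of_ne (ss_nonneg w) fun h0 => hw (ss_eq_zero.1 h0.symm)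
  set W := w ⬝ᵥ w with hWdef
  set ρ := r ⬝ᵥ r with hρdef
  set q := z ⬝ᵥ r with hq
  set b := σ • (z - (q / ρ) • r) with hb
  set X' := X + (-u) • vecMulVec b (W⁻¹ • w) with hX'
  have hrXw : r ⬝ᵥ (X *ᵥ w) = σ * q - ρ := by
    have := congrArg (fun u => r ⬝ᵥ u) hn
    simp only [dotProduct_smul, dotProduct_add, smul_eq_mul] at this
    rw [hq, dotProduct_comm z r]; linarith
  have hrb : r ⬝ᵥ b = 0 := by
    rw [hb, dotProduct_smul, dotProduct_sub, dotProduct_smul, dotProduct_comm r z, ← hρdef, ← hq, smul_eq_mul, smul_eq_mul,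
      div_mul_cancel₀ _ hρ.ne', sub_self, mul_zero]
  have hbz : b ⬝ᵥ z = σ * (z ⬝ᵥ z - q ^ 2 / ρ) := by
    rw [hb, smul_dotProduct, sub_dotProduct, smul_dotProduct, dotProduct_comm r z, ← hq, smul_eq_mul, smul_eq_mul]
    field_simp
  have hbb : b ⬝ᵥ b = σ ^ 2 * (z ⬝ᵥ z - q ^ 2 / ρ) := by
    conv_lhs => rw [hb, smul_dotProduct, sub_dotProduct, smul_dotProduct, ← hb, hrb, dotProduct_comm z b, hbz]
    simp only [smul_eq_mul]; ring
  have hbXw : b ⬝ᵥ (X *ᵥ w) = b ⬝ᵥ b := by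
    have := congrArg (fun u => b ⬝ᵥ u) hn
    simp only [dotProduct_smul, dotProduct_add, smul_eq_mul, dotProduct_comm b r, hrb] at this
    rw [hbz] at this
    rw [hbb]; linarith
  refine ⟨X', fun i => ?_, ?_, ?_⟩
  · have h1 : (lam • ((lam⁻¹ • (r ᵥ* X)) ⬝ᵥ w)) = σ * q - ρ := by
      rw [smul_dotProduct, smul_smul, mul_inv_cancel₀ hl.ne', one_smul, ← dotProduct_mulVec, hrXw]
    rw [smul_eq_mul] at h1
    rw [h1, vecMul_add, vecMul_one, vecMul_vecMulVec]
    have h2 := congrFun hn i.succ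
    have h3 : X i.succ ⬝ᵥ w = σ * z i.succ - r i.succ := by
      simp only [Pi.smul_apply, Pi.add_apply, smul_eq_mul, mulVec] at h2
      linarith
    ext j
    simp only [hX', hb, Matrix.add_apply, Matrix.smul_apply, vecMulVec_apply, Pi.add_apply, Pi.smul_apply, Pi.sub_apply,
      smul_eq_mul, dotProduct_smul, h3]
    field_simp
    ring
  · rw [one_smul, hX', vecMul_add, vecMul_smul, vecMul_vecMulVec, hrb, zero_smul, smul_zero, add_zero, mul_inv_cancel₀ hl.ne',
      one_smul]
  clear_value b
  have hz : σ⁻¹ • ((1 : ℝ) • r + X' *ᵥ w) = z + (-u * σ⁻¹) • b := by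
    rw [one_smul, hX', add_mulVec, ← add_assoc, ← hn, smul_mulVec, vecMulVec_mulVec, smul_dotProduct, ← hWdef, smul_eq_mul,
      inv_mul_cancel₀ hW.ne', smul_add, smul_smul, inv_mul_cancel₀ hσ.ne', one_smul]
    congr 1
    ext i
    simp only [Pi.smul_apply, smul_eq_mul, MulOpposite.smul_eq_mul_unop, MulOpposite.unop_op]
    ring
  have hE : (energy X z - energy X' (z + (-u * σ⁻¹) • b)) / 2 =
      (u - u ^ 2 / 2) * ((z ⬝ᵥ z) - q ^ 2 / ρ) * ((m + 1 : ℕ) * σ ^ 2 / W + 1) := by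
    rw [energy, energy, ss_add, dotProduct_smul, smul_dotProduct, dotProduct_smul, smul_eq_mul, smul_eq_mul, smul_eq_mul,
      hX', frob_add_vecMulVec, mulVec_smul, dotProduct_smul, smul_dotProduct, dotProduct_smul, hbXw, dotProduct_comm z b, hbz, hbb,
      ← hWdef]
    simp only [smul_eq_mul]
    set D := z ⬝ᵥ z - q ^ 2 / ρ
    field_simp
    ring
  rw [hz, hE, inv_mul_cancel₀ hW.ne', mul_one, abs_of_pos (by linarith)]
  have e1 : (1 - u) ^ m = Real.exp (m * Real.log (1 - u)) := by
    rw [mul_comm, Real.exp_mul, Real.exp_log (by linarith), Real.rpow_natCast]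
  have h8 : 1 ≤ Real.exp κ * (1 - u) ^ m * Real.exp ((u - u ^ 2 / 2) * ((z ⬝ᵥ z) - q ^ 2 / ρ) * ((m + 1 : ℕ) * σ ^ 2 / W + 1)) := by
    rw [e1, ← Real.exp_add, ← Real.exp_add]
    apply Real.one_le_exp
    linarith
  have hpos := det_cG_pos hl.le hdet
  refine (le_mul_of_one_le_left hpos.le h8).trans ((mul_le_mul_of_nonneg_left h9 (by positivity)).trans (le_of_eq ?_))
  simp; ring

/-- Tail bound excluding a residual orthogonal to the noise. -/
lemma pmodel_contract_le (hσ : 0 < σ) (hl : 0 < lam) {u κ : ℝ} (hu0 : 0 < u) (hu : u < 1)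
    {S : Set ((Fin (m + 1) → Fin N → ℝ) × (Fin (m + 1) → ℝ))}
    (hS : ∀ (X : Matrix (Fin (m + 1)) (Fin N) ℝ) (z : Fin (m + 1) → ℝ), (X, z) ∈ S →
      ∃ θ, IsLasso X (yvec σ θs X z) lam θ ∧ ∀ r, r = resid X (yvec σ θs X z) θ → r ≠ 0 → ∀ w, w = θ - θs →
        w ≠ 0 ∧ ∀ v, v = u ∨ v = u / 2 →
        -(v - v ^ 2 / 2) * ((z ⬝ᵥ z) - (z ⬝ᵥ r) ^ 2 / (r ⬝ᵥ r)) * ((m + 1 : ℕ) * σ ^ 2 / (w ⬝ᵥ w) + 1) -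
          m * Real.log (1 - v) ≤ κ) :
    Pmodel (m + 1) N S ≤ ENNReal.ofReal (18 * Real.exp κ) := by
  set Q : ℝ → Matrix (Fin (m + 1)) (Fin N) ℝ → (Fin (m + 1) → ℝ) → Prop := fun v X z =>
    ∃ θ, IsLasso X (yvec σ θs X z) lam θ ∧ ∀ r, r = resid X (yvec σ θs X z) θ → r ≠ 0 → ∀ w, w = θ - θs →
        (cG lam X (inact θ)).det ≠ 0 → w ≠ 0 ∧
        (cG lam X (inact θ)).det ≤ 9 *
          (cG lam (X + (-v) • vecMulVec (σ • (z - ((z ⬝ᵥ r) / (r ⬝ᵥ r)) • r)) ((w ⬝ᵥ w)⁻¹ • w)) (inact θ)).det ∧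
        -(v - v ^ 2 / 2) * ((z ⬝ᵥ z) - (z ⬝ᵥ r) ^ 2 / (r ⬝ᵥ r)) * ((m + 1 : ℕ) * σ ^ 2 / (w ⬝ᵥ w) + 1) -
          m * Real.log (1 - v) ≤ κ with hQ
  set G : ℝ → Set ((Fin (m + 1) → Fin N → ℝ) × (Fin (m + 1) → ℝ)) := fun v => {p | Q v p.1 p.2} with hG
  have h1 : ∀ v, v < 1 → Pmodel (m + 1) N (G v) ≤ ENNReal.ofReal (9 * Real.exp κ) := fun v hv =>
    pmodel_contract_aux hσ hl hv fun X z h => h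
  have hsub : S ⊆ G u ∪ G (u / 2) := by
    rintro ⟨X, z⟩ hω
    obtain ⟨θ, hθ, h⟩ := hS X z hω
    set r := resid X (yvec σ θs X z) θ with hr
    set w := θ - θs with hw
    by_cases hdet : (cG lam X (inact θ)).det = 0
    · exact .inl ⟨θ, hθ, fun _ _ _ _ _ h0 => absurd hdet h0⟩
    by_cases hr0 : r = 0
    · exact .inl ⟨θ, hθ, fun r' hr' h0 => absurd (hr'.trans hr0) h0⟩
    obtain ⟨x, hx, -⟩ := det_cG_perturb hl (inact_eq θ) hdet (σ • (z - ((z ⬝ᵥ r) / (r ⬝ᵥ r)) • r)) ((w ⬝ᵥ w)⁻¹ • w)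
    have hpos := det_cG_pos hl.le hdet
    obtain ⟨hw0, h⟩ := h r rfl hr0 w rfl
    have key : ∀ v, (v = u ∨ v = u / 2) → 1 / 9 ≤ (1 + -v * x) ^ 2 → (X, z) ∈ G v := by
      intro v hv hv9
      refine ⟨θ, hθ, ?_⟩
      rintro _ rfl _ _ rfl _
      refine ⟨hw0, ?_, h v hv⟩
      have h2 := hx (-v)
      have h3 := mul_le_mul_of_nonneg_right hv9 hpos.le
      linarith
    by_cases h9 : 1 / 9 ≤ (1 + -u * x) ^ 2
    · exact .inl (key u (.inl rfl) h9)
    · refine .inr (key (u / 2) (.inr rfl) ?_)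
      push Not at h9
      have h4 : |1 + -u * x| < 1 / 3 := by
        apply abs_lt_of_sq_lt_sq _ (by norm_num)
        linarith
      rw [abs_lt] at h4
      nlinarith
  refine (measure_mono hsub).trans ((measure_union_le _ _).trans ((add_le_add (h1 u hu) (h1 _ (by linarith))).trans ?_))
  rw [← ENNReal.ofReal_add (by positivity) (by positivity)]
  exact ENNReal.ofReal_le_ofReal (by linarith)

end Lasso

namespace Lasso

/-- Standard Gaussian measure on `P → ℝ`. -/
abbrev stdGauss (P : Type*) [Fintype P] : Measure (P → ℝ) := Measure.pi fun _ => gaussianReal 0 1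

section IBP

variable {P : Type*} [Fintype P]

lemma integrable_coord (p : P) : Integrable (fun ω : P → ℝ => ω p) (stdGauss P) := by
  have h : Integrable (id : ℝ → ℝ) (gaussianReal 0 1) :=
    (memLp_id_gaussianReal (μ := 0) (v := 1) 1).integrable (by norm_num)
  exact (measurePreserving_eval (fun _ : P => gaussianReal 0 1) p).integrable_comp_of_integrable h

lemma integrable_of_bdd {α : Type*} [MeasurableSpace α] {μ : Measure α} [IsFiniteMeasure μ] {g : α → ℝ} {C : ℝ}
    (hg : AEStronglyMeasurable g μ) (hb : ∀ x, |g x| ≤ C) : Integrable g μ :=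
  Integrable.of_bound hg C (Filter.Eventually.of_forall hb)

lemma gaussian_ibp [DecidableEq P] {g g' : (P → ℝ) → ℝ} {C C' : ℝ} (hg : Continuous g) (hg' : Continuous g')
    (hb : ∀ x, |g x| ≤ C) (hb' : ∀ x, |g' x| ≤ C') (p : P)
    (hd : ∀ x, HasLineDerivAt ℝ g (g' x) x (Pi.single p 1)) :
    ∫ ω, ω p * g ω ∂stdGauss P = ∫ ω, g' ω ∂stdGauss P := by
  set d : (P → ℝ) → ℝ := fun x => ∏ i, gaussianPDFReal 0 1 (x i) with hdd
  have hd0 : ∀ x, 0 ≤ d x := fun x => Finset.prod_nonneg fun i _ => gaussianPDFReal_nonneg _ _ _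
  have hdm : Measurable fun x => ENNReal.ofReal (d x) := by
    refine ENNReal.measurable_ofReal.comp (Finset.measurable_prod _ fun i _ => ?_)
    exact (measurable_gaussianPDFReal _ _).comp (by fun_prop)
  have hlt : ∀ᵐ x ∂(volume : Measure (P → ℝ)), ENNReal.ofReal (d x) < ⊤ :=
    Filter.Eventually.of_forall fun x => ENNReal.ofReal_lt_top
  have heq : stdGauss P = (volume : Measure (P → ℝ)).withDensity fun x => ENNReal.ofReal (d x) :=
    pi_gaussian_withDensity one_ne_zero
  have hI : ∀ f : (P → ℝ) → ℝ, Integrable f (stdGauss P) → Integrable (fun x => d x * f x) volume := by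
    intro f hf
    rw [heq, integrable_withDensity_iff_integrable_smul' hdm hlt] at hf
    simpa [ENNReal.toReal_ofReal (hd0 _)] using hf
  have hE : ∀ f : (P → ℝ) → ℝ, ∫ x, f x ∂stdGauss P = ∫ x, d x * f x := by
    intro f
    rw [heq, integral_withDensity_eq_integral_toReal_smul hdm hlt]
    simp [ENNReal.toReal_ofReal (hd0 _)]
  have hgi : Integrable g (stdGauss P) := integrable_of_bdd hg.aestronglyMeasurable hb
  have hgi' : Integrable g' (stdGauss P) := integrable_of_bdd hg'.aestronglyMeasurable hb'
  have hwi : Integrable (fun ω : P → ℝ => ω p * g ω) (stdGauss P) := by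
    have := (integrable_coord p).bdd_mul hg.aestronglyMeasurable (Filter.Eventually.of_forall hb)
    simpa [mul_comm] using this
  have hdd' : ∀ x, HasLineDerivAt ℝ d (-(x p) * d x) x (Pi.single p 1) := by
    intro x
    have e : d = fun x => (√(2 * Real.pi * (1 : ℝ≥0)))⁻¹ ^ Fintype.card P * Real.exp (-(x ⬝ᵥ x) / (2 * (1 : ℝ≥0))) := by
      funext x; exact prod_gaussianPDF 1 x
    rw [e]
    unfold HasLineDerivAt
    have h1 : ∀ t : ℝ, (x + t • (Pi.single p 1 : P → ℝ)) ⬝ᵥ (x + t • Pi.single p 1) = x ⬝ᵥ x + 2 * t * x p + t ^ 2 := by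
      intro t
      simp [add_dotProduct, dotProduct_add, dotProduct_single, single_dotProduct]
      ring
    simp only [h1]
    have h2 : HasDerivAt (fun t : ℝ => -(x ⬝ᵥ x + 2 * t * x p + t ^ 2) / (2 * ((1 : ℝ≥0) : ℝ))) (-(x p)) 0 := by
      have := ((((hasDerivAt_id (0 : ℝ)).const_mul 2).mul_const (x p)).const_add (x ⬝ᵥ x)).add
        ((hasDerivAt_id (0 : ℝ)).pow 2)
      exact (this.neg.div_const (2 * ((1 : ℝ≥0) : ℝ))).congr_deriv (by simp; ring)
    have h3 := (h2.exp).const_mul ((√(2 * Real.pi * (1 : ℝ≥0)))⁻¹ ^ Fintype.card P)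
    refine h3.congr_deriv ?_
    simp
    ring
  have key := integral_bilinear_hasLineDerivAt_right_eq_neg_left_of_integrable (μ := (volume : Measure (P → ℝ)))
    (B := ContinuousLinearMap.mul ℝ ℝ) (f := d) (f' := fun x => -(x p) * d x) (g := g) (g' := g') (v := Pi.single p 1)
    (by
      have := (hI _ hwi).neg
      refine this.congr (Filter.Eventually.of_forall fun x => ?_)
      simp; ring) (hI _ hgi') (hI _ hgi) (fun x _ => hdd' x) (fun x _ => hd x)
  simp only [ContinuousLinearMap.mul_apply'] at key
  rw [hE, hE, key, ← integral_neg]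
  refine integral_congr_ae (Filter.Eventually.of_forall fun x => ?_)
  simp; ring

end IBP

section Interpolation

variable {P₁ P₂ E : Type*}

/-- Weights of the trigonometric interpolation between two Gaussian vectors. -/
def trigW (φ : ℝ) : P₁ ⊕ P₂ → ℝ := Sum.elim (fun _ => Real.sin φ) (fun _ => Real.cos φ)

/-- Derivative of `trigW`. -/
def trigW' (φ : ℝ) : P₁ ⊕ P₂ → ℝ := Sum.elim (fun _ => Real.cos φ) (fun _ => -Real.sin φ)

lemma hasDerivAt_trigW (φ : ℝ) (p : P₁ ⊕ P₂) : HasDerivAt (fun s => trigW s p) (trigW' φ p) φ := by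
  cases p with
  | inl p => exact Real.hasDerivAt_sin φ
  | inr p => exact Real.hasDerivAt_cos φ

lemma abs_trigW'_le (φ : ℝ) (p : P₁ ⊕ P₂) : |trigW' φ p| ≤ 1 := by
  cases p with
  | inl p => exact Real.abs_cos_le_one φ
  | inr p => simpa [trigW'] using Real.abs_sin_le_one φ

lemma gaussian_interpolation [Fintype P₁] [Fintype P₂] [NormedAddCommGroup E] [NormedSpace ℝ E] {Φ : E → ℝ} {V : P₁ ⊕ P₂ → E} {G H : P₁ ⊕ P₂ → E → ℝ} {C : ℝ}
    (hΦ : Differentiable ℝ Φ) (hΦb : ∀ x, |Φ x| ≤ C)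
    (hG : ∀ p x, HasLineDerivAt ℝ Φ (G p x) x (V p)) (hGc : ∀ p, Continuous (G p)) (hGb : ∀ p x, |G p x| ≤ C)
    (hH : ∀ p x, HasLineDerivAt ℝ (G p) (H p x) x (V p)) (hHc : ∀ p, Continuous (H p)) (hHb : ∀ p x, |H p x| ≤ C)
    (hK : ∀ x, 0 ≤ ∑ p, H (Sum.inl p) x - ∑ p, H (Sum.inr p) x) :
    ∫ ω, Φ (∑ p, ω (Sum.inr p) • V (Sum.inr p)) ∂stdGauss (P₁ ⊕ P₂) ≤
      ∫ ω, Φ (∑ p, ω (Sum.inl p) • V (Sum.inl p)) ∂stdGauss (P₁ ⊕ P₂) := by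
  classical
  set X : ℝ → (P₁ ⊕ P₂ → ℝ) → E := fun φ ω => ∑ p, (trigW φ p * ω p) • V p with hX
  have hXc : ∀ φ, Continuous (X φ) := fun φ => by simp only [hX]; fun_prop
  have hG' : ∀ p x, fderiv ℝ Φ x (V p) = G p x := fun p x => by
    rw [← (hΦ x).lineDeriv_eq_fderiv]; exact (hG p x).lineDeriv
  set F' : ℝ → (P₁ ⊕ P₂ → ℝ) → ℝ := fun φ ω => ∑ p, trigW' φ p * (ω p * G p (X φ ω)) with hF'
  have hder : ∀ ω φ, HasDerivAt (fun φ => Φ (X φ ω)) (F' φ ω) φ := by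
    intro ω φ
    have h1 : HasDerivAt (fun φ => X φ ω) (∑ p, (trigW' φ p * ω p) • V p) φ := by
      simp only [hX]
      exact HasDerivAt.fun_sum fun p _ => ((hasDerivAt_trigW φ p).mul_const (ω p)).smul_const (V p)
    have h2 := (hΦ (X φ ω)).hasFDerivAt.comp_hasDerivAt φ h1
    refine h2.congr_deriv ?_
    simp only [hF', map_sum, map_smul, hG', smul_eq_mul, mul_assoc]
  have hF'm : ∀ φ, Continuous (F' φ) := fun φ => by
    simp only [hF']
    refine continuous_finsetSum _ fun p _ => ?_
    have := (hGc p).comp (hXc φ)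
    exact continuous_const.mul ((continuous_apply p).mul this)
  have hmain : ∀ φ, HasDerivAt (fun φ => ∫ ω, Φ (X φ ω) ∂stdGauss (P₁ ⊕ P₂))
      (∫ ω, F' φ ω ∂stdGauss (P₁ ⊕ P₂)) φ := by
    intro φ
    refine (hasDerivAt_integral_of_dominated_loc_of_deriv_le (bound := fun ω => ∑ p, |ω p| * C)
      (s := Set.univ) Filter.univ_mem ?_ ?_ (hF'm φ).aestronglyMeasurable ?_ ?_ ?_).2
    · exact Filter.Eventually.of_forall fun s => (hΦ.continuous.comp (hXc s)).aestronglyMeasurable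
    · exact integrable_of_bdd (hΦ.continuous.comp (hXc φ)).aestronglyMeasurable fun ω => hΦb _
    · refine Filter.Eventually.of_forall fun ω s _ => ?_
      simp only [hF', Real.norm_eq_abs]
      refine (Finset.abs_sum_le_sum_abs _ _).trans (Finset.sum_le_sum fun p _ => ?_)
      rw [abs_mul, abs_mul]
      calc |trigW' s p| * (|ω p| * |G p (X s ω)|) ≤ 1 * (|ω p| * C) := by
            have := abs_trigW'_le s p
            have := hGb p (X s ω)
            gcongr
        _ = _ := one_mul _
    · exact integrable_finsetSum _ fun p _ => (integrable_coord p).abs.mul_const C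
    · exact Filter.Eventually.of_forall fun ω s _ => hder ω s
  have hval : ∀ φ, ∫ ω, F' φ ω ∂stdGauss (P₁ ⊕ P₂) =
      Real.sin φ * Real.cos φ * ∫ ω, (∑ p, H (Sum.inl p) (X φ ω) - ∑ p, H (Sum.inr p) (X φ ω)) ∂stdGauss (P₁ ⊕ P₂) := by
    intro φ
    have hHi : ∀ p, Integrable (fun ω => H p (X φ ω)) (stdGauss (P₁ ⊕ P₂)) := fun p =>
      integrable_of_bdd ((hHc p).comp (hXc φ)).aestronglyMeasurable fun ω => hHb p _
    have hibp : ∀ p, ∫ ω, ω p * G p (X φ ω) ∂stdGauss (P₁ ⊕ P₂) = trigW φ p * ∫ ω, H p (X φ ω) ∂stdGauss (P₁ ⊕ P₂) := by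
      intro p
      rw [← integral_const_mul]
      refine gaussian_ibp (g := fun ω => G p (X φ ω)) (g' := fun ω => trigW φ p * H p (X φ ω))
        (C := C) (C' := |trigW φ p| * C) ((hGc p).comp (hXc φ))
        (continuous_const.mul ((hHc p).comp (hXc φ))) (fun x => hGb p _) (fun x => ?_) p (fun x => ?_)
      · rw [abs_mul]; have := hHb p (X φ x); gcongr
      · have h1 : ∀ t : ℝ, X φ (x + t • Pi.single p 1) = X φ x + (t * trigW φ p) • V p := by
          intro t
          simp only [hX, Pi.add_apply, Pi.smul_apply, smul_eq_mul, mul_add, add_smul, Finset.sum_add_distrib]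
          congr 1
          rw [Finset.sum_eq_single p]
          · simp [mul_comm]
          · intro b _ hb; simp [hb]
          · simp
        unfold HasLineDerivAt
        simp only [h1]
        have h2 := hH p (X φ x)
        unfold HasLineDerivAt at h2
        have h3 : HasDerivAt (fun t : ℝ => t * trigW φ p) (trigW φ p) 0 := by
          simpa using (hasDerivAt_id (0 : ℝ)).mul_const (trigW φ p)
        have h4 := HasDerivAt.comp (0 : ℝ) (h₂ := fun t => G p (X φ x + t • V p)) (h := fun t : ℝ => t * trigW φ p)
          (by simpa using h2) h3
        rw [mul_comm]
        exact h4
    have hint : ∀ p, Integrable (fun ω : P₁ ⊕ P₂ → ℝ => trigW' φ p * (ω p * G p (X φ ω))) (stdGauss (P₁ ⊕ P₂)) := by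
      intro p
      refine Integrable.const_mul ?_ _
      have := (integrable_coord p).bdd_mul (μ := stdGauss (P₁ ⊕ P₂)) ((hGc p).comp (hXc φ)).aestronglyMeasurable
        (Filter.Eventually.of_forall fun x => hGb p _)
      simpa [mul_comm] using this
    simp only [hF']
    rw [integral_finsetSum _ fun p _ => hint p, integral_sub (integrable_finsetSum _ fun p _ => hHi _)
      (integrable_finsetSum _ fun p _ => hHi _), integral_finsetSum _ fun p _ => hHi _,
      integral_finsetSum _ fun p _ => hHi _, Fintype.sum_sum_type]
    simp only [integral_const_mul, hibp]
    simp only [trigW, trigW', Sum.elim_inl, Sum.elim_inr, ← Finset.mul_sum]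
    ring
  have hmono : MonotoneOn (fun φ => ∫ ω, Φ (X φ ω) ∂stdGauss (P₁ ⊕ P₂)) (Set.Icc 0 (Real.pi / 2)) := by
    refine monotoneOn_of_deriv_nonneg (convex_Icc _ _) (fun φ _ => (hmain φ).continuousAt.continuousWithinAt)
      (fun φ _ => (hmain φ).differentiableAt.differentiableWithinAt) (fun φ hφ => ?_)
    rw [interior_Icc] at hφ
    rw [(hmain φ).deriv, hval]
    refine mul_nonneg (mul_nonneg ?_ ?_) (integral_nonneg fun ω => hK _)
    · exact Real.sin_nonneg_of_nonneg_of_le_pi hφ.1.le (by linarith [hφ.2, Real.pi_pos])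
    · exact Real.cos_nonneg_of_neg_pi_div_two_le_of_le (by linarith [hφ.1, Real.pi_pos]) hφ.2.le
  have := hmono (Set.left_mem_Icc.2 (by positivity)) (Set.right_mem_Icc.2 (by positivity)) (by positivity : (0 : ℝ) ≤ Real.pi / 2)
  simpa [hX, trigW, Fintype.sum_sum_type] using this

end Interpolation

end Lasso

namespace Lasso

section SoftMin

variable {ι U : Type*} [Fintype ι]

/-- Regularized norm of the vector component. -/
def smNorm (κ : ℝ) (x : U → (ι → ℝ) × ℝ) (u : U) : ℝ := √(κ ^ 2 + (x u).1 ⬝ᵥ (x u).1)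

/-- Exponential weight of a point in the soft minimum. -/
def smExp (κ β τ : ℝ) (x : U → (ι → ℝ) × ℝ) (u : U) : ℝ := Real.exp (-(β * (smNorm κ x u + (x u).2 - τ)))

/-- Smooth surrogate of the indicator that the minimum exceeds `τ`. -/
def smVal [Fintype U] (κ β τ : ℝ) (x : U → (ι → ℝ) × ℝ) : ℝ := Real.exp (-∑ u, smExp κ β τ x u)

/-- First derivative of `smNorm + snd` along `V`. -/
def smD1 (κ : ℝ) (V x : U → (ι → ℝ) × ℝ) (u : U) : ℝ := (smNorm κ x u)⁻¹ * ((x u).1 ⬝ᵥ (V u).1) + (V u).2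

/-- Second derivative of `smNorm + snd` along `V`. -/
def smD2 (κ : ℝ) (V x : U → (ι → ℝ) × ℝ) (u : U) : ℝ :=
  (smNorm κ x u)⁻¹ * ((V u).1 ⬝ᵥ (V u).1) - (smNorm κ x u)⁻¹ ^ 3 * ((x u).1 ⬝ᵥ (V u).1) ^ 2

/-- First derivative of `smVal` along `V`. -/
def smG [Fintype U] (κ β τ : ℝ) (V x : U → (ι → ℝ) × ℝ) : ℝ :=
  smVal κ β τ x * ∑ u, β * smExp κ β τ x u * smD1 κ V x u

/-- Second derivative of `smVal` along `V`. -/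
def smH [Fintype U] (κ β τ : ℝ) (V x : U → (ι → ℝ) × ℝ) : ℝ :=
  smVal κ β τ x * ((∑ u, β * smExp κ β τ x u * smD1 κ V x u) ^ 2 +
    ∑ u, β * smExp κ β τ x u * (smD2 κ V x u - β * smD1 κ V x u ^ 2))

variable {κ β τ : ℝ} {V x : U → (ι → ℝ) × ℝ} {u : U}

lemma smNorm_pos (hκ : 0 < κ) : 0 < smNorm κ x u :=
  Real.sqrt_pos.2 (by have := ss_nonneg (x u).1; positivity)

lemma smNorm_sq (κ : ℝ) (x : U → (ι → ℝ) × ℝ) (u : U) : smNorm κ x u ^ 2 = κ ^ 2 + (x u).1 ⬝ᵥ (x u).1 :=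
  Real.sq_sqrt (by have := ss_nonneg (x u).1; positivity)

lemma hasDerivAt_smNorm (hκ : 0 < κ) :
    HasDerivAt (fun t : ℝ => smNorm κ (x + t • V) u) ((smNorm κ x u)⁻¹ * ((x u).1 ⬝ᵥ (V u).1)) 0 := by
  have h1 : ∀ t : ℝ, ((x + t • V) u).1 ⬝ᵥ ((x + t • V) u).1 =
      (x u).1 ⬝ᵥ (x u).1 + t * (2 * ((x u).1 ⬝ᵥ (V u).1)) + t ^ 2 * ((V u).1 ⬝ᵥ (V u).1) := by
    intro t
    simp only [Pi.add_apply, Pi.smul_apply, Prod.fst_add, Prod.smul_fst, add_dotProduct, dotProduct_add,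
      smul_dotProduct, dotProduct_smul, smul_eq_mul]
    rw [dotProduct_comm (V u).1 (x u).1]
    ring
  unfold smNorm
  simp only [h1]
  have h2 : HasDerivAt (fun t : ℝ => κ ^ 2 + ((x u).1 ⬝ᵥ (x u).1 + t * (2 * ((x u).1 ⬝ᵥ (V u).1)) +
      t ^ 2 * ((V u).1 ⬝ᵥ (V u).1))) (2 * ((x u).1 ⬝ᵥ (V u).1)) 0 := by
    have := ((((hasDerivAt_id (0 : ℝ)).mul_const (2 * ((x u).1 ⬝ᵥ (V u).1))).const_add ((x u).1 ⬝ᵥ (x u).1)).add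
      (((hasDerivAt_id (0 : ℝ)).pow 2).mul_const ((V u).1 ⬝ᵥ (V u).1))).const_add (κ ^ 2)
    exact this.congr_deriv (by simp)
  have hne : κ ^ 2 + ((x u).1 ⬝ᵥ (x u).1 + 0 * (2 * ((x u).1 ⬝ᵥ (V u).1)) + 0 ^ 2 * ((V u).1 ⬝ᵥ (V u).1)) ≠ 0 := by
    have := ss_nonneg (x u).1
    simp only [zero_mul, add_zero, ne_eq, OfNat.ofNat_ne_zero, not_false_eq_true, zero_pow]
    positivity
  refine (h2.sqrt hne).congr_deriv ?_
  simp only [zero_mul, add_zero, ne_eq, OfNat.ofNat_ne_zero, not_false_eq_true, zero_pow]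
  field_simp

lemma hasDerivAt_smExp (hκ : 0 < κ) :
    HasDerivAt (fun t : ℝ => smExp κ β τ (x + t • V) u) (-(β * smExp κ β τ x u * smD1 κ V x u)) 0 := by
  have h1 : HasDerivAt (fun t : ℝ => ((x + t • V) u).2) (V u).2 0 := by
    have := ((hasDerivAt_id (0 : ℝ)).mul_const (V u).2).const_add (x u).2
    exact this.congr_deriv (by simp)
  have h2 := ((((hasDerivAt_smNorm (V := V) (x := x) (u := u) hκ).add h1).sub_const τ).const_mul β).neg.exp
  refine h2.congr_deriv ?_
  simp [smExp, smD1]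
  ring

lemma hasDerivAt_smD1 (hκ : 0 < κ) :
    HasDerivAt (fun t : ℝ => smD1 κ V (x + t • V) u) (smD2 κ V x u) 0 := by
  have h1 : HasDerivAt (fun t : ℝ => ((x + t • V) u).1 ⬝ᵥ (V u).1) ((V u).1 ⬝ᵥ (V u).1) 0 := by
    have := ((hasDerivAt_id (0 : ℝ)).mul_const ((V u).1 ⬝ᵥ (V u).1)).const_add ((x u).1 ⬝ᵥ (V u).1)
    refine (this.congr_of_eventuallyEq (Filter.Eventually.of_forall fun t => ?_)).congr_deriv (by simp)
    simp [add_dotProduct, smul_dotProduct]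
  have hp := smNorm_pos (x := x) (u := u) hκ
  have h0 : smNorm κ (x + (0 : ℝ) • V) u = smNorm κ x u := by simp
  have h2 := (((hasDerivAt_smNorm (V := V) (x := x) (u := u) hκ).inv (by rw [h0]; exact hp.ne')).mul h1).add_const (V u).2
  refine h2.congr_deriv ?_
  simp [smD2]
  field_simp
  ring

lemma continuous_smNorm (κ : ℝ) (u : U) : Continuous fun x : U → (ι → ℝ) × ℝ => smNorm κ x u := by
  unfold smNorm dotProduct
  fun_prop

lemma continuous_inv_smNorm (hκ : 0 < κ) (u : U) : Continuous fun x : U → (ι → ℝ) × ℝ => (smNorm κ x u)⁻¹ :=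
  (continuous_smNorm κ u).inv₀ fun _ => (smNorm_pos hκ).ne'

lemma continuous_smExp (κ β τ : ℝ) (u : U) : Continuous fun x : U → (ι → ℝ) × ℝ => smExp κ β τ x u := by
  unfold smExp
  have := continuous_smNorm (ι := ι) κ u
  fun_prop

lemma continuous_smD1 (hκ : 0 < κ) (u : U) : Continuous fun x : U → (ι → ℝ) × ℝ => smD1 κ V x u := by
  unfold smD1 dotProduct
  exact ((continuous_inv_smNorm hκ u).mul (by fun_prop)).add_const _

lemma continuous_smD2 (hκ : 0 < κ) (u : U) : Continuous fun x : U → (ι → ℝ) × ℝ => smD2 κ V x u := by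
  unfold smD2 dotProduct
  exact ((continuous_inv_smNorm hκ u).mul (by fun_prop)).sub (((continuous_inv_smNorm hκ u).pow 3).mul (by fun_prop))

lemma abs_smD1_le (hκ : 0 < κ) : |smD1 κ V x u| ≤ √((V u).1 ⬝ᵥ (V u).1) + |(V u).2| := by
  have hp := smNorm_pos (x := x) (u := u) hκ
  have h1 : √((x u).1 ⬝ᵥ (x u).1) ≤ smNorm κ x u := Real.sqrt_le_sqrt (by nlinarith)
  have h2 := abs_dot_le_sqrt (x u).1 (V u).1
  rw [smD1]
  refine (abs_add_le _ _).trans (add_le_add ?_ le_rfl)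
  rw [abs_mul, abs_of_pos (inv_pos.2 hp), inv_mul_le_iff₀ hp]
  exact h2.trans (mul_le_mul_of_nonneg_right h1 (Real.sqrt_nonneg _))

lemma abs_smD2_le (hκ : 0 < κ) : |smD2 κ V x u| ≤ κ⁻¹ * ((V u).1 ⬝ᵥ (V u).1) := by
  have hp := smNorm_pos (x := x) (u := u) hκ
  have hn : κ ≤ smNorm κ x u := Real.le_sqrt_of_sq_le (by have := ss_nonneg (x u).1; linarith)
  have h2 := dot_sq_le (x u).1 (V u).1
  have h3 : (x u).1 ⬝ᵥ (x u).1 ≤ smNorm κ x u ^ 2 := by rw [smNorm_sq]; nlinarith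
  have hv := ss_nonneg (V u).1
  have h4 : (smNorm κ x u)⁻¹ ^ 3 * ((x u).1 ⬝ᵥ (V u).1) ^ 2 ≤ (smNorm κ x u)⁻¹ * ((V u).1 ⬝ᵥ (V u).1) := by
    calc _ ≤ (smNorm κ x u)⁻¹ ^ 3 * (smNorm κ x u ^ 2 * ((V u).1 ⬝ᵥ (V u).1)) := by
          gcongr
          exact h2.trans (mul_le_mul_of_nonneg_right h3 hv)
      _ = _ := by field_simp
  have h5 : (smNorm κ x u)⁻¹ * ((V u).1 ⬝ᵥ (V u).1) ≤ κ⁻¹ * ((V u).1 ⬝ᵥ (V u).1) := by gcongr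
  have h6 : 0 ≤ (smNorm κ x u)⁻¹ ^ 3 * ((x u).1 ⬝ᵥ (V u).1) ^ 2 := by positivity
  rw [smD2, abs_of_nonneg (by linarith)]
  linarith

lemma mul_exp_neg_le_one (s : ℝ) : s * Real.exp (-s) ≤ 1 := by
  rw [Real.exp_neg, ← div_eq_mul_inv, div_le_one (Real.exp_pos _)]
  linarith [Real.add_one_le_exp s]

lemma sq_mul_exp_neg_le (s : ℝ) (hs : 0 ≤ s) : s ^ 2 * Real.exp (-s) ≤ 4 := by
  have h := mul_exp_neg_le_one (s / 2)
  have h2 : Real.exp (-s) = Real.exp (-(s / 2)) ^ 2 := by rw [← Real.exp_nat_mul]; congr 1; push_cast; ring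
  have h3 : 0 ≤ s / 2 * Real.exp (-(s / 2)) := by positivity
  rw [h2]
  nlinarith

variable [Fintype U]

lemma hasLineDerivAt_smVal (hκ : 0 < κ) : HasLineDerivAt ℝ (smVal κ β τ) (smG κ β τ V x) x V := by
  unfold HasLineDerivAt
  have h := (HasDerivAt.fun_sum (u := Finset.univ) fun u _ =>
    hasDerivAt_smExp (β := β) (τ := τ) (V := V) (x := x) (u := u) hκ).neg.exp
  refine h.congr_deriv ?_
  simp [smG, smVal]

lemma hasLineDerivAt_smG (hκ : 0 < κ) : HasLineDerivAt ℝ (smG κ β τ V) (smH κ β τ V x) x V := by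
  have h0 := hasLineDerivAt_smVal (β := β) (τ := τ) (V := V) (x := x) hκ
  unfold HasLineDerivAt at h0 ⊢
  have h := h0.mul (HasDerivAt.fun_sum (u := Finset.univ) fun u _ =>
    ((hasDerivAt_smExp (β := β) (τ := τ) (V := V) (x := x) (u := u) hκ).const_mul β).mul
      (hasDerivAt_smD1 (V := V) (x := x) (u := u) hκ))
  refine h.congr_deriv ?_
  simp only [zero_smul, add_zero, Pi.mul_apply]
  rw [smH, smG, mul_add, sq, ← mul_assoc]
  congr 2
  refine Finset.sum_congr rfl fun u _ => ?_
  ring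

lemma continuous_smVal (κ β τ : ℝ) : Continuous (smVal (ι := ι) (U := U) κ β τ) := by
  unfold smVal
  have := continuous_smExp (ι := ι) (U := U) κ β τ
  fun_prop

lemma continuous_smG (hκ : 0 < κ) : Continuous (smG κ β τ V) := by
  unfold smG
  have h1 := continuous_smVal (ι := ι) (U := U) κ β τ
  have h2 := continuous_smExp (ι := ι) (U := U) κ β τ
  have h3 := fun u => continuous_smD1 (V := V) hκ u
  fun_prop

lemma continuous_smH (hκ : 0 < κ) : Continuous (smH κ β τ V) := by
  unfold smH
  have h1 := continuous_smVal (ι := ι) (U := U) κ β τ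
  have h2 := continuous_smExp (ι := ι) (U := U) κ β τ
  have h3 := fun u => continuous_smD1 (V := V) hκ u
  have h4 := fun u => continuous_smD2 (V := V) hκ u
  fun_prop

lemma differentiable_smVal (hκ : 0 < κ) : Differentiable ℝ (smVal (ι := ι) (U := U) κ β τ) := by
  have h1 : ∀ u, Differentiable ℝ fun x : U → (ι → ℝ) × ℝ => smNorm κ x u := by
    intro u
    refine Differentiable.sqrt ?_ fun x => ?_
    · unfold dotProduct
      fun_prop
    · have := ss_nonneg (x u).1
      positivity
  unfold smVal smExp
  fun_prop

lemma smVal_mem (κ β τ : ℝ) (x : U → (ι → ℝ) × ℝ) : |smVal κ β τ x| ≤ 1 := by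
  rw [smVal, abs_of_pos (Real.exp_pos _), Real.exp_le_one_iff, neg_nonpos]
  exact Finset.sum_nonneg fun u _ => (Real.exp_pos _).le

lemma exists_bound_smG_smH (hκ : 0 < κ) (hβ : 0 ≤ β) (V : U → (ι → ℝ) × ℝ) (τ : ℝ) :
    ∃ C, 0 ≤ C ∧ ∀ x, |smG κ β τ V x| ≤ C ∧ |smH κ β τ V x| ≤ C := by
  set B₁ : ℝ := ∑ u, (√((V u).1 ⬝ᵥ (V u).1) + |(V u).2|) with hB₁
  set B₂ : ℝ := ∑ u, κ⁻¹ * ((V u).1 ⬝ᵥ (V u).1) with hB₂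
  have hB₁0 : 0 ≤ B₁ := Finset.sum_nonneg fun u _ => by positivity
  have hB₂0 : 0 ≤ B₂ := Finset.sum_nonneg fun u _ => by have := ss_nonneg (V u).1; positivity
  have b1 : ∀ x u, |smD1 κ V x u| ≤ B₁ := fun x u => (abs_smD1_le hκ).trans
    (Finset.single_le_sum (f := fun u => √((V u).1 ⬝ᵥ (V u).1) + |(V u).2|) (fun u _ => by positivity)
      (Finset.mem_univ u))
  have b2 : ∀ x u, |smD2 κ V x u| ≤ B₂ := fun x u => (abs_smD2_le hκ).trans
    (Finset.single_le_sum (f := fun u => κ⁻¹ * ((V u).1 ⬝ᵥ (V u).1))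
      (fun u _ => by have := ss_nonneg (V u).1; positivity) (Finset.mem_univ u))
  have hsum : ∀ (x : U → (ι → ℝ) × ℝ) (f : U → ℝ) (B : ℝ), (∀ u, |f u| ≤ B) →
      |∑ u, β * smExp κ β τ x u * f u| ≤ β * B * ∑ u, smExp κ β τ x u := by
    intro x f B hf
    refine (Finset.abs_sum_le_sum_abs _ _).trans ?_
    rw [Finset.mul_sum]
    refine Finset.sum_le_sum fun u _ => ?_
    have he : 0 ≤ smExp κ β τ x u := (Real.exp_pos _).le
    rw [abs_mul, abs_of_nonneg (by positivity)]
    have := mul_le_mul_of_nonneg_left (hf u) (mul_nonneg hβ he)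
    linarith
  refine ⟨β * B₁ + 4 * (β * B₁) ^ 2 + β * (B₂ + β * B₁ ^ 2), by positivity, fun x => ?_⟩
  set s := ∑ u, smExp κ β τ x u with hs
  have hs0 : 0 ≤ s := Finset.sum_nonneg fun u _ => (Real.exp_pos _).le
  have e1 := mul_exp_neg_le_one s
  have e2 := sq_mul_exp_neg_le s hs0
  have a1 := hsum x _ _ (b1 x)
  have a2 := hsum x (fun u => smD2 κ V x u - β * smD1 κ V x u ^ 2) (B₂ + β * B₁ ^ 2) (fun u => by
    refine (abs_sub _ _).trans (add_le_add (b2 x u) ?_)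
    rw [abs_mul, abs_of_nonneg hβ, abs_pow]
    have := b1 x u
    gcongr)
  rw [← hs] at a1 a2
  have hex : smVal κ β τ x = Real.exp (-s) := rfl
  have hpos := Real.exp_pos (-s)
  have h1 : |smG κ β τ V x| ≤ β * B₁ := by
    rw [smG, abs_mul, hex, abs_of_pos hpos]
    calc _ ≤ Real.exp (-s) * (β * B₁ * s) := by gcongr
      _ = β * B₁ * (s * Real.exp (-s)) := by ring
      _ ≤ β * B₁ * 1 := by gcongr
      _ = _ := mul_one _
  refine ⟨h1.trans (le_add_of_le_of_nonneg (le_add_of_nonneg_right (by positivity)) (by positivity)), ?_⟩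
  rw [smH, abs_mul, hex, abs_of_pos hpos]
  calc _ ≤ Real.exp (-s) * ((β * B₁ * s) ^ 2 + β * (B₂ + β * B₁ ^ 2) * s) := by
        gcongr
        refine (abs_add_le _ _).trans (add_le_add ?_ a2)
        rw [abs_pow]
        gcongr
    _ = (β * B₁) ^ 2 * (s ^ 2 * Real.exp (-s)) + β * (B₂ + β * B₁ ^ 2) * (s * Real.exp (-s)) := by ring
    _ ≤ (β * B₁) ^ 2 * 4 + β * (B₂ + β * B₁ ^ 2) * 1 := by gcongr
    _ ≤ _ := by nlinarith [mul_nonneg hβ hB₁0]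

end SoftMin

end Lasso

namespace Lasso

lemma sum_sq_weighted {U α : Type*} [Fintype α] [Fintype U] (w : U → ℝ) (f : U → α → ℝ) :
    ∑ i, (∑ u, w u * f u i) ^ 2 = ∑ u, ∑ u', w u * w u' * (f u ⬝ᵥ f u') := by
  have h : ∀ i, (∑ u, w u * f u i) ^ 2 = ∑ u, ∑ u', (w u * f u i) * (w u' * f u' i) := fun i => by
    rw [sq, Finset.sum_mul_sum]
  simp only [h, dotProduct, Finset.mul_sum]
  rw [Finset.sum_comm]
  refine Finset.sum_congr rfl fun u _ => ?_
  rw [Finset.sum_comm]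
  refine Finset.sum_congr rfl fun u' _ => Finset.sum_congr rfl fun i _ => ?_
  ring

section Gordon

variable {ι ν U : Type*} [Fintype ι] [Fintype ν] [Fintype U]

lemma dot_le_one {α : Type*} [Fintype α] {x y : α → ℝ} (hx : x ⬝ᵥ x ≤ 1) (hy : y ⬝ᵥ y ≤ 1) : x ⬝ᵥ y ≤ 1 := by
  have := dot_sq_le x y
  have h : (x ⬝ᵥ x) * (y ⬝ᵥ y) ≤ 1 := mul_le_one₀ hx (ss_nonneg y) hy
  nlinarith

/-- Covariance comparison behind Gordon's inequality. -/
lemma gordon_kernel_nonneg (w : U → ℝ) (hw : ∀ u, 0 ≤ w u) (b : U → ι → ℝ) (v : U → ν → ℝ)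
    (hb : ∀ u, b u ⬝ᵥ b u ≤ 1) (hv : ∀ u, v u ⬝ᵥ v u ≤ 1) :
    ∑ i, (∑ u, w u * b u i) ^ 2 + ∑ j, (∑ u, w u * v u j) ^ 2 ≤
      ∑ p : ι × ν, (∑ u, w u * (b u p.1 * v u p.2)) ^ 2 + (∑ u, w u) ^ 2 := by
  have h1 := sum_sq_weighted w b
  have h2 := sum_sq_weighted w v
  have h3 := sum_sq_weighted w fun u (p : ι × ν) => b u p.1 * v u p.2
  have h4 : ∀ u u', (fun p : ι × ν => b u p.1 * v u p.2) ⬝ᵥ (fun p => b u' p.1 * v u' p.2) =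
      (b u ⬝ᵥ b u') * (v u ⬝ᵥ v u') := by
    intro u u'
    simp only [dotProduct, Fintype.sum_prod_type, Finset.sum_mul_sum]
    refine Finset.sum_congr rfl fun i _ => Finset.sum_congr rfl fun j _ => by ring
  have h5 : (∑ u, w u) ^ 2 = ∑ u, ∑ u', w u * w u' := by rw [sq, Finset.sum_mul_sum]
  simp only [h4] at h3
  rw [h1, h2, h3, h5, ← sub_nonneg]
  simp only [← Finset.sum_add_distrib, ← Finset.sum_sub_distrib]
  refine Finset.sum_nonneg fun u _ => Finset.sum_nonneg fun u' _ => ?_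
  have e1 := dot_le_one (hb u) (hb u')
  have e2 := dot_le_one (hv u) (hv u')
  have e3 := mul_nonneg (mul_nonneg (hw u) (hw u')) (mul_nonneg (sub_nonneg.2 e1) (sub_nonneg.2 e2))
  linarith

/-- Directions of the two Gaussian processes compared in Gordon's inequality. -/
def gordonV [DecidableEq ι] (v : U → ν → ℝ) : ((ι × ν) ⊕ Unit) ⊕ (ι ⊕ ν) → U → (ι → ℝ) × ℝ :=
  Sum.elim (Sum.elim (fun p u => (Pi.single p.1 (v u p.2), 0)) fun _ _ => (0, 1))
    (Sum.elim (fun i _ => (Pi.single i 1, 0)) fun j u => (0, v u j))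

lemma gordon_soft {κ β τ : ℝ} (hκ : 0 < κ) (hβ : 0 ≤ β) (v : U → ν → ℝ) (hv : ∀ u, v u ⬝ᵥ v u = 1) :
    ∫ ω, smVal κ β τ (fun u => ((fun i => ω (Sum.inr (Sum.inl i))),
        ∑ j, ω (Sum.inr (Sum.inr j)) * v u j)) ∂stdGauss (((ι × ν) ⊕ Unit) ⊕ (ι ⊕ ν)) ≤
      ∫ ω, smVal κ β τ (fun u => ((fun i => ∑ j, ω (Sum.inl (Sum.inl (i, j))) * v u j),
        ω (Sum.inl (Sum.inr ())))) ∂stdGauss (((ι × ν) ⊕ Unit) ⊕ (ι ⊕ ν)) := by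
  classical
  choose C hC0 hC using fun p => exists_bound_smG_smH hκ hβ (gordonV v p : U → (ι → ℝ) × ℝ) τ
  have hCle : ∀ p, C p ≤ 1 + ∑ q, C q := fun p => by
    have := Finset.single_le_sum (f := C) (fun q _ => hC0 q) (Finset.mem_univ p)
    linarith
  have hsum0 : 0 ≤ ∑ q, C q := Finset.sum_nonneg fun q _ => hC0 q
  have key := gaussian_interpolation (Φ := smVal κ β τ) (V := gordonV (ι := ι) v)
    (G := fun p => smG κ β τ (gordonV v p)) (H := fun p => smH κ β τ (gordonV v p)) (C := 1 + ∑ q, C q)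
    (differentiable_smVal hκ) (fun x => (smVal_mem κ β τ x).trans (by linarith))
    (fun p x => hasLineDerivAt_smVal hκ) (fun p => continuous_smG hκ) (fun p x => (hC p x).1.trans (hCle p))
    (fun p x => hasLineDerivAt_smG hκ) (fun p => continuous_smH hκ) (fun p x => (hC p x).2.trans (hCle p)) ?_
  · convert key using 1
    · refine integral_congr_ae (Filter.Eventually.of_forall fun ω => ?_)
      refine congrArg (smVal κ β τ) (funext fun u => ?_)
      simp only [Fintype.sum_sum_type, gordonV, Sum.elim_inr, Sum.elim_inl]
      ext i
      · simp [Finset.sum_apply, Prod.fst_sum, Pi.single_apply]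
      · simp [Finset.sum_apply, Prod.snd_sum]
    · refine integral_congr_ae (Filter.Eventually.of_forall fun ω => ?_)
      refine congrArg (smVal κ β τ) (funext fun u => ?_)
      simp only [Fintype.sum_sum_type, gordonV, Sum.elim_inr, Sum.elim_inl]
      ext i
      · simp [Finset.sum_apply, Prod.fst_sum, Pi.single_apply, Fintype.sum_prod_type]
      · simp [Finset.sum_apply, Prod.snd_sum]
  · intro x
    set b : U → ι → ℝ := fun u i => (smNorm κ x u)⁻¹ * (x u).1 i with hb
    set w : U → ℝ := fun u => β * smExp κ β τ x u with hw
    have hp : ∀ u, 0 < smNorm κ x u := fun u => smNorm_pos hκ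
    have hb1 : ∀ u, b u ⬝ᵥ b u ≤ 1 := by
      intro u
      have h1 : b u ⬝ᵥ b u = (smNorm κ x u ^ 2)⁻¹ * ((x u).1 ⬝ᵥ (x u).1) := by
        simp only [hb, dotProduct, Finset.mul_sum]
        refine Finset.sum_congr rfl fun i _ => ?_
        field_simp
      rw [h1, inv_mul_le_iff₀ (by have := hp u; positivity), smNorm_sq]
      nlinarith
    have hker := gordon_kernel_nonneg w (fun u => mul_nonneg hβ (Real.exp_pos _).le) b v hb1 fun u => (hv u).le
    have d1 : ∀ p u, smD1 κ (gordonV v (Sum.inl (Sum.inl p))) x u = b u p.1 * v u p.2 := by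
      intro p u; simp [smD1, gordonV, hb, mul_assoc]
    have d1' : ∀ p u, smD1 κ (gordonV v (Sum.inl (Sum.inr p))) x u = 1 := by
      intro p u; simp [smD1, gordonV]
    have d2 : ∀ p u, smD1 κ (gordonV v (Sum.inr (Sum.inl p))) x u = b u p := by
      intro p u; simp [smD1, gordonV, hb]
    have d2' : ∀ p u, smD1 κ (gordonV (ι := ι) v (Sum.inr (Sum.inr p))) x u = v u p := by
      intro p u; simp [smD1, gordonV]
    have s1 : ∀ p u, smD2 κ (gordonV v (Sum.inl (Sum.inl p))) x u =
        ((smNorm κ x u)⁻¹ - (smNorm κ x u)⁻¹ * b u p.1 ^ 2) * v u p.2 ^ 2 := by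
      intro p u; simp [smD2, gordonV, hb]; ring
    have s1' : ∀ p u, smD2 κ (gordonV v (Sum.inl (Sum.inr p))) x u = 0 := by
      intro p u; simp [smD2, gordonV]
    have s2 : ∀ p u, smD2 κ (gordonV v (Sum.inr (Sum.inl p))) x u =
        (smNorm κ x u)⁻¹ - (smNorm κ x u)⁻¹ * b u p ^ 2 := by
      intro p u; simp [smD2, gordonV, hb]; ring
    have s2' : ∀ p u, smD2 κ (gordonV (ι := ι) v (Sum.inr (Sum.inr p))) x u = 0 := by
      intro p u; simp [smD2, gordonV]
    simp only [smH, ← Finset.mul_sum, ← mul_sub]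
    refine mul_nonneg (Real.exp_pos _).le ?_
    simp only [Fintype.sum_sum_type, Finset.sum_add_distrib, d1, d1', d2, d2', s1, s1', s2, s2']
    simp only [Finset.univ_unique, Finset.sum_singleton]
    have hsingle : ∑ p : ι × ν, ∑ u, β * smExp κ β τ x u * (((smNorm κ x u)⁻¹ - (smNorm κ x u)⁻¹ * b u p.1 ^ 2) * v u p.2 ^ 2 -
        β * (b u p.1 * v u p.2) ^ 2) + ∑ u, β * smExp κ β τ x u * (0 - β * 1 ^ 2) =
        ∑ i, ∑ u, β * smExp κ β τ x u * ((smNorm κ x u)⁻¹ - (smNorm κ x u)⁻¹ * b u i ^ 2 - β * b u i ^ 2) +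
        ∑ j, ∑ u, β * smExp κ β τ x u * (0 - β * v u j ^ 2) := by
      rw [Finset.sum_comm, Finset.sum_comm (γ := ι), Finset.sum_comm (γ := ν), ← Finset.sum_add_distrib,
        ← Finset.sum_add_distrib]
      refine Finset.sum_congr rfl fun u _ => ?_
      simp only [← Finset.mul_sum]
      rw [← mul_add, ← mul_add]
      congr 1
      have hvu : ∑ j, v u j ^ 2 = 1 := by rw [← hv u]; simp [dotProduct, sq]
      have e1 : ∀ p : ι × ν, ((smNorm κ x u)⁻¹ - (smNorm κ x u)⁻¹ * b u p.1 ^ 2) * v u p.2 ^ 2 -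
        β * (b u p.1 * v u p.2) ^ 2 = ((smNorm κ x u)⁻¹ - (smNorm κ x u)⁻¹ * b u p.1 ^ 2 - β * b u p.1 ^ 2) * v u p.2 ^ 2 := by
        intro p; ring
      simp only [e1, Fintype.sum_prod_type, ← Finset.mul_sum, hvu, mul_one]
      simp only [zero_sub, Finset.sum_neg_distrib, ← Finset.mul_sum, hvu, mul_one]
      ring
    simp only [← hw] at *
    simp only [mul_one] at *
    linarith

end Gordon

end Lasso

namespace Lasso

section Marginals

variable {P Q : Type*} [Fintype P] [Fintype Q]

lemma measurePreserving_inl : MeasurePreserving (fun (ω : P ⊕ Q → ℝ) (p : P) => ω (Sum.inl p))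
    (stdGauss (P ⊕ Q)) (stdGauss P) := by
  have h := measurePreserving_sumPiEquivProdPi (ι := P) (ι' := Q) fun _ => gaussianReal 0 1
  exact (measurePreserving_fst (μ := stdGauss P) (ν := stdGauss Q)).comp h

lemma measurePreserving_inr : MeasurePreserving (fun (ω : P ⊕ Q → ℝ) (p : Q) => ω (Sum.inr p))
    (stdGauss (P ⊕ Q)) (stdGauss Q) := by
  have h := measurePreserving_sumPiEquivProdPi (ι := P) (ι' := Q) fun _ => gaussianReal 0 1
  exact (measurePreserving_snd (μ := stdGauss P) (ν := stdGauss Q)).comp h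

lemma measurePreserving_uncurry (μ : Measure ℝ) [IsProbabilityMeasure μ] :
    MeasurePreserving (fun (X : P → Q → ℝ) (p : P × Q) => X p.1 p.2)
      (Measure.pi fun _ : P => Measure.pi fun _ : Q => μ) (Measure.pi fun _ : P × Q => μ) := by
  refine ⟨by fun_prop, (Measure.pi_eq fun s hs => ?_).symm⟩
  rw [Measure.map_apply (by fun_prop) (MeasurableSet.univ_pi hs)]
  have h : (fun (X : P → Q → ℝ) (p : P × Q) => X p.1 p.2) ⁻¹' Set.univ.pi s =
      Set.univ.pi fun i => Set.univ.pi fun j => s (i, j) := by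
    ext X; simp [Set.mem_pi]
  rw [h, Measure.pi_pi]
  simp only [Measure.pi_pi, Fintype.prod_prod_type]

lemma measurePreserving_design {n N : ℕ} (hn : 0 < n) :
    MeasurePreserving (fun (X : Fin n → Fin N → ℝ) (p : Fin n × Fin N) => √n * X p.1 p.2)
      (PX n N) (stdGauss (Fin n × Fin N)) := by
  have h1 := measurePreserving_uncurry (P := Fin n) (Q := Fin N) (gaussianReal 0 (n : ℝ≥0)⁻¹)
  have h2 : MeasurePreserving (fun x : ℝ => √n * x) (gaussianReal 0 (n : ℝ≥0)⁻¹) (gaussianReal 0 1) := by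
    refine ⟨by fun_prop, ?_⟩
    rw [gaussianReal_map_const_mul, mul_zero]
    congr 1
    ext
    have hn' : (n : ℝ) ≠ 0 := by positivity
    simp [hn']
  exact (measurePreserving_pi _ _ fun _ : Fin n × Fin N => h2).comp h1

end Marginals

section GordonProb

variable {ι ν U : Type*} [Fintype ι] [Fintype ν]

lemma gordon_finite [Fintype U] (v : U → ν → ℝ) (hv : ∀ u, v u ⬝ᵥ v u = 1) (τ : ℝ) :
    stdGauss (((ι × ν) ⊕ Unit) ⊕ (ι ⊕ ν)) {ω | ∀ u, τ + 1 ≤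
        √((fun i => ω (Sum.inr (Sum.inl i))) ⬝ᵥ fun i => ω (Sum.inr (Sum.inl i))) +
          ∑ j, ω (Sum.inr (Sum.inr j)) * v u j} ≤
      stdGauss (((ι × ν) ⊕ Unit) ⊕ (ι ⊕ ν)) {ω | ∀ u, τ - 2 ≤
        √((fun i => ∑ j, ω (Sum.inl (Sum.inl (i, j))) * v u j) ⬝ᵥ
          fun i => ∑ j, ω (Sum.inl (Sum.inl (i, j))) * v u j) + ω (Sum.inl (Sum.inr ()))} := by
  set π := stdGauss (((ι × ν) ⊕ Unit) ⊕ (ι ⊕ ν)) with hπ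
  set x : (((ι × ν) ⊕ Unit) ⊕ (ι ⊕ ν) → ℝ) → U → (ι → ℝ) × ℝ := fun ω u =>
    ((fun i => ω (Sum.inr (Sum.inl i))), ∑ j, ω (Sum.inr (Sum.inr j)) * v u j) with hx
  set y : (((ι × ν) ⊕ Unit) ⊕ (ι ⊕ ν) → ℝ) → U → (ι → ℝ) × ℝ := fun ω u =>
    ((fun i => ∑ j, ω (Sum.inl (Sum.inl (i, j))) * v u j), ω (Sum.inl (Sum.inr ()))) with hy
  have hxc : Continuous x := by simp only [hx]; fun_prop
  have hyc : Continuous y := by simp only [hy]; fun_prop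
  set B := {ω | ∀ u, τ + 1 ≤ √((x ω u).1 ⬝ᵥ (x ω u).1) + (x ω u).2} with hB
  set A := {ω | ∀ u, τ - 2 ≤ √((y ω u).1 ⬝ᵥ (y ω u).1) + (y ω u).2} with hA
  change π B ≤ π A
  have hBm : MeasurableSet B := by
    have : B = ⋂ u, {ω | τ + 1 ≤ √((x ω u).1 ⬝ᵥ (x ω u).1) + (x ω u).2} := by ext; simp [hB]
    rw [this]
    refine MeasurableSet.iInter fun u => (isClosed_le continuous_const ?_).measurableSet
    simp only [dotProduct]; fun_prop
  have hAm : MeasurableSet A := by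
    have : A = ⋂ u, {ω | τ - 2 ≤ √((y ω u).1 ⬝ᵥ (y ω u).1) + (y ω u).2} := by ext; simp [hA]
    rw [this]
    refine MeasurableSet.iInter fun u => (isClosed_le continuous_const ?_).measurableSet
    simp only [dotProduct]; fun_prop
  have hint : ∀ β, ∀ {w : (((ι × ν) ⊕ Unit) ⊕ (ι ⊕ ν) → ℝ) → U → (ι → ℝ) × ℝ}, Continuous w →
      Integrable (fun ω => smVal 1 β τ (w ω)) π := fun β w hw =>
    integrable_of_bdd ((continuous_smVal 1 β τ).comp hw).aestronglyMeasurable fun ω => smVal_mem 1 β τ _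
  have step : ∀ β : ℝ, 0 ≤ β → π.real B * Real.exp (-(Fintype.card U * Real.exp (-β))) ≤
      π.real A + Real.exp (-Real.exp β) := by
    intro β hβ
    have h0 : ∫ ω, smVal 1 β τ (x ω) ∂π ≤ ∫ ω, smVal 1 β τ (y ω) ∂π := gordon_soft one_pos hβ v hv
    have h1 : π.real B * Real.exp (-(Fintype.card U * Real.exp (-β))) ≤ ∫ ω, smVal 1 β τ (x ω) ∂π := by
      rw [← smul_eq_mul, ← integral_indicator_const _ hBm]
      refine integral_mono ((integrable_const _).indicator hBm) (hint β hxc) fun ω => ?_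
      by_cases hω : ω ∈ B
      · rw [Set.indicator_of_mem hω, smVal]
        refine Real.exp_le_exp.2 (neg_le_neg ?_)
        calc ∑ u, smExp 1 β τ (x ω) u ≤ ∑ _u : U, Real.exp (-β) := by
              refine Finset.sum_le_sum fun u _ => Real.exp_le_exp.2 (neg_le_neg ?_)
              have h2 := hω u
              have h3 : √((x ω u).1 ⬝ᵥ (x ω u).1) ≤ smNorm 1 (x ω) u := Real.sqrt_le_sqrt (by linarith)
              nlinarith
          _ = _ := by simp
      · rw [Set.indicator_of_notMem hω]
        exact (Real.exp_pos _).le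
    have h2 : ∫ ω, smVal 1 β τ (y ω) ∂π ≤ π.real A + Real.exp (-Real.exp β) := by
      have e : π.real A + Real.exp (-Real.exp β) = ∫ ω, (A.indicator (fun _ => (1 : ℝ)) ω + Real.exp (-Real.exp β)) ∂π := by
        rw [integral_add ((integrable_const _).indicator hAm) (integrable_const _), integral_indicator_const _ hAm]
        simp
      rw [e]
      refine integral_mono (hint β hyc) (((integrable_const _).indicator hAm).add (integrable_const _)) fun ω => ?_
      by_cases hω : ω ∈ A
      · simp only [Set.indicator_of_mem hω]
        have := (abs_le.1 (smVal_mem 1 β τ (y ω))).2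
        have := Real.exp_pos (-Real.exp β)
        linarith
      · simp only [Set.indicator_of_notMem hω, zero_add]
        simp only [hA, Set.mem_ofPred_eq, not_forall, not_le] at hω
        obtain ⟨u, hu⟩ := hω
        rw [smVal]
        refine Real.exp_le_exp.2 (neg_le_neg ?_)
        refine le_trans ?_ (Finset.single_le_sum (f := smExp 1 β τ (y ω)) (fun u _ => (Real.exp_pos _).le) (Finset.mem_univ u))
        refine Real.exp_le_exp.2 ?_
        have h3 : smNorm 1 (y ω) u ≤ 1 + √((y ω u).1 ⬝ᵥ (y ω u).1) := by
          have h4 := ss_nonneg (y ω u).1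
          refine Real.sqrt_le_iff.2 ⟨by positivity, ?_⟩
          nlinarith [Real.sq_sqrt h4, Real.sqrt_nonneg ((y ω u).1 ⬝ᵥ (y ω u).1)]
        nlinarith
    exact h1.trans (h0.trans h2)
  have hlim1 : Filter.Tendsto (fun β : ℝ => π.real B * Real.exp (-(Fintype.card U * Real.exp (-β)))) Filter.atTop
      (nhds (π.real B * Real.exp (-(Fintype.card U * 0)))) := by
    refine Filter.Tendsto.const_mul _ ((Real.continuous_exp.tendsto _).comp (Filter.Tendsto.neg (Filter.Tendsto.const_mul _ ?_)))
    exact Real.tendsto_exp_neg_atTop_nhds_zero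
  have hlim2 : Filter.Tendsto (fun β : ℝ => π.real A + Real.exp (-Real.exp β)) Filter.atTop (nhds (π.real A + 0)) := by
    refine Filter.Tendsto.const_add _ ?_
    exact Real.tendsto_exp_neg_atTop_nhds_zero.comp Real.tendsto_exp_atTop
  have hfin := le_of_tendsto_of_tendsto hlim1 hlim2 (Filter.eventually_atTop.2 ⟨0, step⟩)
  simp only [mul_zero, neg_zero, Real.exp_zero, mul_one, add_zero] at hfin
  exact (ENNReal.toReal_le_toReal (measure_ne_top _ _) (measure_ne_top _ _)).1 hfin

lemma gordon {K : Set (ν → ℝ)} (hK : ∀ v ∈ K, v ⬝ᵥ v = 1) (τ : ℝ) :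
    stdGauss (((ι × ν) ⊕ Unit) ⊕ (ι ⊕ ν)) {ω | ∀ v ∈ K, τ + 1 ≤
        √((fun i => ω (Sum.inr (Sum.inl i))) ⬝ᵥ fun i => ω (Sum.inr (Sum.inl i))) +
          ∑ j, ω (Sum.inr (Sum.inr j)) * v j} ≤
      stdGauss (((ι × ν) ⊕ Unit) ⊕ (ι ⊕ ν)) {ω | ∀ v ∈ K, τ - 2 ≤
        √((fun i => ∑ j, ω (Sum.inl (Sum.inl (i, j))) * v j) ⬝ᵥ
          fun i => ∑ j, ω (Sum.inl (Sum.inl (i, j))) * v j) + ω (Sum.inl (Sum.inr ()))} := by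
  rcases K.eq_empty_or_nonempty with rfl | hne
  · simp
  have : Nonempty K := hne.to_subtype
  set π := stdGauss (((ι × ν) ⊕ Unit) ⊕ (ι ⊕ ν)) with hπ
  set d : ℕ → K := TopologicalSpace.denseSeq K with hd
  set F : (((ι × ν) ⊕ Unit) ⊕ (ι ⊕ ν) → ℝ) → (ν → ℝ) → ℝ := fun ω v =>
    √((fun i => ∑ j, ω (Sum.inl (Sum.inl (i, j))) * v j) ⬝ᵥ
          fun i => ∑ j, ω (Sum.inl (Sum.inl (i, j))) * v j) + ω (Sum.inl (Sum.inr ())) with hF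
  set S : ℕ → Set (((ι × ν) ⊕ Unit) ⊕ (ι ⊕ ν) → ℝ) := fun m => {ω | ∀ k < m, τ - 2 ≤ F ω (d k)} with hS
  have hSm : ∀ m, MeasurableSet (S m) := by
    intro m
    have : S m = ⋂ k, ⋂ (_ : k < m), {ω | τ - 2 ≤ F ω (d k)} := by ext; simp [hS]
    rw [this]
    refine MeasurableSet.iInter fun k => MeasurableSet.iInter fun _ => (isClosed_le continuous_const ?_).measurableSet
    simp only [hF, dotProduct]; fun_prop
  have hanti : Antitone S := fun a b hab ω hω k hk => hω k (hk.trans_le hab)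
  have hInter : ⋂ m, S m ⊆ {ω | ∀ v ∈ K, τ - 2 ≤ F ω v} := by
    intro ω hω v hv
    rw [Set.mem_iInter] at hω
    have hcl : IsClosed {v : K | τ - 2 ≤ F ω v} := by
      have hFc : Continuous (F ω) := by simp only [hF, dotProduct]; fun_prop
      exact isClosed_le continuous_const (hFc.comp continuous_subtype_val)
    have hsub : Set.range d ⊆ {v : K | τ - 2 ≤ F ω v} := by
      rintro _ ⟨k, rfl⟩
      exact hω (k + 1) k (Nat.lt_succ_self k)
    have := closure_minimal hsub hcl
    rw [(TopologicalSpace.denseRange_denseSeq K).closure_range] at this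
    exact this (Set.mem_univ (⟨v, hv⟩ : K))
  have hlim := tendsto_measure_iInter_atTop (μ := π) (fun m => (hSm m).nullMeasurableSet) hanti ⟨0, measure_ne_top _ _⟩
  refine le_trans ?_ (measure_mono hInter)
  refine ge_of_tendsto hlim (Filter.Eventually.of_forall fun m => ?_)
  have h := gordon_finite (ι := ι) (fun k : Fin m => (d k : ν → ℝ)) (fun k => hK _ (d k).2) τ
  refine (measure_mono ?_).trans (h.trans (measure_mono (t := S m) fun ω hω k hk => hω ⟨k, hk⟩))
  exact fun ω hω k => hω _ (d k).2

end GordonProb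

end Lasso

namespace Lasso

section Chernoff

lemma integrable_gaussian_iff {f : ℝ → ℝ} :
    Integrable f (gaussianReal 0 1) ↔ Integrable (fun x => gaussianPDFReal 0 1 x * f x) volume := by
  rw [gaussianReal_of_var_ne_zero 0 one_ne_zero, integrable_withDensity_iff_integrable_smul'
    (measurable_gaussianPDF 0 1) (Filter.Eventually.of_forall fun x => gaussianPDF_lt_top)]
  simp [toReal_gaussianPDF]

lemma pdf_mul_exp_quarter (x : ℝ) : gaussianPDFReal 0 1 x * Real.exp (x ^ 2 / 4) =
    (√(2 * Real.pi))⁻¹ * Real.exp (-(1 / 4) * x ^ 2) := by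
  rw [gaussianPDFReal, mul_assoc, ← Real.exp_add]
  simp only [NNReal.coe_one, sub_zero, mul_one]
  congr 2
  ring

lemma integrable_exp_quarter : Integrable (fun x : ℝ => Real.exp (x ^ 2 / 4)) (gaussianReal 0 1) := by
  rw [integrable_gaussian_iff]
  simp only [pdf_mul_exp_quarter]
  exact (integrable_exp_neg_mul_sq (by norm_num)).const_mul _

lemma integral_exp_quarter_le : ∫ x : ℝ, Real.exp (x ^ 2 / 4) ∂gaussianReal 0 1 ≤ 2 := by
  rw [integral_gaussianReal_eq_integral_smul one_ne_zero]
  simp only [smul_eq_mul, pdf_mul_exp_quarter]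
  rw [integral_const_mul, integral_gaussian, ← div_eq_inv_mul, div_le_iff₀ (by positivity)]
  have h : Real.pi / (1 / 4) = 2 * (2 * Real.pi) := by ring
  rw [h, Real.sqrt_mul (by norm_num)]
  gcongr
  rw [Real.sqrt_le_left (by norm_num)]
  norm_num

lemma exp_le_quad (u : ℝ) : Real.exp u ≤ 1 + u + u ^ 2 * Real.exp |u| := by
  rcases le_total 0 u with h | h
  · rw [abs_of_nonneg h]
    have h1 := Real.add_one_le_exp (-u)
    have h2 : Real.exp u * Real.exp (-u) = 1 := by rw [← Real.exp_add]; simp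
    have h3 := Real.exp_pos u
    have h4 : Real.exp u * (1 - u) ≤ 1 := by nlinarith
    have h5 : Real.exp u ≤ 1 + u * Real.exp u := by linarith
    nlinarith
  · have h1 : Real.exp u ≤ 1 + u + u ^ 2 := by
      have h2 := Real.add_one_le_exp (-u)
      have h3 : Real.exp u * Real.exp (-u) = 1 := by rw [← Real.exp_add]; simp
      have h4 := Real.exp_pos u
      have h5 : Real.exp u * (1 - u) ≤ 1 := by nlinarith
      have h6 : (1 : ℝ) ≤ (1 + u + u ^ 2) * (1 - u) := by nlinarith [pow_nonneg (neg_nonneg.2 h) 3]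
      exact le_of_mul_le_mul_right (h5.trans h6) (by linarith)
    have h2 := Real.one_le_exp (abs_nonneg u)
    nlinarith [sq_nonneg u]

lemma gaussian_mgf_le {ψ : ℝ → ℝ} {A lam : ℝ} (hψ : Measurable ψ) (hb : ∀ x, |ψ x| ≤ A * (1 + x ^ 2))
    (hmean : ∫ x, ψ x ∂gaussianReal 0 1 ≤ 0) (hl : 0 ≤ lam) (hlA : lam * A ≤ 1 / 16) :
    Integrable (fun x => Real.exp (lam * ψ x)) (gaussianReal 0 1) ∧
    ∫ x, Real.exp (lam * ψ x) ∂gaussianReal 0 1 ≤ Real.exp (2000 * (lam * A) ^ 2) := by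
  have hA0 : 0 ≤ A := by have := (abs_nonneg _).trans (hb 0); linarith
  have hq : ∀ x : ℝ, (1 + x ^ 2) ≤ 8 * Real.exp ((1 + x ^ 2) / 16 ) * 2 := fun x => by
    have := Real.add_one_le_exp ((1 + x ^ 2) / 16)
    nlinarith [sq_nonneg x]
  have he : ∀ x, |lam * ψ x| ≤ (1 + x ^ 2) / 16 := fun x => by
    rw [abs_mul, abs_of_nonneg hl]
    calc lam * |ψ x| ≤ lam * (A * (1 + x ^ 2)) := by have := hb x; gcongr
      _ = (lam * A) * (1 + x ^ 2) := by ring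
      _ ≤ 1 / 16 * (1 + x ^ 2) := by gcongr
      _ = _ := by ring
  have h16 : ∀ x : ℝ, Real.exp ((1 + x ^ 2) / 16) ^ 3 ≤ 2 * Real.exp (x ^ 2 / 4) := fun x => by
    rw [← Real.exp_nat_mul]
    have e1 : ((3 : ℕ) : ℝ) * ((1 + x ^ 2) / 16) = 3 / 16 + 3 / 16 * x ^ 2 := by push_cast; ring
    rw [e1, Real.exp_add]
    have h1 : Real.exp (3 / 16) ≤ 2 := by
      have := Real.exp_bound_div_one_sub_of_interval (x := 3 / 16) (by norm_num) (by norm_num)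
      linarith [show (1 : ℝ) / (1 - 3 / 16) ≤ 2 by norm_num]
    gcongr
    nlinarith [sq_nonneg x]
  have hbound : ∀ x, Real.exp (lam * ψ x) ≤ 1 + lam * ψ x + (lam * A) ^ 2 * (512 * Real.exp (x ^ 2 / 4)) := fun x => by
    refine (exp_le_quad _).trans (add_le_add le_rfl ?_)
    have h1 : Real.exp |lam * ψ x| ≤ Real.exp ((1 + x ^ 2) / 16) := Real.exp_le_exp.2 (he x)
    have h2 : (lam * ψ x) ^ 2 ≤ (lam * A) ^ 2 * (16 * Real.exp ((1 + x ^ 2) / 16)) ^ 2 := by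
      rw [← sq_abs, abs_mul, abs_of_nonneg hl, ← mul_pow]
      have h3 := hb x
      have h4 := hq x
      refine pow_le_pow_left₀ (by positivity) ?_ 2
      calc lam * |ψ x| ≤ lam * (A * (1 + x ^ 2)) := by gcongr
        _ = (lam * A) * (1 + x ^ 2) := by ring
        _ ≤ (lam * A) * (16 * Real.exp ((1 + x ^ 2) / 16)) := by gcongr; linarith
    calc (lam * ψ x) ^ 2 * Real.exp |lam * ψ x| ≤
        ((lam * A) ^ 2 * (16 * Real.exp ((1 + x ^ 2) / 16)) ^ 2) * Real.exp ((1 + x ^ 2) / 16) := by gcongr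
      _ = (lam * A) ^ 2 * (256 * Real.exp ((1 + x ^ 2) / 16) ^ 3) := by ring
      _ ≤ (lam * A) ^ 2 * (256 * (2 * Real.exp (x ^ 2 / 4))) := by have := h16 x; gcongr
      _ = _ := by ring
  have hψi : Integrable ψ (gaussianReal 0 1) := by
    refine (integrable_exp_quarter.const_mul (4 * A)).mono' hψ.aestronglyMeasurable (Filter.Eventually.of_forall fun x => ?_)
    rw [Real.norm_eq_abs]
    refine (hb x).trans ?_
    have := Real.add_one_le_exp (x ^ 2 / 4)
    calc A * (1 + x ^ 2) ≤ A * (4 * Real.exp (x ^ 2 / 4)) := by gcongr; linarith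
      _ = _ := by ring
  have hRi : Integrable (fun x => 1 + lam * ψ x + (lam * A) ^ 2 * (512 * Real.exp (x ^ 2 / 4))) (gaussianReal 0 1) :=
    ((integrable_const _).add (hψi.const_mul _)).add ((integrable_exp_quarter.const_mul _).const_mul _)
  have hint : Integrable (fun x => Real.exp (lam * ψ x)) (gaussianReal 0 1) := by
    refine hRi.mono' (by fun_prop) (Filter.Eventually.of_forall fun x => ?_)
    rw [Real.norm_eq_abs, abs_of_pos (Real.exp_pos _)]
    exact hbound x
  refine ⟨hint, (integral_mono hint hRi hbound).trans ?_⟩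
  have hli : Integrable (fun x => 1 + lam * ψ x) (gaussianReal 0 1) := (integrable_const _).add (hψi.const_mul _)
  rw [integral_add hli ((integrable_exp_quarter.const_mul _).const_mul _),
    integral_add (integrable_const _) (hψi.const_mul _), integral_const_mul, integral_const_mul, integral_const_mul]
  have h1 := integral_exp_quarter_le
  have h2 := Real.add_one_le_exp (2000 * (lam * A) ^ 2)
  have h3 : (lam * A) ^ 2 * (512 * ∫ x : ℝ, Real.exp (x ^ 2 / 4) ∂gaussianReal 0 1) ≤ (lam * A) ^ 2 * (512 * 2) := by gcongr
  have h4 : lam * ∫ x, ψ x ∂gaussianReal 0 1 ≤ 0 := mul_nonpos_of_nonneg_of_nonpos hl hmean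
  simp only [integral_const, probReal_univ, smul_eq_mul, mul_one]
  nlinarith [sq_nonneg (lam * A)]

/-- Exponential concentration of sums of functions of quadratic growth of independent Gaussians. -/
lemma gaussian_chernoff {A κ : ℝ} (hA : 0 < A) (hκ : 0 < κ) : ∃ c > 0, ∀ {P : Type} [Fintype P] (ψ : P → ℝ → ℝ) (M : ℝ),
    (∀ p, Measurable (ψ p)) → (∀ p x, |ψ p x| ≤ A * (1 + x ^ 2)) → (∀ p, ∫ x, ψ p x ∂gaussianReal 0 1 ≤ 0) →
    (Fintype.card P : ℝ) ≤ M → stdGauss P {ω | κ * M ≤ ∑ p, ψ p (ω p)} ≤ ENNReal.ofReal (Real.exp (-c * M)) := by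
  set lam : ℝ := min (1 / (16 * A)) (κ / (4000 * A ^ 2)) with hlam
  have hl : 0 < lam := by positivity
  have hl1 : lam * A ≤ 1 / 16 := by
    have := min_le_left (1 / (16 * A)) (κ / (4000 * A ^ 2))
    rw [← hlam, le_div_iff₀ (by positivity)] at this
    linarith
  have hl2 : 2000 * (lam * A) ^ 2 ≤ lam * κ / 2 := by
    have := min_le_right (1 / (16 * A)) (κ / (4000 * A ^ 2))
    rw [← hlam, le_div_iff₀ (by positivity)] at this
    nlinarith
  refine ⟨lam * κ / 2, by positivity, fun {P} _ ψ M hm hb hmean hM => ?_⟩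
  have hmgf := fun p => gaussian_mgf_le (hm p) (hb p) (hmean p) hl.le hl1
  have heq : ∀ ω : P → ℝ, Real.exp (lam * ∑ p, ψ p (ω p)) = ∏ p, Real.exp (lam * ψ p (ω p)) := by
    intro ω; rw [Finset.mul_sum, Real.exp_sum]
  have hint : Integrable (fun ω : P → ℝ => Real.exp (lam * ∑ p, ψ p (ω p))) (stdGauss P) := by
    simp only [heq]
    exact Integrable.fintype_prod (f := fun p x => Real.exp (lam * ψ p x)) fun p => (hmgf p).1
  have h := measure_ge_le_exp_mul_mgf (μ := stdGauss P) (X := fun ω => ∑ p, ψ p (ω p)) (κ * M) hl.le hint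
  have hmgf2 : mgf (fun ω : P → ℝ => ∑ p, ψ p (ω p)) (stdGauss P) lam ≤ Real.exp (lam * κ / 2 * M) := by
    rw [mgf]
    simp only [heq]
    rw [integral_fintype_prod_eq_prod (μ := fun _ : P => gaussianReal 0 1) (f := fun p x => Real.exp (lam * ψ p x))]
    calc _ ≤ ∏ _p : P, Real.exp (lam * κ / 2) := by
          refine Finset.prod_le_prod (fun p _ => integral_nonneg fun x => (Real.exp_pos _).le) fun p _ => ?_
          exact (hmgf p).2.trans (Real.exp_le_exp.2 hl2)
      _ = Real.exp (lam * κ / 2 * Fintype.card P) := by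
          rw [Finset.prod_const, Finset.card_univ, ← Real.exp_nat_mul]; congr 1; ring
      _ ≤ _ := by
          refine Real.exp_le_exp.2 ?_
          gcongr
  rw [← ofReal_measureReal]
  refine ENNReal.ofReal_le_ofReal (h.trans ?_)
  calc _ ≤ Real.exp (-lam * (κ * M)) * Real.exp (lam * κ / 2 * M) := by gcongr
    _ = _ := by rw [← Real.exp_add]; congr 1; ring

lemma gaussian_abs_tail {s : ℝ} : gaussianReal 0 1 {x | s ≤ x ^ 2} ≤ ENNReal.ofReal (2 * Real.exp (-s / 4)) := by
  have h := mul_meas_ge_le_integral_of_nonneg (μ := gaussianReal 0 1) (f := fun x : ℝ => Real.exp (x ^ 2 / 4))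
    (Filter.Eventually.of_forall fun x => (Real.exp_pos _).le) integrable_exp_quarter (Real.exp (s / 4))
  have hs : {x : ℝ | s ≤ x ^ 2} ⊆ {x | Real.exp (s / 4) ≤ Real.exp (x ^ 2 / 4)} := fun x hx =>
    Real.exp_le_exp.2 (by have : s ≤ x ^ 2 := hx; linarith)
  refine (measure_mono hs).trans ?_
  rw [← ofReal_measureReal]
  refine ENNReal.ofReal_le_ofReal ?_
  have h2 := h.trans integral_exp_quarter_le
  rw [neg_div, Real.exp_neg, ← div_eq_mul_inv, le_div_iff₀ (Real.exp_pos _), mul_comm]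
  exact h2

end Chernoff

end Lasso

namespace Lasso

section SoftThreshold

/-- Mean squared excess of a standard Gaussian over the level `α`. -/
noncomputable def softRisk (α : ℝ) : ℝ := ∫ x, (max (|x| - α) 0) ^ 2 ∂gaussianReal 0 1

lemma sq_le_exp_quarter (x : ℝ) : x ^ 2 ≤ 4 * Real.exp (x ^ 2 / 4) := by
  linarith [Real.add_one_le_exp (x ^ 2 / 4)]

lemma pow_four_le_exp_quarter (x : ℝ) : x ^ 4 ≤ 32 * Real.exp (x ^ 2 / 4) := by
  have := Real.quadratic_le_exp_of_nonneg (x := x ^ 2 / 4) (by positivity)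
  nlinarith [sq_nonneg x]

lemma excess_le_sq {α : ℝ} (hα : 0 ≤ α) (x : ℝ) : (max (|x| - α) 0) ^ 2 ≤ x ^ 2 := by
  rw [← sq_abs x]
  exact pow_le_pow_left₀ (le_max_right _ _) (max_le (by linarith) (abs_nonneg x)) 2

lemma integrable_of_le_exp_quarter {f : ℝ → ℝ} (hf : Measurable f) {C : ℝ} (h : ∀ x, |f x| ≤ C * Real.exp (x ^ 2 / 4)) :
    Integrable f (gaussianReal 0 1) :=
  (integrable_exp_quarter.const_mul C).mono' hf.aestronglyMeasurable (Filter.Eventually.of_forall h)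

lemma integrable_sq_gaussian : Integrable (fun x : ℝ => x ^ 2) (gaussianReal 0 1) :=
  integrable_of_le_exp_quarter (C := 4) (by fun_prop) fun x => by
    rw [abs_of_nonneg (sq_nonneg x)]; exact sq_le_exp_quarter x

lemma integrable_id_gaussian : Integrable (fun x : ℝ => x) (gaussianReal 0 1) :=
  integrable_of_le_exp_quarter (C := 4) (by fun_prop) fun x => by
    have := Real.add_one_le_exp (x ^ 2 / 4)
    nlinarith [sq_abs x, abs_nonneg x, sq_nonneg (|x| - 2), sq_nonneg x]

lemma integral_id_gaussian : ∫ x : ℝ, x ∂gaussianReal 0 1 = 0 := by simp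

lemma integral_sq_gaussian : ∫ x : ℝ, x ^ 2 ∂gaussianReal 0 1 = 1 := by
  have h := variance_fun_id_gaussianReal (μ := 0) (v := 1)
  rw [variance_of_integral_eq_zero (by fun_prop) (by simp)] at h
  simpa using h

lemma integrable_excess {α : ℝ} (hα : 0 ≤ α) : Integrable (fun x : ℝ => (max (|x| - α) 0) ^ 2) (gaussianReal 0 1) :=
  integrable_sq_gaussian.mono' (by fun_prop) (Filter.Eventually.of_forall fun x => by
    rw [Real.norm_eq_abs, abs_of_nonneg (sq_nonneg _)]; exact excess_le_sq hα x)

lemma softRisk_nonneg (α : ℝ) : 0 ≤ softRisk α := integral_nonneg fun _ => sq_nonneg _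

lemma softRisk_le_one {α : ℝ} (hα : 0 ≤ α) : softRisk α ≤ 1 := by
  rw [← integral_sq_gaussian]
  exact integral_mono (integrable_excess hα) integrable_sq_gaussian (excess_le_sq hα)

lemma softRisk_le {α : ℝ} (hα : 0 < α) : softRisk α ≤ 64 / α ^ 2 := by
  have h : ∀ x : ℝ, (max (|x| - α) 0) ^ 2 ≤ 32 / α ^ 2 * Real.exp (x ^ 2 / 4) := by
    intro x
    have h4 := pow_four_le_exp_quarter x
    rw [div_mul_eq_mul_div, le_div_iff₀ (by positivity)]
    refine le_trans ?_ h4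
    rcases le_total (|x|) α with h | h
    · rw [max_eq_right (by linarith)]; simp; positivity
    · have h1 := excess_le_sq hα.le x
      have h2 : α ^ 2 ≤ x ^ 2 := by rw [← sq_abs x]; gcongr
      calc _ ≤ x ^ 2 * x ^ 2 := by gcongr
        _ = _ := by ring
  calc softRisk α ≤ ∫ x : ℝ, 32 / α ^ 2 * Real.exp (x ^ 2 / 4) ∂gaussianReal 0 1 :=
        integral_mono (integrable_excess hα.le) (integrable_exp_quarter.const_mul _) h
    _ = 32 / α ^ 2 * ∫ x : ℝ, Real.exp (x ^ 2 / 4) ∂gaussianReal 0 1 := integral_const_mul _ _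
    _ ≤ 32 / α ^ 2 * 2 := by gcongr; exact integral_exp_quarter_le
    _ = _ := by ring

lemma gphi_eq_pdf (x : ℝ) : gphi x = gaussianPDFReal 0 1 x := by
  simp [gphi, gaussianPDFReal, div_eq_inv_mul]

lemma hasDerivAt_gphi (x : ℝ) : HasDerivAt gphi (-x * gphi x) x := by
  have h : HasDerivAt (fun x : ℝ => -x ^ 2 / 2) (-x) x :=
    (((hasDerivAt_pow 2 x).neg).div_const 2).congr_deriv (by simp; ring)
  exact (h.exp.div_const (√(2 * Real.pi))).congr_deriv (by simp [gphi]; ring)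

lemma softRisk_eq {α : ℝ} (hα : 0 ≤ α) : softRisk α = 2 * ((1 + α ^ 2) * gPhi (-α) - α * gphi α) := by
  have hi0 : Integrable gphi volume := by
    have := integrable_gaussian_iff.1 (integrable_const (μ := gaussianReal 0 1) (1 : ℝ))
    simpa [← gphi_eq_pdf] using this
  have hi1 : Integrable (fun x => gphi x * x) volume := by
    simpa [← gphi_eq_pdf] using integrable_gaussian_iff.1 integrable_id_gaussian
  have hi2 : Integrable (fun x => gphi x * x ^ 2) volume := by
    simpa [← gphi_eq_pdf] using integrable_gaussian_iff.1 integrable_sq_gaussian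
  have hi3 : Integrable (fun x => (x ^ 2 - 2 * α * x - 1) * gphi x) volume := by
    have := (hi2.sub (hi1.const_mul (2 * α))).sub hi0
    refine this.congr (Filter.Eventually.of_forall fun x => ?_)
    simp only [Pi.sub_apply]; ring
  have hi4 : Integrable (fun x => (-x + 2 * α) * gphi x) volume := by
    have := (hi0.const_mul (2 * α)).sub hi1
    refine this.congr (Filter.Eventually.of_forall fun x => ?_)
    simp only [Pi.sub_apply]; ring
  have hd : ∀ x, HasDerivAt (fun x => (-x + 2 * α) * gphi x) ((x ^ 2 - 2 * α * x - 1) * gphi x) x := fun x =>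
    (((hasDerivAt_id x).neg.add_const (2 * α)).mul (hasDerivAt_gphi x)).congr_deriv (by simp; ring)
  have ht := tendsto_zero_of_hasDerivAt_of_integrableOn_Ioi (a := α) (fun x _ => hd x) hi3.integrableOn hi4.integrableOn
  have hI := integral_Ioi_of_hasDerivAt_of_tendsto' (a := α) (fun x _ => hd x) hi3.integrableOn ht
  have hP : gPhi (-α) = ∫ x in Set.Ioi α, gphi x := by
    have := integral_comp_neg_Iic (-α) gphi
    rw [neg_neg] at this
    rw [← this, gPhi]
    simp [gphi]
  have h1 : ∀ x, gaussianPDFReal 0 1 x • (max (|x| - α) 0) ^ 2 =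
      (fun y => gphi y * (max (y - α) 0) ^ 2) |x| := by
    intro x
    simp [← gphi_eq_pdf, gphi]
  have hs : ∫ x in Set.Ioi (0 : ℝ), gphi x * (max (x - α) 0) ^ 2 =
      ∫ x in Set.Ioi α, gphi x * (max (x - α) 0) ^ 2 := by
    refine setIntegral_eq_of_subset_of_forall_sdiff_eq_zero measurableSet_Ioi (Set.Ioi_subset_Ioi hα) fun x hx => ?_
    have : x ≤ α := not_lt.1 hx.2
    rw [max_eq_right (by linarith)]; simp
  have he : ∫ x in Set.Ioi α, gphi x * (max (x - α) 0) ^ 2 =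
      ∫ x in Set.Ioi α, ((1 + α ^ 2) * gphi x + (x ^ 2 - 2 * α * x - 1) * gphi x) :=
    setIntegral_congr_fun measurableSet_Ioi fun x hx => by
      have : α < x := hx
      rw [max_eq_left (by linarith)]; ring
  rw [softRisk, integral_gaussianReal_eq_integral_smul one_ne_zero]
  simp only [h1]
  rw [integral_comp_abs (f := fun y => gphi y * (max (y - α) 0) ^ 2), hs, he,
    integral_add (hi0.const_mul _).integrableOn hi3.integrableOn, integral_const_mul, hI, ← hP]
  ring

lemma dfam_control {δ q : ℝ} (hδ : 0 < δ) {Dfam : (M : ℕ) → Set (Fin M → ℝ)} (hD : DFamSpec δ Dfam q) :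
    0 ≤ q ∧ ∃ s α M : ℝ, 0 ≤ s ∧ 0 ≤ α ∧ 0 ≤ M ∧ s * (1 + α ^ 2 - softRisk α) + softRisk α < δ ∧
      ∀ N, 0 < N → ∀ θ ∈ Dfam N, ∃ T : Finset (Fin N), (T.card : ℝ) ≤ s * N ∧ ∑ j ∈ Tᶜ, |θ j| ≤ M * N := by
  rcases hD with ⟨p, ξ, hp, hξ, hD, rfl⟩ | ⟨s, hs, hsm, hD, rfl⟩
  · refine ⟨le_max_right _ _, ?_⟩
    obtain ⟨α, hα, hαδ⟩ : ∃ α : ℝ, 0 < α ∧ softRisk α < δ / 2 := by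
      refine ⟨√(256 / δ), by positivity, (softRisk_le (by positivity)).trans_lt ?_⟩
      rw [Real.sq_sqrt (by positivity), div_div_eq_mul_div]
      linarith
    set s : ℝ := δ / (4 * (1 + α ^ 2)) with hs
    have hs0 : 0 < s := by positivity
    have hss : s * (1 + α ^ 2) = δ / 4 := by rw [hs]; field_simp
    have hMp : 0 < ξ / s ^ (1 / p) := by positivity
    refine ⟨s, α, ξ / s ^ (1 / p), hs0.le, hα.le, hMp.le, by nlinarith [softRisk_nonneg α], fun N hN θ hθ => ?_⟩
    have hN' : (0 : ℝ) < N := by exact_mod_cast hN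
    set M := ξ / s ^ (1 / p) with hM
    have hMs : s * M ^ p = ξ ^ p := by
      rw [hM, Real.div_rpow hξ.le (by positivity), ← Real.rpow_mul hs0.le, one_div_mul_cancel hp.ne', Real.rpow_one]
      field_simp
    refine ⟨Finset.univ.filter fun j => M < |θ j|, ?_, ?_⟩
    · rw [hD] at hθ
      have h1 : (1 / (N : ℝ)) * ∑ j, |θ j| ^ p ≤ ξ ^ p := hθ
      rw [one_div, inv_mul_le_iff₀ hN'] at h1
      have h2 : ((Finset.univ.filter fun j => M < |θ j|).card : ℝ) * M ^ p ≤ ∑ j, |θ j| ^ p := by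
        rw [← nsmul_eq_mul]
        refine (Finset.card_nsmul_le_sum _ (fun j => |θ j| ^ p) _ fun j hj => ?_).trans
          (Finset.sum_le_univ_sum_of_nonneg fun j => by positivity)
        exact Real.rpow_le_rpow hMp.le (Finset.mem_filter.1 hj).2.le hp.le
      have h3 : 0 < M ^ p := by positivity
      rw [← hMs] at h1
      refine le_of_mul_le_mul_right ?_ h3
      linarith
    · refine (Finset.sum_le_card_nsmul _ _ M fun j hj => ?_).trans ?_
      · simpa using hj
      · rw [nsmul_eq_mul, mul_comm]
        gcongr
        simpa using Finset.card_le_univ (Finset.univ.filter fun j => M < |θ j|)ᶜ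
  · refine ⟨le_rfl, ?_⟩
    rw [smax] at hsm
    have h1 : s / δ < sSup ((fun α : ℝ =>
      (1 - (2 / δ) * ((1 + α ^ 2) * gPhi (-α) - α * gphi α)) /
        (1 + α ^ 2 - 2 * ((1 + α ^ 2) * gPhi (-α) - α * gphi α))) '' Set.Ici (0 : ℝ)) := by
      rw [div_lt_iff₀ hδ, mul_comm]; exact hsm
    obtain ⟨_, ⟨α, hα, rfl⟩, hlt⟩ := exists_lt_of_lt_csSup ((Set.nonempty_Ici).image _) h1
    have hα : 0 ≤ α := hα
    simp only at hlt
    rw [← softRisk_eq hα] at hlt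
    have e : 2 / δ * ((1 + α ^ 2) * gPhi (-α) - α * gphi α) = softRisk α / δ := by rw [softRisk_eq hα]; ring
    rw [e] at hlt
    have hm1 := softRisk_le_one hα
    have hden : 0 < 1 + α ^ 2 - softRisk α := by
      rcases (show 0 ≤ 1 + α ^ 2 - softRisk α by nlinarith).eq_or_lt with h | h
      · rw [← h, div_zero] at hlt
        exact absurd hlt (not_lt.2 (by positivity))
      · exact h
    rw [lt_div_iff₀ hden, div_mul_eq_mul_div, div_lt_iff₀ hδ, sub_mul, div_mul_cancel₀ _ hδ.ne'] at hlt
    refine ⟨s, α, 0, hs, hα, le_rfl, by linarith, fun N hN θ hθ => ⟨Finset.univ.filter fun j => θ j ≠ 0, ?_, ?_⟩⟩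
    · rw [hD] at hθ
      exact hθ
    · refine le_of_eq ?_
      rw [zero_mul]
      refine Finset.sum_eq_zero fun j hj => ?_
      simp at hj
      simp [hj]

end SoftThreshold

end Lasso

namespace Lasso

open Matrix

section RestrictedEigenvalue
variable {n N : ℕ}

/-- Subgradient-type lower bound on the increase of the `ℓ¹` norm in direction `v`. -/
def coneVal (T : Finset (Fin N)) (sg : Fin N → ℝ) (v : Fin N → ℝ) : ℝ :=
  ∑ j ∈ T, sg j * v j + ∑ j ∈ Tᶜ, |v j|

/-- Summand of the squared distance of `h` to the scaled subdifferential. -/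
def subdist (T : Finset (Fin N)) (sg : Fin N → ℝ) (α : ℝ) (j : Fin N) (x : ℝ) : ℝ :=
  if j ∈ T then (x + α * sg j) ^ 2 else (max (|x| - α) 0) ^ 2

lemma neg_dot_le {T : Finset (Fin N)} {sg : Fin N → ℝ} {α : ℝ} {h v : Fin N → ℝ} (hv : v ⬝ᵥ v = 1) :
    -(√(∑ j, subdist T sg α j (h j)) + α * coneVal T sg v) ≤ ∑ j, h j * v j := by
  set a : Fin N → ℝ := fun j => if j ∈ T then |h j + α * sg j| else max (|h j| - α) 0 with ha
  have haa : a ⬝ᵥ a = ∑ j, subdist T sg α j (h j) := by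
    refine Finset.sum_congr rfl fun j _ => ?_
    simp only [ha, subdist]
    split_ifs
    · rw [← sq, sq_abs]
    · rw [sq]
  have h1 := dot_le_sqrt a fun j => |v j|
  have h2 : (fun j => |v j|) ⬝ᵥ (fun j => |v j|) = 1 := by
    rw [← hv]; simp [dotProduct]
  rw [h2, Real.sqrt_one, mul_one, haa] at h1
  have h3 : -(∑ j, h j * v j) ≤ a ⬝ᵥ (fun j => |v j|) + α * coneVal T sg v := by
    rw [coneVal, ← Finset.sum_add_sum_compl T, dotProduct, ← Finset.sum_add_sum_compl T (fun j => a j * |v j|),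
      mul_add, Finset.mul_sum, Finset.mul_sum]
    have e1 : -(∑ j ∈ T, h j * v j) ≤ ∑ j ∈ T, a j * |v j| + ∑ j ∈ T, α * (sg j * v j) := by
      rw [← Finset.sum_neg_distrib, ← Finset.sum_add_distrib]
      refine Finset.sum_le_sum fun j hj => ?_
      simp only [ha, if_pos hj]
      rw [← abs_mul]
      linarith [neg_abs_le ((h j + α * sg j) * v j)]
    have e2 : -(∑ j ∈ Tᶜ, h j * v j) ≤ ∑ j ∈ Tᶜ, a j * |v j| + ∑ j ∈ Tᶜ, α * |v j| := by
      rw [← Finset.sum_neg_distrib, ← Finset.sum_add_distrib]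
      refine Finset.sum_le_sum fun j hj => ?_
      simp only [ha, if_neg (Finset.mem_compl.1 hj)]
      rw [← add_mul]
      calc -(h j * v j) ≤ |h j * v j| := neg_le_abs _
        _ = |h j| * |v j| := abs_mul _ _
        _ ≤ _ := by gcongr; linarith [le_max_left (|h j| - α) 0]
    linarith
  linarith

lemma ss_chernoff {κ : ℝ} (hκ : 0 < κ) : ∃ c > 0, ∀ {P : Type} [Fintype P] (M : ℝ), (Fintype.card P : ℝ) ≤ M →
    stdGauss P {g | Fintype.card P + κ * M ≤ g ⬝ᵥ g} ≤ ENNReal.ofReal (Real.exp (-c * M)) ∧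
    stdGauss P {g | g ⬝ᵥ g ≤ Fintype.card P - κ * M} ≤ ENNReal.ofReal (Real.exp (-c * M)) := by
  obtain ⟨c, hc, h⟩ := gaussian_chernoff one_pos hκ
  have hb : ∀ x : ℝ, |x ^ 2 - 1| ≤ 1 * (1 + x ^ 2) := fun x => abs_le.2 ⟨by nlinarith [sq_nonneg x], by linarith⟩
  have hi : ∫ x : ℝ, (x ^ 2 - 1) ∂gaussianReal 0 1 = 0 := by
    rw [integral_sub integrable_sq_gaussian (integrable_const _), integral_sq_gaussian]; simp
  refine ⟨c, hc, fun {P} _ M hM => ⟨?_, ?_⟩⟩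
  · refine le_trans (measure_mono fun g hg => ?_) (h (fun _ : P => fun x => (x ^ 2 - 1)) M (fun _ => by fun_prop)
      (fun _ x => ?_) (fun _ => ?_) hM)
    · have hg : (Fintype.card P : ℝ) + κ * M ≤ g ⬝ᵥ g := hg
      change κ * M ≤ ∑ p, (g p ^ 2 - 1)
      rw [Finset.sum_sub_distrib]
      simp only [dotProduct, ← sq] at hg
      simp only [Finset.sum_const, Finset.card_univ, nsmul_eq_mul, mul_one]
      linarith
    · exact hb x
    · exact hi.le
  · refine le_trans (measure_mono fun g hg => ?_) (h (fun _ : P => fun x => (1 - x ^ 2)) M (fun _ => by fun_prop)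
      (fun _ x => ?_) (fun _ => ?_) hM)
    · have hg : g ⬝ᵥ g ≤ (Fintype.card P : ℝ) - κ * M := hg
      change κ * M ≤ ∑ p, (1 - g p ^ 2)
      rw [Finset.sum_sub_distrib]
      simp only [dotProduct, ← sq] at hg
      simp only [Finset.sum_const, Finset.card_univ, nsmul_eq_mul, mul_one]
      linarith
    · rw [abs_sub_comm]; exact hb x
    · simp only [← neg_sub _ (1 : ℝ)]
      rw [integral_neg, hi, neg_zero]

lemma integral_shift_sq (a : ℝ) : ∫ x : ℝ, (x + a) ^ 2 ∂gaussianReal 0 1 = 1 + a ^ 2 := by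
  have e : ∀ x : ℝ, (x + a) ^ 2 = x ^ 2 + 2 * a * x + a ^ 2 := fun x => by ring
  have h1 : Integrable (fun x : ℝ => x ^ 2 + 2 * a * x) (gaussianReal 0 1) :=
    integrable_sq_gaussian.add (integrable_id_gaussian.const_mul _)
  simp only [e]
  rw [integral_add h1 (integrable_const _), integral_add integrable_sq_gaussian (integrable_id_gaussian.const_mul _),
    integral_sq_gaussian, integral_const_mul, integral_id_gaussian]
  simp

lemma integrable_shift_sq (a : ℝ) : Integrable (fun x : ℝ => (x + a) ^ 2) (gaussianReal 0 1) := by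
  have e : ∀ x : ℝ, (x + a) ^ 2 = x ^ 2 + 2 * a * x + a ^ 2 := fun x => by ring
  simp only [e]
  exact (integrable_sq_gaussian.add (integrable_id_gaussian.const_mul _)).add (integrable_const _)

lemma measurable_subdist (T : Finset (Fin N)) (sg : Fin N → ℝ) (α : ℝ) (j : Fin N) :
    Measurable (subdist T sg α j) := by
  unfold subdist; split_ifs <;> fun_prop

lemma subdist_chernoff {α κ : ℝ} (hα : 0 ≤ α) (hκ : 0 < κ) : ∃ c > 0, ∀ {N : ℕ} (T : Finset (Fin N)) (sg : Fin N → ℝ),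
    (∀ j, sg j ^ 2 = 1) → stdGauss (Fin N) {h | T.card * (1 + α ^ 2 - softRisk α) + N * softRisk α + κ * N ≤
      ∑ j, subdist T sg α j (h j)} ≤ ENNReal.ofReal (Real.exp (-c * N)) := by
  obtain ⟨c, hc, h⟩ := gaussian_chernoff (A := 2 * (1 + α ^ 2)) (by positivity) hκ
  refine ⟨c, hc, fun {N} T sg hsg => ?_⟩
  have hm0 := softRisk_nonneg α
  have hm1 := softRisk_le_one hα
  refine le_trans (measure_mono fun g hg => ?_) (h (fun j : Fin N => fun x =>
    subdist T sg α j x - if j ∈ T then 1 + α ^ 2 else softRisk α) N (fun j => (measurable_subdist T sg α j).sub_const _)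
    (fun j x => ?_) (fun j => ?_) (by simp))
  · have hg : T.card * (1 + α ^ 2 - softRisk α) + N * softRisk α + κ * N ≤ ∑ j, subdist T sg α j (g j) := hg
    change κ * N ≤ ∑ j, (subdist T sg α j (g j) - if j ∈ T then 1 + α ^ 2 else softRisk α)
    rw [Finset.sum_sub_distrib]
    have e : ∑ j, (if j ∈ T then 1 + α ^ 2 else softRisk α) = T.card * (1 + α ^ 2 - softRisk α) + N * softRisk α := by
      have e1 : ∀ j, (if j ∈ T then 1 + α ^ 2 else softRisk α) = (if j ∈ T then 1 + α ^ 2 - softRisk α else 0) + softRisk α := by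
        intro j; split_ifs <;> ring
      simp only [e1]
      rw [Finset.sum_add_distrib, ← Finset.sum_filter]
      simp [mul_comm, mul_add, mul_sub]
    linarith
  · simp only [subdist]
    split_ifs
    · have := hsg j
      have e : (x + α * sg j) ^ 2 + (x - α * sg j) ^ 2 = 2 * x ^ 2 + 2 * (α ^ 2 * sg j ^ 2) := by ring
      rw [this] at e
      exact abs_le.2 ⟨by nlinarith [sq_nonneg (x + α * sg j), sq_nonneg x, mul_nonneg (sq_nonneg α) (sq_nonneg x)],
        by nlinarith [sq_nonneg (x - α * sg j), mul_nonneg (sq_nonneg α) (sq_nonneg x)]⟩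
    · have h1 := excess_le_sq hα x
      have h2 := sq_nonneg (max (|x| - α) 0)
      exact abs_le.2 ⟨by nlinarith [sq_nonneg α, sq_nonneg x, mul_nonneg (sq_nonneg α) (sq_nonneg x)],
        by nlinarith [sq_nonneg α, sq_nonneg x, mul_nonneg (sq_nonneg α) (sq_nonneg x)]⟩
  · refine le_of_eq ?_
    simp only [subdist]
    split_ifs
    · rw [integral_sub (integrable_shift_sq _) (integrable_const _), integral_shift_sq, mul_pow, hsg]; simp
    · rw [integral_sub (integrable_excess hα) (integrable_const _)]; simp [softRisk]

end RestrictedEigenvalue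

end Lasso

namespace Lasso

open Matrix

section RestrictedEigenvalue

lemma prob_le_of_compl {Ω : Type*} [MeasurableSpace Ω] {μ : Measure Ω} [IsProbabilityMeasure μ] {L R : Set Ω}
    (hR : MeasurableSet R) (h : μ L ≤ μ R) : μ Rᶜ ≤ μ Lᶜ := by
  rw [prob_compl_eq_one_sub hR]
  refine (tsub_le_tsub_left h 1).trans (tsub_le_iff_left.2 ?_)
  calc (1 : ℝ≥0∞) = μ (L ∪ Lᶜ) := by rw [Set.union_compl_self, measure_univ]
    _ ≤ _ := measure_union_le _ _

lemma gaussian_coord_tail {P : Type*} [Fintype P] (p : P) (s : ℝ) :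
    stdGauss P {ω | s ≤ ω p ^ 2} ≤ ENNReal.ofReal (2 * Real.exp (-s / 4)) := by
  refine le_trans ?_ (gaussian_abs_tail (s := s))
  exact (measurePreserving_eval (fun _ : P => gaussianReal 0 1) p).measure_preimage_le {x | s ≤ x ^ 2}

/-- With overwhelming probability the design is well conditioned on the descent cone. -/
lemma restricted_eigenvalue {δ s α : ℝ} (hδ : 0 < δ) (hs : 0 ≤ s) (hα : 0 ≤ α)
    (hlt : s * (1 + α ^ 2 - softRisk α) + softRisk α < δ) :
    ∃ ζ c₀ C c : ℝ, 0 < ζ ∧ 0 < c₀ ∧ 0 < c ∧ ∀ (N n : ℕ), 0 < N → (n : ℝ) = δ * N →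
      ∀ (T : Finset (Fin N)) (sg : Fin N → ℝ), (T.card : ℝ) ≤ s * N → (∀ j, sg j ^ 2 = 1) →
      PX n N {X | ∃ v : Fin N → ℝ, v ⬝ᵥ v = 1 ∧ coneVal T sg v ≤ ζ * √N ∧
        (fun i => ∑ j, X i j * v j) ⬝ᵥ (fun i => ∑ j, X i j * v j) < c₀} ≤
        ENNReal.ofReal (C * Real.exp (-c * N)) := by
  set m := s * (1 + α ^ 2 - softRisk α) + softRisk α with hm
  set d := δ - m with hd
  have hd0 : 0 < d := by rw [hd]; linarith
  have hm1 := softRisk_le_one hα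
  have hm0 := softRisk_nonneg α
  set η := (√(δ - d / 4) - √(m + d / 4)) / 2 with hη
  have hmn : 0 ≤ m := by
    have : 0 ≤ 1 + α ^ 2 - softRisk α := by nlinarith
    positivity
  have hη0 : 0 < η := by
    have : √(m + d / 4) < √(δ - d / 4) := Real.sqrt_lt_sqrt_iff_of_pos (by linarith) |>.2 (by linarith)
    rw [hη]; linarith
  obtain ⟨c1, hc1, hW⟩ := subdist_chernoff (κ := d / 4) hα (by positivity)
  obtain ⟨c2, hc2, hG⟩ := ss_chernoff (κ := d / (4 * δ)) (by positivity)
  set c := min (min c1 (c2 * δ)) (η ^ 2 / 64) with hc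
  have hc0 : 0 < c := by positivity
  refine ⟨η / (α + 1), (η / 2) ^ 2 / δ, 4 * Real.exp (c * (144 / η ^ 2)), c, by positivity, by positivity, hc0,
    fun N n hN hn T sg hT hsg => ?_⟩
  have hN' : (0 : ℝ) < N := by exact_mod_cast hN
  have hn' : (0 : ℝ) < n := by rw [hn]; positivity
  have hn0 : 0 < n := by exact_mod_cast hn'
  by_cases hsmall : (N : ℝ) ≤ 144 / η ^ 2
  · have : IsProbabilityMeasure (PX n N) := by unfold PX; infer_instance
    refine prob_le_one.trans ?_
    rw [← ENNReal.ofReal_one]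
    apply ENNReal.ofReal_le_ofReal
    rw [mul_assoc, ← Real.exp_add]
    have : 0 ≤ c * (144 / η ^ 2) + -c * N := by nlinarith
    linarith [Real.add_one_le_exp (c * (144 / η ^ 2) + -c * N)]
  push Not at hsmall
  have h12 : 12 ≤ √N * η := by
    rw [div_lt_iff₀ (by positivity)] at hsmall
    have : (12 : ℝ) = √144 := by rw [show (144 : ℝ) = 12 ^ 2 by norm_num, Real.sqrt_sq (by norm_num)]
    rw [this, ← Real.sqrt_sq hη0.le, ← Real.sqrt_mul hN'.le]
    exact Real.sqrt_le_sqrt hsmall.le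
  have hsn : √(N : ℝ) ^ 2 = N := Real.sq_sqrt hN'.le
  set K : Set (Fin N → ℝ) := {v | v ⬝ᵥ v = 1 ∧ coneVal T sg v ≤ η / (α + 1) * √N} with hK
  set τ := √N * η - 1 with hτ
  have hgor := gordon (ι := Fin n) (ν := Fin N) (K := K) (fun v hv => hv.1) τ
  set μ := stdGauss (((Fin n × Fin N) ⊕ Unit) ⊕ (Fin n ⊕ Fin N)) with hμ
  set R : Set (((Fin n × Fin N) ⊕ Unit) ⊕ (Fin n ⊕ Fin N) → ℝ) := {ω | ∀ v ∈ K, τ - 2 ≤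
        √((fun i => ∑ j, ω (Sum.inl (Sum.inl (i, j))) * v j) ⬝ᵥ
          fun i => ∑ j, ω (Sum.inl (Sum.inl (i, j))) * v j) + ω (Sum.inl (Sum.inr ()))} with hRdef
  have hR : MeasurableSet R := by
    apply IsClosed.measurableSet
    rw [hRdef]
    simp only [Set.ofPred_forall]
    refine isClosed_iInter fun v => isClosed_iInter fun _ => isClosed_le continuous_const ?_
    simp only [dotProduct]
    fun_prop
  have hcomp := prob_le_of_compl hR hgor
  set B : Set (Fin n × Fin N → ℝ) := {G | ∃ v ∈ K, (fun i => ∑ j, G (i, j) * v j) ⬝ᵥ (fun i => ∑ j, G (i, j) * v j) <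
    (η / 2) ^ 2 * N} with hB
  have hBm : MeasurableSet B := by
    apply IsOpen.measurableSet
    rw [hB]
    simp only [Set.ofPred_exists, Set.ofPred_and]
    refine isOpen_iUnion fun v => (isOpen_const).inter (isOpen_lt ?_ continuous_const)
    simp only [dotProduct]
    fun_prop
  have hstep1 : PX n N {X | ∃ v : Fin N → ℝ, v ⬝ᵥ v = 1 ∧ coneVal T sg v ≤ η / (α + 1) * √N ∧
        (fun i => ∑ j, X i j * v j) ⬝ᵥ (fun i => ∑ j, X i j * v j) < (η / 2) ^ 2 / δ} ≤
      μ ((fun ω p => ω (Sum.inl (Sum.inl p))) ⁻¹' B) := by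
    have e1 := (measurePreserving_inl (P := Fin n × Fin N) (Q := Unit)).comp
      (measurePreserving_inl (P := (Fin n × Fin N) ⊕ Unit) (Q := Fin n ⊕ Fin N))
    have e2 := e1.measure_preimage hBm.nullMeasurableSet
    refine le_trans ?_ e2.ge
    refine (measure_mono ?_).trans ((measurePreserving_design (N := N) hn0).measure_preimage_le B)
    rintro X ⟨v, hv1, hv2, hv3⟩
    refine ⟨v, ⟨hv1, hv2⟩, ?_⟩
    have e : (fun i => ∑ j, √n * X i j * v j) = √n • fun i => ∑ j, X i j * v j := by
      ext i; simp [Finset.mul_sum, mul_assoc]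
    change (fun i => ∑ j, √n * X i j * v j) ⬝ᵥ (fun i => ∑ j, √n * X i j * v j) < _
    rw [e, smul_dotProduct, dotProduct_smul, smul_eq_mul, smul_eq_mul, ← mul_assoc, Real.mul_self_sqrt hn'.le, hn]
    rw [lt_div_iff₀ hδ] at hv3
    nlinarith
  have hstep2 : (fun ω p => ω (Sum.inl (Sum.inl p))) ⁻¹' B ⊆ Rᶜ ∪ {ω | (√N * η / 4) ^ 2 ≤ ω (Sum.inl (Sum.inr ())) ^ 2} := by
    rintro ω ⟨v, hv, hlt⟩
    by_contra hcon
    rw [Set.mem_union, not_or, Set.notMem_compl_iff] at hcon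
    have h1 := hcon.1 v hv
    have h2 : ω (Sum.inl (Sum.inr ())) ^ 2 < (√N * η / 4) ^ 2 := not_le.1 hcon.2
    have h3 := (abs_lt.1 (abs_lt_of_sq_lt_sq h2 (by positivity))).2
    have h4 := Real.sqrt_lt_sqrt (ss_nonneg _) hlt
    rw [Real.sqrt_mul (by positivity), Real.sqrt_sq (by positivity)] at h4
    have h1' : τ - 2 ≤ √((fun i => ∑ j, ω (Sum.inl (Sum.inl (i, j))) * v j) ⬝ᵥ
          fun i => ∑ j, ω (Sum.inl (Sum.inl (i, j))) * v j) + ω (Sum.inl (Sum.inr ())) := h1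
    rw [hτ] at h1'
    linarith
  have hstep3 : {ω : ((Fin n × Fin N) ⊕ Unit) ⊕ (Fin n ⊕ Fin N) → ℝ | ∀ v ∈ K, τ + 1 ≤
        √((fun i => ω (Sum.inr (Sum.inl i))) ⬝ᵥ fun i => ω (Sum.inr (Sum.inl i))) +
          ∑ j, ω (Sum.inr (Sum.inr j)) * v j}ᶜ ⊆
      (fun ω j => ω (Sum.inr (Sum.inr j))) ⁻¹' {h : Fin N → ℝ | T.card * (1 + α ^ 2 - softRisk α) + N * softRisk α + d / 4 * N ≤
        ∑ j, subdist T sg α j (h j)} ∪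
      (fun ω j => ω (Sum.inr (Sum.inl j))) ⁻¹' {g : Fin n → ℝ | g ⬝ᵥ g ≤ Fintype.card (Fin n) - d / (4 * δ) * (δ * N)} := by
    intro ω hω
    by_contra hcon
    rw [Set.mem_union, not_or] at hcon
    have hw : ∑ j, subdist T sg α j (ω (Sum.inr (Sum.inr j))) <
        T.card * (1 + α ^ 2 - softRisk α) + N * softRisk α + d / 4 * N := lt_of_not_ge hcon.1
    have hg : (Fintype.card (Fin n) : ℝ) - d / (4 * δ) * (δ * N) <
        (fun i => ω (Sum.inr (Sum.inl i))) ⬝ᵥ fun i => ω (Sum.inr (Sum.inl i)) := lt_of_not_ge hcon.2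
    refine hω fun v hv => ?_
    have h1 := neg_dot_le (T := T) (sg := sg) (α := α) (h := fun j => ω (Sum.inr (Sum.inr j))) hv.1
    have h2 : √(∑ j, subdist T sg α j (ω (Sum.inr (Sum.inr j)))) ≤ √N * √(m + d / 4) := by
      rw [← Real.sqrt_mul hN'.le]
      refine Real.sqrt_le_sqrt (hw.le.trans ?_)
      have : T.card * (1 + α ^ 2 - softRisk α) ≤ s * N * (1 + α ^ 2 - softRisk α) := by
        gcongr; nlinarith [sq_nonneg α]
      rw [hm]; linarith
    have h3 : √N * √(δ - d / 4) ≤ √((fun i => ω (Sum.inr (Sum.inl i))) ⬝ᵥ fun i => ω (Sum.inr (Sum.inl i))) := by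
      rw [← Real.sqrt_mul hN'.le]
      refine Real.sqrt_le_sqrt (le_trans (le_of_eq ?_) hg.le)
      rw [Fintype.card_fin, hn]; field_simp
    have h4 : α * coneVal T sg v ≤ √N * η := by
      calc α * coneVal T sg v ≤ α * (η / (α + 1) * √N) := by gcongr; exact hv.2
        _ = √N * η * (α / (α + 1)) := by ring
        _ ≤ √N * η * 1 := by gcongr; rw [div_le_one (by positivity)]; linarith
        _ = _ := mul_one _
    have h5 : √N * √(δ - d / 4) = √N * √(m + d / 4) + 2 * (√N * η) := by rw [hη]; ring
    rw [hτ]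
    linarith
  have hgt := gaussian_coord_tail (P := ((Fin n × Fin N) ⊕ Unit) ⊕ (Fin n ⊕ Fin N)) (Sum.inl (Sum.inr ())) ((√N * η / 4) ^ 2)
  have hW' := ((measurePreserving_inr (P := Fin n) (Q := Fin N)).comp
      (measurePreserving_inr (P := (Fin n × Fin N) ⊕ Unit) (Q := Fin n ⊕ Fin N))).measure_preimage_le _ |>.trans (hW T sg hsg)
  have hG' := ((measurePreserving_inl (P := Fin n) (Q := Fin N)).comp
      (measurePreserving_inr (P := (Fin n × Fin N) ⊕ Unit) (Q := Fin n ⊕ Fin N))).measure_preimage_le _ |>.trans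
        (hG (P := Fin n) (δ * N) (by rw [Fintype.card_fin, hn])).2
  have hexp : ∀ x : ℝ, c ≤ x → Real.exp (-x * N) ≤ Real.exp (-c * N) := fun x hx =>
    Real.exp_le_exp.2 (by nlinarith)
  have hcc : c ≤ c1 ∧ c ≤ c2 * δ ∧ c ≤ η ^ 2 / 64 :=
    ⟨(min_le_left _ _).trans (min_le_left _ _), (min_le_left _ _).trans (min_le_right _ _), min_le_right _ _⟩
  have q1 := hexp _ hcc.1
  have q2 := hexp _ hcc.2.1
  have q3 := hexp _ hcc.2.2
  have hge : Real.exp (-c * N) ≤ Real.exp (c * (144 / η ^ 2)) * Real.exp (-c * N) :=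
    le_mul_of_one_le_left (Real.exp_pos _).le (Real.one_le_exp (by positivity))
  calc _ ≤ μ ((fun ω p => ω (Sum.inl (Sum.inl p))) ⁻¹' B) := hstep1
    _ ≤ μ Rᶜ + μ {ω | (√N * η / 4) ^ 2 ≤ ω (Sum.inl (Sum.inr ())) ^ 2} := (measure_mono hstep2).trans (measure_union_le _ _)
    _ ≤ (ENNReal.ofReal (Real.exp (-c1 * N)) + ENNReal.ofReal (Real.exp (-c2 * (δ * N)))) +
        ENNReal.ofReal (2 * Real.exp (-(√N * η / 4) ^ 2 / 4)) := by
      refine add_le_add (hcomp.trans ((measure_mono hstep3).trans ((measure_union_le _ _).trans (add_le_add hW' hG')))) hgt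
    _ = ENNReal.ofReal (Real.exp (-c1 * N) + Real.exp (-(c2 * δ) * N) + 2 * Real.exp (-(η ^ 2 / 64) * N)) := by
      rw [← ENNReal.ofReal_add (by positivity) (by positivity), ← ENNReal.ofReal_add (by positivity) (by positivity)]
      congr 3
      · ring_nf
      · congr 1
        rw [div_pow, mul_pow, hsn]; ring
    _ ≤ _ := ENNReal.ofReal_le_ofReal (by linarith)

end RestrictedEigenvalue

end Lasso

namespace Lasso

open Matrix

section Risk
variable {n N : ℕ}

lemma continuous_obj (X : Matrix (Fin n) (Fin N) ℝ) (y : Fin n → ℝ) (lam : ℝ) : Continuous (obj X y lam) := by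
  have h : Continuous fun θ : Fin N → ℝ => resid X y θ := by
    unfold resid
    exact continuous_const.sub (Continuous.matrix_mulVec continuous_const continuous_id)
  unfold obj l1
  simp only [dotProduct]
  have h2 : ∀ i, Continuous fun θ : Fin N → ℝ => resid X y θ i := fun i => (continuous_apply i).comp h
  fun_prop

lemma exists_isLasso (X : Matrix (Fin n) (Fin N) ℝ) (y : Fin n → ℝ) {lam : ℝ} (hl : 0 < lam) : ∃ θ, IsLasso X y lam θ := by
  refine (continuous_obj X y lam).exists_forall_le ?_
  refine Filter.tendsto_atTop_mono (fun θ => ?_) ((tendsto_norm_cocompact_atTop (E := Fin N → ℝ)).const_mul_atTop hl)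
  have h1 : ‖θ‖ ≤ l1 θ := (pi_norm_le_iff_of_nonneg (l1_nonneg θ)).2 fun i =>
    Finset.single_le_sum (f := fun i => |θ i|) (fun i _ => abs_nonneg _) (Finset.mem_univ i)
  have h2 := ss_nonneg (resid X y θ)
  rw [obj]
  nlinarith

/-- A choice of signs, nonzero even where the vector vanishes. -/
def signOf (θ : Fin N → ℝ) (j : Fin N) : ℝ := if 0 ≤ θ j then 1 else -1

lemma signOf_sq (θ : Fin N → ℝ) (j : Fin N) : signOf θ j ^ 2 = 1 := by
  unfold signOf; split_ifs <;> norm_num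

lemma coneVal_le_l1_sub {θ : Fin N → ℝ} {T : Finset (Fin N)} (w : Fin N → ℝ) :
    coneVal T (signOf θ) w - 2 * ∑ j ∈ Tᶜ, |θ j| ≤ l1 (θ + w) - l1 θ := by
  rw [l1, l1, ← Finset.sum_sub_distrib, ← Finset.sum_add_sum_compl T, coneVal, Finset.mul_sum, add_sub_assoc,
    ← Finset.sum_sub_distrib]
  refine add_le_add (Finset.sum_le_sum fun j _ => ?_) (Finset.sum_le_sum fun j _ => ?_)
  · simp only [Pi.add_apply, signOf]
    split_ifs with h
    · rw [abs_of_nonneg h]; linarith [le_abs_self (θ j + w j)]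
    · rw [abs_of_neg (not_le.1 h)]; linarith [neg_abs_le (θ j + w j)]
  · have := abs_sub (θ j + w j) (θ j)
    rw [add_sub_cancel_left] at this
    simp only [Pi.add_apply]
    linarith

lemma neg_l1_le_coneVal {θ : Fin N → ℝ} {T : Finset (Fin N)} (w : Fin N → ℝ) : -l1 w ≤ coneVal T (signOf θ) w := by
  rw [l1, ← Finset.sum_add_sum_compl T, coneVal, neg_add, ← Finset.sum_neg_distrib, ← Finset.sum_neg_distrib]
  refine add_le_add (Finset.sum_le_sum fun j _ => ?_) (Finset.sum_le_sum fun j _ => ?_)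
  · unfold signOf
    split_ifs
    · linarith [neg_abs_le (w j)]
    · linarith [le_abs_self (w j)]
  · linarith [abs_nonneg (w j)]

lemma coneVal_smul {T : Finset (Fin N)} {sg : Fin N → ℝ} {c : ℝ} (hc : 0 ≤ c) (w : Fin N → ℝ) :
    coneVal T sg (c • w) = c * coneVal T sg w := by
  simp only [coneVal, Pi.smul_apply, smul_eq_mul, abs_mul, abs_of_nonneg hc, mul_add, Finset.mul_sum]
  congr 1
  exact Finset.sum_congr rfl fun j _ => by ring

lemma l1_le_sqrt (w : Fin N → ℝ) : l1 w ≤ √N * √(w ⬝ᵥ w) := by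
  rw [← Real.sqrt_mul (Nat.cast_nonneg N)]
  apply Real.le_sqrt_of_sq_le
  simpa using l1_sq_le w

lemma resid_yvec (X : Matrix (Fin n) (Fin N) ℝ) (z : Fin n → ℝ) (σ : ℝ) (θs θ : Fin N → ℝ) :
    resid X (yvec σ θs X z) θ = σ • z - X *ᵥ (θ - θs) := by
  ext i
  simp only [resid, yvec, mulVec_sub, Pi.sub_apply, Pi.smul_apply, smul_eq_mul]
  simp only [mulVec, dotProduct]
  ring

/-- Regularity of the design and the noise relative to `θs`. -/
structure Regular (σ lmin lmax : ℝ) (Bd : ℝ → ℝ) (θs : Fin N → ℝ) (X : Matrix (Fin n) (Fin N) ℝ) (z : Fin n → ℝ) : Prop where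
  noise_lower : (n : ℝ) / 2 ≤ z ⬝ᵥ z
  noise_upper : z ⬝ᵥ z ≤ 2 * n
  frob_le : frob X ≤ 2 * N
  risk : ∀ K, 0 ≤ K → ∀ lam ∈ Set.Icc lmin lmax, ∀ θ, obj X (yvec σ θs X z) lam θ ≤ obj X (yvec σ θs X z) lam θs + K * N →
    (θ - θs) ⬝ᵥ (θ - θs) ≤ Bd K * N ∧ resid X (yvec σ θs X z) θ ⬝ᵥ resid X (yvec σ θs X z) θ ≤ Bd K * N

lemma risk_bound {δ σ lmin lmax ζ c₀ M K lam : ℝ} (hδ : 0 < δ) (hl : 0 < lmin) (hlam : lam ∈ Set.Icc lmin lmax) (hM : 0 ≤ M)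
    (hζ : 0 < ζ) (hc₀ : 0 < c₀) (hK : 0 ≤ K) (hn : (n : ℝ) = δ * N) {θs θ : Fin N → ℝ} {T : Finset (Fin N)}
    (hT : ∑ j ∈ Tᶜ, |θs j| ≤ M * N) {X : Matrix (Fin n) (Fin N) ℝ} {z : Fin n → ℝ}
    (hz : z ⬝ᵥ z ≤ 2 * n)
    (hX : ∀ v : Fin N → ℝ, v ⬝ᵥ v = 1 → coneVal T (signOf θs) v ≤ ζ * √N → c₀ ≤ (X *ᵥ v) ⬝ᵥ (X *ᵥ v))
    (hobj : obj X (yvec σ θs X z) lam θ ≤ obj X (yvec σ θs X z) lam θs + K * N) :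
    (θ - θs) ⬝ᵥ (θ - θs) ≤ (((K + 2 * σ ^ 2 * δ + 2 * lmax * M) / (lmin * ζ)) ^ 2 +
      8 * (K + 2 * σ ^ 2 * δ + 2 * lmax * M + 2 * lmax ^ 2 / c₀) / c₀) * N := by
  obtain ⟨hlam1, hlam2⟩ := hlam
  have hlam0 : 0 < lam := hl.trans_le hlam1
  have hlmax : 0 < lmax := hlam0.trans_le hlam2
  set w := θ - θs with hw
  have hθ : θ = θs + w := by rw [hw]; abel
  set E := K + 2 * σ ^ 2 * δ + 2 * lmax * M with hE
  have hE0 : 0 ≤ E := by positivity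
  set b := √(w ⬝ᵥ w) with hb
  have hb0 : 0 ≤ b := Real.sqrt_nonneg _
  have hbb : b ^ 2 = w ⬝ᵥ w := Real.sq_sqrt (ss_nonneg w)
  have hN0 : (0 : ℝ) ≤ N := Nat.cast_nonneg N
  have hsn : √(N : ℝ) ^ 2 = N := Real.sq_sqrt hN0
  set A := (X *ᵥ w) ⬝ᵥ (X *ᵥ w) with hA
  set q := z ⬝ᵥ (X *ᵥ w) with hq
  have hbasic : A / 2 - σ * q + lam * (l1 θ - l1 θs) ≤ K * N := by
    have e1 : resid X (yvec σ θs X z) θ = σ • z - X *ᵥ w := resid_yvec X z σ θs θ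
    have e2 : resid X (yvec σ θs X z) θs = σ • z := by rw [resid_yvec, sub_self, mulVec_zero, sub_zero]
    simp only [obj, e1, e2, ss_sub, smul_dotProduct, dotProduct_smul, smul_eq_mul] at hobj
    linarith
  have hl1 : coneVal T (signOf θs) w - 2 * (M * N) ≤ l1 θ - l1 θs := by
    have := coneVal_le_l1_sub (θ := θs) (T := T) w
    rw [hθ]; linarith
  have hl1' := mul_le_mul_of_nonneg_left hl1 hlam0.le
  have hsq : ∀ t : ℝ, 0 ≤ t ^ 2 * A - 2 * t * (σ * q) + σ ^ 2 * (z ⬝ᵥ z) := by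
    intro t
    have := ss_nonneg (t • (X *ᵥ w) - σ • z)
    rw [ss_sub] at this
    simp only [smul_dotProduct, dotProduct_smul, smul_eq_mul, dotProduct_comm (X *ᵥ w) z, ← hq, ← hA] at this
    linarith
  have hzz : σ ^ 2 * (z ⬝ᵥ z) ≤ 2 * σ ^ 2 * δ * N := by
    have := mul_le_mul_of_nonneg_left hz (sq_nonneg σ)
    rw [hn] at this; linarith
  have hMl : lam * (2 * (M * N)) ≤ 2 * lmax * M * N := by
    have : 0 ≤ M * N := by positivity
    nlinarith
  rw [add_mul, ← hbb]
  have hnn1 : 0 ≤ (E / (lmin * ζ)) ^ 2 * N := by positivity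
  have hnn2 : 0 ≤ 8 * (E + 2 * lmax ^ 2 / c₀) / c₀ * N := by positivity
  by_cases hcone : coneVal T (signOf θs) w ≤ ζ * √N * b
  · have hAb : c₀ * b ^ 2 ≤ A := by
      rcases hb0.eq_or_lt with h | h
      · rw [← h]; simpa using ss_nonneg (X *ᵥ w)
      · have h1 := hX (b⁻¹ • w) (by
          rw [smul_dotProduct, dotProduct_smul, smul_eq_mul, smul_eq_mul, ← hbb]; field_simp) (by
          rw [coneVal_smul (by positivity), inv_mul_le_iff₀ h]; linarith)
        rw [mulVec_smul, smul_dotProduct, dotProduct_smul, smul_eq_mul, smul_eq_mul, ← hA] at h1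
        have : A = b ^ 2 * (b⁻¹ * (b⁻¹ * A)) := by field_simp
        rw [this]
        nlinarith [sq_nonneg b]
    have h2 := hsq (1 / 2)
    have h3 : -(√N * b) ≤ coneVal T (signOf θs) w := by
      linarith [neg_l1_le_coneVal (θ := θs) (T := T) w, l1_le_sqrt w]
    have h4 : lam * (√N * b) ≤ lmax * (√N * b) := by gcongr
    have h5 := mul_le_mul_of_nonneg_left h3 hlam0.le
    have h6 : c₀ / 4 * b ^ 2 ≤ E * N + lmax * (√N * b) := by
      rw [hE]; linarith
    have h7 : lmax * (√N * b) ≤ c₀ / 8 * b ^ 2 + 2 * lmax ^ 2 / c₀ * N := by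
      have : 0 ≤ (c₀ * b - 4 * lmax * √N) ^ 2 / (8 * c₀) := by positivity
      have e : (c₀ * b - 4 * lmax * √N) ^ 2 / (8 * c₀) =
          c₀ / 8 * b ^ 2 + 2 * lmax ^ 2 / c₀ * (√N) ^ 2 - lmax * (√N * b) := by field_simp; ring
      rw [e, hsn] at this
      linarith
    have h8 : b ^ 2 ≤ 8 * (E + 2 * lmax ^ 2 / c₀) / c₀ * N := by
      rw [div_mul_eq_mul_div, le_div_iff₀ hc₀]; linarith
    linarith
  · push Not at hcone
    have h2 := hsq 1
    have h3 := mul_le_mul_of_nonneg_left hcone.le hlam0.le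
    have h4 : lmin * (ζ * √N * b) ≤ lam * (ζ * √N * b) := by gcongr
    have h5 : lmin * ζ * (√N * b) ≤ E * N := by
      have : 0 ≤ σ ^ 2 * δ * N := by positivity
      rw [hE]; linarith
    have h6 : b ^ 2 ≤ (E / (lmin * ζ)) ^ 2 * N := by
      rcases hN0.eq_or_lt with h | h
      · have hNz : N = 0 := by exact_mod_cast h.symm
        subst hNz
        rw [hbb]; simp [dotProduct]
      · have hs : 0 < √(N : ℝ) := Real.sqrt_pos.2 h
        have : b ≤ E / (lmin * ζ) * √N := by
          rw [div_mul_eq_mul_div, le_div_iff₀ (by positivity)]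
          refine le_of_mul_le_mul_left ?_ hs
          calc √(N : ℝ) * (b * (lmin * ζ)) = lmin * ζ * (√N * b) := by ring
            _ ≤ E * (√N : ℝ) ^ 2 := by rw [hsn]; exact h5
            _ = _ := by ring
        calc b ^ 2 ≤ (E / (lmin * ζ) * √N) ^ 2 := by gcongr
          _ = _ := by rw [mul_pow, hsn]
    linarith

lemma resid_bound {δ σ lmax B K lam : ℝ} (hB : 0 ≤ B) (hlam : 0 ≤ lam) (hlam2 : lam ≤ lmax) (hn : (n : ℝ) = δ * N)
    {θs θ : Fin N → ℝ} {X : Matrix (Fin n) (Fin N) ℝ} {z : Fin n → ℝ} (hz : z ⬝ᵥ z ≤ 2 * n)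
    (hobj : obj X (yvec σ θs X z) lam θ ≤ obj X (yvec σ θs X z) lam θs + K * N)
    (hw : (θ - θs) ⬝ᵥ (θ - θs) ≤ B * N) :
    resid X (yvec σ θs X z) θ ⬝ᵥ resid X (yvec σ θs X z) θ ≤ (2 * σ ^ 2 * δ + 2 * K + 2 * lmax * √B) * N := by
  have e2 : resid X (yvec σ θs X z) θs = σ • z := by rw [resid_yvec, sub_self, mulVec_zero, sub_zero]
  rw [obj, obj, e2, smul_dotProduct, dotProduct_smul, smul_eq_mul, smul_eq_mul] at hobj
  have h1 : l1 θs - l1 θ ≤ √B * N := by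
    have h1 : l1 θs - l1 θ ≤ l1 (θ - θs) := by
      rw [l1, l1, l1, ← Finset.sum_sub_distrib]
      refine Finset.sum_le_sum fun j _ => ?_
      rw [Pi.sub_apply, abs_sub_comm]
      exact abs_sub_abs_le_abs_sub _ _
    have h3 : √N * √((θ - θs) ⬝ᵥ (θ - θs)) ≤ √N * √(B * N) := by gcongr
    rw [Real.sqrt_mul hB, mul_left_comm, Real.mul_self_sqrt (Nat.cast_nonneg N)] at h3
    linarith [l1_le_sqrt (θ - θs)]
  have h2 : lam * (l1 θs - l1 θ) ≤ lmax * (√B * N) :=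
    (mul_le_mul_of_nonneg_left h1 hlam).trans (mul_le_mul_of_nonneg_right hlam2 (by positivity))
  have h4 := mul_le_mul_of_nonneg_left hz (sq_nonneg σ)
  rw [hn] at h4
  linarith

end Risk

end Lasso

namespace Lasso

open Matrix

section Regularity

lemma frob_upper_whp : ∃ c > 0, ∀ n N : ℕ, 0 < n → PX n N {X | 2 * (N : ℝ) < frob X} ≤ ENNReal.ofReal (Real.exp (-c * N)) := by
  obtain ⟨c, hc, h⟩ := ss_chernoff (κ := 1 / 2) (by norm_num)
  refine ⟨c, hc, fun n N hn => ?_⟩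
  have h1 := (h (P := Fin n × Fin N) (n * N) (by simp)).1
  have hn' : (1 : ℝ) ≤ n := by exact_mod_cast hn
  have hN' : (0 : ℝ) ≤ N := Nat.cast_nonneg N
  refine le_trans ?_ (h1.trans (ENNReal.ofReal_le_ofReal (Real.exp_le_exp.2 ?_)))
  · refine (measure_mono (fun X hX => ?_)).trans ((measurePreserving_design (N := N) hn).measure_preimage_le _)
    have hX : 2 * (N : ℝ) < frob X := hX
    have e : (fun p : Fin n × Fin N => √n * X p.1 p.2) ⬝ᵥ (fun p => √n * X p.1 p.2) = n * frob X := by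
      simp only [dotProduct, frob, Fintype.sum_prod_type, Finset.mul_sum]
      refine Finset.sum_congr rfl fun i _ => Finset.sum_congr rfl fun j _ => ?_
      rw [mul_mul_mul_comm, Real.mul_self_sqrt (by positivity)]
    change _ ≤ (fun p : Fin n × Fin N => √n * X p.1 p.2) ⬝ᵥ (fun p => √n * X p.1 p.2)
    rw [e, Fintype.card_prod, Fintype.card_fin, Fintype.card_fin]
    push_cast
    nlinarith
  · have : c * N ≤ c * (n * N) := by gcongr; exact le_mul_of_one_le_left hN' hn'
    linarith

instance (n N : ℕ) : IsProbabilityMeasure (PX n N) := by unfold PX; infer_instance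

instance (n : ℕ) : IsProbabilityMeasure (Pz n) := by unfold Pz; infer_instance

lemma pmodel_fst_le {n N : ℕ} (S : Set (Fin n → Fin N → ℝ)) : Pmodel n N {ω | ω.1 ∈ S} ≤ PX n N S :=
  (measurePreserving_fst (μ := PX n N) (ν := Pz n)).measure_preimage_le S

lemma pmodel_snd_le {n N : ℕ} (S : Set (Fin n → ℝ)) : Pmodel n N {ω | ω.2 ∈ S} ≤ Pz n S :=
  (measurePreserving_snd (μ := PX n N) (ν := Pz n)).measure_preimage_le S

lemma regular_whp {δ σ lmin lmax q : ℝ} (hδ : 0 < δ) (hl : 0 < lmin) (hll : lmin ≤ lmax)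
    {Dfam : (M : ℕ) → Set (Fin M → ℝ)} (hD : DFamSpec δ Dfam q) :
    ∃ Bd : ℝ → ℝ, (∀ K, 0 ≤ K → 0 < Bd K) ∧ ∃ C c : ℝ, 0 < C ∧ 0 < c ∧ ∀ N n : ℕ, 0 < N → (n : ℝ) = δ * N → ∀ θs ∈ Dfam N,
      Pmodel n N {ω | ¬ Regular σ lmin lmax Bd θs ω.1 ω.2} ≤ ENNReal.ofReal (C * Real.exp (-c * N)) := by
  obtain ⟨-, s, α, M, hs, hα, hM, hlt, hT⟩ := dfam_control hδ hD
  obtain ⟨ζ, c₀, C₁, c₁, hζ, hc₀, hc₁, hRE⟩ := restricted_eigenvalue hδ hs hα hlt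
  obtain ⟨c₂, hc₂, hfrob⟩ := frob_upper_whp
  obtain ⟨c₃, hc₃, hss⟩ := ss_chernoff (κ := 1 / 2) (by norm_num)
  have hlmax : 0 < lmax := hl.trans_le hll
  set B : ℝ → ℝ := fun K => ((K + 2 * σ ^ 2 * δ + 2 * lmax * M) / (lmin * ζ)) ^ 2 +
      8 * (K + 2 * σ ^ 2 * δ + 2 * lmax * M + 2 * lmax ^ 2 / c₀) / c₀ with hB
  have hB0 : ∀ K, 0 ≤ K → 0 ≤ B K := fun K hK => by positivity
  set c := min c₁ (min c₂ (c₃ * δ)) with hc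
  have hcc : c ≤ c₁ ∧ c ≤ c₂ ∧ c ≤ c₃ * δ :=
    ⟨min_le_left _ _, (min_le_right _ _).trans (min_le_left _ _), (min_le_right _ _).trans (min_le_right _ _)⟩
  refine ⟨fun K => B K + (2 * σ ^ 2 * δ + 2 * K + 2 * lmax * √(B K)) + 1, fun K hK => by
    have := hB0 K hK
    positivity, |C₁| + 3, c, by positivity, by positivity, fun N n hN hn θs hθs => ?_⟩
  have hN' : (0 : ℝ) < N := by exact_mod_cast hN
  have hn' : (0 : ℝ) < n := by rw [hn]; positivity
  have hn0 : 0 < n := by exact_mod_cast hn'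
  obtain ⟨T, hT1, hT2⟩ := hT N hN θs hθs
  have hz := hss (P := Fin n) n (by simp)
  set S₁ : Set (Fin n → Fin N → ℝ) := {X | ∃ v : Fin N → ℝ, v ⬝ᵥ v = 1 ∧ coneVal T (signOf θs) v ≤ ζ * √N ∧
        (fun i => ∑ j, X i j * v j) ⬝ᵥ (fun i => ∑ j, X i j * v j) < c₀} with hS₁
  set S₂ : Set (Fin n → Fin N → ℝ) := {X | 2 * (N : ℝ) < frob X} with hS₂
  set S₃ : Set (Fin n → ℝ) := {g | (Fintype.card (Fin n) : ℝ) + 1 / 2 * n ≤ g ⬝ᵥ g} with hS₃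
  set S₄ : Set (Fin n → ℝ) := {g | g ⬝ᵥ g ≤ (Fintype.card (Fin n) : ℝ) - 1 / 2 * n} with hS₄
  have hsub : {ω : (Fin n → Fin N → ℝ) × (Fin n → ℝ) | ¬ Regular σ lmin lmax
      (fun K => B K + (2 * σ ^ 2 * δ + 2 * K + 2 * lmax * √(B K)) + 1) θs ω.1 ω.2} ⊆
      (({ω | ω.1 ∈ S₁} ∪ {ω | ω.1 ∈ S₂}) ∪ {ω | ω.2 ∈ S₃}) ∪ {ω | ω.2 ∈ S₄} := by
    rintro ⟨X, z⟩ hω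
    by_contra hcon
    simp only [Set.mem_union, not_or] at hcon
    obtain ⟨⟨⟨h1, h2⟩, h3⟩, h4⟩ := hcon
    have h1 : ¬ ∃ v : Fin N → ℝ, v ⬝ᵥ v = 1 ∧ coneVal T (signOf θs) v ≤ ζ * √N ∧
        (fun i => ∑ j, X i j * v j) ⬝ᵥ (fun i => ∑ j, X i j * v j) < c₀ := h1
    have h2 : frob X ≤ 2 * N := not_lt.1 h2
    have h3 : z ⬝ᵥ z < (Fintype.card (Fin n) : ℝ) + 1 / 2 * n := lt_of_not_ge h3
    have h4 : (Fintype.card (Fin n) : ℝ) - 1 / 2 * n < z ⬝ᵥ z := lt_of_not_ge h4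
    rw [Fintype.card_fin] at h3 h4
    refine hω ⟨by dsimp only; linarith, by dsimp only; linarith, h2, fun K hK lam hlam θ hobj => ?_⟩
    have hzz : z ⬝ᵥ z ≤ 2 * n := by linarith
    have hr := risk_bound hδ hl hlam hM hζ hc₀ hK hn hT2 hzz (fun v hv1 hv2 => by
      by_contra hlt'
      exact h1 ⟨v, hv1, hv2, not_le.1 hlt'⟩) hobj
    have hr2 := resid_bound (hB0 K hK) (hl.trans_le hlam.1).le hlam.2 hn hzz hobj hr
    have hb := hB0 K hK
    have e1 : 0 ≤ (2 * σ ^ 2 * δ + 2 * K + 2 * lmax * √(B K)) * N := by positivity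
    have e2 : 0 ≤ B K * N := by positivity
    exact ⟨hr.trans (by change B K * N ≤ _; linarith), hr2.trans (by linarith)⟩
  have hexp : ∀ x : ℝ, c ≤ x → Real.exp (-x * N) ≤ Real.exp (-c * N) := fun x hx =>
    Real.exp_le_exp.2 (by nlinarith)
  have q1 := hexp _ hcc.1
  have q2 := hexp _ hcc.2.1
  have q3 := hexp _ hcc.2.2
  have e3 : -c₃ * (n : ℝ) = -(c₃ * δ) * N := by rw [hn]; ring
  rw [e3] at hz
  have p1 := (pmodel_fst_le S₁).trans (hRE N n hN hn T (signOf θs) hT1 (signOf_sq θs))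
  have p2 := (pmodel_fst_le S₂).trans (hfrob n N hn0)
  have p3 := (pmodel_snd_le (N := N) S₃).trans hz.1
  have p4 := (pmodel_snd_le (N := N) S₄).trans hz.2
  have hC : C₁ * Real.exp (-c₁ * N) ≤ |C₁| * Real.exp (-c * N) := by
    calc _ ≤ |C₁| * Real.exp (-c₁ * N) := by gcongr; exact le_abs_self _
      _ ≤ _ := by gcongr
  calc _ ≤ _ := measure_mono hsub
    _ ≤ ((ENNReal.ofReal (C₁ * Real.exp (-c₁ * N)) + ENNReal.ofReal (Real.exp (-c₂ * N))) +
        ENNReal.ofReal (Real.exp (-(c₃ * δ) * N))) + ENNReal.ofReal (Real.exp (-(c₃ * δ) * N)) := by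
      refine (measure_union_le _ _).trans (add_le_add ?_ p4)
      refine (measure_union_le _ _).trans (add_le_add ?_ p3)
      exact (measure_union_le _ _).trans (add_le_add p1 p2)
    _ ≤ ((ENNReal.ofReal (|C₁| * Real.exp (-c * N)) + ENNReal.ofReal (Real.exp (-c * N))) +
        ENNReal.ofReal (Real.exp (-c * N))) + ENNReal.ofReal (Real.exp (-c * N)) := by
      gcongr
    _ = ENNReal.ofReal ((|C₁| + 3) * Real.exp (-c * N)) := by
      rw [← ENNReal.ofReal_add (by positivity) (by positivity), ← ENNReal.ofReal_add (by positivity) (by positivity),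
        ← ENNReal.ofReal_add (by positivity) (by positivity)]
      congr 1; ring

end Regularity

end Lasso

namespace Lasso

open Matrix

section FixedPenalty

/-- The event that the data are regular and some Lasso solution satisfies `P`. -/
def lassoEvent {n N : ℕ} (σ lmin lmax : ℝ) (Bd : ℝ → ℝ) (θs : Fin N → ℝ) (lam : ℝ)
    (P : Matrix (Fin n) (Fin N) ℝ → (Fin n → ℝ) → (Fin N → ℝ) → Prop) : Set ((Fin n → Fin N → ℝ) × (Fin n → ℝ)) :=
  {ω | Regular σ lmin lmax Bd θs ω.1 ω.2 ∧ ∃ θ, IsLasso ω.1 (yvec σ θs ω.1 ω.2) lam θ ∧ P ω.1 ω.2 θ}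

lemma abs_log_one_add_sub_le {t : ℝ} (ht : |t| ≤ 1 / 2) : |t - Real.log (1 + t)| ≤ 2 * t ^ 2 := by
  obtain ⟨h1, h2⟩ := abs_le.1 ht
  have hp : 0 < 1 + t := by linarith
  have h3 := Real.log_le_sub_one_of_pos hp
  have h4 := Real.one_sub_inv_le_log_of_pos hp
  rw [abs_of_nonneg (by linarith)]
  have h5 : t - (1 - (1 + t)⁻¹) ≤ 2 * t ^ 2 := by
    have : t - (1 - (1 + t)⁻¹) = t ^ 2 / (1 + t) := by field_simp; ring
    rw [this, div_le_iff₀ hp]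
    nlinarith [sq_nonneg t]
  linarith

lemma signed_quadratic_le {τ x H b : ℝ} (hx0 : 0 < x) (hx1 : x ≤ 1 / 2) (hb : 0 < b) (hτ : τ = 1 ∨ τ = -1)
    (h : b < τ * H) : -(τ * x) * H + x ^ 2 / 2 * H ≤ -(x * b) / 2 := by
  have hx2 : x ^ 2 ≤ x * (1 / 2) := by rw [sq]; gcongr
  rcases hτ with rfl | rfl
  · rw [one_mul] at h
    have h1 := mul_le_mul_of_nonneg_right hx2 (hb.trans h).le
    have h2 := mul_lt_mul_of_pos_left h hx0
    linarith [mul_pos hx0 (hb.trans h)]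
  · have h1 := mul_lt_mul_of_pos_left h hx0
    have h2 := mul_nonneg (sq_nonneg x) (show 0 ≤ -1 * H by linarith)
    linarith [mul_pos hx0 hb]

/-- First-order quantity controlled by scaling the residual. -/
def scaleDev {n N : ℕ} (σ : ℝ) (θs : Fin N → ℝ) (X : Matrix (Fin n) (Fin N) ℝ) (z : Fin n → ℝ) (θ : Fin N → ℝ) : ℝ :=
  (z ⬝ᵥ resid X (yvec σ θs X z) θ) / σ - (n - l0 θ)

/-- First-order quantity controlled by stretching the design. -/
def stretchDev {n N : ℕ} (σ : ℝ) (θs : Fin N → ℝ) (X : Matrix (Fin n) (Fin N) ℝ) (z : Fin n → ℝ) (θ : Fin N → ℝ) : ℝ :=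
  let r := resid X (yvec σ θs X z) θ
  n * (((r ᵥ* X) ⬝ᵥ (r ᵥ* X)) / (r ⬝ᵥ r)) + (z ⬝ᵥ r) ^ 2 / (r ⬝ᵥ r) - (z ⬝ᵥ r) / σ - (N - l0 θ)

lemma l0_le {N : ℕ} (θ : Fin N → ℝ) : (l0 θ : ℝ) ≤ N := by
  have : l0 θ ≤ N := by
    unfold l0
    exact (Finset.card_le_univ _).trans (by simp)
  exact_mod_cast this

variable {m N : ℕ} {δ σ lmin lmax lam : ℝ} {Bd : ℝ → ℝ} {θs : Fin N → ℝ}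

lemma Regular.lasso {n : ℕ} {X : Matrix (Fin n) (Fin N) ℝ} {z : Fin n → ℝ} (h : Regular σ lmin lmax Bd θs X z)
    (hlam : lam ∈ Set.Icc lmin lmax) {θ : Fin N → ℝ} (hθ : IsLasso X (yvec σ θs X z) lam θ) :
    (θ - θs) ⬝ᵥ (θ - θs) ≤ Bd 0 * N ∧ resid X (yvec σ θs X z) θ ⬝ᵥ resid X (yvec σ θs X z) θ ≤ Bd 0 * N :=
  h.risk 0 le_rfl lam hlam θ (by rw [zero_mul, add_zero]; exact hθ θs)

lemma scale_whp (hδ : 0 < δ) (hσ : 0 < σ) (hl : 0 < lmin) (hB : 0 < Bd 0) (hn : ((m + 1 : ℕ) : ℝ) = δ * N)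
    (hlam : lam ∈ Set.Icc lmin lmax) {ε τ : ℝ} (hε : 0 < ε) (hε1 : ε ≤ 1) (hτ : |τ| = 1) :
    Pmodel (m + 1) N (lassoEvent σ lmin lmax Bd θs lam fun X z θ => ε * (m + 1 : ℕ) < τ * scaleDev σ θs X z θ) ≤
      ENNReal.ofReal (Real.exp (-(ε ^ 2 / (4 * (Bd 0 / (2 * δ * σ ^ 2) + 2 * (1 + 1 / δ)))) * (m + 1 : ℕ))) := by
  set B := Bd 0 with hBdef
  set A := B / (2 * δ * σ ^ 2) + 2 * (1 + 1 / δ) with hA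
  have hA2 : 2 ≤ A := by
    have h1 : 0 < B / (2 * δ * σ ^ 2) := by positivity
    have h2 : 0 < 1 / δ := by positivity
    rw [hA]; linarith
  set n : ℝ := ((m + 1 : ℕ) : ℝ) with hndef
  have hn0 : 0 < n := by rw [hndef]; positivity
  have hNn : (N : ℝ) = n / δ := by rw [hn]; field_simp
  set x := ε / (2 * A) with hx
  have hx0 : 0 < x := by positivity
  have hx1 : x ≤ 1 / 2 := by rw [hx, div_le_div_iff₀ (by positivity) (by norm_num)]; linarith
  have hta : |-(τ * x)| = x := by rw [abs_neg, abs_mul, hτ, one_mul, abs_of_pos hx0]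
  have ht2 : (-(τ * x)) ^ 2 = x ^ 2 := by rw [← sq_abs, hta]
  refine pmodel_scale_le (θs := θs) (t := -(τ * x)) (lam := lam) hσ (hl.trans_le hlam.1)
    (by linarith [(abs_le.1 hta.le).1]) fun X z hω => ?_
  obtain ⟨hreg, θ, hθ, hdev⟩ := hω
  refine ⟨θ, hθ, fun r hr _ => ?_⟩
  obtain ⟨-, hrB⟩ := hreg.lasso hlam hθ
  have hdev : ε * n < τ * scaleDev σ θs X z θ := hdev
  rw [scaleDev, ← hr, ← hndef] at hdev
  change resid X (yvec σ θs X z) θ ⬝ᵥ resid X (yvec σ θs X z) θ ≤ _ at hrB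
  rw [← hr, hNn] at hrB
  have hlog := abs_log_one_add_sub_le (t := -(τ * x)) (by rw [hta]; exact hx1)
  rw [ht2] at hlog ⊢
  have hk := l0_le θ
  have hk0 : (0 : ℝ) ≤ l0 θ := Nat.cast_nonneg _
  have h1 : (n - l0 θ) * (-(τ * x) - Real.log (1 + -(τ * x))) ≤ (1 + 1 / δ) * n * (2 * x ^ 2) := by
    refine (le_abs_self _).trans ?_
    rw [abs_mul]
    have : (1 + 1 / δ) * n = n + N := by rw [hNn]; ring
    rw [this]
    gcongr
    exact abs_le.2 ⟨by linarith, by linarith⟩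
  have h2 : x ^ 2 * (r ⬝ᵥ r) / (2 * σ ^ 2) ≤ x ^ 2 * (B / (2 * δ * σ ^ 2)) * n := by
    rw [div_le_iff₀ (by positivity)]
    calc x ^ 2 * (r ⬝ᵥ r) ≤ x ^ 2 * (B * (n / δ)) := by gcongr
      _ = _ := by field_simp
  have h3 := mul_lt_mul_of_pos_left hdev hx0
  have h4 : -(x * ε * n) + x ^ 2 * A * n = -(ε ^ 2 / (4 * A)) * n := by rw [hx]; field_simp; ring
  rw [← h4, hA]
  have e : -(τ * x) * (z ⬝ᵥ r) / σ = -(x * (τ * ((z ⬝ᵥ r) / σ - (n - l0 θ)))) - x * τ * (n - l0 θ) := by ring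
  rw [e]
  linarith

lemma stretch_whp (hδ : 0 < δ) (hσ : 0 < σ) (hl : 0 < lmin) (hB : 0 < Bd 0) (hn : ((m + 1 : ℕ) : ℝ) = δ * N)
    (hlam : lam ∈ Set.Icc lmin lmax) {ε τ : ℝ} (hε : 0 < ε) (hε1 : ε ≤ 1) (hτ : τ = 1 ∨ τ = -1) :
    Pmodel (m + 1) N (lassoEvent σ lmin lmax Bd θs lam fun X z θ =>
        resid X (yvec σ θs X z) θ ≠ 0 ∧ ε * (m + 1 : ℕ) < τ * stretchDev σ θs X z θ) ≤
      ENNReal.ofReal (4 * Real.exp (-(ε ^ 2 / (16 * (3 + 2 * (Bd 0 / (δ * σ ^ 2)) + 3 / δ))) * (m + 1 : ℕ))) := by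
  set B := Bd 0 with hBdef
  set A := 3 + 2 * (B / (δ * σ ^ 2)) + 3 / δ with hA
  have hA2 : 2 ≤ A := by
    have h1 : 0 < B / (δ * σ ^ 2) := by positivity
    have h2 : 0 < 3 / δ := by positivity
    rw [hA]; linarith
  set n : ℝ := ((m + 1 : ℕ) : ℝ) with hndef
  have hn0 : 0 < n := by rw [hndef]; positivity
  have hNn : (N : ℝ) = n / δ := by rw [hn]; field_simp
  set x := ε / (4 * A) with hx
  have hx0 : 0 < x := by positivity
  have hx1 : x ≤ 1 / 2 := by rw [hx, div_le_div_iff₀ (by positivity) (by norm_num)]; linarith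
  have hτ1 : |τ| = 1 := by rcases hτ with rfl | rfl <;> simp
  have hta : |-(τ * x)| = x := by rw [abs_neg, abs_mul, hτ1, one_mul, abs_of_pos hx0]
  have ht2 : (-(τ * x)) ^ 2 = x ^ 2 := by rw [← sq_abs, hta]
  refine pmodel_stretch_le (θs := θs) (a := -(τ * x)) (lam := lam) hσ (hl.trans_le hlam.1)
    (by linarith [(abs_le.1 hta.le).1]) fun X z hω => ?_
  obtain ⟨hreg, θ, hθ, -, hdev⟩ := hω
  refine ⟨θ, hθ, fun r hr hr0 β hβ => ?_⟩
  obtain ⟨-, hrB⟩ := hreg.lasso hlam hθ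
  have hdev : ε * n < τ * stretchDev σ θs X z θ := hdev
  rw [stretchDev, ← hr, ← hndef] at hdev
  change resid X (yvec σ θs X z) θ ⬝ᵥ resid X (yvec σ θs X z) θ ≤ _ at hrB
  rw [← hr, hNn] at hrB
  have hρ : 0 < r ⬝ᵥ r := (ss_nonneg r).lt_of_ne' fun h => hr0 (ss_eq_zero.1 h)
  have hlog := abs_log_one_add_sub_le (t := -(τ * x)) (by rw [hta]; exact hx1)
  rw [ht2] at hlog ⊢
  have hk := l0_le θ
  have hk0 : (0 : ℝ) ≤ l0 θ := Nat.cast_nonneg _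
  set ρ := r ⬝ᵥ r with hρdef
  set q := z ⬝ᵥ r with hqdef
  set L := (r ᵥ* X) ⬝ᵥ (r ᵥ* X) / ρ with hL
  set k : ℝ := (l0 θ : ℝ) with hkdef
  have h1 : (N - k) * (-(τ * x) - Real.log (1 + -(τ * x))) ≤ 2 / δ * n * x ^ 2 := by
    have e : 2 / δ * n * x ^ 2 = N * (2 * x ^ 2) := by rw [hNn]; ring
    rw [e]
    refine (mul_le_mul_of_nonneg_left ((le_abs_self _).trans hlog) (by linarith)).trans ?_
    gcongr
    linarith
  have hρ2 : ρ / σ ^ 2 ≤ B / (δ * σ ^ 2) * n := by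
    rw [div_le_iff₀ (by positivity)]
    calc ρ ≤ B * (n / δ) := hrB
      _ = _ := by field_simp
  have hq : q ^ 2 / ρ ≤ 2 * n := by
    rw [div_le_iff₀ hρ]
    refine (dot_sq_le z r).trans ?_
    gcongr
    exact hreg.noise_upper
  have hq2 : q / σ ≤ (q ^ 2 / ρ + ρ / σ ^ 2) / 2 := by
    have : 0 ≤ (q * σ - ρ) ^ 2 / (2 * ρ * σ ^ 2) := by positivity
    have e : (q * σ - ρ) ^ 2 / (2 * ρ * σ ^ 2) = (q ^ 2 / ρ + ρ / σ ^ 2) / 2 - q / σ := by field_simp; ring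
    linarith
  have hβρ : β ^ 2 * ρ ≤ 2 * (q ^ 2 / ρ) + 2 * (ρ / σ ^ 2) := by
    have : 0 ≤ (q / ρ + 1 / σ) ^ 2 * ρ := by positivity
    have e : (q / ρ + 1 / σ) ^ 2 * ρ + β ^ 2 * ρ = 2 * (q ^ 2 / ρ) + 2 * (ρ / σ ^ 2) := by rw [hβ]; field_simp; ring
    linarith
  set H := n * L + q ^ 2 / ρ - q / σ - (N - k) with hH
  have hsum : n * L + β ^ 2 * ρ ≤ H + (6 + 4 * (B / (δ * σ ^ 2)) + 1 / δ) * n := by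
    have e : 1 / δ * n = N := by rw [hNn]; ring
    have hp : 0 ≤ q ^ 2 / ρ := by positivity
    have hp2 : 0 ≤ ρ / σ ^ 2 := by positivity
    have e2 : n * L = H - q ^ 2 / ρ + q / σ + (N - k) := by rw [hH]; ring
    rw [e2, add_mul, add_mul, e]
    linarith
  have hsum2 := mul_le_mul_of_nonneg_left hsum (show 0 ≤ x ^ 2 / 2 by positivity)
  have hmain : -(τ * x) * H + x ^ 2 / 2 * H ≤ -(x * ε * n) / 2 := by
    rw [mul_assoc x]
    exact signed_quadratic_le hx0 hx1 (mul_pos hε hn0) hτ hdev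
  have h4 : -(x * ε * n) / 2 + x ^ 2 * A * n = -(ε ^ 2 / (16 * A)) * n := by rw [hx]; field_simp; ring
  rw [← h4, hA]
  have e : n * (-(τ * x) + x ^ 2 / 2) * L + -(τ * x) * β * q + x ^ 2 * β ^ 2 * ρ / 2 - (N - k) * Real.log (1 + -(τ * x)) =
      -(τ * x) * H + x ^ 2 / 2 * (n * L + β ^ 2 * ρ) + (N - k) * (-(τ * x) - Real.log (1 + -(τ * x))) := by
    rw [hH, hβ]; field_simp; ring
  rw [e]
  have hfin : x ^ 2 / 2 * ((6 + 4 * (B / (δ * σ ^ 2)) + 1 / δ) * n) + 2 / δ * n * x ^ 2 ≤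
      x ^ 2 * (3 + 2 * (B / (δ * σ ^ 2)) + 3 / δ) * n := by
    have : 0 ≤ x ^ 2 * n * (1 / δ) := by positivity
    have e : x ^ 2 * (3 + 2 * (B / (δ * σ ^ 2)) + 3 / δ) * n - (x ^ 2 / 2 * ((6 + 4 * (B / (δ * σ ^ 2)) + 1 / δ) * n) + 2 / δ * n * x ^ 2) =
      x ^ 2 * n * (1 / δ) / 2 := by ring
    linarith
  linarith

end FixedPenalty

end Lasso

namespace Lasso

open Matrix Filter Topology

section FixedPenaltyFit

variable {m N : ℕ} {δ σ lmin lmax lam : ℝ} {Bd : ℝ → ℝ} {θs : Fin N → ℝ}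

lemma abs_dot_le_half_add {n : ℕ} (u v : Fin n → ℝ) : |u ⬝ᵥ v| ≤ (u ⬝ᵥ u + v ⬝ᵥ v) / 2 := by
  have h1 := ss_nonneg (u + v)
  have h2 := ss_nonneg (u - v)
  rw [ss_add] at h1
  rw [ss_sub] at h2
  exact abs_le.2 ⟨by linarith, by linarith⟩

lemma measure_union_le_of_le {α : Type*} [MeasurableSpace α] {μ : Measure α} {s t : Set α} {a b : ℝ≥0∞}
    (hs : μ s ≤ a) (ht : μ t ≤ b) : μ (s ∪ t) ≤ a + b :=
  (measure_union_le s t).trans (add_le_add hs ht)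

lemma card_support_whp (hσ : 0 < σ) (hl : 0 < lmin) (hlam : lam ∈ Set.Icc lmin lmax) :
    Pmodel (m + 1) N (lassoEvent σ lmin lmax Bd θs lam fun _ _ θ => ((m + 1 : ℕ) : ℝ) < l0 θ) = 0 := by
  set n : ℝ := ((m + 1 : ℕ) : ℝ) with hndef
  set M : ℝ := (2 * n + Bd 0 * N) / (2 * σ) + Bd 0 * N / (2 * σ ^ 2) with hM
  have key : ∀ s : ℝ, 0 < s → s < 1 →
      Pmodel (m + 1) N (lassoEvent σ lmin lmax Bd θs lam fun _ _ θ => n < l0 θ) ≤ ENNReal.ofReal (Real.exp M * s) := by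
    intro s hs hs1
    rw [show Real.exp M * s = Real.exp (M + Real.log s) by rw [Real.exp_add M, Real.exp_log hs]]
    refine pmodel_scale_le (θs := θs) (t := s - 1) (lam := lam) hσ (hl.trans_le hlam.1) (by linarith) fun X z hω => ?_
    obtain ⟨hreg, θ, hθ, hk⟩ := hω
    refine ⟨θ, hθ, fun r hr _ => ?_⟩
    obtain ⟨-, hrB⟩ := hreg.lasso hlam hθ
    change resid X (yvec σ θs X z) θ ⬝ᵥ resid X (yvec σ θs X z) θ ≤ _ at hrB
    rw [← hr] at hrB
    have hz : z ⬝ᵥ z ≤ 2 * n := hreg.noise_upper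
    have hk1 : n + 1 ≤ l0 θ := by
      have h : m + 1 < l0 θ := Nat.cast_lt.1 (hk : ((m + 1 : ℕ) : ℝ) < l0 θ)
      rw [hndef]; exact_mod_cast h
    have hq := abs_dot_le_half_add z r
    have e1 : (s - 1) * (z ⬝ᵥ r) / σ ≤ (2 * n + Bd 0 * N) / (2 * σ) := by
      rw [div_le_div_iff₀ hσ (by positivity)]
      have : (s - 1) * (z ⬝ᵥ r) ≤ |z ⬝ᵥ r| := by
        refine (le_abs_self _).trans ?_
        rw [abs_mul]
        exact mul_le_of_le_one_left (abs_nonneg _) (abs_le.2 ⟨by linarith, by linarith⟩)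
      nlinarith
    have e2 : (s - 1) ^ 2 * (r ⬝ᵥ r) / (2 * σ ^ 2) ≤ Bd 0 * N / (2 * σ ^ 2) := by
      have h1 : (s - 1) ^ 2 ≤ 1 := by nlinarith
      have h2 : (s - 1) ^ 2 * (r ⬝ᵥ r) ≤ Bd 0 * N := (mul_le_of_le_one_left (ss_nonneg r) h1).trans hrB
      gcongr
    have e3 : -(n - l0 θ) * Real.log (1 + (s - 1)) ≤ Real.log s := by
      rw [add_sub_cancel]
      nlinarith [Real.log_neg hs hs1]
    rw [hM]
    linarith
  refine le_antisymm (ge_of_tendsto (x := 𝓝[>] (0 : ℝ)) (f := fun s => ENNReal.ofReal (Real.exp M * s)) ?_ ?_) bot_le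
  · have : Tendsto (fun s : ℝ => ENNReal.ofReal (Real.exp M * s)) (𝓝 0) (𝓝 (ENNReal.ofReal (Real.exp M * 0))) :=
      (ENNReal.continuous_ofReal.comp (continuous_const.mul continuous_id)).tendsto _
    rw [mul_zero, ENNReal.ofReal_zero] at this
    exact this.mono_left nhdsWithin_le_nhds
  · filter_upwards [Ioo_mem_nhdsGT (zero_lt_one' ℝ)] with s hs using key s hs.1 hs.2

lemma contract_exponent_le {g v : ℝ} (hg1 : g ≤ 1) (hv : v = g / 8 ∨ v = g / 8 / 2) :
    -(v - v ^ 2 / 2) * (1 + g / 2) + (v + 2 * v ^ 2) ≤ -(g ^ 2 / 64) := by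
  have e : -(v - v ^ 2 / 2) * (1 + g / 2) + (v + 2 * v ^ 2) = -(v * g / 2) + 5 / 2 * v ^ 2 + v ^ 2 * g / 4 := by ring
  have h : v ^ 2 * g ≤ v ^ 2 * 1 := by gcongr
  rw [e]
  rcases hv with rfl | rfl <;> nlinarith

lemma contract_whp (hσ : 0 < σ) (hl : 0 < lmin) (hn : ((m + 1 : ℕ) : ℝ) = δ * N)
    (hlam : lam ∈ Set.Icc lmin lmax) {g : ℝ} (hg0 : 0 < g) (hg1 : g ≤ 1) (hg : g * Bd 0 ≤ δ * σ ^ 2) :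
    Pmodel (m + 1) N (lassoEvent σ lmin lmax Bd θs lam fun X z θ =>
        (1 - g / (4 * (1 + g))) * (m + 1 : ℕ) ≤ z ⬝ᵥ z ∧
        (z ⬝ᵥ resid X (yvec σ θs X z) θ) ^ 2 ≤ g / (4 * (1 + g)) * (m + 1 : ℕ) *
          (resid X (yvec σ θs X z) θ ⬝ᵥ resid X (yvec σ θs X z) θ)) ≤
      ENNReal.ofReal (18 * Real.exp (-(g ^ 2 / 64) * (m + 1 : ℕ))) := by
  set n : ℝ := ((m + 1 : ℕ) : ℝ) with hndef
  have hmn : (m : ℝ) ≤ n := by rw [hndef]; push_cast; linarith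
  have hn0 : 0 < n := by rw [hndef]; positivity
  set c := g / (4 * (1 + g)) with hc
  have hc0 : 0 < c := by positivity
  have hc1 : c ≤ 1 / 4 := by rw [hc, div_le_div_iff₀ (by positivity) (by norm_num)]; linarith
  refine pmodel_contract_le (θs := θs) (u := g / 8) (lam := lam) hσ (hl.trans_le hlam.1) (by linarith) (by linarith)
    fun X z hω => ?_
  obtain ⟨hreg, θ, hθ, hz, hq⟩ := hω
  refine ⟨θ, hθ, fun r hr hr0 w hw => ?_⟩
  obtain ⟨hwB, -⟩ := hreg.lasso hlam hθ
  change (z ⬝ᵥ resid X (yvec σ θs X z) θ) ^ 2 ≤ c * n * (resid X (yvec σ θs X z) θ ⬝ᵥ resid X (yvec σ θs X z) θ) at hq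
  have hz : (1 - c) * n ≤ z ⬝ᵥ z := hz
  rw [← hr] at hq
  rw [← hw] at hwB
  have hρ : 0 < r ⬝ᵥ r := (ss_nonneg r).lt_of_ne' fun h => hr0 (ss_eq_zero.1 h)
  have hw0 : w ≠ 0 := by
    intro h0
    have hrz : r = σ • z := by rw [hr, resid_yvec, ← hw, h0, mulVec_zero, sub_zero]
    rw [hrz] at hq hρ
    simp only [dotProduct_smul, smul_dotProduct, smul_eq_mul] at hq hρ
    have hzp : 0 < z ⬝ᵥ z := lt_of_lt_of_le (by nlinarith) hz
    have e : (σ * (z ⬝ᵥ z)) ^ 2 = (z ⬝ᵥ z) * (σ * (σ * (z ⬝ᵥ z))) := by ring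
    rw [e] at hq
    have := le_of_mul_le_mul_right hq hρ
    nlinarith
  refine ⟨hw0, fun v hv => ?_⟩
  have hwp : 0 < w ⬝ᵥ w := (ss_nonneg w).lt_of_ne' fun h => hw0 (ss_eq_zero.1 h)
  have hv0 : 0 < v := by rcases hv with rfl | rfl <;> linarith
  have hv1 : v ≤ 1 / 8 := by rcases hv with rfl | rfl <;> linarith
  have h1 : g ≤ n * σ ^ 2 / (w ⬝ᵥ w) := by
    rw [le_div_iff₀ hwp]
    calc g * (w ⬝ᵥ w) ≤ g * (Bd 0 * N) := by gcongr
      _ = g * Bd 0 * N := by ring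
      _ ≤ δ * σ ^ 2 * N := by gcongr
      _ = _ := by rw [hn]; ring
  have h2 : (1 - 2 * c) * n ≤ (z ⬝ᵥ z) - (z ⬝ᵥ r) ^ 2 / (r ⬝ᵥ r) := by
    have : (z ⬝ᵥ r) ^ 2 / (r ⬝ᵥ r) ≤ c * n := by rwa [div_le_iff₀ hρ]
    linarith
  have h3 : (1 + g / 2) * n ≤ ((z ⬝ᵥ z) - (z ⬝ᵥ r) ^ 2 / (r ⬝ᵥ r)) * (n * σ ^ 2 / (w ⬝ᵥ w) + 1) := by
    have e : (1 + g / 2) * n = (1 - 2 * c) * n * (g + 1) := by rw [hc]; field_simp; ring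
    rw [e]
    have h7 : 0 ≤ (1 - 2 * c) * n := mul_nonneg (by linarith) hn0.le
    exact mul_le_mul h2 (by linarith) (by linarith) (h7.trans h2)
  have h4 := mul_le_mul_of_nonneg_left h3 (show 0 ≤ v - v ^ 2 / 2 by nlinarith)
  have hlog := (le_abs_self _).trans (abs_log_one_add_sub_le (t := -v) (by rw [abs_neg, abs_of_pos hv0]; linarith))
  have h5 : -(m * Real.log (1 - v)) ≤ (v + 2 * v ^ 2) * n := by
    have h6 : -Real.log (1 - v) ≤ v + 2 * v ^ 2 := by
      rw [neg_sq, ← sub_eq_add_neg] at hlog; linarith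
    calc -(m * Real.log (1 - v)) = m * (-Real.log (1 - v)) := by ring
      _ ≤ m * (v + 2 * v ^ 2) := by gcongr
      _ ≤ n * (v + 2 * v ^ 2) := by gcongr
      _ = _ := by ring
  have h6 := mul_le_mul_of_nonneg_right (contract_exponent_le hg1 hv) hn0.le
  linarith

lemma noise_lower_whp {κ : ℝ} (hκ : 0 < κ) : ∃ c > 0, ∀ m N : ℕ,
    Pmodel (m + 1) N {ω | ω.2 ⬝ᵥ ω.2 < (1 - κ) * (m + 1 : ℕ)} ≤ ENNReal.ofReal (Real.exp (-c * (m + 1 : ℕ))) := by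
  obtain ⟨c, hc, h⟩ := ss_chernoff hκ
  refine ⟨c, hc, fun m N => (pmodel_snd_le {z : Fin (m + 1) → ℝ | z ⬝ᵥ z < (1 - κ) * (m + 1 : ℕ)}).trans
    (le_trans (measure_mono fun z hz => ?_) (h (P := Fin (m + 1)) (m + 1 : ℕ) (by simp)).2)⟩
  have hz : z ⬝ᵥ z < (1 - κ) * (m + 1 : ℕ) := hz
  change z ⬝ᵥ z ≤ _
  rw [Fintype.card_fin]
  linarith

/-- The Lasso solution `θ` satisfies its first-order relations up to `ε` and is bounded away from degeneracy by `κ`. -/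
structure GoodFit {n N : ℕ} (σ κ ε : ℝ) (θs : Fin N → ℝ) (X : Matrix (Fin n) (Fin N) ℝ) (z : Fin n → ℝ)
    (θ : Fin N → ℝ) : Prop where
  scale : |scaleDev σ θs X z θ| ≤ ε * n
  stretch : |stretchDev σ θs X z θ| ≤ ε * n
  gap : κ * n ≤ n - l0 θ
  corr : κ * n ≤ z ⬝ᵥ resid X (yvec σ θs X z) θ
  resid_ss : κ * n ≤ resid X (yvec σ θs X z) θ ⬝ᵥ resid X (yvec σ θs X z) θ

lemma l0_mul_sq_le {n : ℕ} {X : Matrix (Fin n) (Fin N) ℝ} {y : Fin n → ℝ} {θ : Fin N → ℝ} (h : IsLasso X y lam θ)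
    (hl : 0 ≤ lam) : l0 θ * lam ^ 2 ≤ (resid X y θ ᵥ* X) ⬝ᵥ (resid X y θ ᵥ* X) := by
  rw [dotProduct, l0, ← nsmul_eq_mul, ← Finset.sum_const]
  refine (Finset.sum_le_sum fun j hj => ?_).trans
    (Finset.sum_le_sum_of_subset_of_nonneg (Finset.filter_subset _ _) fun j _ _ => mul_self_nonneg _)
  rw [← kkt_of_ne h hl j (by simpa using hj), sq_abs, sq]

lemma nondegenerate_of_dev (hδ : 0 < δ) (hσ : 0 < σ) (hl : 0 < lmin) (hB : 0 < Bd 0) {c : ℝ} (hc : 0 < c) :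
    ∃ κ > (0 : ℝ), ∃ ε₀ > (0 : ℝ), ε₀ ≤ 1 ∧ ∀ {n N : ℕ} {θs θ : Fin N → ℝ} {X : Matrix (Fin n) (Fin N) ℝ} {z : Fin n → ℝ} {lam : ℝ},
      0 < n → (n : ℝ) = δ * N → lam ∈ Set.Icc lmin lmax → Regular σ lmin lmax Bd θs X z →
      IsLasso X (yvec σ θs X z) lam θ → (l0 θ : ℝ) ≤ n → |scaleDev σ θs X z θ| ≤ ε₀ * n → stretchDev σ θs X z θ ≤ n →
      c * n * (resid X (yvec σ θs X z) θ ⬝ᵥ resid X (yvec σ θs X z) θ) < (z ⬝ᵥ resid X (yvec σ θs X z) θ) ^ 2 →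
      κ * n ≤ n - l0 θ ∧ κ * n ≤ z ⬝ᵥ resid X (yvec σ θs X z) θ ∧
        κ * n ≤ resid X (yvec σ θs X z) θ ⬝ᵥ resid X (yvec σ θs X z) θ := by
  set B := Bd 0 with hBdef
  set C := 1 + 1 / δ + (2 + B / δ) / (2 * σ) with hC
  have hC0 : 0 < C := by positivity
  set c₁ := lmin ^ 2 / (2 * C) with hc₁
  have hc₁0 : 0 < c₁ := by positivity
  set b := min (σ / 4) √(c * c₁) with hb
  have hb0 : 0 < b := lt_min (by positivity) (by positivity)
  have hb1 : b ≤ σ / 4 := min_le_left _ _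
  have hb2 : b ≤ √(c * c₁) := min_le_right _ _
  have hbσ : 0 < b / (2 * σ) := by positivity
  refine ⟨min b (min (b / (2 * σ)) (b ^ 2 / 2)), lt_min hb0 (lt_min hbσ (by positivity)), min (1 / 4) (b / (2 * σ)),
    lt_min (by norm_num) hbσ, (min_le_left _ _).trans (by norm_num), ?_⟩
  intro n N θs θ X z lam hn0 hn hlam hreg hθ hk hsc hst hq
  have hn0' : (0 : ℝ) < n := by exact_mod_cast hn0
  have hNn : (N : ℝ) = n / δ := by rw [hn]; field_simp
  obtain ⟨-, hρB⟩ := hreg.lasso hlam hθ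
  have hsup := l0_mul_sq_le hθ (hl.le.trans hlam.1)
  have hzu := hreg.noise_upper
  rw [scaleDev] at hsc
  simp only [stretchDev] at hst
  generalize resid X (yvec σ θs X z) θ = r at *
  have hcs := dot_sq_le z r
  have hhalf := abs_dot_le_half_add z r
  have hρ : 0 < r ⬝ᵥ r := by
    refine (ss_nonneg r).lt_of_ne' fun h => ?_
    rw [h] at hq hcs
    linarith
  set ρ := r ⬝ᵥ r
  set q := z ⬝ᵥ r
  set k : ℝ := (l0 θ : ℝ)
  obtain ⟨hs1, -⟩ := abs_le.1 hsc
  have hε1 : min (1 / 4) (b / (2 * σ)) * n ≤ 1 / 4 * n := by gcongr; exact min_le_left _ _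
  have hε2 : min (1 / 4) (b / (2 * σ)) * n ≤ b / (2 * σ) * n := by gcongr; exact min_le_right _ _
  have hbq : b * n ≤ q := by
    rcases le_or_gt k (n / 2) with hk2 | hk2
    · have h1 : 1 / 4 * n ≤ q / σ := by linarith
      rw [le_div_iff₀ hσ] at h1
      calc b * n ≤ σ / 4 * n := by gcongr
        _ = 1 / 4 * n * σ := by ring
        _ ≤ q := h1
    · have h1 : n * ((r ᵥ* X) ⬝ᵥ (r ᵥ* X) / ρ) ≤ C * n := by
        have h2 : 0 ≤ q ^ 2 / ρ := by positivity
        have h3 : q / σ ≤ (2 + B / δ) / (2 * σ) * n := by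
          rw [div_le_iff₀ hσ]
          have e : (2 + B / δ) / (2 * σ) * n * σ = (2 * n + B * (n / δ)) / 2 := by field_simp
          rw [e, ← hNn]
          linarith [le_abs_self q]
        have e : C * n = n + N + (2 + B / δ) / (2 * σ) * n := by rw [hC, hNn]; ring
        have hk0 : 0 ≤ k := Nat.cast_nonneg _
        linarith
      rw [mul_comm C, mul_le_mul_iff_right₀ hn0', div_le_iff₀ hρ] at h1
      have h2 : c₁ * n ≤ ρ := by
        have h3 : n / 2 * lmin ^ 2 ≤ C * ρ := by
          refine le_trans ?_ (hsup.trans h1)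
          have := hlam.1
          gcongr
        rw [hc₁, div_mul_eq_mul_div, div_le_iff₀ (by positivity)]
        linarith
      have h3 : (√(c * c₁) * n) ^ 2 ≤ q ^ 2 := by
        rw [mul_pow, Real.sq_sqrt (by positivity)]
        calc c * c₁ * n ^ 2 = c * n * (c₁ * n) := by ring
          _ ≤ c * n * ρ := by gcongr
          _ ≤ _ := hq.le
      have h4 : √(c * c₁) * n ≤ |q| := abs_le_of_sq_le_sq' (by rwa [sq_abs]) (abs_nonneg q) |>.2
      have h5 : b * n ≤ |q| := le_trans (by gcongr) h4
      rcases le_or_gt 0 q with h6 | h6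
      · rwa [abs_of_nonneg h6] at h5
      · exfalso
        rw [abs_of_neg h6] at h5
        have h7 : -(b / (2 * σ) * n) ≤ q / σ := by linarith
        rw [le_div_iff₀ hσ] at h7
        have e : -(b / (2 * σ) * n) * σ = -(b * n / 2) := by field_simp
        have : 0 < b * n := by positivity
        rw [e] at h7
        linarith
  have hbqσ : b / σ * n ≤ q / σ := by
    rw [div_mul_eq_mul_div]; gcongr
  refine ⟨?_, ?_, ?_⟩
  · have h1 : min b (min (b / (2 * σ)) (b ^ 2 / 2)) * n ≤ b / (2 * σ) * n := by
      gcongr; exact (min_le_right _ _).trans (min_le_left _ _)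
    have e : b / σ * n = b / (2 * σ) * n + b / (2 * σ) * n := by field_simp; ring
    have h2 := (abs_le.1 hsc).2
    linarith
  · refine le_trans ?_ hbq
    gcongr
    exact min_le_left _ _
  · have h1 : min b (min (b / (2 * σ)) (b ^ 2 / 2)) * n ≤ b ^ 2 / 2 * n := by
      gcongr; exact (min_le_right _ _).trans (min_le_right _ _)
    refine h1.trans ?_
    have h2 : (b * n) ^ 2 ≤ q ^ 2 := by gcongr
    have h3 : (b * n) ^ 2 ≤ 2 * n * ρ := h2.trans (hcs.trans (by gcongr))
    have h4 : n * (b ^ 2 / 2 * n) ≤ n * ρ := by linarith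
    exact le_of_mul_le_mul_left h4 hn0'

lemma goodFit_whp (hδ : 0 < δ) (hσ : 0 < σ) (hl : 0 < lmin) (hB : 0 < Bd 0) :
    ∃ κ > (0 : ℝ), ∃ C > (0 : ℝ), ∃ c > (0 : ℝ), ∀ (m N : ℕ) (θs : Fin N → ℝ) (lam ε : ℝ), ((m + 1 : ℕ) : ℝ) = δ * N →
      lam ∈ Set.Icc lmin lmax → 0 < ε → ε ≤ 1 →
      Pmodel (m + 1) N (lassoEvent σ lmin lmax Bd θs lam fun X z θ => ¬ GoodFit σ κ ε θs X z θ) ≤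
        ENNReal.ofReal (C * Real.exp (-c * ε ^ 2 * (m + 1 : ℕ))) := by
  set g := min 1 (δ * σ ^ 2 / Bd 0) with hg
  have hg0 : 0 < g := lt_min one_pos (by positivity)
  have hg1 : g ≤ 1 := min_le_left _ _
  have hg2 : g * Bd 0 ≤ δ * σ ^ 2 := by
    rw [← le_div_iff₀ hB]; exact min_le_right _ _
  set c₀ := g / (4 * (1 + g)) with hc₀
  have hc₀0 : 0 < c₀ := by positivity
  obtain ⟨κ, hκ, ε₀, hε₀, hε₀1, hdet⟩ := nondegenerate_of_dev (lmax := lmax) hδ hσ hl hB hc₀0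
  obtain ⟨c₁, hc₁, hnoise⟩ := noise_lower_whp hc₀0
  set a₁ := 4 * (Bd 0 / (2 * δ * σ ^ 2) + 2 * (1 + 1 / δ)) with ha₁
  set a₂ := 16 * (3 + 2 * (Bd 0 / (δ * σ ^ 2)) + 3 / δ) with ha₂
  have ha₁0 : 0 < a₁ := by positivity
  have ha₂0 : 0 < a₂ := by positivity
  set c := min (min c₁ (g ^ 2 / 64)) (min (ε₀ ^ 2 / a₁) (1 / a₂)) with hc
  have hc0 : 0 < c := lt_min (lt_min hc₁ (by positivity)) (lt_min (by positivity) (by positivity))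
  refine ⟨κ, hκ, 29, by norm_num, c, hc0, fun m N θs lam ε hn hlam hε hε1 => ?_⟩
  set n : ℝ := ((m + 1 : ℕ) : ℝ) with hndef
  have hn0 : 0 ≤ n := Nat.cast_nonneg _
  set E := Real.exp (-c * ε ^ 2 * n) with hE
  have hexp : ∀ d : ℝ, c * ε ^ 2 ≤ d → Real.exp (-d * n) ≤ E := fun d hd => by
    rw [hE]
    refine Real.exp_le_exp.2 ?_
    have := mul_le_mul_of_nonneg_right hd hn0
    linarith
  have hε2 : ε ^ 2 ≤ 1 := pow_le_one₀ hε.le hε1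
  have hεε : ε₀ * ε ≤ 1 := mul_le_one₀ hε₀1 hε.le hε1
  have d1 : c * ε ^ 2 ≤ c₁ := (mul_le_of_le_one_right hc0.le hε2).trans ((min_le_left _ _).trans (min_le_left _ _))
  have d2 : c * ε ^ 2 ≤ g ^ 2 / 64 := (mul_le_of_le_one_right hc0.le hε2).trans ((min_le_left _ _).trans (min_le_right _ _))
  have d3 : c * ε ^ 2 ≤ (ε₀ * ε) ^ 2 / a₁ := by
    have : c ≤ ε₀ ^ 2 / a₁ := (min_le_right _ _).trans (min_le_left _ _)
    rw [mul_pow, mul_div_right_comm]; gcongr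
  have d4 : c * ε ^ 2 ≤ ε ^ 2 / a₂ := by
    have : c ≤ 1 / a₂ := (min_le_right _ _).trans (min_le_right _ _)
    calc c * ε ^ 2 ≤ 1 / a₂ * ε ^ 2 := by gcongr
      _ = _ := by ring
  set S₁ : ℝ → Set ((Fin (m + 1) → Fin N → ℝ) × (Fin (m + 1) → ℝ)) := fun τ =>
    lassoEvent σ lmin lmax Bd θs lam fun X z θ => ε₀ * ε * n < τ * scaleDev σ θs X z θ with hS₁
  set S₂ : ℝ → Set ((Fin (m + 1) → Fin N → ℝ) × (Fin (m + 1) → ℝ)) := fun τ =>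
    lassoEvent σ lmin lmax Bd θs lam fun X z θ => resid X (yvec σ θs X z) θ ≠ 0 ∧ ε * n < τ * stretchDev σ θs X z θ with hS₂
  set S₃ : Set ((Fin (m + 1) → Fin N → ℝ) × (Fin (m + 1) → ℝ)) :=
    lassoEvent σ lmin lmax Bd θs lam fun _ _ θ => n < l0 θ with hS₃
  set S₄ : Set ((Fin (m + 1) → Fin N → ℝ) × (Fin (m + 1) → ℝ)) :=
    lassoEvent σ lmin lmax Bd θs lam fun X z θ => (1 - c₀) * n ≤ z ⬝ᵥ z ∧
      (z ⬝ᵥ resid X (yvec σ θs X z) θ) ^ 2 ≤ c₀ * n * (resid X (yvec σ θs X z) θ ⬝ᵥ resid X (yvec σ θs X z) θ) with hS₄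
  set S₅ : Set ((Fin (m + 1) → Fin N → ℝ) × (Fin (m + 1) → ℝ)) := {ω | ω.2 ⬝ᵥ ω.2 < (1 - c₀) * n} with hS₅
  set S₆ : Set ((Fin (m + 1) → Fin N → ℝ) × (Fin (m + 1) → ℝ)) := {ω | ∃ θ, IsLasso ω.1 (yvec σ θs ω.1 ω.2) lam θ ∧
      resid ω.1 (yvec σ θs ω.1 ω.2) θ 0 = 0} with hS₆
  have b1 : ∀ τ, τ = 1 ∨ τ = -1 → Pmodel (m + 1) N (S₁ τ) ≤ ENNReal.ofReal E := fun τ hτ =>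
    (scale_whp hδ hσ hl hB hn hlam (mul_pos hε₀ hε) hεε (by rcases hτ with rfl | rfl <;> simp)).trans
      (ENNReal.ofReal_le_ofReal (hexp _ d3))
  have b2 : ∀ τ, τ = 1 ∨ τ = -1 → Pmodel (m + 1) N (S₂ τ) ≤ ENNReal.ofReal (4 * E) := fun τ hτ =>
    (stretch_whp hδ hσ hl hB hn hlam hε hε1 hτ).trans
      (ENNReal.ofReal_le_ofReal (mul_le_mul_of_nonneg_left (hexp _ d4) (by norm_num)))
  have b3 : Pmodel (m + 1) N S₃ = 0 := card_support_whp hσ hl hlam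
  have b4 : Pmodel (m + 1) N S₄ ≤ ENNReal.ofReal (18 * E) :=
    (contract_whp hσ hl hn hlam hg0 hg1 hg2).trans
      (ENNReal.ofReal_le_ofReal (mul_le_mul_of_nonneg_left (hexp _ d2) (by norm_num)))
  have b5 : Pmodel (m + 1) N S₅ ≤ ENNReal.ofReal E := (hnoise m N).trans (ENNReal.ofReal_le_ofReal (hexp _ d1))
  have b6 : Pmodel (m + 1) N S₆ = 0 := pmodel_resid_zero hσ.ne' (hl.trans_le hlam.1)
  have hsub : lassoEvent σ lmin lmax Bd θs lam (fun X z θ => ¬ GoodFit σ κ ε θs X z θ) ⊆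
      S₁ 1 ∪ S₁ (-1) ∪ S₂ 1 ∪ S₂ (-1) ∪ S₃ ∪ S₄ ∪ S₅ ∪ S₆ := by
    rintro ⟨X, z⟩ ⟨hreg, θ, hθ, hbad⟩
    by_contra hcon
    simp only [Set.mem_union, not_or] at hcon
    obtain ⟨⟨⟨⟨⟨⟨⟨h1, h1'⟩, h2⟩, h2'⟩, h3⟩, h4⟩, h5⟩, h6⟩ := hcon
    have hr0 : resid X (yvec σ θs X z) θ ≠ 0 := fun h => h6 ⟨θ, hθ, by change resid X (yvec σ θs X z) θ 0 = 0; rw [h]; rfl⟩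
    have k1 : 1 * scaleDev σ θs X z θ ≤ ε₀ * ε * n := le_of_not_gt fun h => h1 ⟨hreg, θ, hθ, h⟩
    have k1' : -1 * scaleDev σ θs X z θ ≤ ε₀ * ε * n := le_of_not_gt fun h => h1' ⟨hreg, θ, hθ, h⟩
    have k2 : 1 * stretchDev σ θs X z θ ≤ ε * n := le_of_not_gt fun h => h2 ⟨hreg, θ, hθ, hr0, h⟩
    have k2' : -1 * stretchDev σ θs X z θ ≤ ε * n := le_of_not_gt fun h => h2' ⟨hreg, θ, hθ, hr0, h⟩
    have k3 : (l0 θ : ℝ) ≤ n := le_of_not_gt fun h => h3 ⟨hreg, θ, hθ, h⟩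
    have k5 : (1 - c₀) * n ≤ z ⬝ᵥ z := le_of_not_gt fun h => h5 h
    have k4 : c₀ * n * (resid X (yvec σ θs X z) θ ⬝ᵥ resid X (yvec σ θs X z) θ) <
        (z ⬝ᵥ resid X (yvec σ θs X z) θ) ^ 2 := lt_of_not_ge fun h => h4 ⟨hreg, θ, hθ, k5, h⟩
    have e1 : ε₀ * ε * n ≤ ε₀ * n := by gcongr; exact mul_le_of_le_one_right hε₀.le hε1
    have e2 : ε₀ * ε * n ≤ ε * n := by gcongr; exact mul_le_of_le_one_left hε.le hε₀1
    have e3 : ε * n ≤ n := mul_le_of_le_one_left hn0 hε1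
    obtain ⟨q1, q2, q3⟩ := hdet (Nat.succ_pos m) hn hlam hreg hθ k3 (abs_le.2 ⟨by linarith, by linarith⟩) (by linarith) k4
    exact hbad ⟨abs_le.2 ⟨by linarith, by linarith⟩, abs_le.2 ⟨by linarith, by linarith⟩, q1, q2, q3⟩
  have hE0 : 0 ≤ E := (Real.exp_pos _).le
  calc _ ≤ Pmodel (m + 1) N (S₁ 1 ∪ S₁ (-1) ∪ S₂ 1 ∪ S₂ (-1) ∪ S₃ ∪ S₄ ∪ S₅ ∪ S₆) := measure_mono hsub
    _ ≤ ENNReal.ofReal E + ENNReal.ofReal E + ENNReal.ofReal (4 * E) + ENNReal.ofReal (4 * E) + 0 +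
        ENNReal.ofReal (18 * E) + ENNReal.ofReal E + 0 := by
      refine measure_union_le_of_le (measure_union_le_of_le (measure_union_le_of_le (measure_union_le_of_le
        (measure_union_le_of_le (measure_union_le_of_le (measure_union_le_of_le (b1 1 (.inl rfl)) (b1 (-1) (.inr rfl)))
          (b2 1 (.inl rfl))) (b2 (-1) (.inr rfl))) b3.le) b4) b5) b6.le
    _ = ENNReal.ofReal (29 * E) := by
      rw [add_zero, add_zero, ← ENNReal.ofReal_add, ← ENNReal.ofReal_add, ← ENNReal.ofReal_add, ← ENNReal.ofReal_add,
        ← ENNReal.ofReal_add] <;> first | positivity | (congr 1; ring)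

end FixedPenaltyFit

end Lasso

namespace Lasso

open Matrix Topology

section NearTies

variable {n N : ℕ}

lemma isSigmaCompact_of_isClosed {α : Type*} [TopologicalSpace α] [SigmaCompactSpace α] {s : Set α} (hs : IsClosed s) :
    IsSigmaCompact s := by
  have h : s = ⋃ k, s ∩ compactCovering α k := by
    rw [← Set.inter_iUnion, iUnion_compactCovering, Set.inter_univ]
  rw [h]
  exact isSigmaCompact_iUnion_of_isCompact _ fun k => (isCompact_compactCovering α k).inter_left hs

lemma measurableSet_fst_image {α β : Type*} [TopologicalSpace α] [TopologicalSpace β] [T2Space α] [MeasurableSpace α]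
    [OpensMeasurableSpace α] [SigmaCompactSpace (α × β)] {s : Set (α × β)} (hs : IsClosed s) :
    MeasurableSet (Prod.fst '' s) := by
  obtain ⟨K, hK, hKs⟩ := isSigmaCompact_of_isClosed hs
  rw [← hKs, Set.image_iUnion]
  exact MeasurableSet.iUnion fun k => ((hK k).image continuous_fst).isClosed.measurableSet

lemma ss_sub_le {ι : Type*} [Fintype ι] (u v : ι → ℝ) {s : ℝ} (hs : 0 < s) :
    (u - v) ⬝ᵥ (u - v) ≤ (1 + s) * (u ⬝ᵥ u) + (1 + 1 / s) * (v ⬝ᵥ v) := by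
  have h := ss_nonneg (s • u + v)
  rw [ss_add] at h
  simp only [dotProduct_smul, smul_dotProduct, smul_eq_mul] at h
  have h2 : 0 ≤ (s * (s * (u ⬝ᵥ u)) + 2 * (s * (u ⬝ᵥ v)) + v ⬝ᵥ v) / s := div_nonneg h hs.le
  have e : (s * (s * (u ⬝ᵥ u)) + 2 * (s * (u ⬝ᵥ v)) + v ⬝ᵥ v) / s = s * (u ⬝ᵥ u) + 2 * (u ⬝ᵥ v) + 1 / s * (v ⬝ᵥ v) := by
    field_simp
  rw [ss_sub]
  linarith

lemma frob_sub_le (A V : Matrix (Fin n) (Fin N) ℝ) {s : ℝ} (hs : 0 < s) :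
    frob (A - V) ≤ (1 + s) * frob A + (1 + 1 / s) * frob V := by
  simp only [frob, Finset.mul_sum, ← Finset.sum_add_distrib]
  exact Finset.sum_le_sum fun i _ => ss_sub_le (A i) (V i) hs

lemma pmodel_le_translate (hn : 0 < n) {E : Set ((Fin n → Fin N → ℝ) × (Fin n → ℝ))} (hE : MeasurableSet E)
    (v : (Fin n → Fin N → ℝ) × (Fin n → ℝ))
    (h : ∀ ω ∈ E, n * frob (ω.1 - v.1) + (ω.2 - v.2) ⬝ᵥ (ω.2 - v.2) ≤ n * frob ω.1 + ω.2 ⬝ᵥ ω.2 + 2) :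
    Pmodel n N E ≤ ENNReal.ofReal (Real.exp 1) * Pmodel n N {ω | ω + v ∈ E} := by
  have hE' : MeasurableSet {ω | ω + v ∈ E} := hE.preimage (measurable_add_const v)
  have : (volume : Measure ((Fin n → Fin N → ℝ) × (Fin n → ℝ))).IsAddRightInvariant :=
    inferInstanceAs (Measure.IsAddRightInvariant (Measure.prod volume volume))
  rw [pmodel_eq_withDensity hn, withDensity_apply _ hE, withDensity_apply _ hE', ← lintegral_indicator hE,
    ← lintegral_indicator hE', ← lintegral_add_right_eq_self _ v, ← lintegral_const_mul']
  swap
  · exact ENNReal.ofReal_ne_top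
  refine lintegral_mono fun ω => ?_
  by_cases hω : ω + v ∈ E
  · rw [Set.indicator_of_mem hω, Set.indicator_of_mem (by exact hω), ← ENNReal.ofReal_mul (Real.exp_pos _).le]
    refine ENNReal.ofReal_le_ofReal ?_
    have h1 := h _ hω
    simp only [Prod.fst_add, Prod.snd_add, add_sub_cancel_right, frob] at h1
    rw [jointDensity_eq, jointDensity_eq, mul_left_comm, ← Real.exp_add]
    refine mul_le_mul_of_nonneg_left (Real.exp_le_exp.2 ?_) (densityConst_nonneg _ _)
    simp only [Prod.fst_add, Prod.snd_add]
    linarith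
  · rw [Set.indicator_of_notMem hω, Set.indicator_of_notMem (by exact hω)]
    simp

/-- The design with the columns in `J` set to zero. -/
def zeroCols (J : Finset (Fin N)) (X : Matrix (Fin n) (Fin N) ℝ) : Matrix (Fin n) (Fin N) ℝ :=
  fun i j => if j ∈ J then 0 else X i j

/-- After deleting the columns in `J`, these columns are nearly tied with the active ones. -/
def tieEvent (σ : ℝ) (θs : Fin N → ℝ) (J : Finset (Fin N)) (l : Fin n) (lam η κ : ℝ) :
    Set ((Fin n → Fin N → ℝ) × (Fin n → ℝ)) :=
  {ω | (frob ω.1 ≤ 2 * N ∧ ω.2 ⬝ᵥ ω.2 ≤ 2 * n) ∧ ∃ θ, IsLasso (zeroCols J ω.1) (yvec σ θs ω.1 ω.2) lam θ ∧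
    κ ≤ resid (zeroCols J ω.1) (yvec σ θs ω.1 ω.2) θ l ^ 2 ∧
    ∀ j ∈ J, |(|(resid (zeroCols J ω.1) (yvec σ θs ω.1 ω.2) θ ᵥ* ω.1) j|) - lam| ≤ η}

variable {σ : ℝ} {θs : Fin N → ℝ} {J : Finset (Fin N)} {l : Fin n} {lam η κ : ℝ}

lemma measurableSet_tieEvent : MeasurableSet (tieEvent σ θs J l lam η κ) := by
  have hr : ∀ i, Continuous fun p : ((Fin n → Fin N → ℝ) × (Fin n → ℝ)) × (Fin N → ℝ) =>
      resid (zeroCols J p.1.1) (yvec σ θs p.1.1 p.1.2) p.2 i := fun i => by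
    have h2 : ∀ j, Continuous fun p : ((Fin n → Fin N → ℝ) × (Fin n → ℝ)) × (Fin N → ℝ) => zeroCols J p.1.1 i j := fun j => by
      unfold zeroCols
      split_ifs
      · fun_prop
      · fun_prop
    simp only [resid, Pi.sub_apply, yvec, mulVec, dotProduct]
    fun_prop
  have ho : Continuous fun p : ((Fin n → Fin N → ℝ) × (Fin n → ℝ)) × (Fin N → ℝ) =>
      obj (zeroCols J p.1.1) (yvec σ θs p.1.1 p.1.2) lam p.2 := by
    simp only [obj, l1, dotProduct]
    fun_prop
  have hf : Continuous fun p : ((Fin n → Fin N → ℝ) × (Fin n → ℝ)) × (Fin N → ℝ) => frob p.1.1 := by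
    simp only [frob, dotProduct]
    fun_prop
  have hz : Continuous fun p : ((Fin n → Fin N → ℝ) × (Fin n → ℝ)) × (Fin N → ℝ) => p.1.2 ⬝ᵥ p.1.2 := by
    simp only [dotProduct]
    fun_prop
  have hc : ∀ j, Continuous fun p : ((Fin n → Fin N → ℝ) × (Fin n → ℝ)) × (Fin N → ℝ) =>
      (resid (zeroCols J p.1.1) (yvec σ θs p.1.1 p.1.2) p.2 ᵥ* p.1.1) j := fun j => by
    simp only [vecMul, dotProduct]
    fun_prop
  have hcl : IsClosed {p : ((Fin n → Fin N → ℝ) × (Fin n → ℝ)) × (Fin N → ℝ) |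
      (frob p.1.1 ≤ 2 * N ∧ p.1.2 ⬝ᵥ p.1.2 ≤ 2 * n) ∧ IsLasso (zeroCols J p.1.1) (yvec σ θs p.1.1 p.1.2) lam p.2 ∧
        κ ≤ resid (zeroCols J p.1.1) (yvec σ θs p.1.1 p.1.2) p.2 l ^ 2 ∧
        ∀ j ∈ J, |(|(resid (zeroCols J p.1.1) (yvec σ θs p.1.1 p.1.2) p.2 ᵥ* p.1.1) j|) - lam| ≤ η} := by
    simp only [IsLasso, Set.ofPred_and, Set.ofPred_forall]
    refine ((isClosed_le hf continuous_const).inter (isClosed_le hz continuous_const)).inter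
      ((isClosed_iInter fun θ' => isClosed_le ho ?_).inter ((isClosed_le continuous_const ((hr l).pow 2)).inter
        (isClosed_iInter fun j => isClosed_iInter fun _ => isClosed_le (((hc j).abs.sub continuous_const).abs) continuous_const)))
    exact ho.comp (continuous_fst.prodMk continuous_const)
  convert measurableSet_fst_image hcl using 1
  ext ω
  constructor
  · rintro ⟨h1, θ, h2⟩
    exact ⟨(ω, θ), ⟨h1, h2⟩, rfl⟩
  · rintro ⟨⟨ω', θ⟩, ⟨h1, h2⟩, rfl⟩
    exact ⟨h1, θ, h2⟩

lemma card_near_lattice_le {a b c η : ℝ} (hb : 2 * η < |b|) (T : ℕ) :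
    ((Finset.range T).filter fun t : ℕ => |a + b * t - c| ≤ η).card ≤ 1 := by
  refine Finset.card_le_one.2 fun s hs t ht => ?_
  have hs := abs_le.1 (Finset.mem_filter.1 hs).2
  have ht := abs_le.1 (Finset.mem_filter.1 ht).2
  by_contra hne
  have h1 : (1 : ℝ) ≤ |(s : ℝ) - t| := by
    have : (1 : ℤ) ≤ |(s : ℤ) - t| := Int.one_le_abs (sub_ne_zero.2 (by exact_mod_cast hne))
    exact_mod_cast this
  have h2 : |b * ((s : ℝ) - t)| ≤ 2 * η := abs_le.2 ⟨by linarith, by linarith⟩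
  rw [abs_mul] at h2
  have := le_mul_of_one_le_right (abs_nonneg b) h1
  linarith

lemma card_near_abs_lattice_le {a b c η : ℝ} (hb : 2 * η < |b|) (T : ℕ) :
    ((Finset.range T).filter fun t : ℕ => |(|a + b * t|) - c| ≤ η).card ≤ 2 := by
  have hsub : ((Finset.range T).filter fun t : ℕ => |(|a + b * t|) - c| ≤ η) ⊆
      ((Finset.range T).filter fun t : ℕ => |a + b * t - c| ≤ η) ∪
      ((Finset.range T).filter fun t : ℕ => |a + b * t - -c| ≤ η) := fun t ht => by
    obtain ⟨h1, h2⟩ := Finset.mem_filter.1 ht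
    rcases abs_cases (a + b * t) with ⟨h3, -⟩ | ⟨h3, -⟩ <;> rw [h3] at h2
    · exact Finset.mem_union_left _ (Finset.mem_filter.2 ⟨h1, h2⟩)
    · refine Finset.mem_union_right _ (Finset.mem_filter.2 ⟨h1, ?_⟩)
      rwa [← abs_neg, show -(a + b * t - -c) = -(a + b * t) - c by ring]
  exact (Finset.card_le_card hsub).trans ((Finset.card_union_le _ _).trans
    (add_le_add (card_near_lattice_le hb T) (card_near_lattice_le hb T)))

/-- A translation of row `l` in the columns charged by `h`, compensated in the noise so that the response is unchanged. -/
def rowShift (σ : ℝ) (θs : Fin N → ℝ) (l : Fin n) (h : Fin N → ℝ) : (Fin n → Fin N → ℝ) × (Fin n → ℝ) :=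
  (Pi.single l h, Pi.single l (-(h ⬝ᵥ θs) / σ))

lemma yvec_add_rowShift (hσ : σ ≠ 0) (h : Fin N → ℝ) (ω : (Fin n → Fin N → ℝ) × (Fin n → ℝ)) :
    yvec σ θs (ω + rowShift σ θs l h).1 (ω + rowShift σ θs l h).2 = yvec σ θs ω.1 ω.2 := by
  ext i
  simp only [yvec, rowShift, Prod.fst_add, Prod.snd_add, Pi.add_apply]
  by_cases hi : i = l
  · subst hi
    simp only [Pi.single_eq_same, add_mul, Finset.sum_add_distrib, dotProduct]
    field_simp
    ring
  · simp [Pi.single_eq_of_ne hi]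

lemma zeroCols_add_rowShift {h : Fin N → ℝ} (hh : ∀ j, j ∉ J → h j = 0) (ω : (Fin n → Fin N → ℝ) × (Fin n → ℝ)) :
    zeroCols J (ω + rowShift σ θs l h).1 = zeroCols J ω.1 := by
  ext i j
  simp only [zeroCols, rowShift, Prod.fst_add, Pi.add_apply]
  split_ifs with hj
  · rfl
  · by_cases hi : i = l
    · subst hi; simp [hh j hj]
    · simp [Pi.single_eq_of_ne hi]

lemma vecMul_add_rowShift (h : Fin N → ℝ) (r : Fin n → ℝ) (ω : (Fin n → Fin N → ℝ) × (Fin n → ℝ)) (j : Fin N) :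
    (r ᵥ* (ω + rowShift σ θs l h).1) j = (r ᵥ* ω.1) j + r l * h j := by
  simp only [vecMul, dotProduct, rowShift, Prod.fst_add, Pi.add_apply, mul_add, Finset.sum_add_distrib]
  congr 1
  rw [Finset.sum_eq_single l]
  · simp
  · intro i _ hi
    simp [Pi.single_eq_of_ne hi]
  · simp

lemma rowShift_energy_le (hσ : 0 < σ) (hn : 0 < n) (hN : 0 < N) {h : Fin N → ℝ} {b L : ℝ} (hL : ∀ j, |h j| ≤ L)
    (hh : ∀ j, j ∉ J → h j = 0) (hJ : ∑ j ∈ J, θs j ^ 2 ≤ b)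
    (h1 : 10 * (n * N) ^ 2 * L ^ 2 ≤ 1) (h2 : 10 * n * N * b * L ^ 2 ≤ σ ^ 2)
    {ω : (Fin n → Fin N → ℝ) × (Fin n → ℝ)} (hX : frob ω.1 ≤ 2 * N) (hz : ω.2 ⬝ᵥ ω.2 ≤ 2 * n) :
    n * frob (ω.1 - (rowShift σ θs l h).1) + (ω.2 - (rowShift σ θs l h).2) ⬝ᵥ (ω.2 - (rowShift σ θs l h).2) ≤
      n * frob ω.1 + ω.2 ⬝ᵥ ω.2 + 2 := by
  have hn1 : (1 : ℝ) ≤ n := by exact_mod_cast hn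
  have hN1 : (1 : ℝ) ≤ N := by exact_mod_cast hN
  have hhN : h ⬝ᵥ h ≤ N * L ^ 2 := by
    calc h ⬝ᵥ h ≤ ∑ _j : Fin N, L ^ 2 := Finset.sum_le_sum fun j _ => by
          rw [← sq, ← sq_abs]; exact pow_le_pow_left₀ (abs_nonneg _) (hL j) 2
      _ = _ := by simp
  have hf : frob (rowShift σ θs l h).1 = h ⬝ᵥ h := by
    refine (Finset.sum_eq_single l ?_ ?_).trans ?_
    rotate_left 2
    · simp [rowShift]
    · intro i _ hi
      simp [rowShift, Pi.single_eq_of_ne hi]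
    · simp
  have hzz : (rowShift σ θs l h).2 ⬝ᵥ (rowShift σ θs l h).2 = (h ⬝ᵥ θs) ^ 2 / σ ^ 2 := by
    simp only [rowShift, dotProduct_single, Pi.single_eq_same]
    rw [div_mul_div_comm, neg_mul_neg, ← sq, ← sq]
  have hdot : (h ⬝ᵥ θs) ^ 2 ≤ N * L ^ 2 * b := by
    have e : h ⬝ᵥ θs = ∑ j ∈ J, h j * θs j := by
      rw [dotProduct]
      exact (Finset.sum_subset (Finset.subset_univ J) fun j _ hj => by rw [hh j hj, zero_mul]).symm
    rw [e]
    refine (Finset.sum_mul_sq_le_sq_mul_sq J h θs).trans ?_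
    refine mul_le_mul (le_trans ?_ hhN) hJ (Finset.sum_nonneg fun _ _ => sq_nonneg _) (by positivity)
    simp only [dotProduct, ← sq]
    exact Finset.sum_le_sum_of_subset_of_nonneg (Finset.subset_univ J) fun _ _ _ => sq_nonneg _
  have k1 := frob_sub_le ω.1 (rowShift σ θs l h).1 (s := 1 / (4 * n * N)) (by positivity)
  have k2 := ss_sub_le ω.2 (rowShift σ θs l h).2 (s := 1 / (4 * n)) (by positivity)
  rw [hf] at k1
  rw [hzz] at k2
  have k3 : 1 / (4 * n * N : ℝ) * frob ω.1 * n ≤ 1 / 2 := by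
    calc 1 / (4 * n * N : ℝ) * frob ω.1 * n ≤ 1 / (4 * n * N : ℝ) * (2 * N) * n := by gcongr
      _ = 1 / 2 := by field_simp; norm_num
  have k4 : 1 / (4 * n : ℝ) * (ω.2 ⬝ᵥ ω.2) ≤ 1 / 2 := by
    calc 1 / (4 * n : ℝ) * (ω.2 ⬝ᵥ ω.2) ≤ 1 / (4 * n : ℝ) * (2 * n) := by gcongr
      _ = 1 / 2 := by field_simp; norm_num
  have k5 : n * ((1 + 1 / (1 / (4 * n * N : ℝ))) * (h ⬝ᵥ h)) ≤ 1 / 2 := by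
    have hnN : (1 : ℝ) ≤ n * N := one_le_mul_of_one_le_of_one_le hn1 hN1
    rw [one_div_one_div]
    calc n * ((1 + 4 * n * N : ℝ) * (h ⬝ᵥ h)) ≤ n * ((5 * (n * N) : ℝ) * (N * L ^ 2)) := by
          refine mul_le_mul_of_nonneg_left (mul_le_mul ?_ hhN (ss_nonneg h) (by positivity)) (by positivity)
          linarith [mul_assoc 4 (n : ℝ) N]
      _ = (10 * (n * N) ^ 2 * L ^ 2) / 2 := by ring
      _ ≤ _ := by linarith
  have k6 : (1 + 1 / (1 / (4 * n : ℝ))) * ((h ⬝ᵥ θs) ^ 2 / σ ^ 2) ≤ 1 / 2 := by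
    rw [one_div_one_div]
    calc (1 + 4 * n : ℝ) * ((h ⬝ᵥ θs) ^ 2 / σ ^ 2) ≤ (5 * n) * ((N * L ^ 2 * b) / σ ^ 2) := by
          gcongr
          linarith
      _ = (10 * n * N * b * L ^ 2) / σ ^ 2 / 2 := by ring
      _ ≤ 1 / 2 := by
        gcongr
        rwa [div_le_one (by positivity)]
  have k7 := mul_le_mul_of_nonneg_left k1 (show (0 : ℝ) ≤ n by positivity)
  rw [mul_add, add_mul, one_mul, mul_add, mul_comm (n : ℝ) (1 / (4 * n * N : ℝ) * frob ω.1)] at k7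
  rw [add_mul, one_mul] at k2
  exact (add_le_add k7 k2).trans (by linarith)

lemma pmodel_tieEvent_le (hσ : 0 < σ) (hl : 0 ≤ lam) (hn : 0 < n) (hN : 0 < N) {b d : ℝ} {T : ℕ} (hT : 0 < T) (hd : 0 < d)
    (hJ : ∑ j ∈ J, θs j ^ 2 ≤ b) (h1 : 10 * (n * N) ^ 2 * (T * d) ^ 2 ≤ 1) (h2 : 10 * n * N * b * (T * d) ^ 2 ≤ σ ^ 2)
    (hκ : (2 * η) ^ 2 < κ * d ^ 2) :
    Pmodel n N (tieEvent σ θs J l lam η κ) ≤ ENNReal.ofReal (Real.exp 1 * (2 / T) ^ J.card) := by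
  classical
  set H : Finset (Fin N → ℕ) := Fintype.piFinset fun j => if j ∈ J then Finset.range T else {0} with hH
  have hHc : H.card = T ^ J.card := by
    rw [hH, Fintype.card_piFinset]
    simp [apply_ite Finset.card, Finset.prod_ite_mem]
  set E := tieEvent σ θs J l lam η κ with hE
  set v : (Fin N → ℕ) → (Fin n → Fin N → ℝ) × (Fin n → ℝ) := fun t => rowShift σ θs l fun j => d * t j with hv
  have hE' : MeasurableSet E := measurableSet_tieEvent
  have hmemH : ∀ t ∈ H, ∀ j, (j ∈ J → t j ∈ Finset.range T) ∧ (j ∉ J → (t j : ℝ) = 0) := by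
    intro t ht j
    have := Fintype.mem_piFinset.1 ht j
    refine ⟨fun hj => by rwa [if_pos hj] at this, fun hj => ?_⟩
    rw [if_neg hj, Finset.mem_singleton] at this
    rw [this, Nat.cast_zero]
  have hzero : ∀ t ∈ H, ∀ j, j ∉ J → d * (t j : ℝ) = 0 := fun t ht j hj => by rw [(hmemH t ht j).2 hj, mul_zero]
  have htrans : ∀ t ∈ H, Pmodel n N E ≤ ENNReal.ofReal (Real.exp 1) * Pmodel n N {ω | ω + v t ∈ E} := by
    intro t ht
    refine pmodel_le_translate hn hE' (v t) fun ω hω => ?_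
    refine rowShift_energy_le (J := J) (b := b) (L := T * d) hσ hn hN (fun j => ?_) (hzero t ht) hJ h1 h2 hω.1.1 hω.1.2
    rw [abs_of_nonneg (by positivity), mul_comm]
    refine mul_le_mul_of_nonneg_right ?_ hd.le
    by_cases hj : j ∈ J
    · exact_mod_cast (Finset.mem_range.1 ((hmemH t ht j).1 hj)).le
    · rw [(hmemH t ht j).2 hj]; positivity
  have hcount : ∀ ω, ((H.filter fun t => ω + v t ∈ E).card) ≤ 2 ^ J.card := by
    intro ω
    rcases (H.filter fun t => ω + v t ∈ E).eq_empty_or_nonempty with h0 | ⟨t₀, ht₀⟩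
    · rw [h0]; simp
    obtain ⟨ht₀H, ht₀E⟩ := Finset.mem_filter.1 ht₀
    obtain ⟨-, θ₀, hθ₀, hκ₀, -⟩ := ht₀E
    rw [hv] at hθ₀ hκ₀
    simp only at hθ₀ hκ₀
    rw [zeroCols_add_rowShift (hzero t₀ ht₀H), yvec_add_rowShift hσ.ne'] at hθ₀ hκ₀
    set R := resid (zeroCols J ω.1) (yvec σ θs ω.1 ω.2) θ₀ with hR
    have hRl : 2 * η < |R l * d| := by
      refine lt_of_pow_lt_pow_left₀ 2 (abs_nonneg _) ?_
      rw [sq_abs, mul_pow (R l)]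
      exact hκ.trans_le (by gcongr)
    have hsub : (H.filter fun t => ω + v t ∈ E) ⊆ Fintype.piFinset fun j => if j ∈ J then
        (Finset.range T).filter (fun t : ℕ => |(|(R ᵥ* ω.1) j + R l * d * t|) - lam| ≤ η) else {0} := by
      intro t ht
      obtain ⟨htH, -, θ, hθ, -, hj⟩ := Finset.mem_filter.1 ht
      rw [hv] at hθ hj
      simp only [vecMul_add_rowShift] at hθ hj
      rw [zeroCols_add_rowShift (hzero t htH), yvec_add_rowShift hσ.ne'] at hθ hj
      rw [resid_unique hθ hθ₀ hl, ← hR] at hj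
      refine Fintype.mem_piFinset.2 fun j => ?_
      split_ifs with hjJ
      · refine Finset.mem_filter.2 ⟨(hmemH t htH j).1 hjJ, ?_⟩
        have := hj j hjJ
        rwa [← mul_assoc] at this
      · rw [Finset.mem_singleton]
        exact_mod_cast (hmemH t htH j).2 hjJ
    refine (Finset.card_le_card hsub).trans ?_
    rw [Fintype.card_piFinset]
    calc _ ≤ ∏ j : Fin N, if j ∈ J then 2 else 1 := Finset.prod_le_prod' fun j _ => by
          split_ifs
          · exact card_near_abs_lattice_le hRl T
          · simp
      _ = 2 ^ J.card := by simp
  have hsum : ∑ t ∈ H, Pmodel n N {ω | ω + v t ∈ E} ≤ 2 ^ J.card := by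
    have hm : ∀ t, MeasurableSet {ω | ω + v t ∈ E} := fun t => hE'.preimage (measurable_add_const _)
    calc ∑ t ∈ H, Pmodel n N {ω | ω + v t ∈ E}
        = ∑ t ∈ H, ∫⁻ ω, {ω | ω + v t ∈ E}.indicator (1 : (Fin n → Fin N → ℝ) × (Fin n → ℝ) → ℝ≥0∞) ω ∂Pmodel n N :=
          Finset.sum_congr rfl fun t _ => (lintegral_indicator_one (hm t)).symm
      _ = ∫⁻ ω, ∑ t ∈ H, {ω | ω + v t ∈ E}.indicator (1 : (Fin n → Fin N → ℝ) × (Fin n → ℝ) → ℝ≥0∞) ω ∂Pmodel n N :=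
          (lintegral_finsetSum _ fun t _ => measurable_one.indicator (hm t)).symm
      _ ≤ ∫⁻ _, 2 ^ J.card ∂Pmodel n N := by
          refine lintegral_mono fun ω => ?_
          have e : ∑ t ∈ H, {ω | ω + v t ∈ E}.indicator (1 : (Fin n → Fin N → ℝ) × (Fin n → ℝ) → ℝ≥0∞) ω =
              ((H.filter fun t => ω + v t ∈ E).card : ℝ≥0∞) := by
            rw [Finset.card_filter, Nat.cast_sum]
            refine Finset.sum_congr rfl fun t _ => ?_
            by_cases h : ω + v t ∈ E
            · rw [Set.indicator_of_mem (by exact h), if_pos h]; simp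
            · rw [Set.indicator_of_notMem (by exact h), if_neg h]; simp
          rw [e]
          calc _ ≤ ((2 ^ J.card : ℕ) : ℝ≥0∞) := Nat.cast_le.2 (hcount ω)
            _ = _ := by push_cast; rfl
      _ = 2 ^ J.card := by simp
  have hfin : (T : ℝ≥0∞) ^ J.card * Pmodel n N E ≤ ENNReal.ofReal (Real.exp 1) * 2 ^ J.card := by
    calc (T : ℝ≥0∞) ^ J.card * Pmodel n N E = ∑ t ∈ H, Pmodel n N E := by
          rw [Finset.sum_const, hHc, nsmul_eq_mul]; push_cast; rfl
      _ ≤ ∑ t ∈ H, ENNReal.ofReal (Real.exp 1) * Pmodel n N {ω | ω + v t ∈ E} := Finset.sum_le_sum htrans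
      _ = ENNReal.ofReal (Real.exp 1) * ∑ t ∈ H, Pmodel n N {ω | ω + v t ∈ E} := by rw [Finset.mul_sum]
      _ ≤ _ := by gcongr
  have hT0 : (0 : ℝ) < T := by exact_mod_cast hT
  rw [mul_comm, ← ENNReal.le_div_iff_mul_le (.inl (by simp [hT.ne'])) (.inl (by simp))] at hfin
  refine hfin.trans_eq ?_
  rw [div_pow, ENNReal.ofReal_mul (Real.exp_pos _).le, ENNReal.ofReal_div_of_pos (by positivity),
    ENNReal.ofReal_pow (by norm_num), ENNReal.ofReal_pow hT0.le, mul_div_assoc]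
  simp

end NearTies

end Lasso

namespace Lasso

open Matrix

section SupportStability

variable {n N : ℕ} {J : Finset (Fin N)} {X : Matrix (Fin n) (Fin N) ℝ} {y z : Fin n → ℝ} {θ θ' θs : Fin N → ℝ}
  {σ lam lam' lmin lmax κ Δ : ℝ} {Bd : ℝ → ℝ}

lemma zeroCols_mulVec_of_eqOn (h : ∀ j, j ∉ J → θ' j = θ j) (hJ : ∀ j ∈ J, θ' j = 0) : zeroCols J X *ᵥ θ = X *ᵥ θ' := by
  ext i
  simp only [mulVec, dotProduct]
  refine Finset.sum_congr rfl fun j _ => ?_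
  by_cases hj : j ∈ J
  · simp [zeroCols, hj, hJ j hj]
  · simp [zeroCols, hj, h j hj]

lemma resid_zeroCols (hJ : ∀ j ∈ J, θ j = 0) : resid (zeroCols J X) y θ = resid X y θ := by
  rw [resid, resid, zeroCols_mulVec_of_eqOn (fun _ _ => rfl) hJ]

lemma obj_zeroCols (hJ : ∀ j ∈ J, θ j = 0) : obj (zeroCols J X) y lam θ = obj X y lam θ := by
  rw [obj, obj, resid_zeroCols hJ]

lemma IsLasso.zeroCols (h : IsLasso X y lam θ) (hl : 0 ≤ lam) (hJ : ∀ j ∈ J, θ j = 0) :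
    IsLasso (zeroCols J X) y lam θ := fun θ' => by
  set φ : Fin N → ℝ := fun j => if j ∈ J then 0 else θ' j with hφ
  have h1 : l1 φ ≤ l1 θ' := Finset.sum_le_sum fun j _ => by
    rw [hφ]
    dsimp only
    split_ifs
    · simp
    · rfl
  have h2 := h φ
  rw [obj_zeroCols hJ]
  refine h2.trans ?_
  rw [obj, obj, resid, resid, zeroCols_mulVec_of_eqOn (θ := θ') (θ' := φ) (fun j hj => by simp [hφ, hj]) (fun j hj => by simp [hφ, hj])]
  gcongr

lemma IsLasso.eq_zero_of_zeroCols (h : IsLasso (Lasso.zeroCols J X) y lam θ) (hl : 0 < lam) {j : Fin N} (hj : j ∈ J) :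
    θ j = 0 := by
  by_contra hne
  have h1 := kkt_of_ne h hl.le j hne
  have h2 : (resid (Lasso.zeroCols J X) y θ ᵥ* Lasso.zeroCols J X) j = 0 := by
    simp [vecMul, dotProduct, Lasso.zeroCols, hj]
  rw [h2, abs_zero] at h1
  exact hl.ne h1

lemma abs_l1_sub_le {B : ℝ} (h : (θ - θs) ⬝ᵥ (θ - θs) ≤ B * N) : |l1 θ - l1 θs| ≤ √B * N := by
  have h0 : l1 (θ - θs) ≤ √B * N := by
    calc l1 (θ - θs) ≤ √N * √((θ - θs) ⬝ᵥ (θ - θs)) := l1_le_sqrt _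
      _ ≤ √N * √(B * N) := by gcongr
      _ = √B * N := by
        rw [Real.sqrt_mul' B (Nat.cast_nonneg N), mul_left_comm, Real.mul_self_sqrt (Nat.cast_nonneg N)]
  have h1 := l1_sub_le θ θs
  have h2 := l1_sub_le θs θ
  rw [← neg_sub θ θs, l1_neg] at h2
  exact abs_le.2 ⟨by linarith, by linarith⟩

lemma resid_sub_le_of_l1 (h : IsLasso X y lam θ) (h' : IsLasso X y lam' θ') (hl : 0 ≤ lam) (hl' : 0 ≤ lam')
    (hΔ : |lam - lam'| ≤ Δ) {a b : ℝ} (ha : |l1 θ - l1 θs| ≤ a) (hb : |l1 θ' - l1 θs| ≤ b) :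
    (resid X y θ - resid X y θ') ⬝ᵥ (resid X y θ - resid X y θ') ≤ Δ * (a + b) := by
  refine (resid_sub_sq_le h h' hl hl').trans ((le_abs_self _).trans ?_)
  rw [abs_mul]
  refine mul_le_mul hΔ ?_ (abs_nonneg _) ((abs_nonneg _).trans hΔ)
  have e : l1 θ' - l1 θ = (l1 θ' - l1 θs) - (l1 θ - l1 θs) := by ring
  rw [e]
  exact (abs_sub _ _).trans (by linarith)

lemma abs_vecMul_le {B : ℝ} (hX : frob X ≤ 2 * N) {u : Fin n → ℝ} (hu : u ⬝ᵥ u ≤ B) (j : Fin N) :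
    |(u ᵥ* X) j| ≤ √(2 * N * B) := by
  refine (abs_le_sqrt_ss _ j).trans (Real.sqrt_le_sqrt ((ss_vecMul_le X u).trans ?_))
  exact mul_le_mul hX hu (ss_nonneg u) (by positivity)

lemma ss_le_two_add (u v : Fin n → ℝ) : u ⬝ᵥ u ≤ 2 * (v ⬝ᵥ v) + 2 * ((u - v) ⬝ᵥ (u - v)) := by
  have h := ss_sub_le v (v - u) one_pos
  rw [sub_sub_cancel, ← neg_sub u v, neg_dotProduct_neg] at h
  linarith

lemma Regular.abs_l1_sub_le (h : Regular σ lmin lmax Bd θs X z) (hlam : lam ∈ Set.Icc lmin lmax)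
    (hθ : IsLasso X (yvec σ θs X z) lam θ) : |l1 θ - l1 θs| ≤ √(Bd 0) * N :=
  Lasso.abs_l1_sub_le (h.lasso hlam hθ).1

/-- If the columns in `J` are inactive but nearly tied at `lam`, then they are nearly tied at `lam'` after deletion. -/
lemma Regular.mem_tieEvent (h : Regular σ lmin lmax Bd θs X z) (hl : 0 < lmin) (hn : 0 < n)
    (hlam : lam ∈ Set.Icc lmin lmax) (hlam' : lam' ∈ Set.Icc lmin lmax) (hΔ : |lam - lam'| ≤ Δ)
    (hθ : IsLasso X (yvec σ θs X z) lam θ) (hκ : κ * n ≤ resid X (yvec σ θs X z) θ ⬝ᵥ resid X (yvec σ θs X z) θ)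
    {D η : ℝ} (hD : √(Bd (lmax * √(Bd 0))) + √(Bd 0) ≤ D) (hΔκ : 4 * (Δ * (D * N)) ≤ κ * n)
    (hJ : ∀ j ∈ J, θ j = 0) (hη : ∀ j ∈ J, lam - η ≤ |(resid X (yvec σ θs X z) θ ᵥ* X) j|) :
    ∃ l, (X, z) ∈ tieEvent σ θs J l lam' (η + √(2 * N * (Δ * (D * N))) + Δ) (κ / 4) := by
  have hl1 : 0 < lam := hl.trans_le hlam.1
  have hl2 : 0 < lam' := hl.trans_le hlam'.1
  have hΔ0 := (abs_nonneg _).trans hΔ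
  set y := yvec σ θs X z with hy
  have hθJ := hθ.zeroCols hl1.le hJ
  obtain ⟨φ, hφ⟩ := exists_isLasso (zeroCols J X) y hl2
  have hφJ : ∀ j ∈ J, φ j = 0 := fun j hj => hφ.eq_zero_of_zeroCols hl2 hj
  have hb := h.abs_l1_sub_le hlam hθ
  have hobj : obj X y lam' φ ≤ obj X y lam' θs + lmax * √(Bd 0) * N := by
    have k1 : obj X y lam' φ ≤ obj X y lam' θ := by
      have := hφ θ
      rwa [obj_zeroCols hφJ, obj_zeroCols hJ] at this
    have k2 := hθ θs
    have k3 : (lam' - lam) * (l1 θ - l1 θs) ≤ lmax * (√(Bd 0) * N) := by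
      refine (le_abs_self _).trans ?_
      rw [abs_mul]
      refine mul_le_mul (abs_le.2 ⟨?_, ?_⟩) hb (abs_nonneg _) ?_
      · linarith [hlam.2]
      · linarith [hlam'.2]
      · linarith [hlam.2]
    simp only [obj] at k1 k2 ⊢
    linarith
  have hlmax : 0 ≤ lmax := hl1.le.trans hlam.2
  have hφs := (h.risk _ (by positivity) lam' hlam' φ hobj).1
  have hR := resid_sub_le_of_l1 hθJ hφ hl1.le hl2.le hΔ hb (Lasso.abs_l1_sub_le hφs)
  rw [resid_zeroCols hJ] at hR
  set r := resid X y θ with hr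
  set R := resid (zeroCols J X) y φ with hRdef
  have hrR : (r - R) ⬝ᵥ (r - R) ≤ Δ * (D * N) := by
    refine hR.trans (mul_le_mul_of_nonneg_left ?_ hΔ0)
    rw [← add_mul]
    exact mul_le_mul_of_nonneg_right (by linarith) (Nat.cast_nonneg N)
  have hRR : κ / 4 * n ≤ R ⬝ᵥ R := by
    have := ss_le_two_add r R
    linarith
  have : Nonempty (Fin n) := ⟨⟨0, hn⟩⟩
  obtain ⟨l, -, hl'⟩ : ∃ l ∈ (Finset.univ : Finset (Fin n)), κ / 4 ≤ R l ^ 2 := by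
    refine Finset.exists_le_of_sum_le Finset.univ_nonempty ?_
    rw [Finset.sum_const, Finset.card_univ, Fintype.card_fin, nsmul_eq_mul, mul_comm]
    simpa only [dotProduct, ← sq] using hRR
  refine ⟨l, ⟨h.frob_le, h.noise_upper⟩, φ, hφ, hl', fun j hj => ?_⟩
  have c1 := abs_vecMul_le h.frob_le hrR j
  rw [sub_vecMul, Pi.sub_apply] at c1
  have c2 := (abs_sub_abs_le_abs_sub ((r ᵥ* X) j) ((R ᵥ* X) j)).trans c1
  rw [abs_sub_comm] at c1
  have c3 := (abs_sub_abs_le_abs_sub ((R ᵥ* X) j) ((r ᵥ* X) j)).trans c1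
  have c4 := kkt_abs hθ hl1.le j
  have c5 := hη j hj
  have c6 := abs_le.1 hΔ
  rw [← hr] at c4
  exact abs_le.2 ⟨by linarith, by linarith [(abs_nonneg _).trans c4, abs_nonneg ((r ᵥ* X) j)]⟩

lemma Regular.resid_sub_le (h : Regular σ lmin lmax Bd θs X z) (hl : 0 < lmin)
    (hlam : lam ∈ Set.Icc lmin lmax) (hlam' : lam' ∈ Set.Icc lmin lmax) (hΔ : |lam - lam'| ≤ Δ)
    (hθ : IsLasso X (yvec σ θs X z) lam θ) (hθ' : IsLasso X (yvec σ θs X z) lam' θ') {D : ℝ} (hD : 2 * √(Bd 0) ≤ D) :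
    (resid X (yvec σ θs X z) θ - resid X (yvec σ θs X z) θ') ⬝ᵥ (resid X (yvec σ θs X z) θ - resid X (yvec σ θs X z) θ') ≤
      Δ * (D * N) := by
  refine (resid_sub_le_of_l1 hθ hθ' (hl.trans_le hlam.1).le (hl.trans_le hlam'.1).le hΔ (h.abs_l1_sub_le hlam hθ)
    (h.abs_l1_sub_le hlam' hθ')).trans (mul_le_mul_of_nonneg_left ?_ ((abs_nonneg _).trans hΔ))
  rw [← two_mul, ← mul_assoc]
  exact mul_le_mul_of_nonneg_right hD (Nat.cast_nonneg N)

/-- Some set of `m` columns carrying little signal is nearly tied. -/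
def tieUnion (σ : ℝ) (θs : Fin N → ℝ) (n m : ℕ) (b lam η κ : ℝ) : Set ((Fin n → Fin N → ℝ) × (Fin n → ℝ)) :=
  {ω | ∃ J : Finset (Fin N), J.card = m ∧ ∑ j ∈ J, θs j ^ 2 ≤ b ∧ ∃ l, ω ∈ tieEvent σ θs J l lam η κ}

lemma sum_sq_le_of_eq_zero (hJ : ∀ j ∈ J, θ j = 0) : ∑ j ∈ J, θs j ^ 2 ≤ (θ - θs) ⬝ᵥ (θ - θs) := by
  calc ∑ j ∈ J, θs j ^ 2 = ∑ j ∈ J, (θ - θs) j * (θ - θs) j := Finset.sum_congr rfl fun j hj => by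
        rw [Pi.sub_apply, hJ j hj]; ring
    _ ≤ _ := Finset.sum_le_sum_of_subset_of_nonneg (Finset.subset_univ J) fun _ _ _ => mul_self_nonneg _

lemma exists_card_eq_of_l0_le {m : ℕ} (h : l0 θ + m ≤ l0 θ') : ∃ J : Finset (Fin N), J.card = m ∧ ∀ j ∈ J, θ' j ≠ 0 ∧ θ j = 0 := by
  have h1 : m ≤ (Finset.univ.filter (fun j => θ' j ≠ 0) \ Finset.univ.filter fun j => θ j ≠ 0).card := by
    have := Finset.le_card_sdiff (Finset.univ.filter fun j => θ j ≠ 0) (Finset.univ.filter fun j => θ' j ≠ 0)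
    unfold l0 at h
    omega
  obtain ⟨J, hJ, hc⟩ := Finset.exists_subset_card_eq h1
  exact ⟨J, hc, fun j hj => by simpa using hJ hj⟩

lemma Regular.abs_l0_sub_le (h : Regular σ lmin lmax Bd θs X z) (hl : 0 < lmin) (hn : 0 < n)
    (hlam : lam ∈ Set.Icc lmin lmax) (hlam' : lam' ∈ Set.Icc lmin lmax) (hΔ : |lam - lam'| ≤ Δ)
    (hθ : IsLasso X (yvec σ θs X z) lam θ) (hθ' : IsLasso X (yvec σ θs X z) lam' θ')
    (hκ : 4 * κ * n ≤ resid X (yvec σ θs X z) θ' ⬝ᵥ resid X (yvec σ θs X z) θ') (hκ0 : 0 ≤ κ)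
    {D : ℝ} (hD : √(Bd (lmax * √(Bd 0))) + 2 * √(Bd 0) ≤ D) (hΔκ : 4 * (Δ * (D * N)) ≤ κ * n) {m : ℕ}
    (hm : (X, z) ∉ tieUnion σ θs n m (Bd 0 * N) lam' (2 * √(2 * N * (Δ * (D * N))) + 2 * Δ) (κ / 4)) :
    |(l0 θ : ℝ) - l0 θ'| ≤ m := by
  have hl1 : 0 < lam := hl.trans_le hlam.1
  have hl2 : 0 < lam' := hl.trans_le hlam'.1
  have hs0 := Real.sqrt_nonneg (Bd (lmax * √(Bd 0)))
  have hs1 := Real.sqrt_nonneg (Bd 0)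
  have hΔ' : |lam' - lam'| ≤ Δ := by rw [sub_self, abs_zero]; exact (abs_nonneg _).trans hΔ
  have hrr := h.resid_sub_le hl hlam hlam' hΔ hθ hθ' (D := D) (by linarith)
  set r := resid X (yvec σ θs X z) θ with hr
  set r' := resid X (yvec σ θs X z) θ' with hr'
  have c := fun j => abs_vecMul_le h.frob_le hrr j
  simp only [sub_vecMul, Pi.sub_apply] at c
  have c6 := abs_le.1 hΔ
  have hκr : κ * n ≤ r ⬝ᵥ r := by
    have h1 := ss_le_two_add r' r
    rw [← neg_sub r r', neg_dotProduct_neg] at h1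
    have : 0 ≤ κ * n := by positivity
    linarith
  have hκr' : κ * n ≤ r' ⬝ᵥ r' := by
    have : 0 ≤ κ * n := by positivity
    linarith
  have e : 2 * √(2 * N * (Δ * (D * N))) + 2 * Δ = √(2 * N * (Δ * (D * N))) + Δ + √(2 * N * (Δ * (D * N))) + Δ := by ring
  rw [abs_le]
  constructor
  · by_contra hlt
    obtain ⟨J, hJc, hJ⟩ := exists_card_eq_of_l0_le (θ := θ) (θ' := θ') (m := m) (by
      have : (l0 θ : ℝ) + m ≤ l0 θ' := by linarith
      exact_mod_cast this)
    obtain ⟨l, hmem⟩ := h.mem_tieEvent hl hn hlam hlam' hΔ hθ hκr (D := D) (by linarith) hΔκ (fun j hj => (hJ j hj).2)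
      (J := J) (η := √(2 * N * (Δ * (D * N))) + Δ) fun j hj => by
        have c1 := kkt_of_ne hθ' hl2.le j (hJ j hj).1
        have c2 := abs_sub_abs_le_abs_sub ((r' ᵥ* X) j) ((r ᵥ* X) j)
        rw [abs_sub_comm] at c2
        have c3 := c j
        rw [← hr'] at c1
        linarith
    refine hm ⟨J, hJc, (sum_sq_le_of_eq_zero fun j hj => (hJ j hj).2).trans (h.lasso hlam hθ).1, l, ?_⟩
    rw [e]
    exact hmem
  · by_contra hlt
    obtain ⟨J, hJc, hJ⟩ := exists_card_eq_of_l0_le (θ := θ') (θ' := θ) (m := m) (by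
      have : (l0 θ' : ℝ) + m ≤ l0 θ := by linarith
      exact_mod_cast this)
    obtain ⟨l, hmem⟩ := h.mem_tieEvent hl hn hlam' hlam' hΔ' hθ' hκr' (D := D) (by linarith) hΔκ (fun j hj => (hJ j hj).2)
      (J := J) (η := √(2 * N * (Δ * (D * N))) + Δ) fun j hj => by
        have c1 := kkt_of_ne hθ hl1.le j (hJ j hj).1
        have c2 := abs_sub_abs_le_abs_sub ((r ᵥ* X) j) ((r' ᵥ* X) j)
        have c3 := c j
        rw [← hr] at c1
        linarith
    refine hm ⟨J, hJc, (sum_sq_le_of_eq_zero fun j hj => (hJ j hj).2).trans (h.lasso hlam' hθ').1, l, ?_⟩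
    rw [e]
    exact hmem

lemma pmodel_tieUnion_le (hσ : 0 < σ) (hl : 0 ≤ lam) (hn : 0 < n) (hN : 0 < N) {b d η : ℝ} {m T : ℕ} (hT : 0 < T) (hd : 0 < d)
    (h1 : 10 * (n * N) ^ 2 * (T * d) ^ 2 ≤ 1) (h2 : 10 * n * N * b * (T * d) ^ 2 ≤ σ ^ 2) (hκ : (2 * η) ^ 2 < κ * d ^ 2) :
    Pmodel n N (tieUnion σ θs n m b lam η κ) ≤ ENNReal.ofReal (2 ^ N * n * (Real.exp 1 * (2 / T) ^ m)) := by
  classical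
  set S : Finset (Finset (Fin N)) := Finset.univ.filter fun J => J.card = m ∧ ∑ j ∈ J, θs j ^ 2 ≤ b with hS
  have hsub : tieUnion σ θs n m b lam η κ ⊆ ⋃ p ∈ S ×ˢ (Finset.univ : Finset (Fin n)), tieEvent σ θs p.1 p.2 lam η κ := by
    rintro ω ⟨J, hc, hb, l, hω⟩
    exact Set.mem_iUnion₂.2 ⟨(J, l), Finset.mem_product.2 ⟨Finset.mem_filter.2 ⟨Finset.mem_univ _, hc, hb⟩, Finset.mem_univ _⟩, hω⟩
  have hcard : (S ×ˢ (Finset.univ : Finset (Fin n))).card ≤ 2 ^ N * n := by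
    rw [Finset.card_product, Finset.card_univ, Fintype.card_fin]
    refine Nat.mul_le_mul_right _ ((Finset.card_filter_le _ _).trans_eq ?_)
    rw [Finset.card_univ, Fintype.card_finset, Fintype.card_fin]
  calc Pmodel n N (tieUnion σ θs n m b lam η κ)
      ≤ ∑ p ∈ S ×ˢ (Finset.univ : Finset (Fin n)), Pmodel n N (tieEvent σ θs p.1 p.2 lam η κ) :=
        (measure_mono hsub).trans (measure_biUnion_finset_le _ _)
    _ ≤ ∑ _p ∈ S ×ˢ (Finset.univ : Finset (Fin n)), ENNReal.ofReal (Real.exp 1 * (2 / T) ^ m) := by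
        refine Finset.sum_le_sum fun p hp => ?_
        obtain ⟨-, hc, hb⟩ := Finset.mem_filter.1 (Finset.mem_product.1 hp).1
        have := pmodel_tieEvent_le (l := p.2) hσ hl hn hN hT hd hb h1 h2 hκ
        rwa [hc] at this
    _ = ENNReal.ofReal (((S ×ˢ (Finset.univ : Finset (Fin n))).card : ℝ) * (Real.exp 1 * (2 / T) ^ m)) := by
        rw [Finset.sum_const, nsmul_eq_mul, ENNReal.ofReal_mul (Nat.cast_nonneg _), ENNReal.ofReal_natCast]
    _ ≤ _ := by
        refine ENNReal.ofReal_le_ofReal (mul_le_mul_of_nonneg_right ?_ (by positivity))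
        exact_mod_cast hcard

end SupportStability

end Lasso

namespace Lasso

open Matrix

section NoiseLevelTransfer

variable {n N : ℕ} {X : Matrix (Fin n) (Fin N) ℝ} {y z : Fin n → ℝ} {θ θ' θs : Fin N → ℝ}
  {σ lam lam' lmin lmax κ ε Δ : ℝ} {Bd : ℝ → ℝ}

/-- The numerator of `sigmaHatSq - σ ^ 2` over the common denominator `(n - k) ^ 2`. -/
def sigmaGap (σ n N k ρ P : ℝ) : ℝ := ρ * (n + N - 2 * k) - n * P - σ ^ 2 * (n - k) ^ 2

lemma sigmaHatSq_sub_eq (hn : 0 < n) (hk : (l0 θ : ℝ) < n) :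
    sigmaHatSq X y θ - σ ^ 2 = sigmaGap σ n N (l0 θ) (resid X y θ ⬝ᵥ resid X y θ)
      ((resid X y θ ᵥ* X) ⬝ᵥ (resid X y θ ᵥ* X)) / (n - l0 θ) ^ 2 := by
  have hn' : (0 : ℝ) < n := by exact_mod_cast hn
  have hk' : (0 : ℝ) < n - l0 θ := sub_pos.2 hk
  have e1 : ∑ i, (y i - ∑ j, X i j * θ j) ^ 2 = resid X y θ ⬝ᵥ resid X y θ := by
    simp only [dotProduct, resid, Pi.sub_apply, mulVec, sq]
  have e2 : ∑ j, (∑ i, X i j * (y i - ∑ j', X i j' * θ j')) ^ 2 = (resid X y θ ᵥ* X) ⬝ᵥ (resid X y θ ᵥ* X) := by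
    simp only [dotProduct, resid, Pi.sub_apply, mulVec, vecMul, sq, mul_comm (X _ _) (_ - _)]
  unfold sigmaHatSq tauHat
  rw [e1, e2, div_pow, mul_pow, Real.sq_sqrt hn'.le, Real.sq_sqrt (ss_nonneg _), sigmaGap]
  have e3 : (1 - (l0 θ : ℝ) / n) = (n - l0 θ) / n := by field_simp
  rw [e3]
  field_simp

lemma abs_sigmaGap_le {σ n N k ρ P q ε : ℝ} (hσ : 0 < σ) (hρ : 0 < ρ) (hn : 0 ≤ n) (hk : 0 ≤ k) (hkn : k ≤ n) (hε0 : 0 ≤ ε)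
    (hε : ε ≤ 1) (h1 : |q / σ - (n - k)| ≤ ε * n) (h2 : |n * (P / ρ) + q ^ 2 / ρ - q / σ - (N - k)| ≤ ε * n) :
    |sigmaGap σ n N k ρ P| ≤ 2 * ε * n * ρ + 3 * σ ^ 2 * (ε * n * n) := by
  set e₁ := q / σ - (n - k) with he₁
  set e₂ := n * (P / ρ) + q ^ 2 / ρ - q / σ - (N - k) with he₂
  have hq : q = σ * (n - k + e₁) := by rw [he₁]; field_simp; ring
  have hP : n * P = ρ * (e₂ + q / σ + (N - k)) - q ^ 2 := by rw [he₂]; field_simp; ring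
  have hG : sigmaGap σ n N k ρ P = σ ^ 2 * (e₁ * (2 * (n - k) + e₁)) - ρ * (e₁ + e₂) := by
    have hqs : q / σ = n - k + e₁ := by rw [he₁]; ring
    rw [sigmaGap, hP, hqs, hq]
    ring
  have hεn : ε * n ≤ n := mul_le_of_le_one_left hn hε
  have h3 : |2 * (n - k) + e₁| ≤ 3 * n := by
    have := abs_le.1 h1
    exact abs_le.2 ⟨by linarith, by linarith⟩
  have h4 : |e₁ + e₂| ≤ 2 * (ε * n) := (abs_add_le _ _).trans (by linarith)
  rw [hG]
  refine (abs_sub _ _).trans ?_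
  rw [abs_mul, abs_mul e₁, abs_mul ρ, abs_of_pos hρ, abs_of_nonneg (sq_nonneg σ)]
  calc σ ^ 2 * (|e₁| * |2 * (n - k) + e₁|) + ρ * |e₁ + e₂| ≤ σ ^ 2 * ((ε * n) * (3 * n)) + ρ * (2 * (ε * n)) := by gcongr
    _ = _ := by ring

lemma abs_sigmaGap_sub_le {σ n N k k' ρ ρ' P P' a : ℝ} (hn : 0 ≤ n) (hN : 0 ≤ N) (hk : 0 ≤ k) (hkn : k ≤ n)
    (hk' : 0 ≤ k') (hkn' : k' ≤ n) (hρ' : 0 ≤ ρ')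
    (h1 : |ρ - ρ'| ≤ a) (h2 : |P - P'| ≤ a) (h3 : |k - k'| ≤ 2 * a) :
    |sigmaGap σ n N k ρ P - sigmaGap σ n N k' ρ' P'| ≤ a * (n + N) + 4 * ρ' * a + n * a + 4 * σ ^ 2 * n * a := by
  have e : sigmaGap σ n N k ρ P - sigmaGap σ n N k' ρ' P' =
      ((ρ - ρ') * (n + N - 2 * k) - ρ' * (2 * (k - k'))) - (n * (P - P') - σ ^ 2 * ((k - k') * (2 * n - k - k'))) := by
    simp only [sigmaGap]; ring
  have k1 : |n + N - 2 * k| ≤ n + N := abs_le.2 ⟨by linarith, by linarith⟩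
  have k2 : |2 * n - k - k'| ≤ 2 * n := abs_le.2 ⟨by linarith, by linarith⟩
  have ha : 0 ≤ a := (abs_nonneg _).trans h1
  rw [e]
  refine (abs_sub _ _).trans ((add_le_add (abs_sub _ _) (abs_sub _ _)).trans ?_)
  simp only [abs_mul, abs_of_nonneg hn, abs_of_nonneg hρ', abs_of_nonneg (sq_nonneg σ), abs_two]
  calc |ρ - ρ'| * |n + N - 2 * k| + ρ' * (2 * |k - k'|) + (n * |P - P'| + σ ^ 2 * (|k - k'| * |2 * n - k - k'|))
      ≤ a * (n + N) + ρ' * (2 * (2 * a)) + (n * a + σ ^ 2 * ((2 * a) * (2 * n))) := by gcongr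
    _ = _ := by ring

lemma abs_ss_sub_le {ι : Type*} [Fintype ι] (u v : ι → ℝ) :
    |u ⬝ᵥ u - v ⬝ᵥ v| ≤ √((u - v) ⬝ᵥ (u - v)) * √((u + v) ⬝ᵥ (u + v)) := by
  have e : u ⬝ᵥ u - v ⬝ᵥ v = (u - v) ⬝ᵥ (u + v) := by
    rw [sub_dotProduct, dotProduct_add, dotProduct_add, dotProduct_comm v u]; ring
  rw [e]
  exact abs_dot_le_sqrt _ _

/-- A good fit at `lam'` makes the noise estimate accurate at nearby penalties with a comparable support size. -/
lemma Regular.abs_sigmaHatSq_sub_le (h : Regular σ lmin lmax Bd θs X z) (hσ : 0 < σ) (hl : 0 < lmin) (hn : 0 < n) (hN : 0 < N)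
    {γ : ℝ} (hγ : (N : ℝ) ≤ γ * n) (hB : 0 < Bd 0) (hκ : 0 < κ) (hε0 : 0 < ε) (hε : ε ≤ 1) (hεκ : 4 * ε ≤ κ)
    (hlam : lam ∈ Set.Icc lmin lmax) (hlam' : lam' ∈ Set.Icc lmin lmax) (hΔ : |lam - lam'| ≤ Δ)
    (hθ : IsLasso X (yvec σ θs X z) lam θ) (hθ' : IsLasso X (yvec σ θs X z) lam' θ') (hfit : GoodFit σ κ ε θs X z θ')
    {D : ℝ} (hD : 2 * √(Bd 0) ≤ D) (hsmall : 2 * N * (√(Δ * (D * N)) * √(4 * (Bd 0 * N))) ≤ ε * n)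
    (hl0 : |(l0 θ : ℝ) - l0 θ'| ≤ 2 * (ε * n)) :
    |sigmaHatSq X (yvec σ θs X z) θ - σ ^ 2| ≤ 4 / κ ^ 2 * (6 * Bd 0 * γ + 7 * σ ^ 2 + 2 + γ) * ε := by
  have hn' : (0 : ℝ) < n := by exact_mod_cast hn
  have hN1 : (1 : ℝ) ≤ N := by exact_mod_cast hN
  have hrr := h.resid_sub_le hl hlam hlam' hΔ hθ hθ' hD
  have hr2 := (h.lasso hlam hθ).2
  have hr2' := (h.lasso hlam' hθ').2
  obtain ⟨hs1, hs2, hgap, -, hss⟩ := hfit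
  rw [scaleDev] at hs1
  rw [stretchDev] at hs2
  set r := resid X (yvec σ θs X z) θ with hr
  set r' := resid X (yvec σ θs X z) θ' with hr'
  have hadd : (r + r') ⬝ᵥ (r + r') ≤ 4 * (Bd 0 * N) := by
    have := ss_nonneg (r - r')
    rw [ss_sub] at this
    rw [ss_add]
    linarith
  have hS0 : 0 ≤ √(Δ * (D * N)) * √(4 * (Bd 0 * N)) := by positivity
  have hρ : |r ⬝ᵥ r - r' ⬝ᵥ r'| ≤ ε * n := by
    refine (abs_ss_sub_le r r').trans ((mul_le_mul (Real.sqrt_le_sqrt hrr) (Real.sqrt_le_sqrt hadd) (Real.sqrt_nonneg _)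
      (Real.sqrt_nonneg _)).trans (le_trans ?_ hsmall))
    exact le_mul_of_one_le_left hS0 (by linarith)
  have hP : |(r ᵥ* X) ⬝ᵥ (r ᵥ* X) - (r' ᵥ* X) ⬝ᵥ (r' ᵥ* X)| ≤ ε * n := by
    refine (abs_ss_sub_le _ _).trans (le_trans ?_ hsmall)
    rw [← sub_vecMul, ← add_vecMul]
    have hv : ∀ {u : Fin n → ℝ} {B : ℝ}, u ⬝ᵥ u ≤ B → √((u ᵥ* X) ⬝ᵥ (u ᵥ* X)) ≤ √(2 * N) * √B := fun {u B} hu => by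
      rw [← Real.sqrt_mul (by positivity)]
      exact Real.sqrt_le_sqrt ((ss_vecMul_le X u).trans (mul_le_mul h.frob_le hu (ss_nonneg u) (by positivity)))
    calc _ ≤ (√(2 * N) * √(Δ * (D * N))) * (√(2 * N) * √(4 * (Bd 0 * N))) :=
          mul_le_mul (hv hrr) (hv hadd) (Real.sqrt_nonneg _) (by positivity)
      _ = (√(2 * N) * √(2 * N)) * (√(Δ * (D * N)) * √(4 * (Bd 0 * N))) := by ring
      _ = _ := by rw [Real.mul_self_sqrt (by positivity)]
  have hρ0 : 0 < r' ⬝ᵥ r' := lt_of_lt_of_le (by positivity) hss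
  have hκn : 0 < κ * n := by positivity
  have hk4 : 4 * (ε * n) ≤ κ * n := by
    rw [← mul_assoc]
    exact mul_le_mul_of_nonneg_right hεκ hn'.le
  have hl0' := abs_le.1 hl0
  have hgapθ : κ * n / 2 ≤ n - l0 θ := by linarith
  have hg1 := abs_sigmaGap_le hσ hρ0 hn'.le (Nat.cast_nonneg (l0 θ')) (by linarith) hε0.le hε hs1 hs2
  have hg2 := abs_sigmaGap_sub_le (σ := σ) hn'.le (Nat.cast_nonneg N) (Nat.cast_nonneg (l0 θ)) (by linarith)
    (Nat.cast_nonneg (l0 θ')) (by linarith) hρ0.le hρ hP hl0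
  have hG : |sigmaGap σ n N (l0 θ) (r ⬝ᵥ r) ((r ᵥ* X) ⬝ᵥ (r ᵥ* X))| ≤ (6 * Bd 0 * γ + 7 * σ ^ 2 + 2 + γ) * ε * n ^ 2 := by
    have hρB : r' ⬝ᵥ r' ≤ Bd 0 * (γ * n) := hr2'.trans (mul_le_mul_of_nonneg_left hγ hB.le)
    have hεn : 0 ≤ ε * n := by positivity
    have m1 := mul_le_mul_of_nonneg_left hρB hεn
    have m2 := mul_le_mul_of_nonneg_left hγ hεn
    rw [← sub_add_cancel (sigmaGap σ n N (l0 θ) (r ⬝ᵥ r) ((r ᵥ* X) ⬝ᵥ (r ᵥ* X))) (sigmaGap σ n N (l0 θ') (r' ⬝ᵥ r')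
      ((r' ᵥ* X) ⬝ᵥ (r' ᵥ* X)))]
    refine (abs_add_le _ _).trans ((add_le_add hg2 hg1).trans ?_)
    calc _ = 6 * (ε * n * (r' ⬝ᵥ r')) + ε * n * N + (7 * σ ^ 2 + 2) * ε * n ^ 2 := by ring
      _ ≤ 6 * (ε * n * (Bd 0 * (γ * n))) + ε * n * (γ * n) + (7 * σ ^ 2 + 2) * ε * n ^ 2 := by linarith
      _ = _ := by ring
  rw [sigmaHatSq_sub_eq hn (by linarith), abs_div, abs_of_nonneg (sq_nonneg (n - l0 θ : ℝ)), div_le_iff₀ (pow_pos (by linarith) 2)]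
  refine hG.trans ?_
  have hsq : (κ * n / 2) ^ 2 ≤ (n - l0 θ : ℝ) ^ 2 := pow_le_pow_left₀ (by positivity) hgapθ 2
  have hγ0 : 0 < γ := pos_of_mul_pos_left (lt_of_lt_of_le (by linarith) hγ) hn'.le
  calc (6 * Bd 0 * γ + 7 * σ ^ 2 + 2 + γ) * ε * n ^ 2
      = 4 / κ ^ 2 * (6 * Bd 0 * γ + 7 * σ ^ 2 + 2 + γ) * ε * (κ * n / 2) ^ 2 := by field_simp; ring
    _ ≤ _ := by gcongr

end NoiseLevelTransfer

end Lasso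

namespace Lasso

open Matrix

section UniformControl

variable {n N : ℕ} {θs : Fin N → ℝ} {δ σ lmin lmax κ ε Δ q : ℝ} {Bd : ℝ → ℝ}

/-- Some penalty in the range yields a noise estimate off by more than `t`. -/
def noiseBad (n : ℕ) (σ lmin lmax : ℝ) (θs : Fin N → ℝ) (t : ℝ) : Set ((Fin n → Fin N → ℝ) × (Fin n → ℝ)) :=
  {ω | ∃ lam ∈ Set.Icc lmin lmax, ∃ θ, IsLasso ω.1 (yvec σ θs ω.1 ω.2) lam θ ∧
    t < |sigmaHatSq ω.1 (yvec σ θs ω.1 ω.2) θ - σ ^ 2|}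

/-- The `i`-th penalty in a grid of mesh `Δ`. -/
def gridPt (lmin lmax Δ : ℝ) (i : ℕ) : ℝ := min (lmin + i * Δ) lmax

lemma gridPt_mem (hll : lmin ≤ lmax) (hΔ : 0 ≤ Δ) (i : ℕ) : gridPt lmin lmax Δ i ∈ Set.Icc lmin lmax :=
  ⟨le_min (le_add_of_nonneg_right (by positivity)) hll, min_le_right _ _⟩

lemma exists_gridPt (hΔ : 0 < Δ) {lam : ℝ} (hlam : lam ∈ Set.Icc lmin lmax) :
    ∃ i < ⌊(lmax - lmin) / Δ⌋₊ + 1, |lam - gridPt lmin lmax Δ i| ≤ Δ := by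
  have h0 : 0 ≤ (lam - lmin) / Δ := div_nonneg (sub_nonneg.2 hlam.1) hΔ.le
  refine ⟨⌊(lam - lmin) / Δ⌋₊, Nat.lt_succ_of_le (Nat.floor_mono ?_), ?_⟩
  · gcongr
    exact hlam.2
  have h1 := mul_le_mul_of_nonneg_right (Nat.floor_le h0) hΔ.le
  have h2 := mul_lt_mul_of_pos_right (Nat.lt_floor_add_one ((lam - lmin) / Δ)) hΔ
  rw [add_mul, one_mul] at h2
  rw [div_mul_cancel₀ _ hΔ.ne'] at h1 h2
  rw [gridPt, min_eq_left (by linarith [hlam.2]), abs_le]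
  constructor <;> linarith

lemma noiseBad_subset (hσ : 0 < σ) (hl : 0 < lmin) (hll : lmin ≤ lmax) (hn : 0 < n) (hN : 0 < N) {γ : ℝ} (hγ : (N : ℝ) ≤ γ * n)
    (hB : 0 < Bd 0) (hκ : 0 < κ) (hε0 : 0 < ε) (hε : ε ≤ 1) (hεκ : 4 * ε ≤ κ) (hΔ : 0 < Δ) {D : ℝ}
    (hD : √(Bd (lmax * √(Bd 0))) + 2 * √(Bd 0) ≤ D) (hΔκ : 4 * (Δ * (D * N)) ≤ κ / 4 * n)
    (hsmall : 2 * N * (√(Δ * (D * N)) * √(4 * (Bd 0 * N))) ≤ ε * n) {m : ℕ} (hm : (m : ℝ) ≤ 2 * (ε * n)) :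
    noiseBad n σ lmin lmax θs (4 / κ ^ 2 * (6 * Bd 0 * γ + 7 * σ ^ 2 + 2 + γ) * ε) ⊆
      {ω | ¬ Regular σ lmin lmax Bd θs ω.1 ω.2} ∪ ⋃ i ∈ Finset.range (⌊(lmax - lmin) / Δ⌋₊ + 1),
        (lassoEvent σ lmin lmax Bd θs (gridPt lmin lmax Δ i) (fun X z θ => ¬ GoodFit σ κ ε θs X z θ) ∪
          tieUnion σ θs n m (Bd 0 * N) (gridPt lmin lmax Δ i) (2 * √(2 * N * (Δ * (D * N))) + 2 * Δ) (κ / 4 / 4)) := by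
  rintro ⟨X, z⟩ ⟨lam, hlam, θ, hθ, hbad⟩
  by_contra hno
  simp only [Set.mem_union, Set.mem_iUnion, not_or, not_exists, exists_prop, not_and] at hno
  obtain ⟨hreg, hgrid⟩ := hno
  have hreg : Regular σ lmin lmax Bd θs X z := not_not.1 hreg
  obtain ⟨i, hi, hdist⟩ := exists_gridPt hΔ hlam
  obtain ⟨h1, h2⟩ := hgrid i (Finset.mem_range.2 hi)
  have hlam' := gridPt_mem hll hΔ.le i
  obtain ⟨θ', hθ'⟩ := exists_isLasso X (yvec σ θs X z) (hl.trans_le hlam'.1)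
  have hfit : GoodFit σ κ ε θs X z θ' := by_contra fun hf => h1 ⟨hreg, θ', hθ', hf⟩
  have hl0 := hreg.abs_l0_sub_le hl hn hlam hlam' hdist hθ hθ' (κ := κ / 4) (by linarith [hfit.resid_ss]) (by positivity) hD
    hΔκ h2
  have := Real.sqrt_nonneg (Bd (lmax * √(Bd 0)))
  exact absurd hbad (not_lt.2 (hreg.abs_sigmaHatSq_sub_le hσ hl hn hN hγ hB hκ hε0 hε hεκ hlam hlam' hdist hθ hθ' hfit
    (D := D) (by linarith) hsmall (hl0.trans hm)))

/-- A mesh that is polynomially small in `N` and `T` meets all requirements of the support comparison. -/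
lemma exists_mesh {B D : ℝ} (hδ : 0 < δ) (hσ : 0 < σ) (hκ : 0 < κ) (hB : 0 < B) (hD : 0 < D) :
    ∃ E : ℝ, 1 ≤ E ∧ ∀ N n T ε : ℝ, 1 ≤ N → n = δ * N → 1 ≤ T → 1 ≤ ε * N → ∀ x, x = 1 / (E * N ^ 3 * T) →
      4 * (x ^ 2 * (D * N)) ≤ κ / 4 * n ∧ 2 * N * (√(x ^ 2 * (D * N)) * √(4 * (B * N))) ≤ ε * n ∧
      ∃ d > 0, 10 * (n * N) ^ 2 * (T * d) ^ 2 ≤ 1 ∧ 10 * n * N * (B * N) * (T * d) ^ 2 ≤ σ ^ 2 ∧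
        (2 * (2 * √(2 * N * (x ^ 2 * (D * N))) + 2 * x ^ 2)) ^ 2 < κ / 4 / 4 * d ^ 2 := by
  set E₀ := 2 * √(2 * D) + 2 with hE₀
  have hE₀p : 0 < E₀ := by positivity
  set E₁ := 9 * E₀ / √κ with hE₁
  have hE₁p : 0 < E₁ := by positivity
  set a₁ := 10 * δ ^ 2 * E₁ ^ 2 with ha₁
  set a₂ := 10 * δ * B * E₁ ^ 2 / σ ^ 2 with ha₂
  set a₃ := 16 * D / (κ * δ) with ha₃
  set a₄ := 4 * √(D * B) / δ with ha₄
  have p₁ : 0 ≤ a₁ := by positivity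
  have p₂ : 0 ≤ a₂ := by positivity
  have p₃ : 0 ≤ a₃ := by positivity
  have p₄ : 0 ≤ a₄ := by positivity
  set E := 1 + a₁ + a₂ + a₃ + a₄ with hE
  have hE1 : 1 ≤ E := by linarith
  have hE0 : 0 < E := by linarith
  have hEE : E ≤ E ^ 2 := le_self_pow₀ hE1 two_ne_zero
  refine ⟨E, hE1, fun N n T ε hN hn hT hεN x hx => ?_⟩
  subst hn
  have hN0 : 0 < N := by linarith
  have hT0 : 0 < T := by linarith
  have hx0 : 0 < x := by rw [hx]; positivity
  have hxe : x * (E * N ^ 3 * T) = 1 := by rw [hx]; field_simp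
  have hN3 : 1 ≤ N ^ 3 := one_le_pow₀ hN
  have hxE : x * E ≤ 1 := by
    rw [← hxe, mul_assoc E]
    exact mul_le_mul_of_nonneg_left (le_mul_of_one_le_right hE0.le (one_le_mul_of_one_le_of_one_le hN3 hT)) hx0.le
  have hx1 : x ≤ 1 := (le_mul_of_one_le_right hx0.le hE1).trans hxE
  refine ⟨?_, ?_, E₁ * N * x, by positivity, ?_, ?_, ?_⟩
  · have h3 : 16 * D ≤ κ * δ * E ^ 2 := by
      have : a₃ ≤ E ^ 2 := by linarith
      rw [ha₃, div_le_iff₀ (by positivity)] at this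
      linarith
    have h4 : (x * E) ^ 2 ≤ 1 := pow_le_one₀ (by positivity) hxE
    calc 4 * (x ^ 2 * (D * N)) = 16 * D * (x ^ 2 * N / 4) := by ring
      _ ≤ κ * δ * E ^ 2 * (x ^ 2 * N / 4) := by gcongr
      _ = (x * E) ^ 2 * (κ / 4 * (δ * N)) := by ring
      _ ≤ _ := mul_le_of_le_one_left (by positivity) h4
  · have e1 : √(x ^ 2 * (D * N)) * √(4 * (B * N)) = 2 * √(D * B) * N * x := by
      rw [← Real.sqrt_mul (by positivity), show x ^ 2 * (D * N) * (4 * (B * N)) = (D * B) * (2 * N * x) ^ 2 by ring,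
        Real.sqrt_mul (by positivity), Real.sqrt_sq (by positivity)]
      ring
    have h4 : 4 * √(D * B) ≤ E * δ := by
      have : a₄ ≤ E := by linarith
      rwa [ha₄, div_le_iff₀ hδ] at this
    have h5 : x * E * N ^ 3 ≤ 1 := by
      rw [← hxe, show x * (E * N ^ 3 * T) = x * E * N ^ 3 * T by ring]
      exact le_mul_of_one_le_right (by positivity) hT
    rw [e1]
    calc 2 * N * (2 * √(D * B) * N * x) = 4 * √(D * B) * (N ^ 2 * x) := by ring
      _ ≤ E * δ * (N ^ 3 * x) := by gcongr; norm_num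
      _ = (x * E * N ^ 3) * δ := by ring
      _ ≤ 1 * δ := by gcongr
      _ ≤ (ε * N) * δ := by gcongr
      _ = _ := by ring
  · have h1 : a₁ ≤ E ^ 2 := by linarith
    calc 10 * (δ * N * N) ^ 2 * (T * (E₁ * N * x)) ^ 2 = a₁ * (N ^ 3 * T * x) ^ 2 := by rw [ha₁]; ring
      _ ≤ E ^ 2 * (N ^ 3 * T * x) ^ 2 := by gcongr
      _ = (x * (E * N ^ 3 * T)) ^ 2 := by ring
      _ ≤ 1 := by rw [hxe]; norm_num
  · have h2 : 10 * δ * B * E₁ ^ 2 ≤ E ^ 2 * σ ^ 2 := by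
      have : a₂ ≤ E ^ 2 := by linarith
      rwa [ha₂, div_le_iff₀ (by positivity)] at this
    calc 10 * (δ * N) * N * (B * N) * (T * (E₁ * N * x)) ^ 2 = 10 * δ * B * E₁ ^ 2 * (N ^ 5 * (T * x) ^ 2) := by ring
      _ ≤ E ^ 2 * σ ^ 2 * (N ^ 6 * (T * x) ^ 2) := by gcongr; norm_num
      _ = σ ^ 2 * (x * (E * N ^ 3 * T)) ^ 2 := by ring
      _ = σ ^ 2 := by rw [hxe]; ring
  · have e1 : √(2 * N * (x ^ 2 * (D * N))) = √(2 * D) * (N * x) := by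
      rw [show 2 * N * (x ^ 2 * (D * N)) = (2 * D) * (N * x) ^ 2 by ring, Real.sqrt_mul (by positivity),
        Real.sqrt_sq (by positivity)]
    have h6 : x ^ 2 ≤ N * x := by
      rw [sq]; exact mul_le_mul_of_nonneg_right (hx1.trans hN) hx0.le
    have h7 : 2 * √(2 * N * (x ^ 2 * (D * N))) + 2 * x ^ 2 ≤ E₀ * (N * x) := by
      rw [e1, hE₀]; linarith
    have h8 : κ * E₁ ^ 2 = 81 * E₀ ^ 2 := by
      rw [hE₁, div_pow, Real.sq_sqrt hκ.le]; field_simp; norm_num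
    calc (2 * (2 * √(2 * N * (x ^ 2 * (D * N))) + 2 * x ^ 2)) ^ 2 ≤ (2 * (E₀ * (N * x))) ^ 2 := by gcongr
      _ = 64 * E₀ ^ 2 * ((N * x) ^ 2 / 16) := by ring
      _ < 81 * E₀ ^ 2 * ((N * x) ^ 2 / 16) := by gcongr; norm_num
      _ = _ := by rw [← h8]; ring

end UniformControl

end Lasso

namespace Lasso

open Matrix

section Assembly

variable {δ σ lmin lmax q : ℝ}

lemma pow_le_factorial_mul_exp {c V : ℝ} (hc : 0 < c) (hV : 0 ≤ V) (k : ℕ) :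
    V ^ k ≤ k.factorial / c ^ k * Real.exp (c * V) := by
  have h := Real.pow_div_factorial_le_exp (c * V) (by positivity) k
  rw [div_le_iff₀ (by positivity), mul_pow] at h
  rw [div_mul_eq_mul_div, le_div_iff₀ (by positivity)]
  linarith

/-- The noise estimate is uniformly accurate once `N * ε ^ 6` is large. -/
lemma noiseBad_whp (hδ : 0 < δ) (hσ : 0 < σ) (hl : 0 < lmin) (hll : lmin ≤ lmax) {Dfam : (M : ℕ) → Set (Fin M → ℝ)}
    (hD : DFamSpec δ Dfam q) :
    ∃ A κ C c K : ℝ, 0 < A ∧ 0 < κ ∧ 0 < C ∧ 0 < c ∧ 0 < K ∧ ∀ N n : ℕ, 0 < N → (n : ℝ) = δ * N → ∀ θs ∈ Dfam N, ∀ ε : ℝ,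
      0 < ε → ε ≤ 1 → 4 * ε ≤ κ → K ≤ N * ε ^ 6 →
      Pmodel n N (noiseBad n σ lmin lmax θs (A * ε)) ≤ ENNReal.ofReal (C * Real.exp (-c * (ε ^ 2 * N))) := by
  obtain ⟨Bd, hBd, C₁, c₁, hC₁, hc₁, hreg⟩ := regular_whp (σ := σ) hδ hl hll hD
  have hB := hBd 0 le_rfl
  obtain ⟨κ, hκ, C₂, hC₂, c₂, hc₂, hfit⟩ := goodFit_whp (lmax := lmax) (Bd := Bd) hδ hσ hl hB
  set D := √(Bd (lmax * √(Bd 0))) + 2 * √(Bd 0) with hDdef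
  have hD0 : 0 < D := add_pos_of_nonneg_of_pos (Real.sqrt_nonneg _) (by positivity)
  obtain ⟨E, hE1, hmesh⟩ := exists_mesh hδ hσ hκ hB hD0
  set c := min (c₂ * δ) (min 1 c₁) with hc
  have hc0 : 0 < c := by positivity
  have hcδ : c ≤ c₂ * δ := min_le_left _ _
  have hc1 : c ≤ 1 := (min_le_right _ _).trans (min_le_left _ _)
  have hcc : c ≤ c₁ := (min_le_right _ _).trans (min_le_right _ _)
  set a := 2 / δ with ha
  have ha0 : 0 < a := by positivity
  set K := 1 + 1 / δ + 8 * a / c with hK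
  have hK1 : 1 ≤ K := by have : 0 < 1 / δ := by positivity
                         have : 0 < 8 * a / c := by positivity
                         linarith
  have hKδ : 1 / δ ≤ K := by have : 0 < 8 * a / c := by positivity
                             linarith
  have hKa : 8 * a / c ≤ K := by have : 0 < 1 / δ := by positivity
                                 linarith
  set L := lmax - lmin with hL
  have hL0 : 0 ≤ L := sub_nonneg.2 hll
  set Q := 9 * (L * E ^ 2 + 1) * (C₂ + δ * Real.exp 1) with hQ
  have hQ0 : 0 < Q := by positivity
  set F := (Nat.factorial 12 : ℝ) / (c / 4) ^ 12 with hF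
  have hF0 : 0 < F := by positivity
  refine ⟨4 / κ ^ 2 * (6 * Bd 0 * (1 / δ) + 7 * σ ^ 2 + 2 + 1 / δ), κ, C₁ + Q * F, c / 2, K, by positivity, hκ, by positivity,
    by positivity, by linarith, fun N n hN hnδ θs hθs ε hε0 hε1 hεκ hKN => ?_⟩
  have hN1 : (1 : ℝ) ≤ N := by exact_mod_cast hN
  have hN0 : (0 : ℝ) < N := by linarith
  set V := ε ^ 2 * N with hV
  have hpow : ∀ k, k ≤ 6 → K ≤ N * ε ^ k := fun k hk =>
    hKN.trans (mul_le_mul_of_nonneg_left (pow_le_pow_of_le_one hε0.le hε1 hk) hN0.le)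
  have hV1 : 1 ≤ V := hK1.trans ((hpow 2 (by norm_num)).trans_eq (mul_comm _ _))
  have hV0 : 0 < V := by linarith
  have hVN : V ≤ N := mul_le_of_le_one_left hN0.le (pow_le_one₀ hε0.le hε1)
  have hNV : (N : ℝ) ^ 2 ≤ V ^ 3 := by
    calc (N : ℝ) ^ 2 = 1 * N ^ 2 := by ring
      _ ≤ (N * ε ^ 6) * N ^ 2 := by gcongr; exact hK1.trans hKN
      _ = V ^ 3 := by rw [hV]; ring
  have hNV1 : (N : ℝ) ≤ V ^ 3 := (le_self_pow₀ hN1 two_ne_zero).trans hNV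
  have hεN : 1 ≤ ε * N := by
    have := hpow 1 (by norm_num)
    rw [pow_one, mul_comm] at this
    linarith
  have hεn : 1 ≤ ε * n := by
    have h1 := hpow 1 (by norm_num)
    have h2 := (hKδ.trans h1)
    rw [pow_one, div_le_iff₀ hδ] at h2
    rw [hnδ]
    linarith
  have haV : 2 * (a / ε) ≤ c / 4 * V := by
    have h3 := hKa.trans (hpow 3 (by norm_num))
    rw [div_le_iff₀ hc0] at h3
    rw [← mul_div_assoc, div_le_iff₀ hε0, hV]
    linarith
  have hn : 0 < n := by
    have : (0 : ℝ) < n := by rw [hnδ]; positivity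
    exact_mod_cast this
  set T := ⌈2 * Real.exp (a / ε)⌉₊ with hT
  have hexp1 : 1 ≤ Real.exp (a / ε) := Real.one_le_exp (by positivity)
  have hT2 : 2 * Real.exp (a / ε) ≤ T := Nat.le_ceil _
  have hT3 : (T : ℝ) ≤ 3 * Real.exp (a / ε) := by
    have := Nat.ceil_lt_add_one (show 0 ≤ 2 * Real.exp (a / ε) by positivity)
    linarith
  have hT1 : (1 : ℝ) ≤ T := by linarith
  have hT0 : 0 < T := by
    have : (0 : ℝ) < T := by linarith
    exact_mod_cast this
  set m := ⌈ε * n⌉₊ with hm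
  have hm1 : ε * n ≤ m := Nat.le_ceil _
  have hm2 : (m : ℝ) ≤ 2 * (ε * n) := by
    have := Nat.ceil_lt_add_one (show 0 ≤ ε * n by linarith)
    linarith
  set x := 1 / (E * N ^ 3 * T) with hx
  have hx0 : 0 < x := by positivity
  obtain ⟨k1, k2, d, hd, k3, k4, k5⟩ := hmesh N n T ε hN1 hnδ hT1 hεN x hx
  have hsub := noiseBad_subset (θs := θs) (Δ := x ^ 2) (γ := 1 / δ) hσ hl hll hn hN (by rw [hnδ]; field_simp; rfl) hB hκ hε0 hε1 hεκ
    (by positivity) le_rfl k1 k2 hm2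
  set G := ⌊L / x ^ 2⌋₊ + 1 with hG
  have hmeas : Pmodel n N (noiseBad n σ lmin lmax θs (4 / κ ^ 2 * (6 * Bd 0 * (1 / δ) + 7 * σ ^ 2 + 2 + 1 / δ) * ε)) ≤
      ENNReal.ofReal (C₁ * Real.exp (-c₁ * N) +
        G * (C₂ * Real.exp (-c₂ * ε ^ 2 * n) + 2 ^ N * n * (Real.exp 1 * (2 / T) ^ m))) := by
    refine (measure_mono hsub).trans ?_
    rw [ENNReal.ofReal_add (by positivity) (by positivity), ENNReal.ofReal_mul (Nat.cast_nonneg G), ENNReal.ofReal_natCast]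
    refine (measure_union_le _ _).trans (add_le_add (hreg N n hN hnδ θs hθs) ((measure_biUnion_finset_le _ _).trans ?_))
    refine (Finset.sum_le_card_nsmul _ _ _ fun i _ => ?_).trans_eq (by rw [Finset.card_range, nsmul_eq_mul])
    rw [ENNReal.ofReal_add (by positivity) (by positivity)]
    have hg := gridPt_mem hll (sq_nonneg x) i
    refine (measure_union_le _ _).trans (add_le_add ?_ ?_)
    · obtain ⟨j, rfl⟩ := Nat.exists_eq_succ_of_ne_zero hn.ne'
      exact hfit j N θs _ ε hnδ hg hε0 hε1
    · exact pmodel_tieUnion_le hσ (hl.le.trans hg.1) hn hN hT0 hd k3 k4 k5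
  refine hmeas.trans (ENNReal.ofReal_le_ofReal ?_)
  have hexpV : Real.exp (-N) ≤ Real.exp (-(c * V)) := by
    refine Real.exp_le_exp.2 (neg_le_neg ?_)
    exact (mul_le_of_le_one_left hV0.le hc1).trans hVN
  have hb0 : C₁ * Real.exp (-c₁ * N) ≤ C₁ * Real.exp (-(c / 2) * V) := by
    refine mul_le_mul_of_nonneg_left (Real.exp_le_exp.2 ?_) hC₁.le
    have : c / 2 * V ≤ c₁ * N := mul_le_mul (by linarith) hVN hV0.le hc₁.le
    linarith
  have hb1 : C₂ * Real.exp (-c₂ * ε ^ 2 * n) ≤ C₂ * V ^ 3 * Real.exp (-(c * V)) := by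
    have e1 : Real.exp (-c₂ * ε ^ 2 * n) ≤ Real.exp (-(c * V)) := by
      refine Real.exp_le_exp.2 ?_
      have := mul_le_mul_of_nonneg_right hcδ hV0.le
      rw [hnδ]
      linarith
    calc C₂ * Real.exp (-c₂ * ε ^ 2 * n) ≤ C₂ * Real.exp (-(c * V)) := by gcongr
      _ ≤ _ := by
        gcongr
        exact le_mul_of_one_le_right hC₂.le (one_le_pow₀ hV1)
  have hb2 : 2 ^ N * n * (Real.exp 1 * (2 / T) ^ m) ≤ δ * Real.exp 1 * V ^ 3 * Real.exp (-(c * V)) := by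
    have e1 : (2 : ℝ) ^ N ≤ Real.exp N := by
      rw [← mul_one (N : ℝ), Real.exp_nat_mul]
      exact pow_le_pow_left₀ (by norm_num) (by linarith [Real.add_one_le_exp 1]) N
    have e2 : (2 / T : ℝ) ^ m ≤ Real.exp (-(2 * N)) := by
      have h1 : (2 / T : ℝ) ≤ Real.exp (-(a / ε)) := by
        rw [Real.exp_neg, div_le_iff₀ (by linarith), ← div_eq_inv_mul, le_div_iff₀ (Real.exp_pos _)]
        exact hT2
      refine (pow_le_pow_left₀ (by positivity) h1 m).trans ?_
      rw [← Real.exp_nat_mul]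
      refine Real.exp_le_exp.2 ?_
      have h2 : 2 * (N : ℝ) = (ε * n) * (a / ε) := by rw [hnδ, ha]; field_simp
      have h3 := mul_le_mul_of_nonneg_right hm1 (show 0 ≤ a / ε by positivity)
      linarith
    calc 2 ^ N * n * (Real.exp 1 * (2 / T) ^ m) ≤ Real.exp N * n * (Real.exp 1 * Real.exp (-(2 * N))) := by gcongr
      _ = δ * Real.exp 1 * N * (Real.exp N * Real.exp (-(2 * N))) := by rw [hnδ]; ring
      _ = δ * Real.exp 1 * N * Real.exp (-N) := by rw [← Real.exp_add]; congr 2; ring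
      _ ≤ _ := by gcongr
  have hGle : (G : ℝ) ≤ 9 * (L * E ^ 2 + 1) * V ^ 9 * Real.exp (c / 4 * V) := by
    have e1 : (G : ℝ) ≤ L / x ^ 2 + 1 := by
      rw [hG]
      push_cast
      linarith [Nat.floor_le (show 0 ≤ L / x ^ 2 by positivity)]
    have e2 : L / x ^ 2 + 1 ≤ (L * E ^ 2 + 1) * (((N : ℝ) ^ 2) ^ 3 * T ^ 2) := by
      have h1 : L / x ^ 2 = L * E ^ 2 * (((N : ℝ) ^ 2) ^ 3 * T ^ 2) := by rw [hx]; field_simp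
      have h2 : 1 ≤ ((N : ℝ) ^ 2) ^ 3 * T ^ 2 :=
        one_le_mul_of_one_le_of_one_le (one_le_pow₀ (one_le_pow₀ hN1)) (one_le_pow₀ hT1)
      rw [h1]
      linarith
    have e3 : (T : ℝ) ^ 2 ≤ 9 * Real.exp (c / 4 * V) := by
      calc (T : ℝ) ^ 2 ≤ (3 * Real.exp (a / ε)) ^ 2 := by gcongr
        _ = 9 * Real.exp (2 * (a / ε)) := by rw [mul_pow, ← Real.exp_nat_mul]; norm_num
        _ ≤ _ := by gcongr
    calc (G : ℝ) ≤ (L * E ^ 2 + 1) * (((N : ℝ) ^ 2) ^ 3 * T ^ 2) := e1.trans e2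
      _ ≤ (L * E ^ 2 + 1) * ((V ^ 3) ^ 3 * (9 * Real.exp (c / 4 * V))) := by gcongr
      _ = _ := by ring
  have hV12 := pow_le_factorial_mul_exp (show 0 < c / 4 by positivity) hV0.le 12
  rw [← hF] at hV12
  have hmain : G * (C₂ * Real.exp (-c₂ * ε ^ 2 * n) + 2 ^ N * n * (Real.exp 1 * (2 / T) ^ m)) ≤
      Q * F * Real.exp (-(c / 2) * V) := by
    calc _ ≤ (9 * (L * E ^ 2 + 1) * V ^ 9 * Real.exp (c / 4 * V)) *
          (C₂ * V ^ 3 * Real.exp (-(c * V)) + δ * Real.exp 1 * V ^ 3 * Real.exp (-(c * V))) :=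
          mul_le_mul hGle (add_le_add hb1 hb2) (by positivity) (by positivity)
      _ = Q * V ^ 12 * (Real.exp (c / 4 * V) * Real.exp (-(c * V))) := by rw [hQ]; ring
      _ ≤ Q * (F * Real.exp (c / 4 * V)) * (Real.exp (c / 4 * V) * Real.exp (-(c * V))) := by gcongr
      _ = Q * F * (Real.exp (c / 4 * V) * (Real.exp (c / 4 * V) * Real.exp (-(c * V)))) := by ring
      _ = _ := by
        rw [← Real.exp_add, ← Real.exp_add]
        congr 2
        ring
  rw [add_mul]
  exact add_le_add hb0 hmain

lemma isLasso_of_isMinOn {n N : ℕ} (hn : 0 < n) {X : Matrix (Fin n) (Fin N) ℝ} {y : Fin n → ℝ} {lam : ℝ} {θ : Fin N → ℝ}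
    (h : IsMinOn (lassoCost X y lam) Set.univ θ) : IsLasso X y lam θ := fun θ' => by
  have hn' : (0 : ℝ) < n := by exact_mod_cast hn
  have e : ∀ φ, lassoCost X y lam φ = obj X y lam φ / n := fun φ => by
    have e1 : ∑ i, (y i - ∑ j, X i j * φ j) ^ 2 = resid X y φ ⬝ᵥ resid X y φ := by
      simp only [dotProduct, resid, Pi.sub_apply, mulVec, sq]
    unfold lassoCost
    rw [e1, obj, l1]
    field_simp
  have := isMinOn_iff.1 h θ' (Set.mem_univ _)
  rwa [e, e, div_le_div_iff_of_pos_right hn'] at this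

end Assembly

end Lasso

/-- Corollary (consistency of the noise level estimator σ̂²). -/
theorem stmt6 (δ σ lmin lmax q : ℝ)
    (hδ : 0 < δ) (hσ : 0 < σ) (hl : 0 < lmin) (hll : lmin ≤ lmax)
    (Dfam : (M : ℕ) → Set (Fin M → ℝ))
    (hD : DFamSpec δ Dfam q) :
    ∃ C c : ℝ, 0 < C ∧ 0 < c ∧
      ∀ (N n : ℕ), 0 < N → (n : ℝ) = δ * N →
      ∀ θstar ∈ Dfam N,
      ∀ θhat : ℝ → (Fin n → Fin N → ℝ) → (Fin n → ℝ) → (Fin N → ℝ),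
      (∀ lam ∈ Set.Icc lmin lmax, ∀ (X : Fin n → Fin N → ℝ) (z : Fin n → ℝ),
        IsMinOn (lassoCost X (yvec σ θstar X z) lam) Set.univ (θhat lam X z)) →
      ∀ ε : ℝ, ε ∈ Set.Ioc (0 : ℝ) 1 →
      Pmodel n N
        {ω | ∃ lam ∈ Set.Icc lmin lmax,
          ε < |sigmaHatSq ω.1 (yvec σ θstar ω.1 ω.2) (θhat lam ω.1 ω.2) - σ ^ 2|}
      ≤ ENNReal.ofReal (C / ε ^ 6 * (N : ℝ) ^ q * Real.exp (-c * N * ε ^ 6)) := by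
  obtain ⟨A, κ, C, c, K, hA, hκ, hC, hc, hK, hmain⟩ := Lasso.noiseBad_whp hδ hσ hl hll hD
  have hq : 0 ≤ q := (Lasso.dfam_control hδ hD).1
  set B : ℝ := 1 + A + 4 / κ with hB
  have h4 : 0 < 4 / κ := by positivity
  have hB1 : 1 ≤ B := by linarith
  have hB0 : 0 < B := by linarith
  refine ⟨C + Real.exp (c / B ^ 2 * (B ^ 6 * K)), c / B ^ 2, by positivity, by positivity, ?_⟩
  intro N n hN hn θs hθs θhat hmin ε hε
  obtain ⟨hε0, hε1⟩ := hε
  have hN1 : (1 : ℝ) ≤ N := by exact_mod_cast hN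
  have hn0 : 0 < n := by
    have : (0 : ℝ) < n := by rw [hn]; positivity
    exact_mod_cast this
  have hNq : 1 ≤ (N : ℝ) ^ q := Real.one_le_rpow hN1 hq
  have hε6 : 1 ≤ 1 / ε ^ 6 := by
    rw [le_div_iff₀ (by positivity), one_mul]
    exact pow_le_one₀ hε0.le hε1
  have hscale : ∀ D : ℝ, 0 < D → D * Real.exp (-(c / B ^ 2) * N * ε ^ 6) ≤
      D / ε ^ 6 * (N : ℝ) ^ q * Real.exp (-(c / B ^ 2) * N * ε ^ 6) := by
    intro D hD0
    gcongr
    calc D = D * 1 * 1 := by ring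
      _ ≤ D * (1 / ε ^ 6) * (N : ℝ) ^ q := by gcongr
      _ = D / ε ^ 6 * (N : ℝ) ^ q := by ring
  by_cases hlarge : K ≤ N * (ε / B) ^ 6
  · have hAB : A * (ε / B) ≤ ε := by
      rw [mul_div_assoc', div_le_iff₀ hB0, mul_comm]
      gcongr
      linarith
    have hκB : 4 * (ε / B) ≤ κ := by
      rw [mul_div_assoc', div_le_iff₀ hB0]
      calc 4 * ε ≤ 4 := by linarith
        _ = κ * (4 / κ) := by field_simp
        _ ≤ κ * B := by gcongr; linarith
    have hsub : {ω : (Fin n → Fin N → ℝ) × (Fin n → ℝ) | ∃ lam ∈ Set.Icc lmin lmax,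
        ε < |sigmaHatSq ω.1 (yvec σ θs ω.1 ω.2)
          (θhat lam ω.1 ω.2) - σ ^ 2|} ⊆
        Lasso.noiseBad n σ lmin lmax θs (A * (ε / B)) := by
      rintro ω ⟨lam, hlam, hlt⟩
      exact ⟨lam, hlam, _, Lasso.isLasso_of_isMinOn hn0 (hmin lam hlam ω.1 ω.2),
        hAB.trans_lt hlt⟩
    refine (measure_mono hsub).trans ((hmain N n hN hn θs hθs (ε / B) (by positivity)
      ((div_le_one hB0).2 (hε1.trans hB1)) hκB hlarge).trans (ENNReal.ofReal_le_ofReal ?_))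
    refine le_trans ?_ (hscale _ (by positivity))
    have hexp : -c * ((ε / B) ^ 2 * N) ≤ -(c / B ^ 2) * N * ε ^ 6 := by
      have h26 : ε ^ 6 ≤ ε ^ 2 := pow_le_pow_of_le_one hε0.le hε1 (by norm_num)
      have : c / B ^ 2 * N * ε ^ 6 ≤ c / B ^ 2 * N * ε ^ 2 := by gcongr
      calc -c * ((ε / B) ^ 2 * N) = -(c / B ^ 2 * N * ε ^ 2) := by rw [div_pow]; ring
        _ ≤ -(c / B ^ 2 * N * ε ^ 6) := neg_le_neg this
        _ = _ := by ring
    gcongr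
    exact le_add_of_nonneg_right (Real.exp_nonneg _)
  · refine prob_le_one.trans ?_
    rw [ENNReal.one_le_ofReal]
    refine le_trans ?_ (hscale _ (by positivity))
    have hsmall : N * ε ^ 6 ≤ B ^ 6 * K := by
      rw [not_le, div_pow, mul_div_assoc', div_lt_iff₀ (by positivity)] at hlarge
      linarith
    calc (1 : ℝ) ≤ Real.exp (c / B ^ 2 * (B ^ 6 * K) + -(c / B ^ 2) * N * ε ^ 6) := by
          rw [Real.one_le_exp_iff]
          have : c / B ^ 2 * (N * ε ^ 6) ≤ c / B ^ 2 * (B ^ 6 * K) := by gcongr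
          linarith
      _ = Real.exp (c / B ^ 2 * (B ^ 6 * K)) * Real.exp (-(c / B ^ 2) * N * ε ^ 6) :=
          Real.exp_add _ _
      _ ≤ _ := by
          gcongr
          exact le_add_of_nonneg_left hC.le
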